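/- For every integer d ≥ 1 there exist an integer N_0 ≥ 1 and ε_1 > 0 with the following property: for every finite subset F of GL_d(ℂ) generating a subgroup which is not virtually solvable, there exists δ_0 = δ_0(F) > 0 such that for every δ ∈ (0, δ_0) there are two elements a, b, each a product of at most N_0 elements of F ∪ F⁻¹, such that ‖w(a,b) − 1‖ ≥ δ for every nontrivial reduced word w in the free group on two generators of reduced word length at most (log δ⁻¹)^{ε_1}. -/

import Mathlib

open scoped MatrixGroups Pointwise

/-- The operator norm on `d×d` complex matrices induced by the Hermitian norm on `ℂ^d`. -/
noncomputable def matrixOpNorm {d : ℕ} (M : Matrix (Fin d) (Fin d) ℂ) : ℝ :=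
  ‖LinearMap.toContinuousLinearMap (Matrix.toEuclideanLin M)‖

section PartSec01
open scoped MatrixGroups Pointwise
namespace WDC

section PingPong
variable {K : Type*} [Field K] (v : AbsoluteValue K ℝ)

/-- The sum of the absolute values of the coordinates. -/
def vn {n : ℕ} (x : Fin n → K) : ℝ := ∑ i, v (x i)

/-- The sum of the absolute values of the entries. -/
def nm {n : ℕ} (A : Matrix (Fin n) (Fin n) K) : ℝ := ∑ i, ∑ j, v (A i j)

variable {n : ℕ}

lemma vn_nonneg (x : Fin n → K) : 0 ≤ vn v x := Finset.sum_nonneg fun _ _ => v.nonneg _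

lemma nm_nonneg (A : Matrix (Fin n) (Fin n) K) : 0 ≤ nm v A :=
  Finset.sum_nonneg fun _ _ => Finset.sum_nonneg fun _ _ => v.nonneg _

lemma vn_add (x y : Fin n → K) : vn v (x + y) ≤ vn v x + vn v y := by
  unfold vn
  rw [← Finset.sum_add_distrib]
  exact Finset.sum_le_sum fun i _ => v.add_le _ _

lemma le_vn (x : Fin n → K) (i : Fin n) : v (x i) ≤ vn v x :=
  Finset.single_le_sum (f := fun i => v (x i)) (fun _ _ => v.nonneg _) (Finset.mem_univ i)

lemma le_nm (A : Matrix (Fin n) (Fin n) K) (i j : Fin n) : v (A i j) ≤ nm v A :=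
  (Finset.single_le_sum (f := fun j => v (A i j)) (fun _ _ => v.nonneg _) (Finset.mem_univ j)).trans
    (Finset.single_le_sum (f := fun i => ∑ j, v (A i j))
      (fun _ _ => Finset.sum_nonneg fun _ _ => v.nonneg _) (Finset.mem_univ i))

lemma nm_le {A : Matrix (Fin n) (Fin n) K} {C : ℝ} (h : ∀ i j, v (A i j) ≤ C) :
    nm v A ≤ n * n * C := by
  unfold nm
  calc _ ≤ ∑ _i : Fin n, ∑ _j : Fin n, C :=
        Finset.sum_le_sum fun i _ => Finset.sum_le_sum fun j _ => h i j
    _ = _ := by simp; ring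

lemma vn_mulVec (A : Matrix (Fin n) (Fin n) K) (x : Fin n → K) :
    vn v (A.mulVec x) ≤ nm v A * vn v x := by
  unfold nm
  rw [Finset.sum_mul]
  refine Finset.sum_le_sum fun i _ => ?_
  rw [Finset.sum_mul]
  refine (v.sum_le Finset.univ (fun j => A i j * x j)).trans (Finset.sum_le_sum fun j _ => ?_)
  rw [map_mul]
  exact mul_le_mul_of_nonneg_left (le_vn v x j) (v.nonneg _)

lemma vn_pos {x : Fin n → K} (h : x ≠ 0) : 0 < vn v x := by
  obtain ⟨i, hi⟩ := Function.ne_iff.mp h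
  exact lt_of_lt_of_le (v.pos hi) (le_vn v x i)

lemma nm_mul (A B : Matrix (Fin n) (Fin n) K) : nm v (A * B) ≤ nm v A * nm v B := by
  have h : ∀ M : Matrix (Fin n) (Fin n) K, nm v M = ∑ j, vn v (fun i => M i j) := by
    intro M; unfold nm vn; exact Finset.sum_comm
  rw [h (A * B), h B, Finset.mul_sum]
  refine Finset.sum_le_sum fun j _ => ?_
  exact vn_mulVec v A (fun i => B i j)

lemma nm_smul (c : K) (A : Matrix (Fin n) (Fin n) K) : nm v (c • A) = v c * nm v A := by
  simp [nm, Finset.mul_sum]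

lemma nm_neg (A : Matrix (Fin n) (Fin n) K) : nm v (-A) = nm v A := by
  simp [nm]

lemma exists_col {A : Matrix (Fin n) (Fin n) K} {k : ℝ} (h : n * k < nm v A) :
    ∃ x : Fin n → K, x ≠ 0 ∧ k * vn v x < vn v (A.mulVec x) := by
  have h1 : nm v A = ∑ j, vn v (fun i => A i j) := by unfold nm vn; exact Finset.sum_comm
  have : ∃ j, k < vn v (fun i => A i j) := by
    by_contra hc
    push Not at hc
    have := Finset.sum_le_sum (fun j (_ : j ∈ Finset.univ) => hc j)
    simp at this
    linarith
  obtain ⟨j, hj⟩ := this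
  refine ⟨Pi.single j 1, by simp, ?_⟩
  have e1 : vn v (Pi.single j (1 : K) : Fin n → K) = 1 := by
    unfold vn
    rw [Finset.sum_eq_single j] <;> simp +contextual
  have e2 : A.mulVec (Pi.single j 1) = fun i => A i j := by
    ext i; simp
  rw [e1, e2]; simpa using hj

/-- Quantitative open ping-pong condition on a pair of matrices. -/
def PPC (M : Fin 2 × Bool → Matrix (Fin n) (Fin n) K) : Prop :=
  ∃ (k : Fin 2 × Bool → ℝ) (θ : Fin 2 × Bool → Fin 2 × Bool → Matrix (Fin n) (Fin n) K),
    (∀ j, 1 < k j) ∧ (∀ j, n * k j < nm v (M j)) ∧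
    ∀ i j, (i.1 = j.1 → i.2 = j.2) → nm v (θ i j) < 1 / (2 * k i) ∧
      nm v (θ i j * (M i * M j) - M j) < k j / 2

lemma PPC.list {M : Fin 2 × Bool → Matrix (Fin n) (Fin n) K} (h : PPC v M) :
    ∀ (L : List (Fin 2 × Bool)), L ≠ [] → FreeGroup.IsReduced L → (L.map M).prod ≠ 1 := by
  obtain ⟨k, θ, hk, hM, hθ⟩ := h
  have key : ∀ (L : List (Fin 2 × Bool)) (hL : L ≠ []), FreeGroup.IsReduced L →
      ∃ (x y : Fin n → K), x ≠ 0 ∧ vn v x ≤ vn v y ∧ 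
        (L.map M).prod.mulVec x = (M (L.head hL)).mulVec y ∧
        k (L.head hL) * vn v y ≤ vn v ((M (L.head hL)).mulVec y) := by
    intro L
    induction L with
    | nil => intro h; exact absurd rfl h
    | cons i L ih =>
      intro _ hr
      rcases L with _ | ⟨j, L⟩
      · obtain ⟨x, hx, hx2⟩ := exists_col v (hM i)
        exact ⟨x, x, hx, le_rfl, by simp, by simpa using hx2.le⟩
      · rw [FreeGroup.isReduced_cons_cons] at hr
        obtain ⟨x, y, hx, hxy, he, hy⟩ := ih (by simp) hr.2
        refine ⟨x, (M j).mulVec y, hx, ?_, ?_, ?_⟩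
        · simp only [List.head_cons] at hy
          nlinarith [hk j, vn_nonneg v y]
        · simp only [List.map_cons, List.prod_cons, List.head_cons] at he ⊢
          rw [← Matrix.mulVec_mulVec, he]
        · simp only [List.head_cons] at hy ⊢
          obtain ⟨h1, h2⟩ := hθ i j hr.1
          set z := (M j).mulVec y
          set w := (M i).mulVec z
          have hz : z = (θ i j).mulVec w + (-(θ i j * (M i * M j) - M j)).mulVec y := by
            simp only [z, w, Matrix.mulVec_mulVec, Matrix.neg_mulVec, Matrix.sub_mulVec]
            abel
          have hneg : nm v (-(θ i j * (M i * M j) - M j)) = nm v (θ i j * (M i * M j) - M j) := by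
            exact nm_neg v _
          have h3 : vn v z ≤ nm v (θ i j) * vn v w + nm v (θ i j * (M i * M j) - M j) * vn v y := by
            conv_lhs => rw [hz]
            refine (vn_add v _ _).trans (add_le_add (vn_mulVec v _ _) ?_)
            rw [← hneg]; exact vn_mulVec v _ _
          have h4 := vn_nonneg v w
          have h5 := vn_nonneg v y
          have hki := hk i
          have h6 : nm v (θ i j) * vn v w ≤ 1 / (2 * k i) * vn v w :=
            mul_le_mul_of_nonneg_right h1.le h4
          have h7 : nm v (θ i j * (M i * M j) - M j) * vn v y ≤ k j / 2 * vn v y :=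
            mul_le_mul_of_nonneg_right h2.le h5
          have h8 : vn v z ≤ 1 / (2 * k i) * vn v w + vn v z / 2 := by linarith
          have h9 : k i * (1 / (2 * k i) * vn v w) = vn v w / 2 := by
            field_simp
          nlinarith
  intro L hL hr h1
  obtain ⟨x, y, hx, hxy, he, hy⟩ := key L hL hr
  rw [h1, Matrix.one_mulVec] at he
  rw [← he] at hy
  have := vn_pos v hx
  nlinarith [hk (L.head hL)]

/-- The four letters attached to a pair of group elements. -/
def letter {G : Type*} [Group G] (f : Fin 2 → G) (p : Fin 2 × Bool) : G :=
  cond p.2 (f p.1) (f p.1)⁻¹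

lemma PPC.free {f : Fin 2 → SL(n, K)}
    (h : PPC v (fun p => ((letter f p : SL(n, K)) : Matrix (Fin n) (Fin n) K)))
    (w : FreeGroup (Fin 2)) (hw : w ≠ 1) : FreeGroup.lift f w ≠ 1 := by
  intro h1
  have hl := h.list v w.toWord (by simpa using hw) FreeGroup.isReduced_toWord
  apply hl
  have : FreeGroup.lift f w = (w.toWord.map (letter f)).prod := by
    conv_lhs => rw [← FreeGroup.mk_toWord (x := w)]
    rw [FreeGroup.lift_mk]; rfl
  rw [this] at h1
  have h2 := congrArg (fun g : SL(n, K) => (g : Matrix (Fin n) (Fin n) K)) h1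
  simp only [Matrix.SpecialLinearGroup.coe_one] at h2
  rw [← h2]
  generalize w.toWord = L
  induction L with
  | nil => simp
  | cons a L ih => simp [ih]

end PingPong
end WDC
end PartSec01

section PartSec02
open scoped MatrixGroups Pointwise
namespace WDC

section Ultralimit
open Filter Topology
variable (U : Ultrafilter ℕ) {Kf : ℕ → Type*} [∀ i, Field (Kf i)]
  (vf : ∀ i, AbsoluteValue (Kf i) ℝ)

/-- Sequences bounded along the ultrafilter. -/
def bsub : Subring (∀ i, Kf i) where
  carrier := {x | ∃ C : ℝ, ∀ᶠ i in (U : Filter ℕ), vf i (x i) ≤ C}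
  mul_mem' := by
    rintro x y ⟨C, hC⟩ ⟨D, hD⟩
    refine ⟨C * D, ?_⟩
    filter_upwards [hC, hD] with i h1 h2
    rw [Pi.mul_apply, map_mul]
    exact mul_le_mul h1 h2 ((vf i).nonneg _) (((vf i).nonneg _).trans h1)
  one_mem' := ⟨1, by simp⟩
  add_mem' := by
    rintro x y ⟨C, hC⟩ ⟨D, hD⟩
    refine ⟨C + D, ?_⟩
    filter_upwards [hC, hD] with i h1 h2
    exact ((vf i).add_le _ _).trans (add_le_add h1 h2)
  zero_mem' := ⟨0, by simp⟩
  neg_mem' := by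
    rintro x ⟨C, hC⟩
    exact ⟨C, by simpa using hC⟩

lemma mem_bsub {x : ∀ i, Kf i} :
    x ∈ bsub U vf ↔ ∃ C : ℝ, ∀ᶠ i in (U : Filter ℕ), vf i (x i) ≤ C := Iff.rfl

/-- The coordinate projections. -/
def bproj (i : ℕ) : bsub U vf →+* Kf i := (Pi.evalRingHom Kf i).comp (bsub U vf).subtype

@[simp] lemma bproj_apply (i : ℕ) (x : bsub U vf) : bproj U vf i x = x.1 i := rfl

/-- A limit of valued fields along an ultrafilter. -/
structure ULim (K : Type*) [Field K] (v : AbsoluteValue K ℝ) where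
  lm : bsub U vf →+* K
  surj : Function.Surjective lm
  tend : ∀ x : bsub U vf, Tendsto (fun i => vf i (x.1 i)) U (𝓝 (v (lm x)))

lemma exists_ulim_of_bdd {f : ℕ → ℝ} (h0 : ∀ i, 0 ≤ f i) {C : ℝ}
    (h : ∀ᶠ i in (U : Filter ℕ), f i ≤ C) : ∃ L, Tendsto f U (𝓝 L) := by
  have : (Ultrafilter.map f U : Filter ℝ) ≤ 𝓟 (Set.Icc 0 C) := by
    rw [Ultrafilter.coe_map, le_principal_iff, mem_map]
    filter_upwards [h] with i hi using ⟨h0 i, hi⟩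
  obtain ⟨L, -, hL⟩ := isCompact_Icc.ultrafilter_le_nhds _ this
  exact ⟨L, hL⟩

/-- Infinitesimal sequences. -/
def infid : Ideal (bsub U vf) where
  carrier := {x | Tendsto (fun i => vf i (x.1 i)) U (𝓝 0)}
  add_mem' := by
    intro x y hx hy
    refine squeeze_zero (fun i => (vf i).nonneg _) (fun i => (vf i).add_le _ _) ?_
    simpa using hx.add hy
  zero_mem' := by simp
  smul_mem' := by
    intro c x hx
    obtain ⟨C, hC⟩ := c.2
    have h1 : Tendsto (fun i => C * vf i (x.1 i)) U (𝓝 0) := by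
      simpa using hx.const_mul C
    refine squeeze_zero' (Eventually.of_forall fun i => (vf i).nonneg _) ?_ h1
    filter_upwards [hC] with i hi
    simp only [smul_eq_mul, Subring.coe_mul, Pi.mul_apply, map_mul]
    exact mul_le_mul_of_nonneg_right hi ((vf i).nonneg _)

lemma mem_infid {x : bsub U vf} :
    x ∈ infid U vf ↔ Tendsto (fun i => vf i (x.1 i)) U (𝓝 0) := Iff.rfl

lemma exists_lim (x : bsub U vf) : ∃ L, Tendsto (fun i => vf i (x.1 i)) U (𝓝 L) := by
  obtain ⟨C, hC⟩ := x.2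
  exact exists_ulim_of_bdd U (fun i => (vf i).nonneg _) hC

lemma exists_inv {x : bsub U vf} {L : ℝ} (hL : Tendsto (fun i => vf i (x.1 i)) U (𝓝 L))
    (h0 : L ≠ 0) : ∃ y : bsub U vf, ∀ᶠ i in (U : Filter ℕ), x.1 i * y.1 i = 1 := by
  have hpos : 0 < L := lt_of_le_of_ne (ge_of_tendsto' hL fun i => (vf i).nonneg _) h0.symm
  have h1 : ∀ᶠ i in (U : Filter ℕ), L / 2 < vf i (x.1 i) := hL.eventually_const_lt (by linarith)
  refine ⟨⟨fun i => (x.1 i)⁻¹, 2 / L, ?_⟩, ?_⟩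
  · filter_upwards [h1] with i hi
    rw [map_inv₀, show 2 / L = (L / 2)⁻¹ by field_simp]
    exact inv_anti₀ (by positivity) hi.le
  · filter_upwards [h1] with i hi
    refine mul_inv_cancel₀ fun h => ?_
    rw [h, map_zero] at hi
    linarith

instance infid_max : (infid U vf).IsMaximal := by
  rw [Ideal.isMaximal_iff]
  constructor
  · intro h
    rw [mem_infid] at h
    simp only [OneMemClass.coe_one, Pi.one_apply, map_one] at h
    exact one_ne_zero (tendsto_nhds_unique tendsto_const_nhds h)
  · intro J x hJ hx hxJ
    obtain ⟨L, hL⟩ := exists_lim U vf x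
    have h0 : L ≠ 0 := fun h => hx (by rw [mem_infid]; rwa [h] at hL)
    obtain ⟨y, hy⟩ := exists_inv U vf hL h0
    have h1 : 1 - x * y ∈ infid U vf := by
      rw [mem_infid]
      refine tendsto_nhds_of_eventually_eq ?_
      filter_upwards [hy] with i hi
      simp [hi]
    have := J.add_mem (hJ h1) (J.mul_mem_right y hxJ)
    simpa using this

/-- The ultralimit field. -/
abbrev UF := bsub U vf ⧸ infid U vf

noncomputable instance : Field (UF U vf) := Ideal.Quotient.field _

noncomputable def ufAbs (q : UF U vf) : ℝ :=
  Classical.choose (exists_lim U vf (Quotient.out q))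

lemma ufAbs_tend (x : bsub U vf) :
    Tendsto (fun i => vf i (x.1 i)) U (𝓝 (ufAbs U vf (Ideal.Quotient.mk _ x))) := by
  set y : bsub U vf := Quotient.out (Ideal.Quotient.mk (infid U vf) x)
  have hy := Classical.choose_spec (exists_lim U vf y)
  have hxy : x - y ∈ infid U vf := by
    rw [← Ideal.Quotient.eq]
    exact (Quotient.out_eq (s := Submodule.quotientRel (infid U vf)) (Ideal.Quotient.mk (infid U vf) x)).symm
  rw [mem_infid] at hxy
  have : Tendsto (fun i => vf i (x.1 i) - vf i (y.1 i)) U (𝓝 0) := by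
    refine squeeze_zero_norm (fun i => ?_) hxy
    rw [Real.norm_eq_abs]
    exact (vf i).abs_abv_sub_le_abv_sub _ _
  have h := this.add hy
  simp only [sub_add_cancel, zero_add] at h
  exact h

/-- The absolute value of the ultralimit field. -/
noncomputable def ufv : AbsoluteValue (UF U vf) ℝ where
  toFun := ufAbs U vf
  map_mul' := by
    intro a b
    obtain ⟨x, rfl⟩ := Ideal.Quotient.mk_surjective a
    obtain ⟨y, rfl⟩ := Ideal.Quotient.mk_surjective b
    rw [← map_mul]
    refine tendsto_nhds_unique (ufAbs_tend U vf (x * y)) ?_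
    simpa using (ufAbs_tend U vf x).mul (ufAbs_tend U vf y)
  nonneg' := by
    intro a
    obtain ⟨x, rfl⟩ := Ideal.Quotient.mk_surjective a
    exact ge_of_tendsto' (ufAbs_tend U vf x) fun i => (vf i).nonneg _
  eq_zero' := by
    intro a
    obtain ⟨x, rfl⟩ := Ideal.Quotient.mk_surjective a
    rw [Ideal.Quotient.eq_zero_iff_mem, mem_infid]
    constructor
    · intro h
      have := ufAbs_tend U vf x
      rwa [h] at this
    · intro h
      exact tendsto_nhds_unique (ufAbs_tend U vf x) h
  add_le' := by
    intro a b
    obtain ⟨x, rfl⟩ := Ideal.Quotient.mk_surjective a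
    obtain ⟨y, rfl⟩ := Ideal.Quotient.mk_surjective b
    rw [← map_add]
    exact le_of_tendsto_of_tendsto' (ufAbs_tend U vf (x + y))
      ((ufAbs_tend U vf x).add (ufAbs_tend U vf y)) fun i => (vf i).add_le _ _

noncomputable def ufULim : ULim U vf (UF U vf) (ufv U vf) where
  lm := Ideal.Quotient.mk _
  surj := Ideal.Quotient.mk_surjective
  tend := ufAbs_tend U vf

variable {U vf}
variable {K : Type*} [Field K] {v : AbsoluteValue K ℝ} (Λ : ULim U vf K v) {n : ℕ}

lemma ULim.nm_tend (A : Matrix (Fin n) (Fin n) (bsub U vf)) :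
    Tendsto (fun i => nm (vf i) (A.map (bproj U vf i))) U (𝓝 (nm v (A.map Λ.lm))) := by
  unfold nm
  exact tendsto_finsetSum _ fun i _ => tendsto_finsetSum _ fun j _ => Λ.tend (A i j)

lemma ULim.lift_mat (A : Matrix (Fin n) (Fin n) K) :
    ∃ B : Matrix (Fin n) (Fin n) (bsub U vf), B.map Λ.lm = A := by
  choose s hs using Λ.surj
  exact ⟨A.map s, by ext i j; simp [hs]⟩

lemma ULim.ppc {M : Fin 2 × Bool → Matrix (Fin n) (Fin n) (bsub U vf)}
    (h : PPC v (fun p => (M p).map Λ.lm)) :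
    ∀ᶠ i in (U : Filter ℕ), PPC (vf i) (fun p => (M p).map (bproj U vf i)) := by
  obtain ⟨k, θ, hk, hM, hθ⟩ := h
  choose θ' hθ' using fun i j => Λ.lift_mat (θ i j)
  have h1 : ∀ p, ∀ᶠ i in (U : Filter ℕ), n * k p < nm (vf i) ((M p).map (bproj U vf i)) :=
    fun p => (Λ.nm_tend (M p)).eventually_const_lt (hM p)
  have h2 : ∀ p q, ∀ᶠ i in (U : Filter ℕ), (p.1 = q.1 → p.2 = q.2) →
      nm (vf i) ((θ' p q).map (bproj U vf i)) < 1 / (2 * k p) ∧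
      nm (vf i) ((θ' p q).map (bproj U vf i) * ((M p).map (bproj U vf i) *
        (M q).map (bproj U vf i)) - (M q).map (bproj U vf i)) < k q / 2 := by
    intro p q
    by_cases hpq : p.1 = q.1 → p.2 = q.2
    · obtain ⟨a, b⟩ := hθ p q hpq
      have a' := (Λ.nm_tend (θ' p q)).eventually_lt_const (by rw [hθ']; exact a)
      have b' := (Λ.nm_tend (θ' p q * (M p * M q) - M q)).eventually_lt_const (u := k q / 2) (by
        rw [← RingHom.mapMatrix_apply, map_sub, map_mul, map_mul]
        simpa only [RingHom.mapMatrix_apply, hθ'] using b)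
      filter_upwards [a', b'] with i ha hb _
      refine ⟨ha, ?_⟩
      rw [← RingHom.mapMatrix_apply, map_sub, map_mul, map_mul] at hb
      simpa only [RingHom.mapMatrix_apply] using hb
    · exact Eventually.of_forall fun i h => absurd h hpq
  filter_upwards [eventually_all.2 h1, eventually_all.2 fun p => eventually_all.2 (h2 p)]
    with i ha hb
  exact ⟨k, fun p q => (θ' p q).map (bproj U vf i), hk, ha, hb⟩

end Ultralimit
end WDC
end PartSec02

section PartSec03
open scoped MatrixGroups Pointwise
namespace WDC

lemma finiteIndex_stab {G X : Type*} [Group G] [MulAction G X] {S : Set X} (hS : S.Finite) {x : X}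
    (h : ∀ g : G, g • x ∈ S) : (MulAction.stabilizer G x).FiniteIndex := by
  have : (MulAction.orbit G x).Finite := hS.subset (by rintro _ ⟨g, rfl⟩; exact h g)
  have := this.to_subtype
  have : Finite (G ⧸ MulAction.stabilizer G x) :=
    Finite.of_equiv _ (MulAction.orbitEquivQuotientStabilizer G x)
  exact Subgroup.finiteIndex_of_finite_quotient

section LinZar
variable {L : Type*} [Field L] {G : Type*} [Group G] {X : Type*} [AddCommGroup X] [Module L X]

/-- The action on subspaces attached to a linear representation. -/
@[reducible] def subAct (ρ : G →* (X →ₗ[L] X)) : MulAction G (Submodule L X) where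
  smul g W := W.map (ρ g)
  one_smul W := by
    change W.map (ρ 1) = W
    rw [map_one]; exact Submodule.map_id W
  mul_smul g h W := by
    change W.map (ρ (g * h)) = (W.map (ρ h)).map (ρ g)
    rw [map_mul]; exact Submodule.map_comp _ _ _

lemma finrank_map_rep (ρ : G →* (X →ₗ[L] X)) (g : G) (W : Submodule L X) :
    Module.finrank L (W.map (ρ g)) = Module.finrank L W := by
  refine LinearEquiv.finrank_eq (Submodule.equivMapOfInjective (ρ g) ?_ W).symm
  refine Function.LeftInverse.injective (g := ρ g⁻¹) fun x => ?_
  rw [← Module.End.mul_apply, ← map_mul]; simp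

variable [FiniteDimensional L X]

lemma linzar (ρ : G →* (X →ₗ[L] X)) (w : X) (D : ℕ) : ∀ 𝒞 : Finset (Submodule L X),
    (∀ C ∈ 𝒞, Module.finrank L C < D) → (∀ g, ∃ C ∈ 𝒞, ρ g w ∈ C) →
    ∃ (Γ : Subgroup G) (W : Submodule L X), Γ.FiniteIndex ∧ (∀ g ∈ Γ, ∀ x ∈ W, ρ g x ∈ W) ∧
      (∃ C ∈ 𝒞, W ≤ C) ∧ ∃ h, ρ h w ∈ W := by
  classical
  induction D with
  | zero =>
    intro 𝒞 h1 h2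
    obtain ⟨C, hC, -⟩ := h2 1
    exact absurd (h1 C hC) (by omega)
  | succ D ih =>
    intro 𝒞 h1 h2
    let P : ℕ → Prop := fun m => ∃ 𝒞' : Finset (Submodule L X),
      (∀ C ∈ 𝒞', Module.finrank L C < D + 1) ∧ (∀ g, ∃ C ∈ 𝒞', ρ g w ∈ C) ∧
      (∀ C' ∈ 𝒞', ∃ C ∈ 𝒞, C' ≤ C) ∧ (𝒞'.filter (fun C : Submodule L X => Module.finrank L C = D)).card = m
    have hP : ∃ m, P m := ⟨_, 𝒞, h1, h2, fun C hC => ⟨C, hC, le_rfl⟩, rfl⟩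
    obtain ⟨𝒞', a1, a2, a3, a4⟩ := Nat.find_spec hP
    set 𝒟 := 𝒞'.filter (fun C : Submodule L X => Module.finrank L C = D) with h𝒟
    have hmin : ∀ 𝒞'' : Finset (Submodule L X),
      (∀ C ∈ 𝒞'', Module.finrank L C < D + 1) → (∀ g, ∃ C ∈ 𝒞'', ρ g w ∈ C) →
      (∀ C' ∈ 𝒞'', ∃ C ∈ 𝒞', C' ≤ C) → 
      𝒟.card ≤ (𝒞''.filter (fun C : Submodule L X => Module.finrank L C = D)).card := by
      intro 𝒞'' b1 b2 b3
      rw [a4]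
      refine Nat.find_min' hP ⟨𝒞'', b1, b2, fun C hC => ?_, rfl⟩
      obtain ⟨C1, hC1, hle⟩ := b3 C hC
      obtain ⟨C2, hC2, hle2⟩ := a3 C1 hC1
      exact ⟨C2, hC2, hle.trans hle2⟩
    by_cases h0 : 𝒟 = ∅
    · obtain ⟨Γ, W, c1, c2, ⟨C, hC, hWC⟩, c4⟩ := ih 𝒞' (by
        intro C hC
        have := a1 C hC
        rcases Nat.lt_succ_iff_lt_or_eq.mp this with h | h
        · exact h
        · exact (Finset.eq_empty_iff_forall_notMem.mp h0 C (Finset.mem_filter.mpr ⟨hC, h⟩)).elim) a2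
      obtain ⟨C2, hC2, hle2⟩ := a3 C hC
      exact ⟨Γ, W, c1, c2, ⟨C2, hC2, hWC.trans hle2⟩, c4⟩
    obtain ⟨W, hW⟩ := Finset.nonempty_iff_ne_empty.mpr h0
    have key : ∀ g : G, ∀ C ∈ 𝒟, C.map (ρ g⁻¹) ∈ 𝒟 := by
      intro g C hC
      have hsub : (Finset.image₂ (fun C C' => C ⊓ C'.map (ρ g)) 𝒞' 𝒞').filter
          (fun C : Submodule L X => Module.finrank L C = D) ⊆ 𝒟 ∩ 𝒟.image (fun C : Submodule L X => C.map (ρ g)) := by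
        intro E hE
        rw [Finset.mem_filter, Finset.mem_image₂] at hE
        obtain ⟨⟨C1, hC1, C2, hC2, rfl⟩, hE⟩ := hE
        have e1 : C1 ⊓ C2.map (ρ g) = C1 := by
          refine Submodule.eq_of_le_of_finrank_le inf_le_left ?_
          have := a1 C1 hC1; omega
        have e2 : C1 ⊓ C2.map (ρ g) = C2.map (ρ g) := by
          refine Submodule.eq_of_le_of_finrank_le inf_le_right ?_
          rw [finrank_map_rep]
          have := a1 C2 hC2; omega
        rw [Finset.mem_inter, Finset.mem_image]
        refine ⟨Finset.mem_filter.mpr ⟨by rw [e1]; exact hC1, hE⟩, C2,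
          Finset.mem_filter.mpr ⟨hC2, ?_⟩, e2.symm⟩
        rw [e2, finrank_map_rep] at hE; exact hE
      have hle := hmin (Finset.image₂ (fun C C' => C ⊓ C'.map (ρ g)) 𝒞' 𝒞') ?_ ?_ ?_
      · have h3 : 𝒟 ∩ 𝒟.image (fun C : Submodule L X => C.map (ρ g)) = 𝒟 :=
          Finset.eq_of_subset_of_card_le Finset.inter_subset_left
            (hle.trans (Finset.card_le_card hsub))
        rw [← h3, Finset.mem_inter, Finset.mem_image] at hC
        obtain ⟨_, C', hC', rfl⟩ := hC
        rw [← Submodule.map_comp, ← Module.End.mul_eq_comp, ← map_mul]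
        simpa [Module.End.one_eq_id, Submodule.map_id] using hC'
      · intro E hE
        rw [Finset.mem_image₂] at hE
        obtain ⟨C1, hC1, C2, hC2, rfl⟩ := hE
        exact (Submodule.finrank_mono inf_le_left).trans_lt (a1 C1 hC1)
      · intro h
        obtain ⟨C1, hC1, hh⟩ := a2 h
        obtain ⟨C2, hC2, hh2⟩ := a2 (g⁻¹ * h)
        refine ⟨_, Finset.mem_image₂_of_mem hC1 hC2, hh, ?_⟩
        refine ⟨_, hh2, ?_⟩
        rw [← Module.End.mul_apply, ← map_mul]; simp
      · intro E hE
        rw [Finset.mem_image₂] at hE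
        obtain ⟨C1, hC1, C2, hC2, rfl⟩ := hE
        exact ⟨C1, hC1, inf_le_left⟩
    let := subAct ρ
    refine ⟨MulAction.stabilizer G W, W, finiteIndex_stab 𝒟.finite_toSet (fun g => ?_), ?_, ?_, ?_⟩
    · have := key g⁻¹ W hW
      rw [inv_inv] at this
      exact this
    · intro g hg x hx
      have : W.map (ρ g) = W := hg
      rw [← this]; exact Submodule.mem_map_of_mem hx
    · exact a3 W (Finset.mem_filter.mp hW).1
    · by_contra hc
      push Not at hc
      have := hmin (𝒞'.erase W) (fun C hC => a1 C (Finset.mem_of_mem_erase hC)) ?_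
        (fun C hC => ⟨C, Finset.mem_of_mem_erase hC, le_rfl⟩)
      · rw [Finset.filter_erase, Finset.card_erase_of_mem hW] at this
        have := Finset.card_pos.mpr ⟨W, hW⟩
        omega
      · intro g
        obtain ⟨C, hC, hh⟩ := a2 g
        refine ⟨C, Finset.mem_erase.mpr ⟨?_, hC⟩, hh⟩
        rintro rfl; exact hc g hh

end LinZar
end WDC
end PartSec03

section PartSec04
open scoped MatrixGroups Pointwise
namespace WDC
set_option linter.unusedSectionVars false

section Prime
variable {L : Type*} [Field L] {G : Type*} [Group G] {V : Type*} [AddCommGroup V] [Module L V]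

/-- The enveloping algebra of a subgroup. -/
def env (ρ : G →* Module.End L V) (Γ : Subgroup G) : Subalgebra L (Module.End L V) :=
  Algebra.adjoin L (ρ '' (Γ : Set G))

lemma env_toSubmodule (ρ : G →* Module.End L V) (Γ : Subgroup G) :
    Subalgebra.toSubmodule (env ρ Γ) = Submodule.span L (ρ '' (Γ : Set G)) := by
  unfold env
  rw [Algebra.adjoin_eq_span]
  congr 1
  have : ρ '' (Γ : Set G) = ((Γ.toSubmonoid.map ρ : Submonoid (Module.End L V)) : Set _) := rfl
  rw [this, Submonoid.closure_eq]

lemma mem_env (ρ : G →* Module.End L V) (Γ : Subgroup G) {g : G} (hg : g ∈ Γ) : ρ g ∈ env ρ Γ :=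
  Algebra.subset_adjoin ⟨g, hg, rfl⟩

lemma mem_env_iff (ρ : G →* Module.End L V) (Γ : Subgroup G) {A : Module.End L V} :
    A ∈ env ρ Γ ↔ A ∈ Submodule.span L (ρ '' (Γ : Set G)) := by
  rw [← env_toSubmodule]; rfl

lemma rho_inv_mul (ρ : G →* Module.End L V) (g : G) : ρ g⁻¹ * ρ g = 1 := by
  rw [← map_mul]; simp

lemma rho_mul_inv (ρ : G →* Module.End L V) (g : G) : ρ g * ρ g⁻¹ = 1 := by
  rw [← map_mul]; simp

lemma rho_inv_apply (ρ : G →* Module.End L V) (g : G) (x : V) : ρ g⁻¹ (ρ g x) = x := by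
  rw [← Module.End.mul_apply, rho_inv_mul]; rfl

lemma rho_apply_inv (ρ : G →* Module.End L V) (g : G) (x : V) : ρ g (ρ g⁻¹ x) = x := by
  rw [← Module.End.mul_apply, rho_mul_inv]; rfl

lemma env_conj (ρ : G →* Module.End L V) (Γ : Subgroup G) [Γ.Normal] (g : G) {A : Module.End L V}
    (hA : A ∈ env ρ Γ) : ρ g⁻¹ * A * ρ g ∈ env ρ Γ := by
  rw [mem_env_iff] at hA
  induction hA using Submodule.span_induction with
  | mem x hx =>
    obtain ⟨h, hh, rfl⟩ := hx
    rw [← map_mul, ← map_mul]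
    refine mem_env ρ Γ ?_
    have := (inferInstance : Γ.Normal).conj_mem h hh g⁻¹
    simpa using this
  | zero => simp
  | add x y _ _ hx hy => rw [mul_add, add_mul]; exact add_mem hx hy
  | smul c x _ hx => 
    rw [mul_smul_comm, smul_mul_assoc]; exact Subalgebra.smul_mem _ hx c

variable (ρ : G →* Module.End L V) (Γ : Subgroup G) [Γ.Normal]

/-- Translate of an invariant subspace. -/
def tw (g : G) (S : Submodule (env ρ Γ) V) : Submodule (env ρ Γ) V where
  carrier := {x | ρ g⁻¹ x ∈ S}
  add_mem' := by intro x y hx hy; simp only [Set.mem_ofPred_eq, map_add] at *; exact add_mem hx hy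
  zero_mem' := by simp
  smul_mem' := by
    intro r x hx
    simp only [Set.mem_ofPred_eq] at *
    have := S.smul_mem ⟨_, env_conj ρ Γ g r.2⟩ hx
    have e : (⟨_, env_conj ρ Γ g r.2⟩ : env ρ Γ) • (ρ g⁻¹ x) = ρ g⁻¹ (r • x) := by
      change (ρ g⁻¹ * r.1 * ρ g) (ρ g⁻¹ x) = ρ g⁻¹ (r.1 x)
      simp only [Module.End.mul_apply, rho_apply_inv]
    rwa [e] at this

lemma mem_tw {g : G} {S : Submodule (env ρ Γ) V} {x : V} : x ∈ tw ρ Γ g S ↔ ρ g⁻¹ x ∈ S := Iff.rfl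

@[reducible] def twAct : MulAction G (Submodule (env ρ Γ) V) where
  smul g S := tw ρ Γ g S
  one_smul S := by
    ext x; change x ∈ tw ρ Γ 1 S ↔ _
    rw [mem_tw]; simp
  mul_smul g h S := by
    ext x; change x ∈ tw ρ Γ (g * h) S ↔ x ∈ tw ρ Γ g (tw ρ Γ h S)
    rw [mem_tw, mem_tw, mem_tw, mul_inv_rev, map_mul]; rfl

def twIso (g : G) : Submodule (env ρ Γ) V ≃o Submodule (env ρ Γ) V where
  toFun := tw ρ Γ g
  invFun := tw ρ Γ g⁻¹
  left_inv S := by ext x; rw [mem_tw, mem_tw, inv_inv, rho_inv_apply]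
  right_inv S := by ext x; rw [mem_tw, mem_tw, inv_inv, rho_apply_inv]
  map_rel_iff' := by
    intro S T
    constructor
    · intro h x hx
      have : ρ g x ∈ tw ρ Γ g S := by rw [mem_tw, rho_inv_apply]; exact hx
      have := h this
      change ρ g x ∈ tw ρ Γ g T at this
      rwa [mem_tw, rho_inv_apply] at this
    · intro h x hx
      exact h hx

lemma tw_equiv (g : G) {S T : Submodule (env ρ Γ) V} (h : Nonempty (S ≃ₗ[env ρ Γ] T)) :
    Nonempty (tw ρ Γ g S ≃ₗ[env ρ Γ] tw ρ Γ g T) := by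
  obtain ⟨e⟩ := h
  have aux : ∀ (S T : Submodule (env ρ Γ) V) (f : S →ₗ[env ρ Γ] T),
      ∃ f' : tw ρ Γ g S →ₗ[env ρ Γ] tw ρ Γ g T, ∀ x, (f' x : V) = ρ g (f ⟨ρ g⁻¹ x, x.2⟩) := by
    intro S T f
    refine ⟨{ toFun := fun x => ⟨ρ g (f ⟨ρ g⁻¹ x, x.2⟩), ?_⟩, map_add' := ?_, map_smul' := ?_ },
      fun x => rfl⟩
    · rw [mem_tw, rho_inv_apply]; exact Subtype.coe_prop _
    · intro x y
      ext
      have : (⟨ρ g⁻¹ (x + y : tw ρ Γ g S), (x + y).2⟩ : S) = ⟨ρ g⁻¹ x, x.2⟩ + ⟨ρ g⁻¹ y, y.2⟩ := by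
        ext; simp
      change ρ g (f _) = ρ g (f _) + ρ g (f _)
      rw [this, map_add, Submodule.coe_add, map_add]
    · intro r x
      ext
      have : (⟨ρ g⁻¹ ((r : Module.End L V) (x : V)), (tw ρ Γ g S).smul_mem r x.2⟩ : S) =
          (⟨_, env_conj ρ Γ g r.2⟩ : env ρ Γ) • ⟨ρ g⁻¹ x, x.2⟩ := by
        ext
        change ρ g⁻¹ (r.1 x) = (ρ g⁻¹ * r.1 * ρ g) (ρ g⁻¹ x)
        simp only [Module.End.mul_apply, rho_apply_inv]
      have h2 : (f ⟨ρ g⁻¹ ((r : Module.End L V) (x : V)), (tw ρ Γ g S).smul_mem r x.2⟩ : V) = _ :=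
        congrArg (fun z => (f z : V)) this
      refine (congrArg (fun z => ρ g z) h2).trans ?_
      rw [map_smul]
      change ρ g ((ρ g⁻¹ * r.1 * ρ g) _) = _
      simp only [Module.End.mul_apply, rho_apply_inv]
      rfl
  obtain ⟨f1, h1⟩ := aux S T e.toLinearMap
  obtain ⟨f2, h2⟩ := aux T S e.symm.toLinearMap
  refine ⟨LinearEquiv.ofLinearMap f1 f2 ?_ ?_⟩
  · ext x
    simp only [LinearMap.comp_apply, h1, LinearMap.id_apply]
    have : (⟨ρ g⁻¹ (f2 x), (f2 x).2⟩ : S) = e.symm ⟨ρ g⁻¹ x, x.2⟩ := by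
      ext; simp only [h2, rho_inv_apply]; rfl
    rw [this]; simp
  · ext x
    simp only [LinearMap.comp_apply, h2, LinearMap.id_apply]
    have : (⟨ρ g⁻¹ (f1 x), (f1 x).2⟩ : T) = e ⟨ρ g⁻¹ x, x.2⟩ := by
      ext; simp only [h1, rho_inv_apply]; rfl
    rw [this]; simp

lemma tw_isotypic (g : G) (S : Submodule (env ρ Γ) V) :
    tw ρ Γ g (isotypicComponent (env ρ Γ) V S) = isotypicComponent (env ρ Γ) V (tw ρ Γ g S) := by
  have hle : ∀ (g : G) (S : Submodule (env ρ Γ) V),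
      tw ρ Γ g (isotypicComponent (env ρ Γ) V S) ≤ isotypicComponent (env ρ Γ) V (tw ρ Γ g S) := by
    intro g S
    unfold isotypicComponent
    change twIso ρ Γ g _ ≤ _
    rw [OrderIso.map_sSup]
    refine iSup₂_le fun m hm => ?_
    exact le_sSup (tw_equiv ρ Γ g hm)
  refine le_antisymm (hle g S) ?_
  have h1 := hle g⁻¹ (tw ρ Γ g S)
  have e1 : tw ρ Γ g⁻¹ (tw ρ Γ g S) = S := (twIso ρ Γ g).left_inv S
  rw [e1] at h1
  have h2 := (twIso ρ Γ g).monotone h1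
  have e2 : twIso ρ Γ g (tw ρ Γ g⁻¹ (isotypicComponent (env ρ Γ) V (tw ρ Γ g S))) = _ :=
    (twIso ρ Γ g).right_inv _
  rw [e2] at h2
  exact h2

lemma tw_simple (g : G) (S : Submodule (env ρ Γ) V) [h : IsSimpleModule (env ρ Γ) S] :
    IsSimpleModule (env ρ Γ) (tw ρ Γ g S) := by
  rw [isSimpleModule_iff_isAtom] at *
  exact ((twIso ρ Γ g).isAtom_iff S).mpr h

variable [FiniteDimensional L V]

lemma isotypic_card : (isotypicComponents (env ρ Γ) V).Finite ∧
    (isotypicComponents (env ρ Γ) V).ncard ≤ Module.finrank L V := by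
  have h1 := sSupIndep_isotypicComponents (env ρ Γ) V
  have h2 : iSupIndep (fun i : isotypicComponents (env ρ Γ) V => (i.1).restrictScalars L) := by
    rw [sSupIndep_iff] at h1
    intro i
    have := h1 i
    rw [disjoint_iff] at this ⊢
    have h3 := congrArg (Submodule.restrictScalarsLatticeHom L (env ρ Γ) V) this
    simp only [map_inf, map_iSup, map_bot] at h3
    exact h3
  have hne : ∀ i : isotypicComponents (env ρ Γ) V, (i.1).restrictScalars L ≠ ⊥ := by
    intro i h
    exact (bot_lt_isotypicComponents i.2).ne' (by simpa using h)
  have h3 : Finite {i : isotypicComponents (env ρ Γ) V // (i.1).restrictScalars L ≠ ⊥} :=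
    (iSupIndep.fintypeNeBotOfFiniteDimensional h2).finite
  have h4 : Finite (isotypicComponents (env ρ Γ) V) :=
    Finite.of_injective (fun i => (⟨i, hne i⟩ : 
      {i : isotypicComponents (env ρ Γ) V // (i.1).restrictScalars L ≠ ⊥})) (by
        intro a b h; simpa using h)
  refine ⟨h4, ?_⟩
  have := Fintype.ofFinite {i : isotypicComponents (env ρ Γ) V // (i.1).restrictScalars L ≠ ⊥}
  have h5 := h2.subtype_ne_bot_le_finrank
  rw [← Nat.card_coe_set_eq]
  rw [← Nat.card_eq_fintype_card] at h5
  refine le_trans (le_of_eq ?_) h5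
  exact Nat.card_congr (Equiv.subtypeUnivEquiv hne).symm

lemma prime_env (hn : 0 < Module.finrank L V)
    (hirr : ∀ W : Submodule L V,
      (∀ g, ∀ x ∈ W, ρ (g ^ (Module.finrank L V).factorial) x ∈ W) → W = ⊥ ∨ W = ⊤)
    {A B : Module.End L V} (hA : A ∈ env ρ Γ) (hB : B ∈ env ρ Γ) (hA0 : A ≠ 0) (hB0 : B ≠ 0) :
    ∃ g ∈ Γ, A * ρ g * B ≠ 0 := by
  have hnt : Nontrivial V := Module.finrank_pos_iff.mp hn
  have : IsArtinian (env ρ Γ) V := isArtinian_of_tower L inferInstance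
  obtain ⟨W, hW, -⟩ := (IsAtomic.eq_bot_or_exists_atom_le (⊤ : Submodule (env ρ Γ) V)).resolve_left
    top_ne_bot
  have hWs : IsSimpleModule (env ρ Γ) W := isSimpleModule_iff_isAtom.mpr hW
  -- the isotypic component is everything
  have htop : isotypicComponent (env ρ Γ) V W = ⊤ := by
    let := twAct ρ Γ
    have hmem : isotypicComponent (env ρ Γ) V W ∈ isotypicComponents (env ρ Γ) V := ⟨W, hWs, rfl⟩
    obtain ⟨hf, hc⟩ := isotypic_card ρ Γ
    have hst : ∀ g : G, ∀ c ∈ isotypicComponents (env ρ Γ) V,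
        g • c ∈ isotypicComponents (env ρ Γ) V := by
      rintro g _ ⟨S, hS, rfl⟩
      exact ⟨tw ρ Γ g S, tw_simple ρ Γ g S, tw_isotypic ρ Γ g S⟩
    have hfix : ∀ g : G, g ^ (Module.finrank L V).factorial • isotypicComponent (env ρ Γ) V W =
        isotypicComponent (env ρ Γ) V W := by
      intro g
      set c := isotypicComponent (env ρ Γ) V W
      have hper : Function.minimalPeriod (fun x => g • x) c ≤ Module.finrank L V ∧
          0 < Function.minimalPeriod (fun x => g • x) c := by
        have horb : ∀ k : ℕ, (fun x => g • x)^[k] c ∈ isotypicComponents (env ρ Γ) V := by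
          intro k; rw [smul_iterate]; exact hst _ _ hmem
        have hinj : Set.InjOn (fun k => (fun x => g • x)^[k] c)
            (Set.Iio (Function.minimalPeriod (fun x => g • x) c)) := by
          intro a ha b hb hab
          exact (Function.iterate_eq_iterate_iff_of_lt_minimalPeriod ha hb).mp hab
        constructor
        · refine le_trans ?_ hc
          have := Set.ncard_le_ncard (s := (fun k => (fun x => g • x)^[k] c) ''
            (Set.Iio (Function.minimalPeriod (fun x => g • x) c))) (by
              rintro _ ⟨k, -, rfl⟩; exact horb k) hf
          rw [Set.InjOn.ncard_image hinj] at this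
          simpa [Set.ncard_eq_toFinset_card'] using this
        · rw [Function.minimalPeriod_pos_iff_mem_periodicPts]
          have hni : ¬ Function.Injective (fun k : ℕ => (⟨_, horb k⟩ : isotypicComponents (env ρ Γ) V)) := by
            have := hf.to_subtype
            exact not_injective_infinite_finite _
          simp only [Function.Injective, not_forall] at hni
          obtain ⟨a, b, hab, hne⟩ := hni
          simp only [Subtype.mk.injEq, smul_iterate] at hab
          wlog hlt : a < b generalizing a b
          · exact this b a (Ne.symm hne) hab.symm (lt_of_le_of_ne (not_lt.mp hlt) (Ne.symm hne))
          refine Function.mk_mem_periodicPts (n := b - a) (by omega) ?_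
          change (fun x => g • x)^[b - a] c = c
          rw [smul_iterate]
          have e : g ^ b = g ^ a * g ^ (b - a) := by rw [← pow_add]; congr 1; omega
          rw [e, mul_smul] at hab
          exact (MulAction.injective (g ^ a) hab).symm
      have hdvd : Function.minimalPeriod (fun x => g • x) c ∣ (Module.finrank L V).factorial :=
        Nat.dvd_factorial hper.2 hper.1
      have := (Function.isPeriodicPt_minimalPeriod (fun x => g • x) c).trans_dvd hdvd
      have h2 : (fun x => g • x)^[(Module.finrank L V).factorial] c = c := this
      rwa [smul_iterate] at h2
    have h := hirr ((isotypicComponent (env ρ Γ) V W).restrictScalars L) (by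
      intro g x hx
      have h1 : x ∈ isotypicComponent (env ρ Γ) V W := hx
      rw [← hfix g⁻¹] at h1
      have h2 : ρ ((g⁻¹ ^ (Module.finrank L V).factorial)⁻¹) x ∈ isotypicComponent (env ρ Γ) V W := h1
      rw [← inv_pow, inv_inv] at h2
      exact h2)
    rcases h with h | h
    · exact absurd (by simpa using h) (bot_lt_isotypicComponent W).ne'
    · simpa using h
  have hfaith : ∀ C ∈ env ρ Γ, (∀ w ∈ W, C w = 0) → C = 0 := by
    intro C hC hw
    let Z : Submodule L V := LinearMap.ker C
    have hle : ∀ m : Submodule (env ρ Γ) V, Nonempty (m ≃ₗ[env ρ Γ] W) → ∀ x ∈ m, C x = 0 := by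
      rintro m ⟨e⟩ x hx
      have h1 : e ((⟨C, hC⟩ : env ρ Γ) • (⟨x, hx⟩ : m)) = 0 := by
        rw [map_smul]; ext
        exact hw _ (e ⟨x, hx⟩).2
      have h2 := (map_eq_zero_iff e e.injective).mp h1
      exact congrArg Subtype.val h2
    have h3 : (isotypicComponent (env ρ Γ) V W).restrictScalars L ≤ LinearMap.ker C := by
      unfold isotypicComponent
      rw [Submodule.restrictScalars_sSup]
      refine sSup_le ?_
      rintro _ ⟨m, hm, rfl⟩ x hx
      exact hle m hm x hx
    rw [htop] at h3
    ext x
    exact h3 (Submodule.mem_top)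
  by_contra hcon
  push Not at hcon
  have hall : ∀ r ∈ env ρ Γ, A * r * B = 0 := by
    intro r hr
    rw [mem_env_iff] at hr
    induction hr using Submodule.span_induction with
    | mem x hx => obtain ⟨g, hg, rfl⟩ := hx; exact hcon g hg
    | zero => simp
    | add x y _ _ hx hy => rw [mul_add, add_mul, hx, hy, add_zero]
    | smul c x _ hx => rw [mul_smul_comm, smul_mul_assoc, hx, smul_zero]
  obtain ⟨w, hw, hBw⟩ : ∃ w ∈ W, B w ≠ 0 := by
    by_contra h; push Not at h; exact hB0 (hfaith B hB h)
  apply hA0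
  apply hfaith A hA
  intro w' hw'
  have hBwW : B w ∈ W := W.smul_mem ⟨B, hB⟩ hw
  have hs : Submodule.span (env ρ Γ) {B w} = W := by
    refine (hW.le_iff.mp ?_).resolve_left ?_
    · rw [Submodule.span_singleton_le_iff_mem]; exact hBwW
    · rw [Submodule.span_singleton_eq_bot]; exact hBw
  have hm : w' ∈ Submodule.span (env ρ Γ) {B w} := by rw [hs]; exact hw'
  rw [Submodule.mem_span_singleton] at hm
  obtain ⟨r, hr⟩ := hm
  have hr' : r.1 (B w) = w' := hr
  rw [← hr']
  have := congrArg (fun f : Module.End L V => f w) (hall r.1 r.2)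
  exact this

end Prime
end WDC
end PartSec04

section PartSec05
open scoped MatrixGroups Pointwise
namespace WDC

section Generic
variable {L : Type*} [Field L] {G : Type*} [Group G] {V : Type*} [AddCommGroup V] [Module L V]
  [FiniteDimensional L V] (ρ : G →* Module.End L V)

lemma env_mono {Γ₁ Γ₂ : Subgroup G} (h : Γ₁ ≤ Γ₂) : env ρ Γ₁ ≤ env ρ Γ₂ :=
  Algebra.adjoin_mono (Set.image_mono h)

lemma exists_min_env : ∃ Γ₀ : Subgroup G, Γ₀.Normal ∧ Γ₀.FiniteIndex ∧
    ∀ Γ₁ : Subgroup G, Γ₁.FiniteIndex → env ρ Γ₀ ≤ env ρ Γ₁ := by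
  classical
  let P : ℕ → Prop := fun m => ∃ Γ : Subgroup G, Γ.Normal ∧ Γ.FiniteIndex ∧
    Module.finrank L (Subalgebra.toSubmodule (env ρ Γ)) = m
  have hP : ∃ m, P m := ⟨_, ⊤, inferInstance, inferInstance, rfl⟩
  obtain ⟨Γ₀, hn, hf, hm⟩ := Nat.find_spec hP
  refine ⟨Γ₀, hn, hf, fun Γ₁ h1 => ?_⟩
  have hfi : (Γ₁ ⊓ Γ₀).normalCore.FiniteIndex := inferInstance
  have hle : (Γ₁ ⊓ Γ₀).normalCore ≤ Γ₁ ⊓ Γ₀ := Subgroup.normalCore_le _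
  have h2 : Nat.find hP ≤ Module.finrank L (Subalgebra.toSubmodule (env ρ (Γ₁ ⊓ Γ₀).normalCore)) :=
    Nat.find_min' hP ⟨_, inferInstance, hfi, rfl⟩
  have h3 : Subalgebra.toSubmodule (env ρ (Γ₁ ⊓ Γ₀).normalCore) ≤
      Subalgebra.toSubmodule (env ρ Γ₀) := env_mono ρ (hle.trans inf_le_right)
  have h4 := Submodule.eq_of_le_of_finrank_le h3 (by rw [hm]; exact h2)
  have h5 : Subalgebra.toSubmodule (env ρ Γ₀) ≤ Subalgebra.toSubmodule (env ρ Γ₁) := by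
    rw [← h4]; exact env_mono ρ (hle.trans inf_le_left)
  exact h5

/-- `Γ₀` acts on pairs of endomorphisms. -/
def pairRep (Γ : Subgroup G) : Γ →* Module.End L (Module.End L V × Module.End L V) where
  toFun g := LinearMap.prodMap (LinearMap.mulLeft L (ρ g)) (LinearMap.mulRight L (ρ (g : G)⁻¹))
  map_one' := by ext <;> simp
  map_mul' g h := by
    ext <;> simp

lemma pairRep_apply (Γ : Subgroup G) (g : Γ) (x : Module.End L V × Module.End L V) :
    pairRep ρ Γ g x = (ρ g * x.1, x.2 * ρ (g : G)⁻¹) := rfl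

lemma exists_transverse (hn : 0 < Module.finrank L V)
    (hirr : ∀ W : Submodule L V,
      (∀ g, ∀ x ∈ W, ρ (g ^ (Module.finrank L V).factorial) x ∈ W) → W = ⊥ ∨ W = ⊤)
    (Γ₀ : Subgroup G) [Γ₀.Normal] [Γ₀.FiniteIndex]
    (hmin : ∀ Γ₁ : Subgroup G, Γ₁.FiniteIndex → env ρ Γ₀ ≤ env ρ Γ₁)
    (S : Finset (Module.End L V × Module.End L V))
    (hS : ∀ p ∈ S, p.1 ∈ env ρ Γ₀ ∧ p.2 ∈ env ρ Γ₀ ∧ p.1 ≠ 0 ∧ p.2 ≠ 0) :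
    ∃ h ∈ Γ₀, ∀ p ∈ S, p.1 * ρ h * p.2 ≠ 0 ∧ p.1 * ρ h⁻¹ * p.2 ≠ 0 := by
  classical
  by_contra hcon
  push Not at hcon
  let bil : Module.End L V × Module.End L V → Module.End L V →ₗ[L] Module.End L V := fun p =>
    (LinearMap.mulRight L p.2).comp (LinearMap.mulLeft L p.1)
  have hbil : ∀ p x, bil p x = p.1 * x * p.2 := fun p x => rfl
  let C1 : Module.End L V × Module.End L V → Submodule L (Module.End L V × Module.End L V) :=
    fun p => LinearMap.ker ((bil p).comp (LinearMap.fst L _ _))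
  let C2 : Module.End L V × Module.End L V → Submodule L (Module.End L V × Module.End L V) :=
    fun p => LinearMap.ker ((bil p).comp (LinearMap.snd L _ _))
  obtain ⟨Γ, W, hΓ, hW, ⟨C, hC, hWC⟩, h, hh⟩ := linzar (pairRep ρ Γ₀) (1, 1)
    (Module.finrank L (Module.End L V × Module.End L V) + 1) (S.image C1 ∪ S.image C2)
    (fun C _ => Nat.lt_succ_of_le (Submodule.finrank_le C)) (by
      intro g
      by_cases hx : ∀ p ∈ S, p.1 * ρ g * p.2 ≠ 0
      · obtain ⟨p, hp, hp1⟩ := hcon g g.2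
        refine ⟨C2 p, Finset.mem_union_right _ (Finset.mem_image_of_mem _ hp), ?_⟩
        have := hp1 (hx p hp)
        simpa [C2, pairRep_apply, hbil] using this
      · push Not at hx
        obtain ⟨p, hp, hp1⟩ := hx
        refine ⟨C1 p, Finset.mem_union_left _ (Finset.mem_image_of_mem _ hp), ?_⟩
        simpa [C1, pairRep_apply, hbil] using hp1)
  let Γ₁ : Subgroup G := Γ.map Γ₀.subtype
  have hΓ₁ : Γ₁.FiniteIndex := by
    constructor
    rw [Subgroup.index_map_subtype]
    exact mul_ne_zero hΓ.index_ne_zero Subgroup.FiniteIndex.index_ne_zero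
  have hle := hmin Γ₁ hΓ₁
  have horb : ∀ g ∈ Γ, (ρ (g : G) * ρ (h : G), ρ (h : G)⁻¹ * ρ (g : G)⁻¹) ∈ C := by
    intro g hg
    have := hWC (hW g hg _ hh)
    simpa [pairRep_apply] using this
  have hspan : ∀ A B : Module.End L V, (∀ g ∈ Γ, A * ρ (g : G) * B = 0) → ∀ g ∈ Γ₀, A * ρ g * B = 0 := by
    intro A B hz g hg
    have hr := hle (mem_env ρ Γ₀ hg)
    rw [mem_env_iff] at hr
    generalize ρ g = r at hr
    induction hr using Submodule.span_induction with
    | mem x hx =>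
      obtain ⟨g, hg, rfl⟩ := hx
      obtain ⟨g', hg', rfl⟩ := hg
      exact hz g' hg'
    | zero => simp
    | add x y _ _ hx hy => rw [mul_add, add_mul, hx, hy, add_zero]
    | smul c x _ hx => rw [mul_smul_comm, smul_mul_assoc, hx, smul_zero]
  rw [Finset.mem_union, Finset.mem_image, Finset.mem_image] at hC
  rcases hC with ⟨p, hp, rfl⟩ | ⟨p, hp, rfl⟩
  · obtain ⟨h1, h2, h3, h4⟩ := hS p hp
    have hB : ρ (h : G) * p.2 ≠ 0 := by
      intro h0
      apply h4
      have : ρ (h : G)⁻¹ * (ρ (h : G) * p.2) = p.2 := by rw [← mul_assoc, rho_inv_mul, one_mul]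
      rw [← this, h0, mul_zero]
    obtain ⟨g, hg, hg'⟩ := prime_env ρ Γ₀ hn hirr h1 (mul_mem (mem_env ρ Γ₀ h.2) h2) h3 hB
    apply hg'
    refine hspan p.1 (ρ (h : G) * p.2) ?_ g hg
    intro g hg
    have := horb g hg
    simpa [C1, hbil, mul_assoc] using this
  · obtain ⟨h1, h2, h3, h4⟩ := hS p hp
    have hB : p.1 * ρ (h : G)⁻¹ ≠ 0 := by
      intro h0
      apply h3
      have : (p.1 * ρ (h : G)⁻¹) * ρ (h : G) = p.1 := by rw [mul_assoc, rho_inv_mul, mul_one]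
      rw [← this, h0, zero_mul]
    obtain ⟨g, hg, hg'⟩ := prime_env ρ Γ₀ hn hirr (mul_mem h1 (mem_env ρ Γ₀ (inv_mem h.2))) h2 hB h4
    apply hg'
    refine hspan (p.1 * ρ (h : G)⁻¹) p.2 ?_ g hg
    intro g hg
    have := horb g⁻¹ (inv_mem hg)
    simpa [C2, hbil, mul_assoc] using this

end Generic

section Rank
variable {L : Type*} [Field L] {n : ℕ}

lemma exists_theta (A B : Matrix (Fin n) (Fin n) L) (h : (A * B).rank = B.rank) :
    ∃ θ : Matrix (Fin n) (Fin n) L, θ * (A * B) = B := by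
  set f := Matrix.toLin' A with hf
  set b := Matrix.toLin' B with hb
  have hfb : Matrix.toLin' (A * B) = f ∘ₗ b := by simp [hf, hb, Matrix.toLin'_mul]
  let f' := f.comp (LinearMap.range b).subtype
  have hinj : LinearMap.ker f' = ⊥ := by
    have h1 := LinearMap.finrank_range_add_finrank_ker f'
    have h2 : LinearMap.range f' = LinearMap.range (f ∘ₗ b) := by
      rw [LinearMap.range_comp, LinearMap.range_comp, Submodule.range_subtype]
    have h3 : Module.finrank L (LinearMap.range (f ∘ₗ b)) = Module.finrank L (LinearMap.range b) := by
      rw [← hfb]; exact h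
    rw [h2, h3] at h1
    exact Submodule.finrank_eq_zero.mp (by omega)
  obtain ⟨g, hg⟩ := LinearMap.exists_leftInverse_of_injective f' hinj
  refine ⟨LinearMap.toMatrix' ((LinearMap.range b).subtype.comp g), ?_⟩
  apply Matrix.toLin'.injective
  rw [Matrix.toLin'_mul, hfb, Matrix.toLin'_toMatrix']
  ext1 x
  have := congrArg (fun q => (q ⟨b (Pi.single x 1), LinearMap.mem_range_self _ _⟩ : (Fin n → L))) (congrArg (fun t => (LinearMap.range b).subtype.comp t) hg)
  ext i
  have hB : b (Pi.single x 1) i = B i x := by simp [hb]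
  simpa [f', hB] using congrFun this i
end Rank

end WDC
end PartSec05

section PartSec06
open scoped MatrixGroups Pointwise
namespace WDC

section PP
open Filter Topology
variable {U : Ultrafilter ℕ} {K : Type*} [Field K] {v : AbsoluteValue K ℝ} {L : Type*} [Field L]
  {w : AbsoluteValue L ℝ} (Λ : ULim U (fun _ : ℕ => v) L w) {n : ℕ} {G : Type*} [Group G]
  (σ : G →* SL(n, K)) (Γ : Subgroup G)

variable (U v) in
/-- Constant sequences. -/
def cst : K →+* bsub U (fun _ : ℕ => v) :=
  (Pi.constRingHom ℕ K).codRestrict _ (fun x => ⟨v x, by simp⟩)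

variable (U v) in
lemma cst_apply (x : K) (i : ℕ) : (cst U v x).1 i = x := rfl

lemma cst_bproj (x : K) (i : ℕ) : bproj U (fun _ : ℕ => v) i (cst U v x) = x := rfl

lemma cst_map_bproj (M : Matrix (Fin n) (Fin n) K) (i : ℕ) :
    (M.map (cst U v)).map (bproj U (fun _ : ℕ => v) i) = M := by
  ext; rfl

/-- Limit endomorphism. -/
noncomputable def tl : Matrix (Fin n) (Fin n) (bsub U (fun _ : ℕ => v)) →+* Module.End L (Fin n → L) :=
  ((Matrix.toLinAlgEquiv' : Matrix (Fin n) (Fin n) L ≃ₐ[L] _).toRingEquiv : _ →+* _).comp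
    Λ.lm.mapMatrix

lemma tl_apply (M : Matrix (Fin n) (Fin n) (bsub U (fun _ : ℕ => v))) :
    tl Λ M = Matrix.toLin' (M.map Λ.lm) := rfl

/-- The scalar extension of the representation. -/
noncomputable def extRep : G →* Module.End L (Fin n → L) where
  toFun g := tl Λ ((σ g : Matrix (Fin n) (Fin n) K).map (cst U v))
  map_one' := by simp
  map_mul' g h := by
    rw [map_mul, ← map_mul (tl Λ), Matrix.SpecialLinearGroup.coe_mul, Matrix.map_mul]

lemma extRep_apply (g : G) :
    extRep Λ σ g = tl Λ ((σ g : Matrix (Fin n) (Fin n) K).map (cst U v)) := rfl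

/-- Sequences of rescaled group elements. -/
def IsLim (M : Matrix (Fin n) (Fin n) (bsub U (fun _ : ℕ => v))) : Prop :=
  ∀ p, ∃ γ ∈ Γ, ∃ l : K, l ≠ 0 ∧ M.map (bproj U (fun _ : ℕ => v) p) = l • (σ γ : Matrix (Fin n) (Fin n) K)

variable {σ Γ} in
lemma IsLim.mul {M N : Matrix (Fin n) (Fin n) (bsub U (fun _ : ℕ => v))} (hM : IsLim σ Γ M)
    (hN : IsLim σ Γ N) : IsLim σ Γ (M * N) := by
  intro p
  obtain ⟨γ, hγ, l, hl, h1⟩ := hM p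
  obtain ⟨γ', hγ', l', hl', h2⟩ := hN p
  refine ⟨γ * γ', mul_mem hγ hγ', l * l', mul_ne_zero hl hl', ?_⟩
  rw [Matrix.map_mul, h1, h2, smul_mul_smul_comm, map_mul, Matrix.SpecialLinearGroup.coe_mul]

variable {Γ} in
lemma IsLim.const {g : G} (hg : g ∈ Γ) :
    IsLim σ Γ ((σ g : Matrix (Fin n) (Fin n) K).map (cst U v)) := by
  intro p
  exact ⟨g, hg, 1, one_ne_zero, by rw [one_smul, cst_map_bproj]⟩

variable {σ Γ} in
lemma IsLim.mem_env {M : Matrix (Fin n) (Fin n) (bsub U (fun _ : ℕ => v))} (hM : IsLim σ Γ M) :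
    tl Λ M ∈ env (extRep Λ σ) Γ := by
  let S : Submodule K (Matrix (Fin n) (Fin n) K) :=
    Submodule.span K ((fun g => (σ g : Matrix (Fin n) (Fin n) K)) '' (Γ : Set G))
  obtain ⟨f, hf⟩ := LinearMap.exists_leftInverse_of_injective S.subtype (Submodule.ker_subtype S)
  have hS : ∀ x ∈ S, tl Λ (x.map (cst U v)) ∈ env (extRep Λ σ) Γ := by
    intro x hx
    induction hx using Submodule.span_induction with
    | mem x hx => obtain ⟨g, hg, rfl⟩ := hx; exact WDC.mem_env (extRep Λ σ) Γ hg
    | zero => simp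
    | add x y _ _ hx hy =>
      rw [Matrix.map_add _ (map_add _), map_add]; exact add_mem hx hy
    | smul c x _ hx =>
      have : tl Λ ((c • x).map (cst U v)) = Λ.lm (cst U v c) • tl Λ (x.map (cst U v)) := by
        rw [tl_apply, tl_apply, ← map_smul]
        congr 1
        ext i j; simp
      rw [this]; exact Subalgebra.smul_mem _ hx _
  have hM' : M = ∑ i, ∑ j, M i j • ((f (Matrix.single i j (1 : K))).1.map (cst U v)) := by
    ext a b p
    obtain ⟨γ, hγ, l, hl, h1⟩ := hM p
    have hmem : M.map (bproj U (fun _ : ℕ => v) p) ∈ S := by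
      rw [h1]; exact S.smul_mem _ (Submodule.subset_span ⟨γ, hγ, rfl⟩)
    have h3 : M.map (bproj U (fun _ : ℕ => v) p) = ∑ i, ∑ j, ((M i j).1 p) • Matrix.single i j (1 : K) := by
      conv_lhs => rw [Matrix.matrix_eq_sum_single (M.map (bproj U (fun _ : ℕ => v) p))]
      simp [Matrix.smul_single]
    have h5 := congrFun (congrFun (congrArg (fun z => (f z).1) h3) a) b
    have h6 : (M a b).1 p = (f (M.map (bproj U (fun _ : ℕ => v) p))).1 a b := by
      have := congrArg Subtype.val (LinearMap.congr_fun hf ⟨_, hmem⟩)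
      exact (congrFun (congrFun this a) b).symm
    rw [h6, h5]
    simp only [map_sum, map_smul, Submodule.coe_sum, Submodule.coe_smul, Matrix.sum_apply,
      Matrix.smul_apply]
    have hval : ∀ x : bsub U (fun _ : ℕ => v), x.1 p = bproj U (fun _ : ℕ => v) p x := fun _ => rfl
    rw [hval (∑ i, _), map_sum]
    refine Finset.sum_congr rfl fun i _ => ?_
    rw [map_sum]
    refine Finset.sum_congr rfl fun j _ => ?_
    rfl
  rw [hM', map_sum]
  refine sum_mem fun i _ => ?_
  rw [map_sum]
  refine sum_mem fun j _ => ?_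
  have : tl Λ (M i j • ((f (Matrix.single i j (1 : K))).1.map (cst U v))) =
      Λ.lm (M i j) • tl Λ ((f (Matrix.single i j (1 : K))).1.map (cst U v)) := by
    rw [tl_apply, tl_apply, ← map_smul]
    congr 1
    ext i j; simp
  rw [this]
  exact Subalgebra.smul_mem _ (hS _ (f _).2) _

/-- Normalised limits of nonzero matrices. -/
lemma exists_normalize (X : ℕ → Matrix (Fin n) (Fin n) K) (hX : ∀ p, X p ≠ 0) :
    ∃ (l : ℕ → K) (M : Matrix (Fin n) (Fin n) (bsub U (fun _ : ℕ => v))),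
      (∀ p, l p ≠ 0) ∧ (∀ p i j, v (X p i j) ≤ v (l p)) ∧
      (∀ p, M.map (bproj U (fun _ : ℕ => v) p) = (l p)⁻¹ • X p) ∧ tl Λ M ≠ 0 := by
  have h1 : ∀ p, ∃ l : K, l ≠ 0 ∧ (∀ i j, v (X p i j) ≤ v l) ∧ ∃ i j, X p i j = l := by
    intro p
    have hne : ∃ i j, X p i j ≠ 0 := by
      by_contra h; push Not at h; exact hX p (by ext i j; exact h i j)
    obtain ⟨i₀, j₀, h0⟩ := hne
    have : Nonempty (Fin n × Fin n) := ⟨(i₀, j₀)⟩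
    obtain ⟨q, hq⟩ := Finite.exists_max (fun q : Fin n × Fin n => v (X p q.1 q.2))
    refine ⟨X p q.1 q.2, ?_, fun i j => hq (i, j), q.1, q.2, rfl⟩
    intro hz
    have := hq (i₀, j₀)
    rw [hz, map_zero] at this
    exact absurd (v.pos h0) (not_lt.mpr this)
  choose l hl0 hl he using h1
  let M : Matrix (Fin n) (Fin n) (bsub U (fun _ : ℕ => v)) := fun i j =>
    ⟨fun p => (l p)⁻¹ * X p i j, 1, Eventually.of_forall fun p => by
      rw [map_mul, map_inv₀]
      rw [inv_mul_le_iff₀ (v.pos (hl0 p)), mul_one]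
      exact hl p i j⟩
  refine ⟨l, M, hl0, hl, fun p => by ext; rfl, ?_⟩
  · intro h0
    have h0' : (M.map Λ.lm : Matrix (Fin n) (Fin n) L) = 0 :=
      Matrix.toLin'.injective (h0.trans (map_zero _).symm)
    have ht := Λ.nm_tend M
    rw [h0'] at ht
    have : (1 : ℝ) ≤ nm w (0 : Matrix (Fin n) (Fin n) L) := by
      refine ge_of_tendsto' ht fun p => ?_
      obtain ⟨i, j, hij⟩ := he p
      refine le_trans ?_ (le_nm v _ i j)
      change 1 ≤ v ((l p)⁻¹ * X p i j)
      rw [hij, inv_mul_cancel₀ (hl0 p), map_one]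
    simp [nm] at this
    linarith


lemma ext_irr (hspan : Submodule.span K ((fun g => (σ g : Matrix (Fin n) (Fin n) K)) ''
      (Subgroup.closure (Set.range (fun g : G => g ^ n.factorial)) : Set G)) = ⊤)
    (W : Submodule L (Fin n → L))
    (hW : ∀ g, ∀ x ∈ W, extRep Λ σ (g ^ n.factorial) x ∈ W) : W = ⊥ ∨ W = ⊤ := by
  have h1 : ∀ g ∈ Subgroup.closure (Set.range (fun g : G => g ^ n.factorial)), ∀ x ∈ W,
      extRep Λ σ g x ∈ W := by
    intro g hg
    induction hg using Subgroup.closure_induction'' with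
    | mem x hx => obtain ⟨g, rfl⟩ := hx; exact hW g
    | inv_mem x hx => obtain ⟨g, rfl⟩ := hx; simp only [← inv_pow]; exact hW g⁻¹
    | one => simp
    | mul x y _ _ hx hy => intro z hz; rw [map_mul]; exact hx _ (hy z hz)
  have h2 : ∀ A : Matrix (Fin n) (Fin n) K, ∀ x ∈ W, tl Λ (A.map (cst U v)) x ∈ W := by
    intro A
    have hA : A ∈ Submodule.span K ((fun g => (σ g : Matrix (Fin n) (Fin n) K)) ''
      (Subgroup.closure (Set.range (fun g : G => g ^ n.factorial)) : Set G)) := by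
      rw [hspan]; trivial
    induction hA using Submodule.span_induction with
    | mem x hx => obtain ⟨g, hg, rfl⟩ := hx; exact h1 g hg
    | zero => intro x hx; simp
    | add x y _ _ hx hy =>
      intro z hz
      rw [Matrix.map_add _ (map_add _), map_add]; exact add_mem (hx z hz) (hy z hz)
    | smul c x _ hx =>
      intro z hz
      have : tl Λ ((c • x).map (cst U v)) = Λ.lm (cst U v c) • tl Λ (x.map (cst U v)) := by
        rw [tl_apply, tl_apply, ← map_smul]
        congr 1
        ext i j; simp
      rw [this]; exact W.smul_mem _ (hx z hz)
  by_cases hb : W = ⊥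
  · exact Or.inl hb
  · right
    obtain ⟨x, hx, hx0⟩ := Submodule.exists_mem_ne_zero_of_ne_bot hb
    obtain ⟨j, hj⟩ := Function.ne_iff.mp hx0
    have hj' : x j ≠ 0 := hj
    rw [eq_top_iff]
    intro y _
    have hy : y = ∑ i, (y i * (x j)⁻¹) • tl Λ ((Matrix.single i j (1 : K)).map (cst U v)) x := by
      ext a
      rw [Finset.sum_apply, Finset.sum_eq_single a]
      · rw [tl_apply]
        simp [Matrix.mulVec, dotProduct, Matrix.map_apply, Matrix.single_apply, hj', apply_ite]
      · intro b _ hba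
        rw [tl_apply]
        simp [Matrix.mulVec, dotProduct, Matrix.map_apply, Matrix.single_apply, hba]
      · simp
    rw [hy]
    exact sum_mem fun i _ => W.smul_mem _ (h2 _ x hx)

variable {σ} in
lemma exists_unb [Γ.FiniteIndex] (hunb : ∀ C, ∃ g, C < nm v (σ g : Matrix (Fin n) (Fin n) K)) (C : ℝ) :
    ∃ g ∈ Γ, C < nm v (σ g : Matrix (Fin n) (Fin n) K) := by
  by_contra h
  push Not at h
  have : Finite (G ⧸ Γ) := inferInstance
  obtain ⟨q, hq⟩ := Finite.exists_max
    (fun q : G ⧸ Γ => nm v (σ (Quotient.out q) : Matrix (Fin n) (Fin n) K))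
  obtain ⟨g, hg⟩ := hunb (nm v (σ (Quotient.out q) : Matrix (Fin n) (Fin n) K) * C)
  have h1 : (Quotient.out (g : G ⧸ Γ))⁻¹ * g ∈ Γ := by
    rw [← QuotientGroup.eq]; exact QuotientGroup.out_eq' _
  have h2 : g = Quotient.out (g : G ⧸ Γ) * ((Quotient.out (g : G ⧸ Γ))⁻¹ * g) := by group
  have h3 := h _ h1
  have h4 := nm_mul v (σ (Quotient.out (g : G ⧸ Γ)) : Matrix (Fin n) (Fin n) K)
    (σ ((Quotient.out (g : G ⧸ Γ))⁻¹ * g))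
  rw [← Matrix.SpecialLinearGroup.coe_mul, ← map_mul, ← h2] at h4
  have h5 : nm v (σ (Quotient.out (g : G ⧸ Γ)) : Matrix (Fin n) (Fin n) K) *
      nm v (σ ((Quotient.out (g : G ⧸ Γ))⁻¹ * g) : Matrix (Fin n) (Fin n) K) ≤
      nm v (σ (Quotient.out q) : Matrix (Fin n) (Fin n) K) * C :=
    mul_le_mul (hq _) h3 (nm_nonneg _ _) (nm_nonneg _ _)
  linarith

end PP
end WDC
end PartSec06

section PartSec07
open scoped MatrixGroups Pointwise
namespace WDC

section PP2
open Filter Topology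
variable {U : Ultrafilter ℕ} {K : Type*} [Field K] {v : AbsoluteValue K ℝ} {L : Type*} [Field L]
  {w : AbsoluteValue L ℝ} (Λ : ULim U (fun _ : ℕ => v) L w) {n : ℕ} {G : Type*} [Group G]
  (σ : G →* SL(n, K)) (Γ : Subgroup G)

lemma det_tend (l : ℕ → K) (γ : ℕ → G) (M : Matrix (Fin n) (Fin n) (bsub U (fun _ : ℕ => v)))
    (hM : ∀ p, M.map (bproj U (fun _ : ℕ => v) p) = (l p)⁻¹ • (σ (γ p) : Matrix (Fin n) (Fin n) K)) :
    Tendsto (fun p => (v (l p))⁻¹ ^ n) U (𝓝 (w (M.map Λ.lm).det)) := by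
  have h1 : (M.map Λ.lm).det = Λ.lm M.det := (Λ.lm.map_det M).symm
  rw [h1]
  refine (Λ.tend M.det).congr fun p => ?_
  have h2 : M.det.1 p = (M.map (bproj U (fun _ : ℕ => v) p)).det :=
    (bproj U (fun _ : ℕ => v) p).map_det M
  rw [h2, hM p, Matrix.det_smul, Matrix.SpecialLinearGroup.det_coe, mul_one]
  simp

/-- rank of the limit -/
noncomputable def lrk (M : Matrix (Fin n) (Fin n) (bsub U (fun _ : ℕ => v))) : ℕ := (M.map Λ.lm).rank

lemma lrk_mul_left (M N : Matrix (Fin n) (Fin n) (bsub U (fun _ : ℕ => v))) :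
    lrk Λ (M * N) ≤ lrk Λ M := by
  unfold lrk; rw [Matrix.map_mul]; exact Matrix.rank_mul_le_left _ _

lemma lrk_mul_right (M N : Matrix (Fin n) (Fin n) (bsub U (fun _ : ℕ => v))) :
    lrk Λ (M * N) ≤ lrk Λ N := by
  unfold lrk; rw [Matrix.map_mul]; exact Matrix.rank_mul_le_right _ _

/-- Limit data of minimal rank gives ping-pong. -/
lemma ppc_of_limits (hn : 0 < n) (hU : (U : Filter ℕ).NeBot)
    (N : Fin 2 × Bool → Matrix (Fin n) (Fin n) (bsub U (fun _ : ℕ => v))) (μ : ℕ → K)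
    (hμ : Tendsto (fun p => v (μ p)) U atTop) (h0 : ∀ i, (N i).map Λ.lm ≠ 0)
    (hrk : ∀ i j, (i.1 = j.1 → i.2 = j.2) → lrk Λ (N i * N j) = lrk Λ (N j)) :
    ∀ᶠ p in (U : Filter ℕ), PPC v (fun i => μ p • (N i).map (bproj U (fun _ : ℕ => v) p)) := by
  have h1 : ∀ i j : Fin 2 × Bool, ∃ θ : Matrix (Fin n) (Fin n) (bsub U (fun _ : ℕ => v)),
      (i.1 = j.1 → i.2 = j.2) → (θ * (N i * N j) - N j).map Λ.lm = 0 := by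
    intro i j
    by_cases hij : (i.1 = j.1 → i.2 = j.2)
    · have := hrk i j hij
      unfold lrk at this
      rw [Matrix.map_mul] at this
      obtain ⟨θ, hθ⟩ := exists_theta _ _ this
      obtain ⟨θ', hθ'⟩ := Λ.lift_mat θ
      refine ⟨θ', fun _ => ?_⟩
      rw [Matrix.map_sub _ (map_sub _), Matrix.map_mul, Matrix.map_mul, hθ', hθ, sub_self]
    · exact ⟨0, fun h => absurd h hij⟩
  choose θ hθ using h1
  have hpos : ∀ i, 0 < nm w ((N i).map Λ.lm) := by
    intro i
    by_contra hc
    apply h0 i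
    ext a b
    have := (le_nm w ((N i).map Λ.lm) a b).trans (not_lt.mp hc)
    exact (w.eq_zero).mp (le_antisymm this (w.nonneg _))
  obtain ⟨i₀, hi₀⟩ := Finite.exists_min (fun i => nm w ((N i).map Λ.lm))
  obtain ⟨q₀, hq₀⟩ := Finite.exists_max (fun q : (Fin 2 × Bool) × (Fin 2 × Bool) =>
    nm w ((θ q.1 q.2).map Λ.lm))
  set m := nm w ((N i₀).map Λ.lm) with hm
  set C := nm w ((θ q₀.1 q₀.2).map Λ.lm) with hC
  have hmp : 0 < m := hpos i₀
  have hC0 : 0 ≤ C := nm_nonneg _ _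
  have hn' : (0 : ℝ) < n := by exact_mod_cast hn
  obtain ⟨κ, hκ0, hκ1, hκ2⟩ : ∃ κ : ℝ, 0 < κ ∧ n * κ < m ∧ (C + 1) * (2 * κ) < 1 := by
    have e1 : ∀ᶠ κ : ℝ in 𝓝[>] 0, n * κ < m := by
      have : Tendsto (fun κ : ℝ => n * κ) (𝓝[>] 0) (𝓝 (n * 0)) :=
        ((continuous_const.mul continuous_id).tendsto 0).mono_left nhdsWithin_le_nhds
      exact this.eventually_lt_const (by simpa using hmp)
    have e2 : ∀ᶠ κ : ℝ in 𝓝[>] 0, (C + 1) * (2 * κ) < 1 := by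
      have : Tendsto (fun κ : ℝ => (C + 1) * (2 * κ)) (𝓝[>] 0) (𝓝 ((C + 1) * (2 * 0))) :=
        ((continuous_const.mul (continuous_const.mul continuous_id)).tendsto 0).mono_left
          nhdsWithin_le_nhds
      exact this.eventually_lt_const (by simp)
    obtain ⟨κ, h⟩ := (e1.and (e2.and self_mem_nhdsWithin)).exists
    exact ⟨κ, h.2.2, h.1, h.2.1⟩
  have E1 : ∀ᶠ p in (U : Filter ℕ), ∀ i, n * κ < nm v ((N i).map (bproj U (fun _ : ℕ => v) p)) := by
    rw [eventually_all]
    intro i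
    exact (Λ.nm_tend (N i)).eventually_const_lt (lt_of_lt_of_le hκ1 (hi₀ i))
  have E2 : ∀ᶠ p in (U : Filter ℕ), ∀ i j, nm v ((θ i j).map (bproj U (fun _ : ℕ => v) p)) < C + 1 := by
    rw [eventually_all]; intro i
    rw [eventually_all]; intro j
    exact (Λ.nm_tend (θ i j)).eventually_lt_const (lt_of_le_of_lt (hq₀ (i, j)) (by linarith))
  have E3 : ∀ᶠ p in (U : Filter ℕ), ∀ i j, (i.1 = j.1 → i.2 = j.2) →
      nm v ((θ i j * (N i * N j) - N j).map (bproj U (fun _ : ℕ => v) p)) < κ / 2 := by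
    rw [eventually_all]; intro i
    rw [eventually_all]; intro j
    by_cases hij : (i.1 = j.1 → i.2 = j.2)
    · have := Λ.nm_tend (θ i j * (N i * N j) - N j)
      rw [hθ i j hij] at this
      filter_upwards [this.eventually_lt_const (show nm w (0 : Matrix (Fin n) (Fin n) L) < κ / 2 by
        simp [nm]; exact hκ0)] with p hp _ using hp
    · exact Eventually.of_forall fun p h => absurd h hij
  have E4 : ∀ᶠ p in (U : Filter ℕ), 1 / κ < v (μ p) := hμ.eventually_gt_atTop _
  filter_upwards [E1, E2, E3, E4] with p h1 h2 h3 h4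
  have hvp : 0 < v (μ p) := lt_trans (by positivity) h4
  have hμ0 : μ p ≠ 0 := fun h => by simp [h] at hvp
  refine ⟨fun _ => κ * v (μ p), fun i j => (μ p)⁻¹ • (θ i j).map (bproj U (fun _ : ℕ => v) p),
    fun j => ?_, fun j => ?_, fun i j hij => ⟨?_, ?_⟩⟩
  · rwa [div_lt_iff₀' hκ0] at h4
  · rw [nm_smul, ← mul_assoc, mul_comm]
    exact mul_lt_mul_of_pos_left (h1 j) hvp
  · rw [nm_smul, map_inv₀, lt_div_iff₀ (by positivity)]
    have e : (v (μ p))⁻¹ * nm v ((θ i j).map (bproj U (fun _ : ℕ => v) p)) * (2 * (κ * v (μ p))) =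
      nm v ((θ i j).map (bproj U (fun _ : ℕ => v) p)) * (2 * κ) := by field_simp
    rw [e]
    refine lt_of_le_of_lt ?_ hκ2
    exact mul_le_mul_of_nonneg_right (h2 i j).le (by positivity)
  · have e : (μ p)⁻¹ • (θ i j).map (bproj U (fun _ : ℕ => v) p) *
        (μ p • (N i).map (bproj U (fun _ : ℕ => v) p) * μ p • (N j).map (bproj U (fun _ : ℕ => v) p)) -
        μ p • (N j).map (bproj U (fun _ : ℕ => v) p) =
        μ p • (θ i j * (N i * N j) - N j).map (bproj U (fun _ : ℕ => v) p) := by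
      rw [Matrix.map_sub _ (map_sub _), Matrix.map_mul, Matrix.map_mul, smul_sub]
      rw [smul_mul_smul_comm, smul_mul_smul_comm]
      congr 2
      field_simp
    rw [e, nm_smul]
    have := mul_lt_mul_of_pos_left (h3 i j hij) hvp
    linarith


lemma tl_ne_iff (M : Matrix (Fin n) (Fin n) (bsub U (fun _ : ℕ => v))) :
    tl Λ M ≠ 0 ↔ M.map Λ.lm ≠ 0 := by
  rw [tl_apply, Ne, Ne, LinearEquiv.map_eq_zero_iff]

lemma pp_core {L : Type*} [Field L] {w : AbsoluteValue L ℝ} (Λ : ULim U (fun _ : ℕ => v) L w)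
    (σ : G →* SL(n, K)) (hU : Tendsto (fun p : ℕ => p) U atTop) (hn : 0 < n)
    (hspan : Submodule.span K ((fun g => (σ g : Matrix (Fin n) (Fin n) K)) ''
      (Subgroup.closure (Set.range (fun g : G => g ^ n.factorial)) : Set G)) = ⊤)
    (hunb : ∀ C, ∃ g, C < nm v (σ g : Matrix (Fin n) (Fin n) K)) :
    ∃ f : Fin 2 → G, PPC v
      (fun p => ((letter (fun i => σ (f i)) p : SL(n, K)) : Matrix (Fin n) (Fin n) K)) := by
  classical
  have hfr : Module.finrank L (Fin n → L) = n := by simp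
  have hirr : ∀ W : Submodule L (Fin n → L), (∀ g, ∀ x ∈ W,
      extRep Λ σ (g ^ (Module.finrank L (Fin n → L)).factorial) x ∈ W) → W = ⊥ ∨ W = ⊤ := by
    rw [hfr]; exact ext_irr Λ σ hspan
  obtain ⟨Γ, hnorm, hfi, hmin⟩ := exists_min_env (extRep Λ σ)
  have htr := exists_transverse (extRep Λ σ) (by rw [hfr]; exact hn) hirr Γ hmin
  have hσ0 : ∀ g : G, (σ g : Matrix (Fin n) (Fin n) K) ≠ 0 := by
    intro g h
    have := (σ g).det_coe
    have hne := Fin.pos_iff_nonempty.mp hn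
    rw [h, Matrix.det_zero] at this
    exact zero_ne_one this
  -- minimal rank
  let P : ℕ → Prop := fun r => ∃ M : Matrix (Fin n) (Fin n) (bsub U (fun _ : ℕ => v)),
    IsLim σ Γ M ∧ tl Λ M ≠ 0 ∧ lrk Λ M = r
  have hex : ∃ r < n, P r := by
    choose γ hγ hγ' using fun p : ℕ => exists_unb Γ hunb (p : ℝ)
    obtain ⟨l, M, hl0, hl, hM, hM0⟩ := exists_normalize Λ (fun p => (σ (γ p) : Matrix (Fin n) (Fin n) K))
      (fun p => hσ0 _)
    refine ⟨lrk Λ M, ?_, M, ?_, hM0, rfl⟩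
    · have hd := det_tend Λ σ l γ M hM
      have hz : Tendsto (fun p => (v (l p))⁻¹ ^ n) U (𝓝 0) := by
        have h1 : Tendsto (fun p => v (l p)) U atTop := by
          have h2 : Tendsto (fun p : ℕ => (p : ℝ) / (n * n)) U atTop :=
            (tendsto_natCast_atTop_atTop.comp hU).atTop_div_const
              (by have : (0 : ℝ) < n := by exact_mod_cast hn
                  positivity)
          refine tendsto_atTop_mono (fun p => ?_) h2
          have h3 := nm_le v (hl p)
          have h4 := (hγ' p).le.trans h3
          have : (0 : ℝ) < n := by exact_mod_cast hn
          rw [div_le_iff₀ (by positivity)]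
          linarith
        have := (tendsto_inv_atTop_zero.comp h1).pow n
        simpa [hn.ne'] using this
      have h0 := tendsto_nhds_unique hd hz
      have h0' : (M.map Λ.lm).det = 0 := w.eq_zero.mp h0
      refine lt_of_le_of_ne ((Matrix.rank_le_width _)) ?_
      intro hr
      obtain ⟨x, hx, hx0⟩ := Matrix.exists_mulVec_eq_zero_iff.mpr h0'
      have h1 := LinearMap.finrank_range_add_finrank_ker (Matrix.toLin' (M.map Λ.lm))
      have h2 : Module.finrank L (LinearMap.range (Matrix.toLin' (M.map Λ.lm))) = n := hr
      rw [h2, hfr] at h1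
      have h3 : LinearMap.ker (Matrix.toLin' (M.map Λ.lm)) = ⊥ :=
        Submodule.finrank_eq_zero.mp (by omega)
      exact hx (LinearMap.ker_eq_bot'.mp h3 x (by rw [Matrix.toLin'_apply]; exact hx0))
    · intro p
      exact ⟨γ p, hγ p, (l p)⁻¹, inv_ne_zero (hl0 p), hM p⟩
  have hP : ∃ r, P r := hex.imp fun r h => h.2
  set r := Nat.find hP with hr
  have hrn : r < n := by
    obtain ⟨r', h1, h2⟩ := hex
    exact lt_of_le_of_lt (Nat.find_min' hP h2) h1
  have hrmin : ∀ M, IsLim σ Γ M → tl Λ M ≠ 0 → r ≤ lrk Λ M :=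
    fun M h1 h2 => Nat.find_min' hP ⟨M, h1, h2, rfl⟩
  obtain ⟨A, hA, hA0, hAr⟩ := Nat.find_spec hP
  choose γ hγ l' hl' hAγ using hA
  have hA : IsLim σ Γ A := fun p => ⟨γ p, hγ p, l' p, hl' p, hAγ p⟩
  set l : ℕ → K := fun p => (l' p)⁻¹ with hldef
  have hl0 : ∀ p, l p ≠ 0 := fun p => inv_ne_zero (hl' p)
  have hAl : ∀ p, A.map (bproj U (fun _ : ℕ => v) p) = (l p)⁻¹ • (σ (γ p) : Matrix (Fin n) (Fin n) K) := by
    intro p; rw [hAγ p, hldef]; simp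
  have hltop : Tendsto (fun p => v (l p)) U atTop := by
    have hd := det_tend Λ σ l γ A hAl
    have hdet : (A.map Λ.lm).det = 0 := by
      by_contra hne
      have : IsUnit (A.map Λ.lm) := by rw [Matrix.isUnit_iff_isUnit_det]; exact isUnit_iff_ne_zero.mpr hne
      have := Matrix.rank_of_isUnit _ this
      rw [Fintype.card_fin] at this
      have h2 : lrk Λ A = n := this
      omega
    rw [hdet, map_zero] at hd
    have hd' : Tendsto (fun p => (v (l p))⁻¹) U (𝓝[>] 0) := by
      rw [tendsto_nhdsWithin_iff]
      refine ⟨?_, Eventually.of_forall fun p => inv_pos.mpr (v.pos (hl0 p))⟩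
      rw [Metric.tendsto_nhds] at hd ⊢
      intro ε hε
      filter_upwards [hd (ε ^ n) (by positivity)] with p hp
      rw [Real.dist_0_eq_abs] at hp ⊢
      rw [abs_pow] at hp
      exact lt_of_pow_lt_pow_left₀ n hε.le hp
    exact (hd'.inv_tendsto_nhdsGT_zero).congr fun p => inv_inv _
  obtain ⟨l2, A2, hl20, hl2, hA2, hA20⟩ := exists_normalize Λ
    (fun p => (σ (γ p)⁻¹ : Matrix (Fin n) (Fin n) K)) (fun p => hσ0 _)
  have hA2lim : IsLim σ Γ A2 := fun p =>
    ⟨(γ p)⁻¹, inv_mem (hγ p), (l2 p)⁻¹, inv_ne_zero (hl20 p), hA2 p⟩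
  have hl2b : ∀ p, (1 : ℝ) / n.factorial ≤ v (l2 p) := by
    intro p
    by_contra hc
    push Not at hc
    have h1 := Matrix.det_le (hl2 p)
    rw [Matrix.SpecialLinearGroup.det_coe, map_one, Fintype.card_fin, nsmul_eq_mul] at h1
    have hf : (1 : ℝ) ≤ n.factorial := by exact_mod_cast n.factorial_pos
    have h2 : v (l2 p) ≤ 1 := hc.le.trans (by rw [div_le_one (by linarith)]; exact hf)
    have h3 : v (l2 p) ^ n ≤ v (l2 p) := pow_le_of_le_one (v.nonneg _) h2 hn.ne'
    rw [lt_div_iff₀ (by linarith)] at hc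
    nlinarith
  set μ : ℕ → K := fun p => l p * l2 p with hμdef
  have hμ : Tendsto (fun p => v (μ p)) U atTop := by
    have h1 : Tendsto (fun p => v (l p) * ((1 : ℝ) / n.factorial)) U atTop :=
      hltop.atTop_mul_const (by have := n.factorial_pos; positivity)
    refine tendsto_atTop_mono (fun p => ?_) h1
    rw [hμdef, map_mul]
    exact mul_le_mul_of_nonneg_left (hl2b p) (v.nonneg _)
  -- choose the group elements
  let c : G → Matrix (Fin n) (Fin n) (bsub U (fun _ : ℕ => v)) :=
    fun g => (σ g : Matrix (Fin n) (Fin n) K).map (cst U v)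
  have hcmul : ∀ g h, c g * c h = c (g * h) := by
    intro g h; simp only [c]; rw [← Matrix.map_mul, map_mul, Matrix.SpecialLinearGroup.coe_mul]
  have hc1 : c 1 = 1 := by simp [c]
  have hctl : ∀ g, tl Λ (c g) = extRep Λ σ g := fun g => rfl
  have hclim : ∀ g ∈ Γ, IsLim σ Γ (c g) := fun g hg => IsLim.const σ hg
  have hcp : ∀ g p, (c g).map (bproj U (fun _ : ℕ => v) p) = (σ g : Matrix (Fin n) (Fin n) K) :=
    fun g p => cst_map_bproj _ _
  have hcl : ∀ g X, tl Λ X ≠ 0 → tl Λ (c g * X) ≠ 0 := by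
    intro g X h h2
    apply h
    have : X = c g⁻¹ * (c g * X) := by rw [← mul_assoc, hcmul, inv_mul_cancel, hc1, one_mul]
    rw [this, map_mul, h2, mul_zero]
  have hcr : ∀ g X, tl Λ X ≠ 0 → tl Λ (X * c g) ≠ 0 := by
    intro g X h h2
    apply h
    have : X = (X * c g) * c g⁻¹ := by rw [mul_assoc, hcmul, mul_inv_cancel, hc1, mul_one]
    rw [this, map_mul, h2, zero_mul]
  have htr' : ∀ S : Finset (Matrix (Fin n) (Fin n) (bsub U (fun _ : ℕ => v)) ×
      Matrix (Fin n) (Fin n) (bsub U (fun _ : ℕ => v))),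
      (∀ q ∈ S, IsLim σ Γ q.1 ∧ IsLim σ Γ q.2 ∧ tl Λ q.1 ≠ 0 ∧ tl Λ q.2 ≠ 0) →
      ∃ h ∈ Γ, ∀ q ∈ S, tl Λ (q.1 * c h * q.2) ≠ 0 ∧ tl Λ (q.1 * c h⁻¹ * q.2) ≠ 0 := by
    intro S hS
    obtain ⟨h, hh, hh'⟩ := htr (S.image (fun q => (tl Λ q.1, tl Λ q.2))) (by
      intro q hq
      obtain ⟨q', hq', rfl⟩ := Finset.mem_image.mp hq
      obtain ⟨h1, h2, h3, h4⟩ := hS q' hq'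
      exact ⟨h1.mem_env Λ, h2.mem_env Λ, h3, h4⟩)
    refine ⟨h, hh, fun q hq => ?_⟩
    have := hh' _ (Finset.mem_image_of_mem _ hq)
    simpa only [map_mul, hctl] using this
  obtain ⟨h, hh, hh'⟩ := htr' {(A, A2)} (by
    intro q hq; rw [Finset.mem_singleton] at hq; subst hq; exact ⟨hA, hA2lim, hA0, hA20⟩)
  have hh' := hh' (A, A2) (Finset.mem_singleton_self _)
  set α := A * c h * A2 with hα
  set α' := A * c h⁻¹ * A2 with hα'
  have hαl : IsLim σ Γ α := (hA.mul (hclim h hh)).mul hA2lim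
  have hαl' : IsLim σ Γ α' := (hA.mul (hclim _ (inv_mem hh))).mul hA2lim
  obtain ⟨k, hk, hk'⟩ := htr' {(α, α), (α', α')} (by
    intro q hq
    rw [Finset.mem_insert, Finset.mem_singleton] at hq
    rcases hq with rfl | rfl
    · exact ⟨hαl, hαl, hh'.1, hh'.1⟩
    · exact ⟨hαl', hαl', hh'.2, hh'.2⟩)
  have hk1 := (hk' (α, α) (by simp)).1
  have hk2 := (hk' (α', α') (by simp)).2
  set φ : Bool → Matrix (Fin n) (Fin n) (bsub U (fun _ : ℕ => v)) :=
    fun b => cond b (α * c k) (c k⁻¹ * α') with hφ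
  have hφlim : ∀ b, IsLim σ Γ (φ b) := by
    intro b; cases b
    · exact (hclim _ (inv_mem hk)).mul hαl'
    · exact hαl.mul (hclim _ hk)
  have hφ0 : ∀ b, tl Λ (φ b) ≠ 0 := by
    intro b; cases b
    · exact hcl _ _ hh'.2
    · exact hcr _ _ hh'.1
  have hφφ : ∀ b, tl Λ (φ b * φ b) ≠ 0 := by
    intro b; cases b
    · change tl Λ (c k⁻¹ * α' * (c k⁻¹ * α')) ≠ 0
      have : c k⁻¹ * α' * (c k⁻¹ * α') = c k⁻¹ * (α' * c k⁻¹ * α') := by simp only [mul_assoc]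
      rw [this]; exact hcl _ _ hk2
    · change tl Λ (α * c k * (α * c k)) ≠ 0
      have : α * c k * (α * c k) = (α * c k * α) * c k := by simp only [mul_assoc]
      rw [this]; exact hcr _ _ hk1
  obtain ⟨g, hg, hg'⟩ := htr' (Finset.univ.image (fun q : Bool × Bool => (φ q.1, φ q.2))) (by
    intro q hq
    obtain ⟨q', -, rfl⟩ := Finset.mem_image.mp hq
    exact ⟨hφlim _, hφlim _, hφ0 _, hφ0 _⟩)
  have hg1 : ∀ b b', tl Λ (φ b * c g * φ b') ≠ 0 ∧ tl Λ (φ b * c g⁻¹ * φ b') ≠ 0 := fun b b' =>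
    hg' (φ b, φ b') (Finset.mem_image.mpr ⟨(b, b'), Finset.mem_univ _, rfl⟩)
  set N : Fin 2 × Bool → Matrix (Fin n) (Fin n) (bsub U (fun _ : ℕ => v)) :=
    fun q => if q.1 = 0 then φ q.2 else c g * φ q.2 * c g⁻¹ with hN
  have hNlim : ∀ q, IsLim σ Γ (N q) := by
    intro q
    simp only [hN]
    split_ifs
    · exact hφlim _
    · exact ((hclim _ hg).mul (hφlim _)).mul (hclim _ (inv_mem hg))
  have hN0 : ∀ q, tl Λ (N q) ≠ 0 := by
    intro q
    simp only [hN]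
    split_ifs
    · exact hφ0 _
    · exact hcr _ _ (hcl _ _ (hφ0 _))
  have hNr : ∀ q, lrk Λ (N q) ≤ r := by
    have hφr : ∀ b, lrk Λ (φ b) ≤ r := by
      intro b; cases b
      · refine (lrk_mul_right Λ _ _).trans ?_
        rw [hα', mul_assoc]
        exact (lrk_mul_left Λ _ _).trans hAr.le
      · refine (lrk_mul_left Λ _ _).trans ?_
        rw [hα, mul_assoc]
        exact (lrk_mul_left Λ _ _).trans hAr.le
    intro q
    simp only [hN]
    split_ifs
    · exact hφr _
    · exact (lrk_mul_left Λ _ _).trans ((lrk_mul_right Λ _ _).trans (hφr _))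
  have hNN : ∀ i j : Fin 2 × Bool, (i.1 = j.1 → i.2 = j.2) → tl Λ (N i * N j) ≠ 0 := by
    rintro ⟨i, b⟩ ⟨j, b'⟩ hij
    simp only [hN]
    by_cases hi : i = 0 <;> by_cases hj : j = 0
    · have : b = b' := hij (by simp [hi, hj])
      subst this
      simp only [hi, hj, if_true]
      exact hφφ b
    · simp only [hi, hj, if_true, if_false]
      rw [← mul_assoc, ← mul_assoc]
      exact hcr _ _ (hg1 b b').1
    · simp only [hi, hj, if_true, if_false]
      have e : c g * φ b * c g⁻¹ * φ b' = c g * (φ b * c g⁻¹ * φ b') := by simp only [mul_assoc]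
      rw [e]
      exact hcl _ _ (hg1 b b').2
    · have h1 : i = 1 := by omega
      have h2 : j = 1 := by omega
      have : b = b' := hij (by simp [h1, h2])
      subst this
      simp only [hi, hj, if_false]
      have e : c g * φ b * c g⁻¹ * (c g * φ b * c g⁻¹) = c g * (φ b * φ b) * c g⁻¹ := by
        have e1 : c g⁻¹ * c g = 1 := by rw [hcmul, inv_mul_cancel, hc1]
        calc _ = c g * φ b * (c g⁻¹ * c g) * (φ b * c g⁻¹) := by simp only [mul_assoc]
          _ = _ := by rw [e1]; simp only [mul_assoc, mul_one, one_mul]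
      rw [e]
      exact hcr _ _ (hcl _ _ (hφφ b))
  have hrk : ∀ i j : Fin 2 × Bool, (i.1 = j.1 → i.2 = j.2) → lrk Λ (N i * N j) = lrk Λ (N j) := by
    intro i j hij
    refine le_antisymm (lrk_mul_right Λ _ _) ((hNr j).trans ?_)
    exact hrmin _ ((hNlim i).mul (hNlim j)) (hNN i j hij)
  obtain ⟨p, hp⟩ := (ppc_of_limits Λ hn inferInstance N μ hμ (fun i => (tl_ne_iff Λ _).mp (hN0 i))
    hrk).exists
  set a := γ p * h * (γ p)⁻¹ * k with ha
  refine ⟨fun i => if i = 0 then a else g * a * g⁻¹, ?_⟩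
  have hμ0 : l p * l2 p ≠ 0 := mul_ne_zero (hl0 p) (hl20 p)
  have hφp : ∀ b, μ p • (φ b).map (bproj U (fun _ : ℕ => v) p) =
      (σ (cond b a a⁻¹) : Matrix (Fin n) (Fin n) K) := by
    intro b; cases b
    · change μ p • (c k⁻¹ * (A * c h⁻¹ * A2)).map (bproj U (fun _ : ℕ => v) p) = _
      have e : a⁻¹ = k⁻¹ * (γ p * h⁻¹ * (γ p)⁻¹) := by rw [ha]; group
      rw [cond_false, e]
      simp only [Matrix.map_mul, hcp, hAl, hA2, Matrix.smul_mul, Matrix.mul_smul, smul_smul, map_mul,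
        Matrix.SpecialLinearGroup.coe_mul]
      rw [hμdef]
      have : l p * l2 p * ((l2 p)⁻¹ * (l p)⁻¹) = 1 := by
        have := hl0 p; have := hl20 p; field_simp
      simp only [this, one_smul]
    · change μ p • (A * c h * A2 * c k).map (bproj U (fun _ : ℕ => v) p) = _
      rw [cond_true, ha]
      simp only [Matrix.map_mul, hcp, hAl, hA2, Matrix.smul_mul, Matrix.mul_smul, smul_smul, map_mul,
        Matrix.SpecialLinearGroup.coe_mul]
      rw [hμdef]
      have : l p * l2 p * ((l2 p)⁻¹ * (l p)⁻¹) = 1 := by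
        have := hl0 p; have := hl20 p; field_simp
      simp only [this, one_smul]
  convert hp using 2 with q
  obtain ⟨i, b⟩ := q
  simp only [hN, letter]
  by_cases hi : i = 0
  · simp only [hi, if_true]
    rw [hφp]
    cases b <;> simp
  · simp only [hi, if_false]
    rw [Matrix.map_mul, Matrix.map_mul, hcp, hcp, ← Matrix.smul_mul, ← Matrix.mul_smul, hφp,
      ← Matrix.SpecialLinearGroup.coe_mul, ← Matrix.SpecialLinearGroup.coe_mul, ← map_mul, ← map_mul]
    congr 1
    cases b
    · simp only [cond_false]; rw [← map_inv]; congr 1; group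
    · rfl

end PP2
/-- The ping-pong theorem for unbounded strongly irreducible representations. -/
theorem pp_theorem {K : Type*} [Field K] (v : AbsoluteValue K ℝ) {n : ℕ} {G : Type*} [Group G]
    (σ : G →* SL(n, K)) (hn : 0 < n)
    (hspan : Submodule.span K ((fun g => (σ g : Matrix (Fin n) (Fin n) K)) ''
      (Subgroup.closure (Set.range (fun g : G => g ^ n.factorial)) : Set G)) = ⊤)
    (hunb : ∀ C, ∃ g, C < nm v (σ g : Matrix (Fin n) (Fin n) K)) :
    ∃ f : Fin 2 → G, PPC v
      (fun p => ((letter (fun i => σ (f i)) p : SL(n, K)) : Matrix (Fin n) (Fin n) K)) :=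
  pp_core (ufULim (Filter.hyperfilter ℕ) (fun _ => v)) σ
    (Filter.tendsto_id'.mpr (Nat.hyperfilter_le_atTop)) hn hspan hunb

end WDC
end PartSec07

section PartSec08
open scoped MatrixGroups Pointwise commutatorElement
namespace WDC

section AL

lemma close_pair (D : ℕ) (m : ℕ) : ∃ M : ℕ, ∀ (E : Type) [NormedAddCommGroup E] [NormedSpace ℝ E]
    [FiniteDimensional ℝ E], Module.finrank ℝ E = D → ∀ (s : Finset ℕ) (z : ℕ → E), M < s.card →
    (∀ i ∈ s, ‖z i‖ ≤ 2) → ∃ i ∈ s, ∃ j ∈ s, i < j ∧ ‖z i - z j‖ < (1 / 2 : ℝ) ^ m := by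
  classical
  induction m with
  | zero =>
    refine ⟨5 ^ D, ?_⟩
    intro E _ _ _ hD s z hs hz
    by_contra hcon
    push Not at hcon
    have hsep : ∀ i ∈ s, ∀ j ∈ s, i ≠ j → 1 ≤ ‖z i - z j‖ := by
      intro i hi j hj hij
      rcases lt_or_gt_of_ne hij with h | h
      · simpa using hcon i hi j hj h
      · rw [norm_sub_rev]; simpa using hcon j hj i hi h
    have hinj : Set.InjOn z s := by
      intro i hi j hj h
      by_contra hij
      have := hsep i hi j hj hij
      rw [h, sub_self, norm_zero] at this
      linarith
    have := Besicovitch.card_le_of_separated (s.image z)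
      (by intro c hc; obtain ⟨i, hi, rfl⟩ := Finset.mem_image.mp hc; exact hz i hi)
      (by
        intro c hc d hd hcd
        obtain ⟨i, hi, rfl⟩ := Finset.mem_image.mp hc
        obtain ⟨j, hj, rfl⟩ := Finset.mem_image.mp hd
        exact hsep i hi j hj (fun h => hcd (by rw [h])))
    rw [Finset.card_image_of_injOn hinj, hD] at this
    omega
  | succ m ih =>
    obtain ⟨M, hM⟩ := ih
    refine ⟨5 ^ D * M, ?_⟩
    intro E _ _ _ hD s z hs hz
    -- a maximal separated subset
    let P : Finset ℕ → Prop := fun t => t ⊆ s ∧ ∀ i ∈ t, ∀ j ∈ t, i ≠ j → 1 ≤ ‖z i - z j‖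
    obtain ⟨t, ht, htmax⟩ : ∃ t, P t ∧ ∀ t', P t' → t'.card ≤ t.card := by
      have hfin : (s.powerset.filter P).Nonempty := ⟨∅, by simp [P]⟩
      obtain ⟨t, h1, h2⟩ := Finset.exists_max_image _ Finset.card hfin
      refine ⟨t, (Finset.mem_filter.mp h1).2, fun t' h' => h2 t' ?_⟩
      exact Finset.mem_filter.mpr ⟨Finset.mem_powerset.mpr h'.1, h'⟩
    have hinj : Set.InjOn z t := by
      intro i hi j hj h
      by_contra hij
      have := ht.2 i hi j hj hij
      rw [h, sub_self, norm_zero] at this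
      linarith
    have hcard : t.card ≤ 5 ^ D := by
      have := Besicovitch.card_le_of_separated (t.image z)
        (by intro c hc; obtain ⟨i, hi, rfl⟩ := Finset.mem_image.mp hc; exact hz i (ht.1 hi))
        (by
          intro c hc d hd hcd
          obtain ⟨i, hi, rfl⟩ := Finset.mem_image.mp hc
          obtain ⟨j, hj, rfl⟩ := Finset.mem_image.mp hd
          exact ht.2 i hi j hj (fun h => hcd (by rw [h])))
      rwa [Finset.card_image_of_injOn hinj, hD] at this
    have hnear : ∀ i ∈ s, ∃ c ∈ t, ‖z i - z c‖ < 1 := by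
      intro i hi
      by_contra hc
      push Not at hc
      have hit : i ∉ t := by
        intro h; have := hc i h; rw [sub_self, norm_zero] at this; linarith
      have := htmax (insert i t) ⟨Finset.insert_subset hi ht.1, by
        intro a ha b hb hab
        rw [Finset.mem_insert] at ha hb
        rcases ha with rfl | ha <;> rcases hb with rfl | hb
        · exact absurd rfl hab
        · exact hc b hb
        · rw [norm_sub_rev]; exact hc a ha
        · exact ht.2 a ha b hb hab⟩
      rw [Finset.card_insert_of_notMem hit] at this
      omega
    choose! c hct hc using hnear
    obtain ⟨q, hq, hq'⟩ := Finset.exists_lt_card_fiber_of_mul_lt_card_of_maps_to hct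
      (show t.card * M < s.card from lt_of_le_of_lt (Nat.mul_le_mul_right _ hcard) hs)
    obtain ⟨i, hi, j, hj, hij, h⟩ := hM E hD (s.filter (fun x => c x = q))
      (fun i => (2 : ℝ) • (z i - z q)) hq' (by
        intro i hi
        obtain ⟨h1, rfl⟩ := Finset.mem_filter.mp hi
        rw [norm_smul, Real.norm_ofNat]
        have := hc i h1
        linarith)
    refine ⟨i, (Finset.mem_filter.mp hi).1, j, (Finset.mem_filter.mp hj).1, hij, ?_⟩
    have e : (2 : ℝ) • (z i - z q) - (2 : ℝ) • (z j - z q) = (2 : ℝ) • (z i - z j) := by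
      rw [← smul_sub]; congr 1; abel
    rw [e, norm_smul, Real.norm_ofNat] at h
    rw [pow_succ]
    linarith

/-- The iterated commutator words. -/
def Uw {G : Type*} [Group G] (x : G) (y : ℕ → G) : ℕ → G
  | 0 => x
  | j + 1 => ⁅⁅Uw x y j, y (2 * j) * x ^ (j + 1) * (y (2 * j))⁻¹⁆,
      y (2 * j + 1) * ⁅Uw x y j, y (2 * j) * x ^ (j + 1) * (y (2 * j))⁻¹⁆ * (y (2 * j + 1))⁻¹⁆

lemma map_Uw {G H : Type*} [Group G] [Group H] (σ : G →* H) (x : G) (y : ℕ → G) (j : ℕ) :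
    σ (Uw x y j) = Uw (σ x) (fun i => σ (y i)) j := by
  induction j with
  | zero => rfl
  | succ j ih => simp only [Uw, map_commutatorElement, map_mul, map_inv, map_pow, ih]

variable {V : Type} [NormedAddCommGroup V] [NormedSpace ℂ V] {G : Type*} [Group G]
  (ψ : G →* (V →L[ℂ] V))

lemma dsp_mul_right (hψ : ∀ g, ‖ψ g‖ ≤ 1) (A : V →L[ℂ] V) (g : G) : ‖A * ψ g‖ ≤ ‖A‖ :=
  (norm_mul_le _ _).trans (by nlinarith [hψ g, norm_nonneg A])

lemma dsp_mul_left (hψ : ∀ g, ‖ψ g‖ ≤ 1) (A : V →L[ℂ] V) (g : G) : ‖ψ g * A‖ ≤ ‖A‖ :=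
  (norm_mul_le _ _).trans (by nlinarith [hψ g, norm_nonneg A])

lemma psi_mul_inv (g : G) : ψ g * ψ g⁻¹ = 1 := by rw [← map_mul]; simp

lemma dsp_le_two (hψ : ∀ g, ‖ψ g‖ ≤ 1) (g : G) : ‖ψ g - 1‖ ≤ 2 := by
  have h1 : ‖(1 : V →L[ℂ] V)‖ ≤ 1 := ContinuousLinearMap.norm_id_le
  have := norm_sub_le (ψ g) 1
  linarith [hψ g]

lemma dsp_conj (hψ : ∀ g, ‖ψ g‖ ≤ 1) (g h : G) : ‖ψ (g * h * g⁻¹) - 1‖ ≤ ‖ψ h - 1‖ := by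
  have : ψ (g * h * g⁻¹) - 1 = ψ g * (ψ h - 1) * ψ g⁻¹ := by
    rw [mul_sub, sub_mul, mul_one, psi_mul_inv, map_mul, map_mul]
  rw [this]
  exact (dsp_mul_right ψ hψ _ _).trans (dsp_mul_left ψ hψ _ _)

lemma dsp_comm (hψ : ∀ g, ‖ψ g‖ ≤ 1) (a b : G) : ‖ψ ⁅a, b⁆ - 1‖ ≤ 2 * ‖ψ a - 1‖ * ‖ψ b - 1‖ := by
  have e : ψ ⁅a, b⁆ - 1 = ((ψ a - 1) * (ψ b - 1) - (ψ b - 1) * (ψ a - 1)) * ψ (a⁻¹ * b⁻¹) := by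
    have e1 : (ψ a - 1) * (ψ b - 1) - (ψ b - 1) * (ψ a - 1) = ψ (a * b) - ψ (b * a) := by
      rw [map_mul, map_mul]; noncomm_ring
    rw [e1, sub_mul, ← map_mul, ← map_mul]
    have e2 : b * a * (a⁻¹ * b⁻¹) = 1 := by group
    rw [e2, map_one, commutatorElement_def]
    congr 2
    group
  rw [e]
  refine (dsp_mul_right ψ hψ _ _).trans ((norm_sub_le _ _).trans ?_)
  have h1 := norm_mul_le (ψ a - 1) (ψ b - 1)
  have h2 := norm_mul_le (ψ b - 1) (ψ a - 1)
  linarith [mul_comm ‖ψ a - 1‖ ‖ψ b - 1‖]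

lemma dsp_Uw_succ (hψ : ∀ g, ‖ψ g‖ ≤ 1) (x : G) (y : ℕ → G) (j : ℕ) :
    ‖ψ (Uw x y (j + 1)) - 1‖ ≤ 8 * (‖ψ (Uw x y j) - 1‖ * ‖ψ (x ^ (j + 1)) - 1‖) ^ 2 := by
  set u := ⁅Uw x y j, y (2 * j) * x ^ (j + 1) * (y (2 * j))⁻¹⁆ with hu
  have h1 : ‖ψ u - 1‖ ≤ 2 * ‖ψ (Uw x y j) - 1‖ * ‖ψ (x ^ (j + 1)) - 1‖ := by
    refine (dsp_comm ψ hψ _ _).trans ?_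
    exact mul_le_mul_of_nonneg_left (dsp_conj ψ hψ _ _) (by positivity)
  have h2 : ‖ψ (Uw x y (j + 1)) - 1‖ ≤ 2 * ‖ψ u - 1‖ * ‖ψ u - 1‖ := by
    refine (dsp_comm ψ hψ _ _).trans ?_
    exact mul_le_mul_of_nonneg_left (dsp_conj ψ hψ _ _) (by positivity)
  refine h2.trans ?_
  have := pow_le_pow_left₀ (norm_nonneg _) h1 2
  nlinarith

lemma almost_law_iso (n : ℕ) (η : ℝ) (hη : 0 < η) : ∃ J : ℕ, ∀ (V : Type) [NormedAddCommGroup V]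
    [NormedSpace ℂ V] [FiniteDimensional ℂ V], Module.finrank ℂ V = n →
    ∀ (G : Type) [Group G] (ψ : G →* (V →L[ℂ] V)), (∀ g, ‖ψ g‖ ≤ 1) → ∀ x y,
    ‖ψ (Uw x y J) - 1‖ ≤ η := by
  obtain ⟨M, hM⟩ := close_pair (2 * (n * n)) 6
  obtain ⟨m, hm⟩ := exists_pow_lt_of_lt_one hη (show (1 / 4 : ℝ) < 1 by norm_num)
  refine ⟨M + 1 + m, ?_⟩
  intro V _ _ _ hV G _ ψ hψ x y
  have hfr : Module.finrank ℝ (V →L[ℂ] V) = 2 * (n * n) := by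
    rw [finrank_real_of_complex, ← LinearEquiv.finrank_eq (LinearMap.toContinuousLinearMap),
      Module.finrank_linearMap, hV]
  have hfd : FiniteDimensional ℂ (V →L[ℂ] V) :=
    LinearEquiv.finiteDimensional (LinearMap.toContinuousLinearMap (𝕜 := ℂ) (E := V) (F' := V))
  have hfd' : FiniteDimensional ℝ (V →L[ℂ] V) := FiniteDimensional.complexToReal _
  obtain ⟨a, ha, b, hb, hab, h⟩ := hM (V →L[ℂ] V) hfr (Finset.range (M + 1)) (fun i => ψ (x ^ i))
    (by simp) (fun i _ => (hψ _).trans (by norm_num))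
  rw [Finset.mem_range] at ha hb
  obtain ⟨j, hj⟩ : ∃ j, b = a + (j + 1) := ⟨b - a - 1, by omega⟩
  have hx : ‖ψ (x ^ (j + 1)) - 1‖ ≤ 1 / 64 := by
    have e : ψ (x ^ (j + 1)) - 1 = ψ (x ^ a)⁻¹ * (ψ (x ^ b) - ψ (x ^ a)) := by
      rw [mul_sub, ← map_mul, ← map_mul, hj, pow_add x a, inv_mul_cancel_left, inv_mul_cancel, map_one]
    rw [e]
    refine (dsp_mul_left ψ hψ _ _).trans ?_
    rw [norm_sub_rev]
    norm_num at h ⊢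
    exact h.le
  have h1 : ∀ i, ‖ψ (Uw x y (j + 1 + i)) - 1‖ ≤ (1 / 128) * (1 / 4) ^ i := by
    intro i
    induction i with
    | zero =>
      refine (dsp_Uw_succ ψ hψ x y j).trans ?_
      have h2 := dsp_le_two ψ hψ (Uw x y j)
      have : ‖ψ (Uw x y j) - 1‖ * ‖ψ (x ^ (j + 1)) - 1‖ ≤ 2 * (1 / 64) :=
        mul_le_mul h2 hx (norm_nonneg _) (by norm_num)
      have := pow_le_pow_left₀ (by positivity) this 2
      norm_num at this ⊢
      linarith
    | succ i ih =>
      refine (dsp_Uw_succ ψ hψ x y (j + 1 + i)).trans ?_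
      have h2 := dsp_le_two ψ hψ (x ^ (j + 1 + i + 1))
      set ρ := ‖ψ (Uw x y (j + 1 + i)) - 1‖
      have hρ0 : 0 ≤ ρ := norm_nonneg _
      have h3 : ρ * ‖ψ (x ^ (j + 1 + i + 1)) - 1‖ ≤ ρ * 2 := mul_le_mul_of_nonneg_left h2 hρ0
      have h4 := pow_le_pow_left₀ (by positivity) h3 2
      have h5 : ρ ≤ 1 / 128 := ih.trans (by
        have : (1 / 4 : ℝ) ^ i ≤ 1 := pow_le_one₀ (by norm_num) (by norm_num)
        linarith)
      rw [pow_succ (1 / 4 : ℝ) i]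
      have h6 : ρ * ρ ≤ ρ * (1 / 128) := mul_le_mul_of_nonneg_left h5 hρ0
      have h7 : (ρ * 2) ^ 2 = 4 * (ρ * ρ) := by ring
      rw [h7] at h4
      linarith
  obtain ⟨i, hi⟩ : ∃ i, M + 1 + m = j + 1 + i := ⟨M + m - j, by omega⟩
  rw [hi]
  refine (h1 i).trans ?_
  have h2 : (1 / 4 : ℝ) ^ i ≤ (1 / 4) ^ m := pow_le_pow_of_le_one (by norm_num) (by norm_num) (by omega)
  have h3 : (0 : ℝ) < (1 / 4) ^ m := by positivity
  linarith

end AL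
end WDC
end PartSec08

section PartSec09
open scoped MatrixGroups Pointwise commutatorElement
namespace WDC

section GramDef
variable {K : Type*} [CommRing K] {n : ℕ} {G : Type*} [Group G]

/-- The trace of a representation. -/
def tr (σ : G →* SL(n, K)) (g : G) : K := (σ g : Matrix (Fin n) (Fin n) K).trace

/-- The Gram matrix of the trace form. -/
def gram (σ : G →* SL(n, K)) (e : Fin n × Fin n → G) : Matrix (Fin n × Fin n) (Fin n × Fin n) K :=
  Matrix.of fun i j => tr σ (e i * e j)

/-- The test quantity. -/
def pv (σ : G →* SL(n, K)) (e : Fin n × Fin n → G) (q c : G) : K :=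
  (gram σ e).det * (tr σ (q * c) - tr σ c)

lemma pv_congr {σ σ' : G →* SL(n, K)} (h : ∀ w, tr σ' w = tr σ w) (e : Fin n × Fin n → G) (q c : G) :
    pv σ' e q c = pv σ e q c := by
  simp only [pv, gram, h]

lemma gram_congr {σ σ' : G →* SL(n, K)} (h : ∀ w, tr σ' w = tr σ w) (e : Fin n × Fin n → G) :
    gram σ' e = gram σ e := by
  simp only [gram, h]

/-- Extension of scalars. -/
def mapRep {L : Type*} [CommRing L] (φ : K →+* L) (σ : G →* SL(n, K)) : G →* SL(n, L) :=
  (Matrix.SpecialLinearGroup.map φ).comp σ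

lemma coe_mapRep {L : Type*} [CommRing L] (φ : K →+* L) (σ : G →* SL(n, K)) (w : G) :
    (mapRep φ σ w : Matrix (Fin n) (Fin n) L) = (σ w : Matrix (Fin n) (Fin n) K).map φ := rfl

lemma tr_map {L : Type*} [CommRing L] (φ : K →+* L) (σ : G →* SL(n, K)) (w : G) :
    tr (mapRep φ σ) w = φ (tr σ w) := by
  rw [tr, tr, coe_mapRep, ← RingHom.mapMatrix_apply]
  simp [Matrix.trace]

lemma gram_map {L : Type*} [CommRing L] (φ : K →+* L) (σ : G →* SL(n, K)) (e : Fin n × Fin n → G) :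
    (gram (mapRep φ σ) e).det = φ (gram σ e).det := by
  rw [RingHom.map_det]
  congr 1
  ext i j
  simp [gram, tr_map]

lemma pv_map {L : Type*} [CommRing L] (φ : K →+* L) (σ : G →* SL(n, K)) (e : Fin n × Fin n → G)
    (q c : G) : pv (mapRep φ σ) e q c = φ (pv σ e q c) := by
  rw [pv, pv, gram_map, tr_map, tr_map, map_mul, map_sub]

end GramDef

section Bdd

/-- A copy of the coordinate space, without a norm. -/
def IV (n : ℕ) : Type := Fin n → ℂ

instance (n : ℕ) : AddCommGroup (IV n) := inferInstanceAs (AddCommGroup (Fin n → ℂ))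
instance (n : ℕ) : Module ℂ (IV n) := inferInstanceAs (Module ℂ (Fin n → ℂ))
instance (n : ℕ) : FiniteDimensional ℂ (IV n) := inferInstanceAs (FiniteDimensional ℂ (Fin n → ℂ))

lemma finrank_IV (n : ℕ) : Module.finrank ℂ (IV n) = n := by
  have : Module.finrank ℂ (Fin n → ℂ) = n := by simp
  exact this

lemma trace_le_of_norm {n : ℕ} (A : Matrix (Fin n) (Fin n) ℂ) (N : (Fin n → ℂ) → ℝ) (c : ℝ)
    (hN : ∀ v, v ≠ 0 → 0 < N v) (hs : ∀ (z : ℂ) v, N (z • v) = ‖z‖ * N v)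
    (hA : ∀ v, N (A.mulVec v) ≤ c * N v) (hc : 0 ≤ c) : ‖A.trace‖ ≤ n * c := by
  rw [Matrix.trace_eq_sum_roots_charpoly]
  have h1 : ∀ z ∈ A.charpoly.roots, ‖z‖ ≤ c := by
    intro z hz
    have hz' := (Polynomial.mem_roots'.mp hz).2
    rw [Polynomial.IsRoot.def, Matrix.eval_charpoly, ← Matrix.exists_mulVec_eq_zero_iff] at hz'
    obtain ⟨v, hv, h⟩ := hz'
    rw [Matrix.sub_mulVec, sub_eq_zero] at h
    have h2 : (Matrix.scalar (Fin n) z).mulVec v = z • v := by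
      simp [Matrix.scalar_apply, Matrix.mulVec_diagonal, funext_iff]
    have h3 := hA v
    rw [← h, h2, hs] at h3
    exact le_of_mul_le_mul_right h3 (hN v hv)
  have h2 : A.charpoly.roots.card ≤ n := by
    have := Polynomial.card_roots' A.charpoly
    rwa [Matrix.charpoly_natDegree_eq_dim, Fintype.card_fin] at this
  have h3 : ∀ s : Multiset ℂ, (∀ z ∈ s, ‖z‖ ≤ c) → ‖s.sum‖ ≤ s.card * c := by
    intro s
    induction s using Multiset.induction with
    | empty => simp
    | cons a s ih =>
      intro h
      rw [Multiset.sum_cons, Multiset.card_cons]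
      have := ih fun z hz => h z (Multiset.mem_cons_of_mem hz)
      have h4 := h a (Multiset.mem_cons_self a s)
      have h5 := norm_add_le a s.sum
      push_cast
      linarith
  refine (h3 _ h1).trans ?_
  exact mul_le_mul_of_nonneg_right (by exact_mod_cast h2) hc

/-- The supremum norm over an orbit. -/
noncomputable def orbn {n : ℕ} {G : Type} [Group G] (σ : G →* SL(n, ℂ)) (v : Fin n → ℂ) : ℝ :=
  ⨆ g : G, ‖(σ g : Matrix (Fin n) (Fin n) ℂ).mulVec v‖

variable {n : ℕ} {G : Type} [Group G] (σ : G →* SL(n, ℂ))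

lemma orbn_bdd {C : ℝ} (hC : ∀ g, nm (NormedField.toAbsoluteValue ℂ) (σ g : Matrix (Fin n) (Fin n) ℂ) ≤ C)
    (v : Fin n → ℂ) : BddAbove (Set.range fun g : G => ‖(σ g : Matrix (Fin n) (Fin n) ℂ).mulVec v‖) := by
  refine ⟨n * (C * ‖v‖), ?_⟩
  rintro _ ⟨g, rfl⟩
  have hC0 : 0 ≤ C := (nm_nonneg _ _).trans (hC g)
  refine (pi_norm_le_iff_of_nonneg (by positivity)).mpr fun i => ?_
  rw [Matrix.mulVec, dotProduct]
  refine (norm_sum_le _ _).trans ?_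
  refine (Finset.sum_le_sum (g := fun _ => C * ‖v‖) fun j _ => ?_).trans (by simp)
  rw [norm_mul]
  have := le_nm (NormedField.toAbsoluteValue ℂ) (σ g : Matrix (Fin n) (Fin n) ℂ) i j
  exact mul_le_mul (this.trans (hC g)) (norm_le_pi_norm v j) (norm_nonneg _) hC0

/-- The almost law. -/
def AlmostLaw (n J : ℕ) : Prop := ∀ (G : Type) [Group G] (σ : G →* SL(n, ℂ)),
  (∃ C, ∀ g, nm (NormedField.toAbsoluteValue ℂ) (σ g : Matrix (Fin n) (Fin n) ℂ) ≤ C) →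
  ∀ e x y c, ‖pv σ e (Uw x y J) c‖ < 1

lemma almost_law (n : ℕ) : ∃ J, AlmostLaw n J := by
  set D : ℝ := (n * n).factorial * (n : ℝ) ^ (n * n) * n with hD
  have hD0 : 0 ≤ D := by positivity
  have hη : 0 < 1 / (D + 1) := by positivity
  obtain ⟨J, hJ⟩ := almost_law_iso n (1 / (D + 1)) hη
  refine ⟨J, ?_⟩
  rintro G _ σ ⟨C, hC⟩ e x y c
  have hb := orbn_bdd σ hC
  have hle : ∀ v g, ‖(σ g : Matrix (Fin n) (Fin n) ℂ).mulVec v‖ ≤ orbn σ v :=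
    fun v g => le_ciSup (hb v) g
  have hone : ∀ v, ‖v‖ ≤ orbn σ v := fun v => by simpa using hle v 1
  have hsm : ∀ (z : ℂ) v, orbn σ (z • v) = ‖z‖ * orbn σ v := by
    intro z v
    simp only [orbn, Matrix.mulVec_smul, norm_smul]
    rw [Real.mul_iSup_of_nonneg (norm_nonneg z)]
  have hinv : ∀ g v, orbn σ ((σ g : Matrix (Fin n) (Fin n) ℂ).mulVec v) ≤ orbn σ v := by
    intro g v
    refine ciSup_le fun h => ?_
    rw [Matrix.mulVec_mulVec, ← Matrix.SpecialLinearGroup.coe_mul, ← map_mul]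
    exact hle v _
  have hpos : ∀ v, v ≠ 0 → 0 < orbn σ v := fun v hv => (norm_pos_iff.mpr hv).trans_le (hone v)
  let iN : Norm (IV n) := ⟨fun v => orbn σ v⟩
  have core : NormedSpace.Core ℂ (IV n) := by
    refine ⟨⟨fun v => (norm_nonneg _).trans (hone v), hsm, ?_⟩, ?_⟩
    · intro v w
      refine ciSup_le fun g => ?_
      refine (congrArg norm (Matrix.mulVec_add (σ g : Matrix (Fin n) (Fin n) ℂ) v w)).le.trans ?_
      exact (norm_add_le _ _).trans (add_le_add (hle v g) (hle w g))
    · intro v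
      constructor
      · intro h
        by_contra hv
        exact (hpos v hv).ne' h
      · rintro rfl
        have := hsm 0 0
        rw [zero_smul, norm_zero, zero_mul] at this
        exact this
  let i1 : NormedAddCommGroup (IV n) := NormedAddCommGroup.ofCore core
  let i2 : NormedSpace ℂ (IV n) := NormedSpace.ofCore core
  have hn : ∀ v : IV n, ‖v‖ = orbn σ v := fun v => rfl
  let ψ : G →* (IV n →L[ℂ] IV n) :=
    { toFun := fun g => LinearMap.toContinuousLinearMap (E := IV n) (F' := IV n)
        (Matrix.mulVecLin (σ g : Matrix (Fin n) (Fin n) ℂ) : (Fin n → ℂ) →ₗ[ℂ] (Fin n → ℂ))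
      map_one' := by
        ext v
        change (Matrix.mulVec ((σ 1 : SL(n, ℂ)) : Matrix (Fin n) (Fin n) ℂ) v) = v
        rw [map_one, Matrix.SpecialLinearGroup.coe_one]
        exact Matrix.one_mulVec (show Fin n → ℂ from v)
      map_mul' := by
        intro g h
        ext v
        change (Matrix.mulVec ((σ (g * h) : SL(n, ℂ)) : Matrix (Fin n) (Fin n) ℂ) v) =
          Matrix.mulVec (σ g : Matrix (Fin n) (Fin n) ℂ)
            (Matrix.mulVec (σ h : Matrix (Fin n) (Fin n) ℂ) v)
        rw [map_mul, Matrix.SpecialLinearGroup.coe_mul]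
        exact (Matrix.mulVec_mulVec (show Fin n → ℂ from v) _ _).symm }
  have hψ : ∀ g v, ψ g v = Matrix.mulVec (σ g : Matrix (Fin n) (Fin n) ℂ) v := fun g v => rfl
  have hψ1 : ∀ g, ‖ψ g‖ ≤ 1 := by
    intro g
    refine ContinuousLinearMap.opNorm_le_bound _ zero_le_one fun v => ?_
    rw [one_mul, hψ]
    exact hinv g v
  have key := hJ (IV n) (finrank_IV n) G ψ hψ1 x y
  have htr : ∀ g, ‖tr σ g‖ ≤ n := by
    intro g
    have := trace_le_of_norm (σ g : Matrix (Fin n) (Fin n) ℂ) (orbn σ) 1 hpos hsm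
      (fun v => by rw [one_mul]; exact hinv g v) zero_le_one
    rwa [mul_one] at this
  have hQ : ‖tr σ (Uw x y J * c) - tr σ c‖ ≤ n * (1 / (D + 1)) := by
    have e1 : tr σ (Uw x y J * c) - tr σ c =
        (((σ (Uw x y J) : Matrix (Fin n) (Fin n) ℂ) - 1) * (σ c : Matrix (Fin n) (Fin n) ℂ)).trace := by
      rw [sub_mul, one_mul, Matrix.trace_sub, ← Matrix.SpecialLinearGroup.coe_mul, ← map_mul]; rfl
    rw [e1]
    refine trace_le_of_norm _ (orbn σ) _ hpos hsm (fun v => ?_) hη.le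
    rw [← Matrix.mulVec_mulVec]
    have h1 := (ψ (Uw x y J) - 1).le_opNorm ((σ c : Matrix (Fin n) (Fin n) ℂ).mulVec v : Fin n → ℂ)
    have h2 : ((ψ (Uw x y J) - 1) ((σ c : Matrix (Fin n) (Fin n) ℂ).mulVec v : Fin n → ℂ) : IV n) =
        ((σ (Uw x y J) : Matrix (Fin n) (Fin n) ℂ) - 1).mulVec
          ((σ c : Matrix (Fin n) (Fin n) ℂ).mulVec v) := by
      rw [Matrix.sub_mulVec, Matrix.one_mulVec]; rfl
    rw [h2] at h1
    refine h1.trans ?_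
    exact mul_le_mul key (hinv c v) (norm_nonneg _) hη.le
  have hG : ‖(gram σ e).det‖ ≤ (n * n).factorial * (n : ℝ) ^ (n * n) := by
    have := Matrix.det_le (A := gram σ e) (abv := NormedField.toAbsoluteValue ℂ) (x := (n : ℝ))
      (fun i j => htr _)
    simp only [Fintype.card_prod, Fintype.card_fin, nsmul_eq_mul] at this
    exact this
  rw [pv, norm_mul]
  have h1 := mul_le_mul hG hQ (norm_nonneg _) (by positivity)
  refine h1.trans_lt ?_
  have : ((n * n).factorial * (n : ℝ) ^ (n * n)) * (n * (1 / (D + 1))) = D / (D + 1) := by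
    rw [hD]; ring
  rw [this, div_lt_one (by positivity)]
  linarith

end Bdd
end WDC
end PartSec09

section PartSec10
open scoped MatrixGroups Pointwise commutatorElement Matrix
namespace WDC

section Conj

/-- Conjugation of a representation by an invertible matrix. -/
noncomputable def conjRep {K : Type*} [Field K] {n : ℕ} {G : Type*} [Group G] (σ : G →* SL(n, K))
    (P : Matrix (Fin n) (Fin n) K) (hP : IsUnit P.det) : G →* SL(n, K) where
  toFun w := ⟨P⁻¹ * (σ w : Matrix (Fin n) (Fin n) K) * P, by
    rw [Matrix.det_mul_comm, ← mul_assoc, Matrix.mul_nonsing_inv _ hP, one_mul]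
    exact (σ w).2⟩
  map_one' := by
    apply Subtype.ext
    simp [Matrix.nonsing_inv_mul _ hP]
  map_mul' a b := by
    apply Subtype.ext
    simp only [map_mul, Matrix.SpecialLinearGroup.coe_mul]
    have h : P * P⁻¹ = 1 := Matrix.mul_nonsing_inv _ hP
    calc _ = P⁻¹ * (σ a : Matrix (Fin n) (Fin n) K) * 1 * (σ b : Matrix (Fin n) (Fin n) K) * P := by
          simp only [mul_one, mul_assoc]
      _ = (P⁻¹ * (σ a : Matrix (Fin n) (Fin n) K) * P) * (P⁻¹ * (σ b : Matrix (Fin n) (Fin n) K) * P) := by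
          rw [← h]; simp only [mul_assoc]

variable {K : Type*} [Field K] {n : ℕ} {G : Type*} [Group G] (σ : G →* SL(n, K))
    (P : Matrix (Fin n) (Fin n) K) (hP : IsUnit P.det)

lemma coe_conjRep (w : G) : (conjRep σ P hP w : Matrix (Fin n) (Fin n) K) = P⁻¹ * σ w * P := rfl

lemma tr_conjRep (w : G) : tr (conjRep σ P hP) w = tr σ w := by
  rw [tr, coe_conjRep, Matrix.trace_mul_comm, ← mul_assoc, Matrix.mul_nonsing_inv _ hP, one_mul, tr]

lemma conjRep_eq_one {w : G} (h : σ w = 1) : conjRep σ P hP w = 1 := by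
  apply Subtype.ext
  change P⁻¹ * (σ w : Matrix (Fin n) (Fin n) K) * P = 1
  rw [h, Matrix.SpecialLinearGroup.coe_one, mul_one, Matrix.nonsing_inv_mul _ hP]

lemma gram_basis (e : Fin n × Fin n → G) (h : (gram σ e).det ≠ 0) :
    LinearIndependent K (fun i => (σ (e i) : Matrix (Fin n) (Fin n) K)) := by
  rw [Fintype.linearIndependent_iff]
  intro a ha
  have h1 : Matrix.vecMul a (gram σ e) = 0 := by
    funext j
    have h2 : (∑ i, a i • (σ (e i) : Matrix (Fin n) (Fin n) K)) * σ (e j) = 0 := by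
      rw [ha, zero_mul]
    have h3 := congrArg Matrix.trace h2
    rw [Finset.sum_mul, Matrix.trace_sum, Matrix.trace_zero] at h3
    rw [Pi.zero_apply, ← h3, Matrix.vecMul, dotProduct]
    refine Finset.sum_congr rfl fun i _ => ?_
    rw [smul_mul_assoc, Matrix.trace_smul, smul_eq_mul, gram, Matrix.of_apply, tr, map_mul,
      Matrix.SpecialLinearGroup.coe_mul]
  have h4 : a = 0 := by
    by_contra h0
    exact h (Matrix.exists_vecMul_eq_zero_iff.mp ⟨a, h0, h1⟩)
  intro i
  rw [h4]; rfl

/-- Bounded traces give a bounded conjugate. -/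
lemma conj_bdd (n : ℕ) (hn : 0 < n) (B c : ℝ) (hc : 0 < c) : ∃ C : ℝ, ∀ (k : ℕ) (K : Type) [Field K]
    (v : AbsoluteValue K ℝ) (σ : FreeGroup (Fin k) →* SL(n, K)) (e : Fin n × Fin n → FreeGroup (Fin k)),
    (∀ i j, v (tr σ (e i * e j)) ≤ B) →
    (∀ s i j, v (tr σ (FreeGroup.of s * (e i * e j))) ≤ B) → c ≤ v (gram σ e).det →
    ∃ σ' : FreeGroup (Fin k) →* SL(n, K), (∀ w, tr σ' w = tr σ w) ∧ (∀ w, σ w = 1 → σ' w = 1) ∧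
      ∀ s i j, v ((σ' (FreeGroup.of s) : Matrix (Fin n) (Fin n) K) i j) ≤ C := by
  classical
  set M : ℝ := ((Fintype.card (Fin n × Fin n)).factorial : ℝ) * (max B 1) ^ (Fintype.card (Fin n × Fin n))
    with hM
  set CL : ℝ := Fintype.card (Fin n × Fin n) * (c⁻¹ * M * max B 1) with hCL
  have hCL0 : 0 ≤ CL := by positivity
  refine ⟨Fintype.card (Fin n × Fin n) * CL, ?_⟩
  intro k K _ v σ e h1 h2 h3
  have hdet : (gram σ e).det ≠ 0 := by
    intro h; rw [h, map_zero] at h3; linarith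
  have hli := gram_basis σ e hdet
  have : Nonempty (Fin n × Fin n) := ⟨(⟨0, hn⟩, ⟨0, hn⟩)⟩
  let b := basisOfLinearIndependentOfCardEqFinrank hli (by
    rw [Module.finrank_matrix]; simp)
  have hb : ∀ i, b i = (σ (e i) : Matrix (Fin n) (Fin n) K) := fun i => by
    simp [b, coe_basisOfLinearIndependentOfCardEqFinrank]
  have hdT : IsUnit ((gram σ e)ᵀ).det := by rw [Matrix.det_transpose]; exact hdet.isUnit
  -- structure constants
  let L : Fin k → Matrix (Fin n × Fin n) (Fin n × Fin n) K := fun s => Matrix.of fun i j =>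
    b.repr ((σ (FreeGroup.of s) : Matrix (Fin n) (Fin n) K) * σ (e j)) i
  have hL : ∀ s j, (σ (FreeGroup.of s) : Matrix (Fin n) (Fin n) K) * σ (e j) =
      ∑ i, L s i j • (σ (e i) : Matrix (Fin n) (Fin n) K) := by
    intro s j
    rw [← b.sum_repr ((σ (FreeGroup.of s) : Matrix (Fin n) (Fin n) K) * σ (e j))]
    refine Finset.sum_congr rfl fun i _ => ?_
    simp only [L, Matrix.of_apply, hb]
    try rw [b.sum_repr]
  have hLT : ∀ s, (gram σ e)ᵀ * L s = Matrix.of fun l j => tr σ (FreeGroup.of s * (e j * e l)) := by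
    intro s
    ext l j
    rw [Matrix.mul_apply, Matrix.of_apply, tr, ← mul_assoc, map_mul, map_mul,
      Matrix.SpecialLinearGroup.coe_mul, Matrix.SpecialLinearGroup.coe_mul, hL, Finset.sum_mul,
      Matrix.trace_sum]
    refine Finset.sum_congr rfl fun i _ => ?_
    rw [smul_mul_assoc, Matrix.trace_smul, smul_eq_mul, Matrix.transpose_apply, gram, Matrix.of_apply,
      tr, map_mul, Matrix.SpecialLinearGroup.coe_mul, mul_comm]
  have hadj : ∀ i j, v ((gram σ e)ᵀ.adjugate i j) ≤ M := by
    intro i j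
    rw [Matrix.adjugate_apply]
    refine (Matrix.det_le (abv := v) (x := max B 1) fun a a' => ?_).trans (by rw [hM, nsmul_eq_mul])
    rw [Matrix.updateRow_apply]
    split_ifs
    · rw [Pi.single_apply]
      split_ifs
      · rw [map_one]; exact le_max_right _ _
      · rw [map_zero]; exact zero_le_one.trans (le_max_right _ _)
    · exact (h1 _ _).trans (le_max_left _ _)
  have hLb : ∀ s i j, v (L s i j) ≤ CL := by
    intro s i j
    have e1 : L s = ((gram σ e)ᵀ)⁻¹ * Matrix.of fun l j => tr σ (FreeGroup.of s * (e j * e l)) := by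
      rw [← hLT, ← mul_assoc, Matrix.nonsing_inv_mul _ hdT, one_mul]
    rw [e1, Matrix.mul_apply]
    refine (v.sum_le _ _).trans ?_
    refine (Finset.sum_le_sum (g := fun _ => c⁻¹ * M * max B 1) fun l _ => ?_).trans (by
      rw [Finset.sum_const, nsmul_eq_mul, Finset.card_univ])
    rw [map_mul, Matrix.of_apply]
    refine mul_le_mul ?_ ((h2 s j l).trans (le_max_left _ _)) (v.nonneg _) (by positivity)
    rw [Matrix.inv_def, Matrix.smul_apply, smul_eq_mul, map_mul, Ring.inverse_eq_inv', map_inv₀,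
      Matrix.det_transpose]
    exact mul_le_mul (inv_anti₀ hc h3) (hadj i l) (v.nonneg _) (by positivity)
  -- the first columns
  let u : Fin n × Fin n → Fin n → K := fun j a => (σ (e j) : Matrix (Fin n) (Fin n) K) a ⟨0, hn⟩
  have hu : ∀ s j, (σ (FreeGroup.of s) : Matrix (Fin n) (Fin n) K).mulVec (u j) =
      ∑ i, L s i j • u i := by
    intro s j
    funext a
    have := congrFun (congrFun (hL s j) a) ⟨0, hn⟩
    rw [Matrix.mul_apply, Matrix.sum_apply] at this
    rw [Finset.sum_apply]
    exact this
  have hex : ∃ I : Fin n → Fin n × Fin n, (Matrix.of fun a => u (I a)).det ≠ 0 := by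
    by_contra hcon
    push Not at hcon
    have hs : ∀ a : Fin n, ∃ cc : Fin n × Fin n → K, (Pi.single a 1 : Fin n → K) = ∑ j, cc j • u j := by
      intro a
      refine ⟨fun j => b.repr (Matrix.single a ⟨0, hn⟩ 1) j, ?_⟩
      funext a'
      have := congrFun (congrFun (b.sum_repr (Matrix.single a ⟨0, hn⟩ 1)) a') ⟨0, hn⟩
      rw [Matrix.sum_apply] at this
      rw [Finset.sum_apply]
      simp only [hb, Matrix.smul_apply] at this
      simp only [Pi.smul_apply, u]
      rw [this]
      simp [Matrix.single_apply, Pi.single_apply, eq_comm]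
    choose cc hcc using hs
    have h5 : (1 : Matrix (Fin n) (Fin n) K) = fun a => ∑ j, cc a j • u j := by
      funext a
      rw [← hcc]
      funext a'
      rw [Matrix.one_apply, Pi.single_apply]
      simp only [eq_comm]
    have h6 : (1 : Matrix (Fin n) (Fin n) K).det = 0 := by
      have h7 := MultilinearMap.map_sum
        (Matrix.detRowAlternating (R := K) (n := Fin n)).toMultilinearMap (fun a j => cc a j • u j)
      have h8 : (1 : Matrix (Fin n) (Fin n) K).det =
          (Matrix.detRowAlternating (R := K) (n := Fin n)).toMultilinearMap
            (fun a => ∑ j, cc a j • u j) := by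
        rw [h5]; rfl
      rw [h8, h7]
      refine Finset.sum_eq_zero fun I _ => ?_
      rw [MultilinearMap.map_smul_univ]
      have := hcon I
      have h9 : (Matrix.detRowAlternating (R := K) (n := Fin n)).toMultilinearMap
          (fun a => u (I a)) = 0 := this
      rw [h9, smul_zero]
    rw [Matrix.det_one] at h6
    exact one_ne_zero h6
  obtain ⟨I, hImax⟩ : ∃ I : Fin n → Fin n × Fin n, ∀ I' : Fin n → Fin n × Fin n,
      v (Matrix.of fun a => u (I' a)).det ≤ v (Matrix.of fun a => u (I a)).det :=
    Finite.exists_max (fun I : Fin n → Fin n × Fin n => v (Matrix.of fun a => u (I a)).det)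
  have hI : (Matrix.of fun a => u (I a)).det ≠ 0 := by
    obtain ⟨I', h'⟩ := hex
    intro h0
    have := hImax I'
    rw [h0, map_zero] at this
    exact (v.pos h').not_ge this
  set P : Matrix (Fin n) (Fin n) K := (Matrix.of fun a => u (I a))ᵀ with hPdef
  have hPd : P.det ≠ 0 := by rw [hPdef, Matrix.det_transpose]; exact hI
  have hP : IsUnit P.det := hPd.isUnit
  have hco : ∀ j a, v ((P⁻¹).mulVec (u j) a) ≤ 1 := by
    intro j a
    have h5 : (P⁻¹).mulVec (u j) a = P.det⁻¹ * P.cramer (u j) a := by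
      rw [Matrix.inv_def, Ring.inverse_eq_inv', Matrix.smul_mulVec, ← Matrix.cramer_eq_adjugate_mulVec]
      rfl
    rw [h5, Matrix.cramer_apply, map_mul, map_inv₀, inv_mul_le_iff₀ (v.pos hPd), mul_one]
    have h6 : P.updateCol a (u j) = (Matrix.of fun a' => u (Function.update I a j a'))ᵀ := by
      ext x y
      rw [Matrix.updateCol_apply, Matrix.transpose_apply, Matrix.of_apply]
      split_ifs with h
      · rw [h, Function.update_self]
      · rw [Function.update_of_ne h]; rfl
    rw [h6, Matrix.det_transpose, hPdef, Matrix.det_transpose]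
    exact hImax _
  refine ⟨conjRep σ P hP, tr_conjRep σ P hP, fun w => conjRep_eq_one σ P hP, ?_⟩
  intro s i j
  rw [coe_conjRep, mul_assoc]
  have h7 : (P⁻¹ * ((σ (FreeGroup.of s) : Matrix (Fin n) (Fin n) K) * P)) i j =
      ∑ l, L s l (I j) * (P⁻¹).mulVec (u l) i := by
    have h8 : (P⁻¹ * ((σ (FreeGroup.of s) : Matrix (Fin n) (Fin n) K) * P)) i j =
        (P⁻¹).mulVec ((σ (FreeGroup.of s) : Matrix (Fin n) (Fin n) K).mulVec (u (I j))) i := by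
      rw [Matrix.mul_apply, Matrix.mulVec, dotProduct]
      rfl
    rw [h8, hu, Matrix.mulVec_sum, Finset.sum_apply]
    refine Finset.sum_congr rfl fun l _ => ?_
    rw [Matrix.mulVec_smul]; rfl
  rw [h7]
  refine (v.sum_le _ _).trans ?_
  refine (Finset.sum_le_sum (g := fun _ => CL) fun l _ => ?_).trans (by
    rw [Finset.sum_const, nsmul_eq_mul, Finset.card_univ])
  rw [map_mul]
  calc _ ≤ CL * 1 := mul_le_mul (hLb _ _ _) (hco _ _) (v.nonneg _) hCL0
    _ = CL := mul_one _

end Conj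

section NA
open Polynomial

variable {K : Type*} [Field K] {n : ℕ}

lemma charpolyRev_sq (M : Matrix (Fin n) (Fin n) K) :
    M.charpolyRev * (M.charpolyRev.comp (-X)) = expand K 2 (M * M).charpolyRev := by
  have h1 : M.charpolyRev.comp (-X) = (1 + (X : K[X]) • M.map C).det := by
    have : M.charpolyRev.comp (-X) = compRingHom (-X) M.charpolyRev := rfl
    rw [this, Matrix.charpolyRev, RingHom.map_det]
    congr 1
    ext i j : 1
    rw [RingHom.mapMatrix_apply, Matrix.map_apply, Matrix.sub_apply, Matrix.add_apply, Matrix.one_apply]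
    split_ifs <;> simp
  have h2 : expand K 2 (M * M).charpolyRev = (1 - (X ^ 2 : K[X]) • (M * M).map C).det := by
    have : expand K 2 (M * M).charpolyRev = (expand K 2 : K[X] →ₐ[K] K[X]).toRingHom (M * M).charpolyRev := rfl
    rw [this, Matrix.charpolyRev, RingHom.map_det]
    congr 1
    ext i j : 1
    rw [RingHom.mapMatrix_apply, Matrix.map_apply, Matrix.sub_apply, Matrix.sub_apply, Matrix.one_apply,
      Matrix.smul_apply, Matrix.smul_apply, Matrix.map_apply]
    split_ifs <;> simp
  rw [h1, h2, Matrix.charpolyRev, ← Matrix.det_mul]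
  congr 1
  rw [Matrix.map_mul]
  rw [sub_mul, mul_add, mul_add]
  simp only [one_mul, mul_one, smul_mul_assoc, mul_smul_comm, smul_smul, sq]
  abel

lemma gauss_sq (v : AbsoluteValue K ℝ) (hna : IsNonarchimedean v) (M : Matrix (Fin n) (Fin n) K) :
    gaussNorm v 1 M.charpolyRev ^ 2 ≤ gaussNorm v 1 (M * M).charpolyRev := by
  have h1 : gaussNorm v 1 M.charpolyRev ≤ gaussNorm v 1 (M.charpolyRev.comp (-X)) := by
    obtain ⟨i, hi⟩ := exists_eq_gaussNorm v 1 M.charpolyRev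
    have := le_gaussNorm v (M.charpolyRev.comp (-X)) (zero_le_one (α := ℝ)) i
    rw [hi]
    refine le_trans (le_of_eq ?_) this
    have hX : (-X : K[X]) = C (-1) * X := by simp
    rw [hX, comp_C_mul_X_coeff, map_mul, map_pow, v.map_neg, map_one, one_pow, mul_one, mul_one]
  have h2 : gaussNorm v 1 (expand K 2 (M * M).charpolyRev) ≤ gaussNorm v 1 (M * M).charpolyRev := by
    obtain ⟨i, hi⟩ := exists_eq_gaussNorm v 1 (expand K 2 (M * M).charpolyRev)
    rw [hi, coeff_expand (by norm_num)]
    split_ifs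
    · have := le_gaussNorm v ((M * M).charpolyRev) (zero_le_one (α := ℝ)) (i / 2)
      simpa using this
    · rw [map_zero, zero_mul]; exact gaussNorm_nonneg v _ zero_le_one
  rw [← charpolyRev_sq, gaussNorm_mul hna one_pos] at h2
  have h0 : 0 ≤ gaussNorm v 1 M.charpolyRev := gaussNorm_nonneg v _ zero_le_one
  nlinarith

lemma gauss_bdd (v : AbsoluteValue K ℝ) (hna : IsNonarchimedean v) {b : ℝ}
    (M : Matrix (Fin n) (Fin n) K) (hC : nm v M ≤ b) :
    gaussNorm v 1 M.charpolyRev ≤ n.factorial * (1 + b) ^ n := by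
  have hC0 : 0 ≤ b := (nm_nonneg v M).trans hC
  let w : AbsoluteValue K[X] ℝ := 
    { toFun := gaussNorm v 1
      map_mul' := gaussNorm_mul hna one_pos
      nonneg' := fun p => gaussNorm_nonneg v p zero_le_one
      eq_zero' := fun p => gaussNorm_eq_zero_iff v p (fun x hx => v.eq_zero.mp hx) one_pos
      add_le' := fun p q => (isNonarchimedean_gaussNorm v hna zero_le_one p q).trans
        (max_le_add_of_nonneg (gaussNorm_nonneg v p zero_le_one) (gaussNorm_nonneg v q zero_le_one)) }
  have := Matrix.det_le (A := (1 - (X : K[X]) • M.map C)) (abv := w) (x := 1 + b) (by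
    intro i j
    have h0 : (1 - (X : K[X]) • M.map Polynomial.C) i j = Polynomial.C ((1 : Matrix (Fin n) (Fin n) K) i j) +
      Polynomial.monomial 1 (- M i j) := by
      rw [Matrix.sub_apply, Matrix.one_apply, Matrix.one_apply, Matrix.smul_apply, Matrix.map_apply,
        ← Polynomial.C_mul_X_pow_eq_monomial]
      split_ifs <;> simp <;> ring
    rw [h0]
    refine (w.add_le _ _).trans (add_le_add ?_ ?_)
    · change gaussNorm v 1 _ ≤ 1
      rw [gaussNorm_C, Matrix.one_apply]
      split_ifs <;> simp
    · change gaussNorm v 1 _ ≤ b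
      rw [gaussNorm_monomial, v.map_neg, one_pow, mul_one]
      exact (le_nm v M i j).trans hC)
  rw [Fintype.card_fin, nsmul_eq_mul] at this
  exact this

lemma na_trace {G : Type*} [Group G] (v : AbsoluteValue K ℝ) (hna : IsNonarchimedean v)
    (σ : G →* SL(n, K)) {C : ℝ} (hC : ∀ g, nm v (σ g : Matrix (Fin n) (Fin n) K) ≤ C) (g : G) :
    v (tr σ g) ≤ 1 := by
  have h1 : ∀ k : ℕ, ∀ g, gaussNorm v 1 (σ g : Matrix (Fin n) (Fin n) K).charpolyRev ^ (2 ^ k) ≤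
      n.factorial * (1 + C) ^ n := by
    intro k
    induction k with
    | zero => intro g; simpa using gauss_bdd v hna _ (hC g)
    | succ k ih =>
      intro g
      have := ih (g * g)
      rw [map_mul, Matrix.SpecialLinearGroup.coe_mul] at this
      refine le_trans ?_ this
      rw [pow_succ', pow_mul]
      exact pow_le_pow_left₀ (by positivity) (gauss_sq v hna _) _
  have h2 : gaussNorm v 1 (σ g : Matrix (Fin n) (Fin n) K).charpolyRev ≤ 1 := by
    by_contra hcon
    push Not at hcon
    obtain ⟨m, hm⟩ := pow_unbounded_of_one_lt (n.factorial * (1 + C) ^ n) hcon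
    have := h1 m g
    have h3 : gaussNorm v 1 (σ g : Matrix (Fin n) (Fin n) K).charpolyRev ^ m ≤
      gaussNorm v 1 (σ g : Matrix (Fin n) (Fin n) K).charpolyRev ^ (2 ^ m) :=
      pow_le_pow_right₀ hcon.le (Nat.lt_two_pow_self).le
    linarith
  have h3 := le_gaussNorm v (σ g : Matrix (Fin n) (Fin n) K).charpolyRev (zero_le_one (α := ℝ)) 1
  rw [Matrix.coeff_charpolyRev_eq_neg_trace, v.map_neg, one_pow, mul_one] at h3
  exact h3.trans h2

end NA
end WDC
end PartSec10

section PartSec11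
open scoped MatrixGroups Pointwise commutatorElement
namespace WDC

section S2
open Filter Topology

/-- A pair of short words generating a free group. -/
def FreePair {k : ℕ} {H : Type*} [Group H] (N : ℕ) (σ : FreeGroup (Fin k) →* H) : Prop :=
  ∃ f : Fin 2 → FreeGroup (Fin k), (∀ p, (f p).toWord.length ≤ N) ∧
    ∀ w : FreeGroup (Fin 2), w ≠ 1 → FreeGroup.lift (fun p => σ (f p)) w ≠ 1

lemma lift_comp {k : ℕ} {H : Type*} [Group H] (σ : FreeGroup (Fin k) →* H)
    (f : Fin 2 → FreeGroup (Fin k)) (w : FreeGroup (Fin 2)) :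
    FreeGroup.lift (fun p => σ (f p)) w = σ (FreeGroup.lift f w) := by
  have : FreeGroup.lift (fun p => σ (f p)) = σ.comp (FreeGroup.lift f) := by
    ext p; simp
  rw [this]; rfl

lemma FreePair.of_ker {k : ℕ} {H H' : Type*} [Group H] [Group H'] {N : ℕ}
    {σ : FreeGroup (Fin k) →* H} {σ' : FreeGroup (Fin k) →* H'} (h : ∀ w, σ w = 1 → σ' w = 1)
    (h' : FreePair N σ') : FreePair N σ := by
  obtain ⟨f, h1, h2⟩ := h'
  refine ⟨f, h1, fun w hw h3 => h2 w hw ?_⟩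
  rw [lift_comp] at h3 ⊢
  exact h _ h3

lemma FreePair.mono {k : ℕ} {H : Type*} [Group H] {N N' : ℕ} {σ : FreeGroup (Fin k) →* H}
    (h : FreePair N σ) (hN : N ≤ N') : FreePair N' σ := by
  obtain ⟨f, h1, h2⟩ := h
  exact ⟨f, fun p => (h1 p).trans hN, h2⟩

lemma limit_rep (U : Ultrafilter ℕ) (hU : (U : Filter ℕ) ≤ atTop) {Kf : ℕ → Type} [∀ i, Field (Kf i)]
    (vf : ∀ i, AbsoluteValue (Kf i) ℝ) {K : Type} [Field K] {v : AbsoluteValue K ℝ}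
    (Λ : ULim U vf K v) {n k : ℕ} (hn : 0 < n) (σf : ∀ i, FreeGroup (Fin k) →* SL(n, Kf i))
    {C : ℝ} (hC : ∀ i s a b, vf i ((σf i (FreeGroup.of s) : Matrix (Fin n) (Fin n) (Kf i)) a b) ≤ C)
    (e : Fin n × Fin n → FreeGroup (Fin k))
    (he : ∀ i, e i ∈ Subgroup.closure (Set.range (fun g : FreeGroup (Fin k) => g ^ n.factorial)))
    {c : ℝ} (hc : 0 < c) (hg : ∀ i, c ≤ vf i (gram (σf i) e).det)
    (hfree : ∀ i, ¬ FreePair i (σf i)) :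
    ∃ σ : FreeGroup (Fin k) →* SL(n, K),
      (∀ w, Tendsto (fun i => vf i (tr (σf i) w)) U (𝓝 (v (tr σ w)))) ∧
      (∀ q c, Tendsto (fun i => vf i (pv (σf i) e q c)) U (𝓝 (v (pv σ e q c)))) ∧
      ∃ D, ∀ w, nm v (σ w : Matrix (Fin n) (Fin n) K) ≤ D := by
  classical
  let gen : Fin k → SL(n, bsub U vf) := fun s =>
    ⟨Matrix.of fun a b => ⟨fun i => (σf i (FreeGroup.of s) : Matrix (Fin n) (Fin n) (Kf i)) a b,
      C, Eventually.of_forall fun i => hC i s a b⟩, by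
      apply Subtype.ext
      funext i
      change bproj U vf i _ = bproj U vf i 1
      rw [RingHom.map_det, map_one]
      exact (σf i (FreeGroup.of s)).2⟩
  let τ : FreeGroup (Fin k) →* SL(n, bsub U vf) := FreeGroup.lift gen
  have hτ : ∀ i, mapRep (bproj U vf i) τ = σf i := by
    intro i
    ext s : 1
    apply Subtype.ext
    change ((τ (FreeGroup.of s) : SL(n, bsub U vf)) : Matrix (Fin n) (Fin n) (bsub U vf)).map
      (bproj U vf i) = _
    simp only [τ, FreeGroup.lift_apply_of]
    rfl
  have hpv : ∀ q c, Tendsto (fun i => vf i (pv (σf i) e q c)) U (𝓝 (v (pv (mapRep Λ.lm τ) e q c))) := by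
    intro q c
    rw [pv_map]
    have := Λ.tend (pv τ e q c)
    refine this.congr fun i => ?_
    rw [← hτ i, pv_map]; rfl
  refine ⟨mapRep Λ.lm τ, ?_, hpv, ?_⟩
  · intro w
    rw [tr_map]
    refine (Λ.tend (tr τ w)).congr fun i => ?_
    rw [← hτ i, tr_map]; rfl
  by_contra hcon
  push Not at hcon
  have hgd : (gram (mapRep Λ.lm τ) e).det ≠ 0 := by
    rw [gram_map]
    have h1 := Λ.tend (gram τ e).det
    have h2 : c ≤ v (Λ.lm (gram τ e).det) := by
      refine ge_of_tendsto' h1 fun i => ?_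
      have := hg i
      rwa [← hτ i, gram_map] at this
    intro h
    rw [h, map_zero] at h2
    linarith
  obtain ⟨f, hf⟩ := pp_theorem v (mapRep Λ.lm τ) hn (by
    have hli := gram_basis _ e hgd
    have : Nonempty (Fin n × Fin n) := ⟨(⟨0, hn⟩, ⟨0, hn⟩)⟩
    have h1 := hli.span_eq_top_of_card_eq_finrank (by rw [Module.finrank_matrix]; simp)
    rw [eq_top_iff, ← h1]
    refine Submodule.span_mono ?_
    rintro _ ⟨i, rfl⟩
    exact ⟨e i, he i, rfl⟩) hcon
  have hlet : ∀ {L : Type} [CommRing L] (φ : bsub U vf →+* L) (p : Fin 2 × Bool),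
      ((letter (fun i => mapRep φ τ (f i)) p : SL(n, L)) : Matrix (Fin n) (Fin n) L) =
      ((letter (fun i => τ (f i)) p : SL(n, bsub U vf)) : Matrix (Fin n) (Fin n) (bsub U vf)).map φ := by
    intro L _ φ p
    have : letter (fun i => mapRep φ τ (f i)) p =
        Matrix.SpecialLinearGroup.map φ (letter (fun i => τ (f i)) p) := by
      rcases p with ⟨a, b⟩
      cases b
      · simp only [letter, cond_false, map_inv]; rfl
      · rfl
    rw [this]; rfl
  have h1 : ∀ᶠ i in (U : Filter ℕ), PPC (vf i)
      (fun p => ((letter (fun j => σf i (f j)) p : SL(n, Kf i)) : Matrix (Fin n) (Fin n) (Kf i))) := by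
    have h2 := Λ.ppc (M := fun p => ((letter (fun i => τ (f i)) p : SL(n, bsub U vf)) :
      Matrix (Fin n) (Fin n) (bsub U vf))) (by
        convert hf using 2 with p
        exact (hlet Λ.lm p).symm)
    filter_upwards [h2] with i hi
    convert hi using 2 with p
    rw [← hlet (bproj U vf i) p, hτ]
  have h2 : ∀ᶠ i in (U : Filter ℕ), ∀ p, (f p).toWord.length ≤ i :=
    eventually_all.2 fun p => hU (eventually_ge_atTop _)
  obtain ⟨i, hi1, hi2⟩ := (h1.and h2).exists
  exact hfree i ⟨f, hi2, hi1.free⟩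

/-- The complex limit. -/
noncomputable def cULim (U : Ultrafilter ℕ) :
    ULim U (fun _ : ℕ => NormedField.toAbsoluteValue ℂ) ℂ (NormedField.toAbsoluteValue ℂ) := by
  have hex : ∀ x : bsub U (fun _ : ℕ => NormedField.toAbsoluteValue ℂ), ∃ L : ℂ, Tendsto x.1 U (𝓝 L) := by
    intro x
    obtain ⟨C, hC⟩ := x.2
    have : (Ultrafilter.map x.1 U : Filter ℂ) ≤ 𝓟 (Metric.closedBall 0 C) := by
      rw [Ultrafilter.coe_map, le_principal_iff, mem_map]
      filter_upwards [hC] with i hi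
      rw [Set.mem_preimage, mem_closedBall_zero_iff]
      exact hi
    obtain ⟨L, -, hL⟩ := (isCompact_closedBall (0 : ℂ) C).ultrafilter_le_nhds _ this
    exact ⟨L, hL⟩
  choose L hL using hex
  exact
  { lm :=
    { toFun := L
      map_one' := tendsto_nhds_unique (hL 1) tendsto_const_nhds
      map_zero' := tendsto_nhds_unique (hL 0) tendsto_const_nhds
      map_mul' := fun x y => tendsto_nhds_unique (hL (x * y)) ((hL x).mul (hL y))
      map_add' := fun x y => tendsto_nhds_unique (hL (x + y)) ((hL x).add (hL y)) }
    surj := fun z => ⟨⟨fun _ => z, ‖z‖, Eventually.of_forall fun _ => le_rfl⟩,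
      tendsto_nhds_unique (hL _) tendsto_const_nhds⟩
    tend := fun x => (hL x).norm }

lemma gram_lower {K : Type*} [Field K] (v : AbsoluteValue K ℝ) {n : ℕ} {G : Type*} [Group G]
    (σ : G →* SL(n, K)) (e : Fin n × Fin n → G) (q c : G) {D : ℝ} (hD : 0 < D)
    (h1 : v (tr σ (q * c)) ≤ D) (h2 : v (tr σ c) ≤ D) (h3 : 1 ≤ v (pv σ e q c)) :
    1 / (2 * D) ≤ v (gram σ e).det := by
  rw [pv, map_mul] at h3
  have h4 : v (tr σ (q * c) - tr σ c) ≤ 2 * D := by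
    have := v.sub_le_add (tr σ (q * c)) (tr σ c)
    linarith
  rw [div_le_iff₀ (by positivity)]
  exact h3.trans (mul_le_mul_of_nonneg_left h4 (v.nonneg _))

section
variable {n k : ℕ} (hn : 0 < n) (e : Fin n × Fin n → FreeGroup (Fin k))
    (he : ∀ i, e i ∈ Subgroup.closure (Set.range (fun g : FreeGroup (Fin k) => g ^ n.factorial)))
    (q c : FreeGroup (Fin k))

/-- The test set of words, as an indexed family. -/
def tset : (Fin n × Fin n) × (Fin n × Fin n) ⊕ Fin k × ((Fin n × Fin n) × (Fin n × Fin n)) ⊕ Bool →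
    FreeGroup (Fin k)
  | Sum.inl p => e p.1 * e p.2
  | Sum.inr (Sum.inl p) => FreeGroup.of p.1 * (e p.2.1 * e p.2.2)
  | Sum.inr (Sum.inr true) => q * c
  | Sum.inr (Sum.inr false) => c

lemma s2_arch (hn : 0 < n)
    (he : ∀ i, e i ∈ Subgroup.closure (Set.range (fun g : FreeGroup (Fin k) => g ^ n.factorial)))
    (x : FreeGroup (Fin k)) (y : ℕ → FreeGroup (Fin k)) (J : ℕ) (hJ : AlmostLaw n J) (D : ℝ) (hD : 0 < D) :
    ∃ N, ∀ σ : FreeGroup (Fin k) →* SL(n, ℂ), (∀ t, ‖tr σ (tset e (Uw x y J) c t)‖ ≤ D) →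
      1 ≤ ‖pv σ e (Uw x y J) c‖ → FreePair N σ := by
  by_contra hcon
  push Not at hcon
  choose σ h1 h2 h3 using hcon
  have hg : ∀ i, 1 / (2 * D) ≤ ‖(gram (σ i) e).det‖ := fun i =>
    gram_lower (NormedField.toAbsoluteValue ℂ) (σ i) e _ c hD (h1 i (Sum.inr (Sum.inr true)))
      (h1 i (Sum.inr (Sum.inr false))) (h2 i)
  obtain ⟨C, hC⟩ := conj_bdd n hn D (1 / (2 * D)) (by positivity)
  have h4 := fun i => hC k ℂ (NormedField.toAbsoluteValue ℂ) (σ i) e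
    (fun a b => h1 i (Sum.inl (a, b))) (fun s a b => h1 i (Sum.inr (Sum.inl (s, (a, b))))) (hg i)
  choose σ' ht hker hb using h4
  obtain ⟨τ, -, hpv, hbd⟩ := limit_rep (hyperfilter ℕ) Nat.hyperfilter_le_atTop _
    (cULim (hyperfilter ℕ)) hn σ' hb e he (c := 1 / (2 * D)) (by positivity)
    (fun i => by rw [gram_congr (ht i)]; exact hg i)
    (fun i hf => h3 i (hf.of_ker (hker i)))
  have h5 := hJ _ τ hbd e x y c
  have h6 : 1 ≤ ‖pv τ e (Uw x y J) c‖ := by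
    refine ge_of_tendsto' (hpv (Uw x y J) c) fun i => ?_
    rw [pv_congr (ht i)]
    exact h2 i
  linarith

lemma s2_na (hn : 0 < n)
    (he : ∀ i, e i ∈ Subgroup.closure (Set.range (fun g : FreeGroup (Fin k) => g ^ n.factorial))) :
    ∃ N : ℕ, ∀ (K : Type) [Field K] (v : AbsoluteValue K ℝ) (σ : FreeGroup (Fin k) →* SL(n, K)),
      (∀ a b, v (a + b) ≤ (1 + 1 / ((N : ℝ) + 1)) * max (v a) (v b)) →
      (∀ t, v (tr σ (tset e q c t)) ≤ 2) → (∃ t, v (tr σ (tset e q c t)) = 2) →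
      1 ≤ v (pv σ e q c) → FreePair N σ := by
  by_contra hcon
  push Not at hcon
  choose K iK v σ h0 h1 h1' h2 h3 using hcon
  have hg : ∀ i, 1 / (2 * 2) ≤ v i (gram (σ i) e).det := fun i =>
    gram_lower (v i) (σ i) e _ c two_pos (h1 i (Sum.inr (Sum.inr true)))
      (h1 i (Sum.inr (Sum.inr false))) (h2 i)
  obtain ⟨C, hC⟩ := conj_bdd n hn 2 (1 / (2 * 2)) (by positivity)
  have h4 := fun i => hC k (K i) (v i) (σ i) e
    (fun a b => h1 i (Sum.inl (a, b))) (fun s a b => h1 i (Sum.inr (Sum.inl (s, (a, b))))) (hg i)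
  choose σ' ht hker hb using h4
  obtain ⟨τ, htr, -, D, hbd⟩ := limit_rep (hyperfilter ℕ) Nat.hyperfilter_le_atTop v
    (ufULim (hyperfilter ℕ) v) hn σ' hb e he (c := 1 / (2 * 2)) (by positivity)
    (fun i => by rw [gram_congr (ht i)]; exact hg i)
    (fun i hf => h3 i (hf.of_ker (hker i)))
  have hna : IsNonarchimedean (ufv (hyperfilter ℕ) v) := by
    intro a b
    obtain ⟨x, rfl⟩ := (ufULim (hyperfilter ℕ) v).surj a
    obtain ⟨y, rfl⟩ := (ufULim (hyperfilter ℕ) v).surj b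
    rw [← map_add]
    have e1 := (ufULim (hyperfilter ℕ) v).tend (x + y)
    have e2 := ((ufULim (hyperfilter ℕ) v).tend x).max ((ufULim (hyperfilter ℕ) v).tend y)
    have e3 : Tendsto (fun i : ℕ => 1 + 1 / ((i : ℝ) + 1)) (hyperfilter ℕ) (𝓝 (1 + 0)) :=
      (tendsto_one_div_add_atTop_nhds_zero_nat.const_add 1).mono_left Nat.hyperfilter_le_atTop
    have e4 := e3.mul e2
    rw [add_zero, one_mul] at e4
    exact le_of_tendsto_of_tendsto' e1 e4 fun i => h0 i _ _
  have h5 : ∀ t, ∀ᶠ i in (hyperfilter ℕ : Filter ℕ), v i (tr (σ i) (tset e q c t)) < 2 := by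
    intro t
    have h6 := na_trace (ufv (hyperfilter ℕ) v) hna τ hbd (tset e q c t)
    have h7 := (htr (tset e q c t)).eventually_lt_const (h6.trans_lt one_lt_two)
    filter_upwards [h7] with i hi
    rwa [ht i] at hi
  obtain ⟨i, hi⟩ := (eventually_all.2 h5).exists
  obtain ⟨t, ht⟩ := h1' i
  exact (hi t).ne ht

/-- A power of an absolute value. -/
noncomputable def vpow {K : Type*} [Field K] (v : AbsoluteValue K ℝ) (s : ℝ) (hs : 0 < s)
    (hadd : ∀ x y, v (x + y) ^ s ≤ v x ^ s + v y ^ s) : AbsoluteValue K ℝ where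
  toFun x := v x ^ s
  map_mul' x y := by rw [map_mul, Real.mul_rpow (v.nonneg _) (v.nonneg _)]
  nonneg' x := Real.rpow_nonneg (v.nonneg _) _
  eq_zero' x := by rw [Real.rpow_eq_zero (v.nonneg _) hs.ne', v.eq_zero]
  add_le' := hadd

lemma pv_le_one {K : Type*} [Field K] (v : AbsoluteValue K ℝ) (hna : IsNonarchimedean v)
    (σ : FreeGroup (Fin k) →* SL(n, K)) (h : ∀ t, v (tr σ (tset e q c t)) ≤ 1) : v (pv σ e q c) ≤ 1 := by
  let R : Subring K :=
    { carrier := {x | v x ≤ 1}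
      mul_mem' := by
        intro a b ha hb
        rw [Set.mem_ofPred_eq] at *
        rw [map_mul]; exact mul_le_one₀ ha (v.nonneg _) hb
      one_mem' := by simp
      add_mem' := fun {a b} ha hb => (hna a b).trans (max_le ha hb)
      zero_mem' := by simp
      neg_mem' := by
        intro a ha
        rw [Set.mem_ofPred_eq] at *
        rwa [v.map_neg] }
  have hR : ∀ t, tr σ (tset e q c t) ∈ R := h
  have : pv σ e q c ∈ R := by
    refine R.mul_mem ?_ (R.sub_mem (hR (Sum.inr (Sum.inr true))) (hR (Sum.inr (Sum.inr false))))
    rw [Matrix.det_apply]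
    refine R.sum_mem fun p _ => ?_
    rw [Units.smul_def]
    refine R.zsmul_mem (R.prod_mem fun i _ => hR (Sum.inl (p i, i))) _
  exact this

/-- Uniform free pairs over number fields. -/
theorem s2_main (hn : 0 < n)
    (he : ∀ i, e i ∈ Subgroup.closure (Set.range (fun g : FreeGroup (Fin k) => g ^ n.factorial)))
    (x : FreeGroup (Fin k)) (y : ℕ → FreeGroup (Fin k)) (J : ℕ) (hJ : AlmostLaw n J) :
    ∃ N, ∀ (K : Type) [Field K] [NumberField K] (σ : FreeGroup (Fin k) →* SL(n, K)),
      pv σ e (Uw x y J) c ≠ 0 → FreePair N σ := by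
  set q := Uw x y J with hq
  obtain ⟨N2, hN2⟩ := s2_na e q c hn he
  set D : ℝ := 2 ^ ((N2 : ℝ) + 2) with hD
  have hD2 : (2 : ℝ) ≤ D := by
    have := Real.rpow_le_rpow_of_exponent_le one_le_two (show (1 : ℝ) ≤ (N2 : ℝ) + 2 by
      have : (0 : ℝ) ≤ N2 := by positivity
      linarith)
    rwa [Real.rpow_one] at this
  obtain ⟨N1, hN1⟩ := s2_arch e c hn he x y J hJ D (by positivity)
  -- rescaling
  have resc : ∀ (K : Type) [Field K] (v : AbsoluteValue K ℝ) (σ : FreeGroup (Fin k) →* SL(n, K)),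
      1 ≤ v (pv σ e q c) → ∀ t, 1 < v (tr σ (tset e q c t)) → 
      (∀ t', v (tr σ (tset e q c t')) ≤ v (tr σ (tset e q c t))) → ∀ s : ℝ,
      s = Real.log 2 / Real.log (v (tr σ (tset e q c t))) →
      (∀ x y, v (x + y) ^ s ≤ v x ^ s + v y ^ s) → 
      (∀ a b, v (a + b) ^ s ≤ (1 + 1 / ((N2 : ℝ) + 1)) * max (v a ^ s) (v b ^ s)) → FreePair N2 σ := by
    intro K _ v σ h1 t ht htm s hs ha hm
    have hl : 0 < Real.log (v (tr σ (tset e q c t))) := Real.log_pos ht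
    have hs0 : 0 < s := by rw [hs]; exact div_pos (Real.log_pos one_lt_two) hl
    have e2 : v (tr σ (tset e q c t)) ^ s = 2 := by
      rw [Real.rpow_def_of_pos (by linarith), hs, mul_div_cancel₀ _ hl.ne', Real.exp_log two_pos]
    refine hN2 K (vpow v s hs0 ha) σ hm (fun t' => ?_) ⟨t, e2⟩ ?_
    · rw [← e2]
      exact Real.rpow_le_rpow (v.nonneg _) (htm t') hs0.le
    · exact Real.one_le_rpow h1 hs0.le
  have hmaxpow : ∀ (s : ℝ), 0 < s → ∀ a b : ℝ, 0 ≤ a → 0 ≤ b → (max a b) ^ s = max (a ^ s) (b ^ s) := by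
    intro s hs a b ha hb
    rcases le_total a b with h | h
    · rw [max_eq_right h, max_eq_right (Real.rpow_le_rpow ha h hs.le)]
    · rw [max_eq_left h, max_eq_left (Real.rpow_le_rpow hb h hs.le)]
  have hNpos : (0 : ℝ) < 1 / ((N2 : ℝ) + 1) := by positivity
  refine ⟨max N1 N2, ?_⟩
  intro K _ _ σ hP
  have hdich : (∃ w : NumberField.InfinitePlace K, 1 ≤ w (pv σ e q c)) ∨
      ∃ w : NumberField.FinitePlace K, 1 < w (pv σ e q c) := by
    by_contra hcon
    push Not at hcon
    have h1 := NumberField.prod_abs_eq_one hP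
    have h2 : ∏ w : NumberField.InfinitePlace K, w (pv σ e q c) ^ w.mult < 1 := by
      have h0 : ∏ w : NumberField.InfinitePlace K, w (pv σ e q c) ^ w.mult
          < ∏ _w : NumberField.InfinitePlace K, (1 : ℝ) := by
        refine Finset.prod_lt_prod_of_nonempty ?_ ?_ Finset.univ_nonempty
        · intro w _
          exact pow_pos (NumberField.InfinitePlace.pos_iff.2 hP) _
        · intro w _
          exact pow_lt_one₀ (apply_nonneg _ _) (hcon.1 w) NumberField.InfinitePlace.mult_ne_zero
      simpa using h0
    have h3 : 0 ≤ ∏ᶠ w : NumberField.FinitePlace K, w (pv σ e q c) ∧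
        ∏ᶠ w : NumberField.FinitePlace K, w (pv σ e q c) ≤ 1 := by
      refine finprod_induction (fun r : ℝ => 0 ≤ r ∧ r ≤ 1) (by norm_num) ?_ ?_
      · rintro a b ⟨h1, h2⟩ ⟨h3, h4⟩
        exact ⟨mul_nonneg h1 h3, mul_le_one₀ h2 h3 h4⟩
      · intro w
        exact ⟨apply_nonneg _ _, hcon.2 w⟩
    have h4 : 0 ≤ ∏ w : NumberField.InfinitePlace K, w (pv σ e q c) ^ w.mult :=
      Finset.prod_nonneg fun w _ => pow_nonneg (apply_nonneg _ _) _
    nlinarith [h3.1, h3.2]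
  have hT : Nonempty ((Fin n × Fin n) × (Fin n × Fin n) ⊕
      Fin k × ((Fin n × Fin n) × (Fin n × Fin n)) ⊕ Bool) := ⟨Sum.inr (Sum.inr true)⟩
  rcases hdich with ⟨w, hw⟩ | ⟨w, hw⟩
  · set σ' := mapRep w.embedding σ with hσ'
    have hker : ∀ u, σ u = 1 → σ' u = 1 := by
      intro u hu
      rw [hσ', mapRep, MonoidHom.comp_apply, hu, map_one]
    have hpv : 1 ≤ ‖pv σ' e q c‖ := by
      rw [hσ', pv_map, NumberField.InfinitePlace.norm_embedding_eq]; exact hw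
    suffices h : FreePair (max N1 N2) σ' from h.of_ker hker
    obtain ⟨t, ht⟩ := Finite.exists_max fun t => ‖tr σ' (tset e q c t)‖
    by_cases hB : ‖tr σ' (tset e q c t)‖ ≤ D
    · exact (hN1 σ' (fun t' => (ht t').trans hB) hpv).mono (le_max_left _ _)
    · push Not at hB
      have hB1 : 1 < ‖tr σ' (tset e q c t)‖ := by linarith
      have hl : 0 < Real.log ‖tr σ' (tset e q c t)‖ := Real.log_pos hB1
      obtain ⟨s, hs⟩ : ∃ s, s = Real.log 2 / Real.log ‖tr σ' (tset e q c t)‖ := ⟨_, rfl⟩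
      have hs0 : 0 < s := by rw [hs]; exact div_pos (Real.log_pos one_lt_two) hl
      have hs1 : s * ((N2 : ℝ) + 2) ≤ 1 := by
        have h1 := Real.log_le_log (by positivity) hB.le
        rw [hD, Real.log_rpow two_pos] at h1
        rw [hs, div_mul_eq_mul_div, div_le_one hl]
        linarith
      have hs1' : s ≤ 1 := by
        have : (0 : ℝ) ≤ N2 := by positivity
        nlinarith
      have h2s : (2 : ℝ) ^ s ≤ 1 + 1 / ((N2 : ℝ) + 1) := by
        have hN : (0 : ℝ) ≤ N2 := by positivity
        have h2 := rpow_one_add_le_one_add_mul_self (s := 1) (by norm_num) hs0.le hs1'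
        have h3 : s ≤ 1 / ((N2 : ℝ) + 1) := by
          rw [le_div_iff₀ (by positivity)]
          nlinarith
        norm_num at h2 h3 ⊢
        linarith
      refine (resc ℂ (NormedField.toAbsoluteValue ℂ) σ' hpv t hB1 ht s hs ?_ ?_).mono (le_max_right _ _)
      · intro x y
        refine (Real.rpow_le_rpow (norm_nonneg _) (norm_add_le x y) hs0.le).trans ?_
        exact Real.rpow_add_le_add_rpow (norm_nonneg _) (norm_nonneg _) hs0.le hs1'
      · intro a b
        have h3 : ‖a + b‖ ≤ 2 * max ‖a‖ ‖b‖ := by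
          have := norm_add_le a b
          linarith [le_max_left ‖a‖ ‖b‖, le_max_right ‖a‖ ‖b‖]
        have h4 : ‖a + b‖ ^ s ≤ 2 ^ s * max (‖a‖ ^ s) (‖b‖ ^ s) := by
          refine (Real.rpow_le_rpow (norm_nonneg _) h3 hs0.le).trans (le_of_eq ?_)
          rw [Real.mul_rpow two_pos.le (by positivity), hmaxpow s hs0 _ _ (norm_nonneg _) (norm_nonneg _)]
        exact h4.trans (mul_le_mul_of_nonneg_right h2s (by positivity))
  · have hna : IsNonarchimedean w.1 := fun a b => NumberField.FinitePlace.add_le w a b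
    obtain ⟨t, ht⟩ := Finite.exists_max fun t => w.1 (tr σ (tset e q c t))
    have hB1 : 1 < w.1 (tr σ (tset e q c t)) := by
      by_contra hle
      push Not at hle
      exact (pv_le_one e q c w.1 hna σ fun t' => (ht t').trans hle).not_gt hw
    obtain ⟨s, hs⟩ : ∃ s, s = Real.log 2 / Real.log (w.1 (tr σ (tset e q c t))) := ⟨_, rfl⟩
    have hs0 : 0 < s := by
      rw [hs]; exact div_pos (Real.log_pos one_lt_two) (Real.log_pos hB1)
    have h5 : ∀ a b, w.1 (a + b) ^ s ≤ max (w.1 a ^ s) (w.1 b ^ s) := by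
      intro a b
      rw [← hmaxpow s hs0 _ _ (w.1.nonneg _) (w.1.nonneg _)]
      exact Real.rpow_le_rpow (w.1.nonneg _) (hna a b) hs0.le
    refine (resc K w.1 σ hw.le t hB1 ht s hs ?_ ?_).mono (le_max_right _ _)
    · intro x y
      exact (h5 x y).trans (max_le_add_of_nonneg (Real.rpow_nonneg (w.1.nonneg _) _)
        (Real.rpow_nonneg (w.1.nonneg _) _))
    · intro a b
      refine (h5 a b).trans (le_mul_of_one_le_left ?_ (by linarith))
      exact le_max_of_le_left (Real.rpow_nonneg (w.1.nonneg _) _)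

end
end S2
end WDC
end PartSec11

section PartSec12
open scoped MatrixGroups Pointwise commutatorElement
namespace WDC

section SIdef
variable {K : Type*} [Field K] {V : Type*} [AddCommGroup V] [Module K V]
  {G : Type*} [Group G]

/-- Strong irreducibility. -/
def SI (ρ : G →* Module.End K V) : Prop :=
  ∀ H : Subgroup G, H.FiniteIndex → ∀ W : Submodule K V, (∀ g ∈ H, ∀ x ∈ W, ρ g x ∈ W) → W = ⊥ ∨ W = ⊤

/-- Scalar operators. -/
def Sc (T : Module.End K V) : Prop := ∃ c : K, T = c • 1

/-- Restriction to a subgroup. -/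
def res (ρ : G →* Module.End K V) (N : Subgroup G) : N →* Module.End K V := ρ.comp N.subtype

lemma res_apply (ρ : G →* Module.End K V) (N : Subgroup G) (g : N) : res ρ N g = ρ g := rfl

lemma fi_map (H : Subgroup G) (hH : H.FiniteIndex) (H' : Subgroup H) (hH' : H'.FiniteIndex) :
    (H'.map H.subtype).FiniteIndex := by
  refine ⟨?_⟩
  rw [Subgroup.index_map_subtype]
  exact mul_ne_zero hH'.index_ne_zero hH.index_ne_zero

lemma SI.res_fi {ρ : G →* Module.End K V} (h : SI ρ) (H : Subgroup G) (hH : H.FiniteIndex) :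
    SI (res ρ H) := by
  intro H' hH' W hW
  refine h _ (fi_map H hH H' hH') W ?_
  rintro _ ⟨g, hg, rfl⟩ x hx
  exact hW g hg x hx

variable [FiniteDimensional K V] [IsAlgClosed K]

lemma schur [Nontrivial V] (ρ : G →* Module.End K V)
    (hI : ∀ W : Submodule K V, (∀ g, ∀ x ∈ W, ρ g x ∈ W) → W = ⊥ ∨ W = ⊤)
    (T : Module.End K V) (hT : ∀ g, ρ g * T = T * ρ g) : Sc T := by
  obtain ⟨c, hc⟩ := Module.End.exists_eigenvalue T
  rcases hI (T.eigenspace c) (fun g x hx => by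
    rw [Module.End.mem_eigenspace_iff] at hx ⊢
    have := congrArg (fun S : Module.End K V => S x) (hT g)
    simp only [Module.End.mul_apply] at this
    rw [← this, hx, map_smul]) with h | h
  · exact absurd h hc
  · refine ⟨c, LinearMap.ext fun x => ?_⟩
    have : x ∈ T.eigenspace c := h ▸ Submodule.mem_top
    rw [Module.End.mem_eigenspace_iff] at this
    simpa using this

/-- The conjugation action on operators. -/
@[reducible] def cjAct (ρ : G →* Module.End K V) : MulAction G (Module.End K V) where
  smul g T := ρ g * T * ρ g⁻¹
  one_smul T := by
    change ρ 1 * T * ρ 1⁻¹ = T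
    simp
  mul_smul g h T := by
    change ρ (g * h) * T * ρ (g * h)⁻¹ = ρ g * (ρ h * T * ρ h⁻¹) * ρ g⁻¹
    simp [mul_assoc]

lemma e5 [Nontrivial V] {ρ : G →* Module.End K V} (hS : SI ρ) (a : Module.End K V)
    (ha : a.det ≠ 0) (h : ∀ g, ∃ c : K, ρ g * a = c • (a * ρ g)) : Sc a := by
  let _ := cjAct ρ
  have hn : 0 < Module.finrank K V := Module.finrank_pos
  let S : Set (Module.End K V) := (fun c : K => c • a) '' {c : K | c ^ Module.finrank K V = 1}
  have hfin : {c : K | c ^ Module.finrank K V = 1}.Finite := by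
    refine (Polynomial.nthRootsFinset (Module.finrank K V) (1 : K)).finite_toSet.subset fun c hc => ?_
    rw [Finset.mem_coe, Polynomial.mem_nthRootsFinset hn]
    exact hc
  have hst := finiteIndex_stab (G := G) (S := S) (x := a) (hfin.image _) (fun g => by
    obtain ⟨c, hc⟩ := h g
    refine ⟨c, ?_, ?_⟩
    · have h1 := congrArg LinearMap.det hc
      rw [LinearMap.det_smul, map_mul, map_mul] at h1
      have h2 : (ρ g).det ≠ 0 := by
        intro h0
        have := congrArg LinearMap.det (rho_mul_inv ρ g)
        rw [map_mul, h0, zero_mul, map_one] at this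
        exact zero_ne_one this
      have h3 : (c ^ Module.finrank K V - 1) * ((ρ g).det * a.det) = 0 := by
        linear_combination -h1
      rcases mul_eq_zero.1 h3 with h4 | h4
      · exact sub_eq_zero.1 h4
      · exact absurd h4 (mul_ne_zero h2 ha)
    · change c • a = ρ g * a * ρ g⁻¹
      rw [hc, smul_mul_assoc, mul_assoc, rho_mul_inv, mul_one])
  refine schur (res ρ (MulAction.stabilizer G a)) (fun W hW => hS _ hst W fun g hg x hx =>
    hW ⟨g, hg⟩ x hx) a ?_
  rintro ⟨g, hg⟩
  have h1 : ρ g * a * ρ g⁻¹ = a := hg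
  change ρ g * a = a * ρ g
  conv_rhs => rw [← h1]
  rw [mul_assoc, rho_inv_mul, mul_one]

end SIdef

section E1
variable {K : Type*} [Field K] {V : Type*} [AddCommGroup V] [Module K V]
  {G : Type*} [Group G]

/-- Joint eigenspaces. -/
def jes (ρ : G →* Module.End K V) (N : Subgroup G) (χ : G → K) : Submodule K V where
  carrier := {v | ∀ g ∈ N, ρ g v = χ g • v}
  zero_mem' := by intro g _; simp
  add_mem' := by
    intro a b ha hb g hg
    rw [map_add, ha g hg, hb g hg, smul_add]
  smul_mem' := by
    intro c a ha g hg
    rw [map_smul, ha g hg, smul_comm]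

lemma mem_jes (ρ : G →* Module.End K V) (N : Subgroup G) (χ : G → K) (v : V) :
    v ∈ jes ρ N χ ↔ ∀ g ∈ N, ρ g v = χ g • v := Iff.rfl

lemma jes_map (ρ : G →* Module.End K V) (N : Subgroup G) (χ : G → K) (h : G) :
    (jes ρ N χ).map (ρ h) = jes ρ (N.map (MulAut.conj h).toMonoidHom) (fun g => χ (h⁻¹ * g * h)) := by
  ext v
  rw [mem_jes, Submodule.mem_map]
  constructor
  · rintro ⟨v, hv, rfl⟩ _ ⟨g, hg, rfl⟩
    have h1 : h⁻¹ * (MulAut.conj h).toMonoidHom g * h = g := by simp; group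
    rw [h1]
    rw [← map_smul, ← hv g hg, ← Module.End.mul_apply, ← Module.End.mul_apply, ← map_mul, ← map_mul]
    congr 2
    simp
  · intro hv
    refine ⟨ρ h⁻¹ v, ?_, rho_apply_inv ρ h v⟩
    intro g hg
    have h1 := hv _ (Subgroup.mem_map_of_mem _ hg)
    have h2 : h⁻¹ * (MulAut.conj h).toMonoidHom g * h = g := by simp; group
    rw [h2] at h1
    rw [← map_smul, ← h1, ← Module.End.mul_apply, ← Module.End.mul_apply, ← map_mul, ← map_mul]
    congr 2
    simp
    group

lemma relIndex_conj (N : Subgroup G) [hN : N.Normal] (N' : Subgroup G) (h : G) (h0 : N'.relIndex N ≠ 0) :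
    (N'.map (MulAut.conj h).toMonoidHom).relIndex N ≠ 0 := by
  have h1 : N.map (MulAut.conj h).toMonoidHom = N := by
    exact Subgroup.Normal.map_conj_eq N h
  conv in N => rw [← h1]
  rwa [Subgroup.relIndex_map_map_of_injective _ _ (MulAut.conj h).injective]

lemma e1_max [FiniteDimensional K V] (ρ : G →* Module.End K V) (N : Subgroup G) (N₀ : Subgroup G)
    (h0 : N₀.relIndex N ≠ 0) (χ₀ : G → K) (hne : jes ρ N₀ χ₀ ≠ ⊥) :
    ∃ (N' : Subgroup G) (χ : G → K), N'.relIndex N ≠ 0 ∧ jes ρ N' χ ≠ ⊥ ∧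
      ∀ (N'' : Subgroup G) (χ' : G → K), N''.relIndex N ≠ 0 → jes ρ N'' χ' ≠ ⊥ →
        Module.finrank K (jes ρ N'' χ') ≤ Module.finrank K (jes ρ N' χ) := by
  let S : Set ℕ := {m | ∃ (N' : Subgroup G) (χ : G → K), N'.relIndex N ≠ 0 ∧ jes ρ N' χ ≠ ⊥ ∧
    Module.finrank K (jes ρ N' χ) = m}
  have hb : BddAbove S := ⟨Module.finrank K V, by
    rintro m ⟨N', χ, -, -, rfl⟩
    exact Submodule.finrank_le _⟩
  have hm := Nat.sSup_mem (s := S) ⟨_, N₀, χ₀, h0, hne, rfl⟩ hb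
  obtain ⟨N', χ, h1, h2, h3⟩ := hm
  exact ⟨N', χ, h1, h2, fun N'' χ' h4 h5 => h3 ▸ le_csSup hb ⟨N'', χ', h4, h5, rfl⟩⟩

lemma e1_fin [FiniteDimensional K V] (ρ : G →* Module.End K V) (N : Subgroup G) (S : Set (Submodule K V))
    (hS : ∀ W ∈ S, W ≠ ⊥ ∧ ∃ (N' : Subgroup G) (χ : G → K), N'.relIndex N ≠ 0 ∧ W = jes ρ N' χ ∧
      ∀ (N'' : Subgroup G) (χ' : G → K), N''.relIndex N ≠ 0 → jes ρ N'' χ' ≠ ⊥ →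
        Module.finrank K (jes ρ N'' χ') ≤ Module.finrank K W) : S.Finite := by
  classical
  have h1 : ∀ W : S, ∃ v ∈ W.1, v ≠ 0 := fun W => Submodule.exists_mem_ne_zero_of_ne_bot (hS W.1 W.2).1
  choose v hv hv0 using h1
  choose Nf χ hrel hW hmax using fun W : S => (hS W.1 W.2).2
  have hli : LinearIndependent K v := by
    rw [linearIndependent_iff']
    intro s c hc
    let M : Subgroup G := ⨅ W : s, Nf W.1
    have hM : M.relIndex N ≠ 0 := Subgroup.relIndex_iInf_ne_zero fun W => hrel W.1
    have hMle : ∀ W ∈ s, M ≤ Nf W := fun W hW => iInf_le (fun W : s => Nf W.1) ⟨W, hW⟩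
    have hjes : ∀ W ∈ s, W.1 = jes ρ M (χ W) := by
      intro W hWs
      have hle : W.1 ≤ jes ρ M (χ W) := by
        rw [hW W]
        intro x hx g hg
        exact hx g (hMle W hWs hg)
      refine Submodule.eq_of_le_of_finrank_le hle (hmax W M (χ W) hM ?_)
      intro hbot
      rw [hbot, le_bot_iff] at hle
      exact (hS W.1 W.2).1 hle
    have hvM : ∀ W ∈ s, ∀ g ∈ M, ρ g (v W) = χ W g • v W := by
      intro W hWs g hg
      have := hv W
      rw [hjes W hWs] at this
      exact this g hg
    have hχ1 : ∀ W ∈ s, χ W 1 = 1 := by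
      intro W hWs
      have := hvM W hWs 1 M.one_mem
      rw [map_one, Module.End.one_apply] at this
      have h2 : (1 - χ W 1) • v W = 0 := by rw [sub_smul, one_smul, ← this, sub_self]
      rcases smul_eq_zero.1 h2 with h3 | h3
      · exact (sub_eq_zero.1 h3).symm
      · exact absurd h3 (hv0 W)
    have hχm : ∀ W ∈ s, ∀ a ∈ M, ∀ b ∈ M, χ W (a * b) = χ W a * χ W b := by
      intro W hWs a ha b hb
      have := hvM W hWs (a * b) (M.mul_mem ha hb)
      rw [map_mul, Module.End.mul_apply, hvM W hWs b hb, map_smul, hvM W hWs a ha, smul_smul] at this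
      have h2 : (χ W b * χ W a - χ W (a * b)) • v W = 0 := by rw [sub_smul, ← this, sub_self]
      rcases smul_eq_zero.1 h2 with h3 | h3
      · rw [← sub_eq_zero.1 h3, mul_comm]
      · exact absurd h3 (hv0 W)
    let X : s → (M →* K) := fun W =>
      { toFun := fun g => χ W.1 g
        map_one' := hχ1 W.1 W.2
        map_mul' := fun a b => hχm W.1 W.2 a a.2 b b.2 }
    have hXinj : Function.Injective X := by
      intro W W' hWW
      apply Subtype.ext
      apply Subtype.ext
      rw [hjes W.1 W.2, hjes W'.1 W'.2]
      ext x
      rw [mem_jes, mem_jes]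
      have h5 : ∀ g ∈ M, χ W.1 g = χ W'.1 g := fun g hg => DFunLike.congr_fun hWW ⟨g, hg⟩
      exact ⟨fun h g hg => by rw [h g hg, h5 g hg], fun h g hg => by rw [h g hg, h5 g hg]⟩
    have hind := (linearIndependent_monoidHom M K).comp X hXinj
    intro W hWs
    have key : c W • v W = 0 := by
      rw [← Module.forall_dual_apply_eq_zero_iff K]
      intro f
      have h6 : ∑ i : s, f (c i.1 • v i.1) • ((fun F : M →* K => (F : M → K)) ∘ X) i = 0 := by
        funext g
        rw [Finset.sum_apply, Pi.zero_apply]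
        have h7 := congrArg (fun x => f (ρ g x)) hc
        simp only [map_sum, map_zero] at h7
        rw [← Finset.sum_coe_sort] at h7
        rw [← h7]
        refine Finset.sum_congr rfl fun i _ => ?_
        rw [map_smul (ρ g), hvM i.1 i.2 g g.2]
        simp [X]
        ring
      exact Fintype.linearIndependent_iff.1 hind _ h6 ⟨W, hWs⟩
    exact (smul_eq_zero.1 key).resolve_right (hv0 W)
  have := hli.finite
  exact Set.toFinite S

lemma sc_fin [FiniteDimensional K V] [IsAlgClosed K] [Nontrivial V] {ρ : G →* Module.End K V} (hS : SI ρ)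
    (N : Subgroup G) [N.Normal] (N' : Subgroup G) (h0 : N'.relIndex N ≠ 0)
    (hsc : ∀ g ∈ N', Sc (ρ g)) (a : G) (ha : a ∈ N) : Sc (ρ a) := by
  -- the normal subgroup of scalar elements
  let Z : Subgroup G :=
    { carrier := {g | Sc (ρ g)}
      one_mem' := ⟨1, by simp⟩
      mul_mem' := by
        rintro a b ⟨c, hc⟩ ⟨c', hc'⟩
        exact ⟨c * c', by rw [map_mul, hc, hc', smul_mul_smul_comm, one_mul]⟩
      inv_mem' := by
        rintro a ⟨c, hc⟩
        refine ⟨c⁻¹, ?_⟩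
        have h1 := rho_mul_inv ρ a
        rw [hc, smul_mul_assoc, one_mul] at h1
        have hc0 : c ≠ 0 := by
          rintro rfl
          rw [zero_smul] at h1
          exact zero_ne_one h1
        rw [← h1, smul_smul, inv_mul_cancel₀ hc0, one_smul] }
  have hZn : Z.Normal := ⟨by
    rintro a ⟨c, hc⟩ g
    refine ⟨c, ?_⟩
    rw [map_mul, map_mul, hc, mul_smul_comm, mul_one, smul_mul_assoc, rho_mul_inv]⟩
  have hZ : Z.relIndex N ≠ 0 := fun h => h0 (Subgroup.relIndex_eq_zero_of_le_left (fun g hg => hsc g hg) h)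
  let _ : MulAction G (G ⧸ Z) := MulAction.compHom (G ⧸ Z)
    ((MulAut.conj (G := G ⧸ Z)).comp (QuotientGroup.mk' Z))
  have hsm : ∀ g b : G, g • (QuotientGroup.mk' Z b) = QuotientGroup.mk' Z (g * b * g⁻¹) := by
    intro g b
    rw [map_mul, map_mul, map_inv]
    rfl
  have hfin : ((QuotientGroup.mk' Z) '' (N : Set G)).Finite := by
    have : (Z.subgroupOf N).FiniteIndex := ⟨hZ⟩
    have : Finite (N ⧸ Z.subgroupOf N) := inferInstance
    refine (Set.finite_range (fun q : N ⧸ Z.subgroupOf N => QuotientGroup.mk' Z (q.out : G))).subset ?_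
    rintro _ ⟨b, hb, rfl⟩
    refine ⟨QuotientGroup.mk ⟨b, hb⟩, ?_⟩
    have h1 := QuotientGroup.mk_out_eq_mul (Z.subgroupOf N) ⟨b, hb⟩
    obtain ⟨z, hz⟩ := h1
    simp only [hz]
    rw [QuotientGroup.mk'_apply, QuotientGroup.mk'_apply, QuotientGroup.eq]
    have h2 := z.2
    rw [Subgroup.mem_subgroupOf] at h2
    simpa using h2
  have hst := finiteIndex_stab (x := QuotientGroup.mk' Z a) hfin (fun g => by
    rw [hsm]
    exact ⟨_, Subgroup.Normal.conj_mem inferInstance a ha g, rfl⟩)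
  refine e5 (hS.res_fi _ hst) (ρ a) ?_ ?_
  · intro h
    have := congrArg LinearMap.det (rho_mul_inv ρ a)
    rw [map_mul, h, zero_mul, map_one] at this
    exact zero_ne_one this
  · rintro ⟨g, hg⟩
    rw [MulAction.mem_stabilizer_iff, hsm, QuotientGroup.mk'_apply, QuotientGroup.mk'_apply, eq_comm,
      QuotientGroup.eq] at hg
    obtain ⟨c, hc⟩ := hg
    refine ⟨c, ?_⟩
    change ρ g * ρ a = c • (ρ a * ρ g)
    have h1 : g * a = a * (a⁻¹ * (g * a * g⁻¹)) * g := by group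
    rw [← map_mul, h1, map_mul, map_mul, hc, mul_smul_comm, mul_one, smul_mul_assoc]

lemma e1 [FiniteDimensional K V] [IsAlgClosed K] [Nontrivial V] {ρ : G →* Module.End K V} (hS : SI ρ)
    (N : Subgroup G) [N.Normal] (N₀ : Subgroup G) (h0 : N₀.relIndex N ≠ 0) (χ₀ : G → K)
    (hne : jes ρ N₀ χ₀ ≠ ⊥) : ∀ g ∈ N, Sc (ρ g) := by
  obtain ⟨N', χ, h1, h2, h3⟩ := e1_max ρ N N₀ h0 χ₀ hne
  let _ := subAct ρ
  have hfin := e1_fin ρ N (MulAction.orbit G (jes ρ N' χ)) (by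
    rintro _ ⟨g, rfl⟩
    change (jes ρ N' χ).map (ρ g) ≠ ⊥ ∧ _
    have hfr : Module.finrank K ((jes ρ N' χ).map (ρ g)) = Module.finrank K (jes ρ N' χ) :=
      finrank_map_rep ρ g _
    refine ⟨?_, _, _, relIndex_conj N N' g h1, jes_map ρ N' χ g, ?_⟩
    · intro h
      rw [h, finrank_bot, eq_comm, Submodule.finrank_eq_zero] at hfr
      exact h2 hfr
    · intro N'' χ' h4 h5
      exact (h3 N'' χ' h4 h5).trans hfr.ge)
  have hst := finiteIndex_stab (x := jes ρ N' χ) hfin (fun g => MulAction.mem_orbit _ g)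
  have htop : jes ρ N' χ = ⊤ := by
    refine (hS _ hst (jes ρ N' χ) ?_).resolve_left h2
    intro g hg x hx
    have h4 : (jes ρ N' χ).map (ρ g) = jes ρ N' χ := hg
    rw [← h4]
    exact Submodule.mem_map_of_mem hx
  refine sc_fin hS N N' h1 ?_
  intro g hg
  refine ⟨χ g, LinearMap.ext fun x => ?_⟩
  have h5 : x ∈ jes ρ N' χ := htop ▸ Submodule.mem_top
  simpa using h5 g hg
end E1
end WDC
end PartSec12

section PartSec13
open scoped MatrixGroups Pointwise commutatorElement
namespace WDC

section Dich

/-- There is a strongly irreducible subquotient of dimension `n`. -/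
def Sub {K : Type} [Field K] {V : Type} [AddCommGroup V] [Module K V] {G : Type} [Group G]
    (Φ : G →* Module.End K V) (n : ℕ) : Prop :=
  ∃ (G' : Type) (_ : Group G') (ι : G' →* G) (V' : Type) (_ : AddCommGroup V') (_ : Module K V')
    (_ : FiniteDimensional K V') (ρ : G' →* Module.End K V') (A : V →ₗ[K] V') (B : V' →ₗ[K] V),
    (∀ g, A ∘ₗ Φ (ι g) ∘ₗ B = ρ g) ∧ SI ρ ∧ Module.finrank K V' = n

/-- Virtually triangular. -/
def VT {K : Type} [Field K] {V : Type} [AddCommGroup V] [Module K V] {G : Type} [Group G]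
    (ρ : G →* Module.End K V) : Prop :=
  ∃ H : Subgroup G, H.FiniteIndex ∧ ∃ (m : ℕ) (b : Module.Basis (Fin m) K V),
    ∀ h ∈ H, ∀ i j, j < i → b.repr (ρ h (b j)) i = 0

variable {K : Type} [Field K] {V : Type} [AddCommGroup V] [Module K V] {G : Type} [Group G]

lemma Sub.trans {V' : Type} [AddCommGroup V'] [Module K V'] {G' : Type} [Group G']
    {Φ : G →* Module.End K V} {ρ : G' →* Module.End K V'} (ι : G' →* G) (A : V →ₗ[K] V') (B : V' →ₗ[K] V)
    (h : ∀ g, A ∘ₗ Φ (ι g) ∘ₗ B = ρ g) {n : ℕ} (hs : Sub ρ n) : Sub Φ n := by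
  obtain ⟨G₂, i1, ι₂, V₂, i2, i3, i4, ρ₂, A₂, B₂, h1, h2, h3⟩ := hs
  refine ⟨G₂, i1, ι.comp ι₂, V₂, i2, i3, i4, ρ₂, A₂ ∘ₗ A, B ∘ₗ B₂, fun g => ?_, h2, h3⟩
  rw [← h1 g, ← h (ι₂ g)]
  rfl

/-- Subrepresentation. -/
def subRep (ρ : G →* Module.End K V) (W : Submodule K V) (hW : ∀ g, ∀ x ∈ W, ρ g x ∈ W) :
    G →* Module.End K W where
  toFun g := (ρ g).restrict (hW g)
  map_one' := by
    ext x
    simp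
  map_mul' a b := by
    ext x
    simp

/-- Quotient representation. -/
def quoRep (ρ : G →* Module.End K V) (W : Submodule K V) (hW : ∀ g, ∀ x ∈ W, ρ g x ∈ W) :
    G →* Module.End K (V ⧸ W) where
  toFun g := W.mapQ W (ρ g) (hW g)
  map_one' := by
    ext x
    simp
  map_mul' a b := by
    ext x
    simp

lemma Sub.of_sub {ρ : G →* Module.End K V} {W : Submodule K V} {hW : ∀ g, ∀ x ∈ W, ρ g x ∈ W} {n : ℕ}
    (h : Sub (subRep ρ W hW) n) : Sub ρ n := by
  obtain ⟨p, hp⟩ := W.subtype.exists_leftInverse_of_injective W.ker_subtype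
  refine Sub.trans (MonoidHom.id G) p W.subtype (fun g => ?_) h
  ext x
  have := LinearMap.congr_fun hp (subRep ρ W hW g x)
  exact congrArg Subtype.val this

lemma Sub.of_quo {ρ : G →* Module.End K V} {W : Submodule K V} {hW : ∀ g, ∀ x ∈ W, ρ g x ∈ W} {n : ℕ}
    (h : Sub (quoRep ρ W hW) n) : Sub ρ n := by
  obtain ⟨p, hp⟩ := W.mkQ.exists_rightInverse_of_surjective W.range_mkQ
  refine Sub.trans (MonoidHom.id G) W.mkQ p (fun g => ?_) h
  refine LinearMap.ext fun x => ?_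
  have h1 : x = W.mkQ (p x) := (LinearMap.congr_fun hp x).symm
  conv_rhs => rw [h1]
  rfl

lemma VT.of_sub_quo {ρ : G →* Module.End K V} {W : Submodule K V} {hW : ∀ g, ∀ x ∈ W, ρ g x ∈ W}
    (h1 : VT (subRep ρ W hW)) (h2 : VT (quoRep ρ W hW)) : VT ρ := by
  obtain ⟨H1, i1, m1, b1, h1⟩ := h1
  obtain ⟨H2, i2, m2, b2, h2⟩ := h2
  refine ⟨H1 ⊓ H2, inferInstance, m1 + m2, (b1.sumQuot b2).reindex finSumFinEquiv, ?_⟩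
  rintro h ⟨hh1, hh2⟩ i j
  obtain ⟨i, rfl⟩ := finSumFinEquiv.surjective i
  obtain ⟨j, rfl⟩ := finSumFinEquiv.surjective j
  rw [Module.Basis.reindex_apply, Equiv.symm_apply_apply, Module.Basis.repr_reindex_apply,
    Equiv.symm_apply_apply]
  intro hlt
  rcases j with j | j
  · rw [Module.Basis.sumQuot_inl]
    have hmem : ρ h (b1 j : V) ∈ W := hW h _ (b1 j).2
    rcases i with i | i
    · rw [Module.Basis.sumQuot_repr_inl_of_mem _ _ _ hmem]
      exact h1 h hh1 i j (by
        rw [Fin.lt_def] at hlt ⊢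
        simpa using hlt)
    · exact Module.Basis.sumQuot_repr_inr_of_mem _ _ _ hmem _
  · rcases i with i | i
    · exfalso
      rw [Fin.lt_def] at hlt
      simp at hlt
      omega
    · rw [Module.Basis.sumQuot_repr_inr]
      have := h2 h hh2 i j (by
        rw [Fin.lt_def] at hlt ⊢
        simpa using hlt)
      rw [← Module.Basis.sumQuot_inr b1 b2 j] at this
      exact this

lemma VT.of_res {ρ : G →* Module.End K V} {H : Subgroup G} (hH : H.FiniteIndex) (h : VT (res ρ H)) : VT ρ := by
  obtain ⟨H1, i1, m1, b1, h1⟩ := h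
  refine ⟨H1.map H.subtype, fi_map H hH H1 i1, m1, b1, ?_⟩
  rintro _ ⟨g, hg, rfl⟩ i j hij
  exact h1 g hg i j hij

lemma Sub.of_res {ρ : G →* Module.End K V} {H : Subgroup G} {n : ℕ} (h : Sub (res ρ H) n) : Sub ρ n :=
  Sub.trans H.subtype LinearMap.id LinearMap.id (fun _ => rfl) h

lemma VT.of_le_one [FiniteDimensional K V] (ρ : G →* Module.End K V) (h : Module.finrank K V ≤ 1) : VT ρ := by
  refine ⟨⊤, inferInstance, _, Module.finBasis K V, ?_⟩
  intro g _ i j hij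
  exfalso
  have := i.2
  have := j.2
  rw [Fin.lt_def] at hij
  omega

lemma dich (n : ℕ) : ∀ (V : Type) [AddCommGroup V] [Module K V] [FiniteDimensional K V] (G : Type) [Group G]
    (ρ : G →* Module.End K V), Module.finrank K V = n →
    VT ρ ∨ (SI ρ ∧ 2 ≤ n) ∨ ∃ m, 2 ≤ m ∧ m < n ∧ Sub ρ m := by
  induction n using Nat.strong_induction_on with
  | _ n ih =>
  intro V _ _ _ G _ ρ hn
  rcases Nat.lt_or_ge n 2 with h2 | h2
  · exact Or.inl (VT.of_le_one ρ (by omega))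
  by_cases hS : SI ρ
  · exact Or.inr (Or.inl ⟨hS, h2⟩)
  unfold SI at hS
  push Not at hS
  obtain ⟨H, hH, W, hW, hbot, htop⟩ := hS
  have hW' : ∀ g : H, ∀ x ∈ W, res ρ H g x ∈ W := fun g x hx => hW g g.2 x hx
  have hr1 : Module.finrank K W < n := hn ▸ Submodule.finrank_lt htop
  have hr2 : Module.finrank K (V ⧸ W) < n := by
    have h1 := Submodule.finrank_quotient_add_finrank W
    have h3 : Module.finrank K W ≠ 0 := fun h => hbot (Submodule.finrank_eq_zero.1 h)
    omega
  rcases ih _ hr1 W H (subRep _ W hW') rfl with h1 | ⟨h1, h1'⟩ | ⟨m, hm1, hm2, hm3⟩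
  · rcases ih _ hr2 (V ⧸ W) H (quoRep _ W hW') rfl with h3 | ⟨h3, h3'⟩ | ⟨m, hm1, hm2, hm3⟩
    · exact Or.inl (VT.of_res hH (h1.of_sub_quo h3))
    · refine Or.inr (Or.inr ⟨_, h3', hr2, Sub.of_res (Sub.of_quo (hW := hW') ?_)⟩)
      exact ⟨H, inferInstance, MonoidHom.id H, _, _, _, inferInstance, _, LinearMap.id, LinearMap.id, fun _ => rfl, h3, rfl⟩
    · exact Or.inr (Or.inr ⟨m, hm1, hm2.trans hr2, Sub.of_res (Sub.of_quo (hW := hW') hm3)⟩)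
  · refine Or.inr (Or.inr ⟨_, h1', hr1, Sub.of_res (Sub.of_sub (hW := hW') ?_)⟩)
    exact ⟨H, inferInstance, MonoidHom.id H, _, _, _, inferInstance, _, LinearMap.id, LinearMap.id, fun _ => rfl, h1, rfl⟩
  · exact Or.inr (Or.inr ⟨m, hm1, hm2.trans hr1, Sub.of_res (Sub.of_sub (hW := hW') hm3)⟩)

/-- Minimal strongly irreducible. -/
def MSI (ρ : G →* Module.End K V) : Prop :=
  SI ρ ∧ 2 ≤ Module.finrank K V ∧ ∀ m, 2 ≤ m → m < Module.finrank K V → ¬ Sub ρ m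

lemma e2 [FiniteDimensional K V] [IsAlgClosed K] {ρ : G →* Module.End K V} (h : MSI ρ) (N : Subgroup G)
    [N.Normal] (hN : ∃ g ∈ N, ¬ Sc (ρ g)) : MSI (res ρ N) := by
  obtain ⟨hS, h2, hmin⟩ := h
  have : Nontrivial V := Module.nontrivial_of_finrank_pos (R := K) (by omega)
  refine ⟨?_, h2, fun m hm1 hm2 hm3 => hmin m hm1 hm2 (Sub.of_res hm3)⟩
  rcases dich _ V N (res ρ N) rfl with h1 | h1 | ⟨m, hm1, hm2, hm3⟩
  · exfalso
    obtain ⟨H, hH, m, b, hb⟩ := h1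
    have hm : m = Module.finrank K V := by
      have := Module.finrank_eq_card_basis b
      simpa using this.symm
    have hm0 : 0 < m := by omega
    have hz : ∀ g (hg : g ∈ N), (⟨g, hg⟩ : N) ∈ H → ∃ c : K, ρ g (b ⟨0, hm0⟩) = c • b ⟨0, hm0⟩ := by
      intro g hg hgH
      refine ⟨b.repr (ρ g (b ⟨0, hm0⟩)) ⟨0, hm0⟩, ?_⟩
      conv_lhs => rw [← b.sum_repr (ρ g (b ⟨0, hm0⟩))]
      rw [Finset.sum_eq_single ⟨0, hm0⟩]
      · intro i _ hi
        have := hb ⟨g, hg⟩ hgH i ⟨0, hm0⟩ (by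
          rw [Fin.lt_def]
          have : (i : ℕ) ≠ 0 := fun h => hi (Fin.ext h)
          simp only
          omega)
        rw [res_apply] at this
        simp only at this
        rw [this, zero_smul]
      · simp
    have hz' : ∀ g : G, ∃ c : K, g ∈ H.map N.subtype → ρ g (b ⟨0, hm0⟩) = c • b ⟨0, hm0⟩ := by
      intro g
      by_cases hg : g ∈ H.map N.subtype
      · obtain ⟨⟨g', h1⟩, h2, rfl⟩ := hg
        obtain ⟨c, hc⟩ := hz g' h1 h2
        exact ⟨c, fun _ => hc⟩
      · exact ⟨0, fun h => absurd h hg⟩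
    choose χ hχ using hz'
    obtain ⟨g, hg, hgs⟩ := hN
    refine hgs (e1 hS N (H.map N.subtype) ?_ χ ?_ g hg)
    · rw [Subgroup.relIndex, Subgroup.subgroupOf, Subgroup.comap_map_eq_self_of_injective N.subtype_injective]
      exact hH.index_ne_zero
    · intro hbot
      have : b ⟨0, hm0⟩ ∈ jes ρ (H.map N.subtype) χ := fun g hg => hχ g hg
      rw [hbot, Submodule.mem_bot] at this
      exact b.ne_zero _ this
  · exact h1.1
  · exact absurd (Sub.of_res hm3) (hmin m hm1 hm2)

end Dich
end WDC
end PartSec13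

section PartSec14
open scoped MatrixGroups Pointwise commutatorElement
namespace WDC

section Alg
variable {K : Type} [Field K] {V : Type} [AddCommGroup V] [Module K V] {G : Type} [Group G]
  [FiniteDimensional K V] [IsAlgClosed K]

lemma burnside [Nontrivial V] (ρ : G →* Module.End K V)
    (hI : ∀ W : Submodule K V, (∀ g, ∀ x ∈ W, ρ g x ∈ W) → W = ⊥ ∨ W = ⊤) :
    Submodule.span K (Set.range ρ) = ⊤ := by
  let R := env ρ (⊤ : Subgroup G)
  have hsimple : IsSimpleModule R V := by
    rw [isSimpleModule_iff]
    refine ⟨fun S => ?_⟩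
    have h1 := hI (S.restrictScalars K) (fun g x hx =>
      S.smul_mem (⟨ρ g, mem_env ρ ⊤ (Subgroup.mem_top g)⟩ : R) hx)
    rcases h1 with h1 | h1
    · left
      rw [Submodule.restrictScalars_eq_bot_iff] at h1
      exact h1
    · right
      rw [Submodule.restrictScalars_eq_top_iff] at h1
      exact h1
  have hend : ∀ f : Module.End R V, ∃ c : K, ∀ x, f x = c • x := by
    intro f
    obtain ⟨c, hc⟩ := schur ρ hI (f.restrictScalars K) (fun g => by
      refine LinearMap.ext fun x => ?_
      have := f.map_smul (⟨ρ g, mem_env ρ ⊤ (Subgroup.mem_top g)⟩ : R) x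
      exact this.symm)
    refine ⟨c, fun x => ?_⟩
    have := LinearMap.congr_fun hc x
    simpa using this
  rw [eq_top_iff]
  intro T _
  let F : Module.End (Module.End R V) V :=
    { toFun := T
      map_add' := map_add T
      map_smul' := by
        intro f x
        obtain ⟨c, hc⟩ := hend f
        change T (f x) = f (T x)
        rw [hc, hc, map_smul] }
  classical
  let b := Module.finBasis K V
  obtain ⟨r, hr⟩ := jacobson_density F (Finset.univ.image b)
  have hT : T = r.1 := by
    refine b.ext fun i => ?_
    exact hr (b i) (Finset.mem_image_of_mem _ (Finset.mem_univ _))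
  have h2 := r.2
  rw [mem_env_iff] at h2
  rw [hT]
  simpa using h2

lemma SI.irr {ρ : G →* Module.End K V} (h : SI ρ) (W : Submodule K V) (hW : ∀ g, ∀ x ∈ W, ρ g x ∈ W) :
    W = ⊥ ∨ W = ⊤ :=
  h ⊤ inferInstance W (fun g _ => hW g)

lemma MSI.nontrivial {ρ : G →* Module.End K V} (h : MSI ρ) : Nontrivial V :=
  Module.nontrivial_of_finrank_pos (R := K) (by have := h.2.1; omega)

lemma not_triv (h2 : 2 ≤ Module.finrank K V) (h : ∀ W : Submodule K V, W = ⊥ ∨ W = ⊤) : False := by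
  have : Nontrivial V := Module.nontrivial_of_finrank_pos (R := K) (by omega)
  obtain ⟨v, hv⟩ := exists_ne (0 : V)
  rcases h (K ∙ v) with h1 | h1
  · exact hv (Submodule.span_singleton_eq_bot.1 h1)
  · have := finrank_span_singleton (K := K) hv
    rw [h1, finrank_top] at this
    omega

lemma MSI.exists_not_sc {ρ : G →* Module.End K V} (h : MSI ρ) : ∃ g, ¬ Sc (ρ g) := by
  by_contra hcon
  push Not at hcon
  refine not_triv h.2.1 fun W => h.1.irr W fun g x hx => ?_
  obtain ⟨c, hc⟩ := hcon g
  rw [hc]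
  exact W.smul_mem c hx

lemma det_rho_ne (ρ : G →* Module.End K V) (g : G) : (ρ g).det ≠ 0 := by
  intro h0
  have := congrArg LinearMap.det (rho_mul_inv ρ g)
  rw [map_mul, h0, zero_mul, map_one] at this
  exact zero_ne_one this

lemma comm_eq {ρ : G →* Module.End K V} {g a : G} {c : K} (h : ρ ⁅g, a⁆ = c • 1) :
    ρ g * ρ a = c • (ρ a * ρ g) := by
  have h1 : g * a = ⁅g, a⁆ * (a * g) := by rw [commutatorElement_def]; group
  rw [← map_mul, h1, map_mul, h, smul_mul_assoc, one_mul, map_mul]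

lemma e6 {ρ : G →* Module.End K V} (h : MSI ρ) {a b : G} (ha : ¬ Sc (ρ a)) (hb : ¬ Sc (ρ b)) :
    ∃ y, ¬ Sc (ρ ⁅a, y * b * y⁻¹⁆) := by
  have := h.nontrivial
  by_contra hcon
  push Not at hcon
  let C : Subgroup G :=
    { carrier := {z | ∃ c : K, c ≠ 0 ∧ ρ z * ρ a = c • (ρ a * ρ z)}
      one_mem' := ⟨1, one_ne_zero, by simp⟩
      mul_mem' := by
        rintro z z' ⟨c, hc0, hc⟩ ⟨c', hc0', hc'⟩
        refine ⟨c * c', mul_ne_zero hc0 hc0', ?_⟩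
        rw [map_mul, mul_assoc, hc', mul_smul_comm, ← mul_assoc, hc, smul_mul_assoc, smul_smul, mul_comm c',
          mul_assoc]
      inv_mem' := by
        rintro z ⟨c, hc0, hc⟩
        refine ⟨c⁻¹, inv_ne_zero hc0, ?_⟩
        have h1 : ρ z⁻¹ * (ρ z * ρ a) * ρ z⁻¹ = c • (ρ z⁻¹ * ρ a) := by
          rw [hc, mul_smul_comm, smul_mul_assoc, mul_assoc, mul_assoc, rho_mul_inv, mul_one]
        rw [← mul_assoc, rho_inv_mul, one_mul] at h1
        rw [h1, smul_smul, inv_mul_cancel₀ hc0, one_smul] }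
  have hle : Subgroup.normalClosure {b} ≤ C := by
    rw [Subgroup.normalClosure, Subgroup.closure_le]
    intro z hz
    rw [Group.mem_conjugatesOfSet_iff] at hz
    obtain ⟨b', hb', hconj⟩ := hz
    rw [Set.mem_singleton_iff] at hb'
    subst hb'
    obtain ⟨y, rfl⟩ := isConj_iff.1 hconj
    obtain ⟨c, hc⟩ := hcon y
    have hc0 : c ≠ 0 := by
      rintro rfl
      apply det_rho_ne ρ ⁅a, y * b' * y⁻¹⁆
      rw [hc, zero_smul]
      exact LinearMap.det_zero''
    refine ⟨c⁻¹, inv_ne_zero hc0, ?_⟩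
    rw [comm_eq hc, smul_smul, inv_mul_cancel₀ hc0, one_smul]
  have hN := e2 h (Subgroup.normalClosure {b}) ⟨b, Subgroup.subset_normalClosure rfl, hb⟩
  refine ha (e5 hN.1 (ρ a) (det_rho_ne ρ a) ?_)
  rintro ⟨z, hz⟩
  obtain ⟨c, -, hc⟩ := hle hz
  exact ⟨c, hc⟩

lemma MSI.comm {ρ : G →* Module.End K V} (h : MSI ρ) : MSI (res ρ (commutator G)) := by
  have := h.nontrivial
  refine e2 h _ ?_
  obtain ⟨a, ha⟩ := h.exists_not_sc
  by_contra hcon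
  push Not at hcon
  refine ha (e5 h.1 (ρ a) (det_rho_ne ρ a) fun g => ?_)
  obtain ⟨c, hc⟩ := hcon ⁅g, a⁆ (Subgroup.commutator_mem_commutator (Subgroup.mem_top _) (Subgroup.mem_top _))
  exact ⟨c, comm_eq hc⟩

lemma det_comm (ρ : G →* Module.End K V) (g : commutator G) : (res ρ (commutator G) g).det = 1 := by
  have h := Abelianization.commutator_subset_ker ((LinearMap.det.comp ρ).toHomUnits) g.2
  rw [MonoidHom.mem_ker] at h
  have := congrArg Units.val h
  exact this

lemma trace_form_zero (X : Module.End K V) (h : ∀ Y, LinearMap.trace K V (X * Y) = 0) : X = 0 := by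
  let b := Module.finBasis K V
  apply (LinearMap.toMatrixAlgEquiv b).injective
  rw [map_zero, Matrix.ext_iff_trace_mul_right]
  intro Y
  have h1 := h ((LinearMap.toMatrixAlgEquiv b).symm Y)
  rw [LinearMap.trace_eq_matrix_trace K b, LinearMap.toMatrix_mul] at h1
  rw [zero_mul, Matrix.trace_zero, ← h1]
  congr 2
  exact ((LinearMap.toMatrixAlgEquiv b).apply_symm_apply Y).symm

lemma trace_finite (M : ℕ) (hM : 0 < M) :
    {t : K | ∃ T : Module.End K V, T ^ M = 1 ∧ LinearMap.trace K V T = t}.Finite := by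
  classical
  let b := Module.finBasis K V
  refine ((Finset.sym (Polynomial.nthRootsFinset M (1 : K)) (Module.finrank K V)).image
    (fun m => m.1.sum)).finite_toSet.subset ?_
  rintro t ⟨T, hT, rfl⟩
  rw [Finset.mem_coe, Finset.mem_image]
  let A := LinearMap.toMatrixAlgEquiv b T
  have hA : A ^ M = 1 := by rw [← map_pow, hT, map_one]
  have hcard : A.charpoly.roots.card = Module.finrank K V := by
    have h1 := (IsAlgClosed.splits A.charpoly).natDegree_eq_card_roots
    rw [← h1, Matrix.charpoly_natDegree_eq_dim, Fintype.card_fin]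
  refine ⟨Sym.mk A.charpoly.roots hcard, ?_, ?_⟩
  · rw [Finset.mem_sym_iff]
    intro z hz
    rw [Polynomial.mem_nthRootsFinset hM]
    have hz' := (Polynomial.mem_roots'.mp ((Sym.mem_mk _ _ _).1 hz)).2
    rw [Polynomial.IsRoot.def, Matrix.eval_charpoly, ← Matrix.exists_mulVec_eq_zero_iff] at hz'
    obtain ⟨v, hv, h⟩ := hz'
    rw [Matrix.sub_mulVec, sub_eq_zero] at h
    have h2 : (Matrix.scalar _ z).mulVec v = z • v := by
      simp [Matrix.scalar_apply, Matrix.mulVec_diagonal, funext_iff]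
    rw [h2] at h
    have h3 : ∀ m : ℕ, (A ^ m).mulVec v = z ^ m • v := by
      intro m
      induction m with
      | zero => simp
      | succ m ih => rw [pow_succ, ← Matrix.mulVec_mulVec, ← h, Matrix.mulVec_smul, ih, smul_smul, pow_succ, mul_comm]
    have h4 := h3 M
    rw [hA, Matrix.one_mulVec] at h4
    have h5 : (1 - z ^ M) • v = 0 := by rw [sub_smul, one_smul, ← h4, sub_self]
    rcases smul_eq_zero.1 h5 with h6 | h6
    · exact (sub_eq_zero.1 h6).symm
    · exact absurd h6 hv
  · rw [LinearMap.trace_eq_matrix_trace K b]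
    exact (Matrix.trace_eq_sum_roots_charpoly A).symm

lemma exists_span_fun {S : Set G} (ρ : G →* Module.End K V) (h : Submodule.span K (ρ '' S) = ⊤) :
    ∃ e : Fin (Module.finrank K V) × Fin (Module.finrank K V) → G, (∀ i, e i ∈ S) ∧
      Submodule.span K (Set.range (fun i => ρ (e i))) = ⊤ ∧ LinearIndependent K (fun i => ρ (e i)) := by
  obtain ⟨f, h1, h2, h3⟩ := Submodule.exists_fun_fin_finrank_span_eq K (ρ '' S)
  have hcard : Module.finrank K (Submodule.span K (ρ '' S)) =
      Module.finrank K V * Module.finrank K V := by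
    rw [h, finrank_top]
    exact Module.finrank_linearMap K K V V
  choose g hg hgf using h1
  let q := finProdFinEquiv.trans (finCongr hcard.symm)
  have hcomp : (fun i => ρ (g (q i))) = f ∘ q := by
    funext i
    exact hgf _
  refine ⟨fun i => g (q i), fun i => hg _, ?_, ?_⟩
  · rw [hcomp, q.surjective.range_comp, h2, h]
  · rw [hcomp]
    exact h3.comp q q.injective

/-- Left multiplication action. -/
@[reducible] def lmAct (ρ : G →* Module.End K V) : MulAction G (Module.End K V) where
  smul g T := ρ g * T
  one_smul T := by
    change ρ 1 * T = T
    simp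
  mul_smul g h T := by
    change ρ (g * h) * T = ρ g * (ρ h * T)
    simp [mul_assoc]

lemma e4 {ρ : G →* Module.End K V} (h : MSI ρ) (hdet : ∀ g, (ρ g).det = 1) (L : ℕ) (hL : 0 < L) :
    ∃ x, ¬ Sc (ρ (x ^ L)) := by
  have := h.nontrivial
  by_contra hcon
  push Not at hcon
  have hpow : ∀ x, ρ x ^ (L * Module.finrank K V) = 1 := by
    intro x
    obtain ⟨c, hc⟩ := hcon x
    have h1 := hdet (x ^ L)
    rw [hc, LinearMap.det_smul, map_one, mul_one] at h1
    rw [pow_mul, ← map_pow, hc, smul_pow, one_pow, h1, one_smul]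
  have hspan := burnside ρ h.1.irr
  rw [← Set.image_univ] at hspan
  obtain ⟨e, -, he, -⟩ := exists_span_fun ρ hspan
  have hfinT := trace_finite (K := K) (V := V) (L * Module.finrank K V)
    (Nat.mul_pos hL Module.finrank_pos)
  let tf : Module.End K V → (Fin (Module.finrank K V) × Fin (Module.finrank K V) → K) :=
    fun T i => LinearMap.trace K V (T * ρ (e i))
  have htinj : Function.Injective tf := by
    intro T T' hTT
    rw [← sub_eq_zero]
    apply trace_form_zero
    intro Y
    have hY : Y ∈ Submodule.span K (Set.range (fun i => ρ (e i))) := he ▸ Submodule.mem_top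
    induction hY using Submodule.span_induction with
    | mem Y hY =>
      obtain ⟨i, rfl⟩ := hY
      have := congrFun hTT i
      simp only [tf] at this
      rw [sub_mul, map_sub, this, sub_self]
    | zero => simp
    | add Y Z _ _ h1 h2 => rw [mul_add, map_add, h1, h2, add_zero]
    | smul c Y _ h1 => rw [mul_smul_comm, map_smul, h1, smul_zero]
  have hfin : (Set.range ρ).Finite := by
    refine Set.Finite.of_finite_image (f := tf) ?_ htinj.injOn
    refine (Set.Finite.pi' (t := fun _ => {t : K | ∃ T : Module.End K V,
      T ^ (L * Module.finrank K V) = 1 ∧ LinearMap.trace K V T = t}) (fun _ => hfinT)).subset ?_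
    rintro _ ⟨_, ⟨g, rfl⟩, rfl⟩ i
    exact ⟨ρ g * ρ (e i), by rw [← map_mul]; exact hpow _, rfl⟩
  let _ := lmAct ρ
  have hst := finiteIndex_stab (G := G) (x := (1 : Module.End K V)) hfin (fun g => by
    change ρ g * 1 ∈ _
    rw [mul_one]
    exact ⟨g, rfl⟩)
  refine not_triv h.2.1 fun W => h.1 _ hst W fun g hg x hx => ?_
  have h1 : ρ g * 1 = 1 := hg
  rw [mul_one] at h1
  rw [h1]
  exact hx

lemma exists_Uw {ρ : G →* Module.End K V} (h : MSI ρ) (x : G) (J : ℕ)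
    (hx : ¬ Sc (ρ (x ^ J.factorial))) : ∃ y : ℕ → G, ∀ j ≤ J, ¬ Sc (ρ (Uw x y j)) := by
  have hxp : ∀ j, 1 ≤ j → j ≤ J → ¬ Sc (ρ (x ^ j)) := by
    rintro j hj1 hj2 ⟨c, hc⟩
    apply hx
    obtain ⟨m, hm⟩ := Nat.dvd_factorial hj1 hj2
    refine ⟨c ^ m, ?_⟩
    rw [hm, pow_mul, map_pow, hc, smul_pow, one_pow]
  have hx1 : ¬ Sc (ρ x) := by
    rintro ⟨c, hc⟩
    apply hx
    exact ⟨c ^ J.factorial, by rw [map_pow, hc, smul_pow, one_pow]⟩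
  have step : ∀ u : G, ∃ y : ℕ → G, ∀ j, j + 1 ≤ J → ¬ Sc (ρ u) →
      ¬ Sc (ρ ⁅u, y j * x ^ (j + 1) * (y j)⁻¹⁆) := by
    intro u
    have : ∀ j, ∃ y, j + 1 ≤ J → ¬ Sc (ρ u) → ¬ Sc (ρ ⁅u, y * x ^ (j + 1) * y⁻¹⁆) := by
      intro j
      by_cases hj : j + 1 ≤ J ∧ ¬ Sc (ρ u)
      · obtain ⟨y, hy⟩ := e6 h hj.2 (hxp (j + 1) (by omega) hj.1)
        exact ⟨y, fun _ _ => hy⟩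
      · exact ⟨1, fun h1 h2 => absurd ⟨h1, h2⟩ hj⟩
    choose y hy using this
    exact ⟨y, hy⟩
  choose Y hY using step
  have step2 : ∀ u : G, ∃ y, ¬ Sc (ρ u) → ¬ Sc (ρ ⁅u, y * u * y⁻¹⁆) := by
    intro u
    by_cases hu : Sc (ρ u)
    · exact ⟨1, fun h => absurd hu h⟩
    · obtain ⟨y, hy⟩ := e6 h hu hu
      exact ⟨y, fun _ => hy⟩
  choose Z hZ using step2
  -- the recursive construction
  let vv : ℕ → G → G := fun j u => ⁅u, Y u j * x ^ (j + 1) * (Y u j)⁻¹⁆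
  let nx : ℕ → G → G := fun j u => ⁅vv j u, Z (vv j u) * vv j u * (Z (vv j u))⁻¹⁆
  let U : ℕ → G := fun j => Nat.rec x (fun j u => nx j u) j
  have hU1 : ∀ j, U (j + 1) = nx j (U j) := fun j => rfl
  let y : ℕ → G := fun i => if i % 2 = 0 then Y (U (i / 2)) (i / 2) else Z (vv (i / 2) (U (i / 2)))
  have hUU : ∀ j, Uw x y j = U j := by
    intro j
    induction j with
    | zero => rfl
    | succ j ih =>
      have e1 : y (2 * j) = Y (U j) j := by
        have a1 : 2 * j % 2 = 0 := by omega
        have a2 : 2 * j / 2 = j := by omega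
        simp only [y, a1, a2, if_true]
      have e2 : y (2 * j + 1) = Z (vv j (U j)) := by
        have a1 : ¬ (2 * j + 1) % 2 = 0 := by omega
        have a2 : (2 * j + 1) / 2 = j := by omega
        simp only [y, a1, a2, if_false]
      rw [Uw, ih, e1, e2]
  refine ⟨y, fun j => ?_⟩
  rw [hUU]
  induction j with
  | zero => intro _; exact hx1
  | succ j ih =>
    intro hj
    rw [hU1]
    exact hZ _ (hY _ j hj (ih (by omega)))

end Alg
end WDC
end PartSec14

section PartSec15
open scoped MatrixGroups Pointwise commutatorElement
namespace WDC

section S1a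
variable {K : Type} [Field K] {V : Type} [AddCommGroup V] [Module K V] {G : Type} [Group G]

/-- The matrix form of a representation with determinant one. -/
noncomputable def repSL {n : ℕ} (b : Module.Basis (Fin n) K V) (ρ : G →* Module.End K V)
    (hdet : ∀ g, (ρ g).det = 1) : G →* SL(n, K) where
  toFun g := ⟨LinearMap.toMatrixAlgEquiv b (ρ g), by
    have := LinearMap.det_toMatrix b (ρ g)
    rw [hdet] at this
    exact this⟩
  map_one' := by
    ext1
    simp
  map_mul' g h := by
    apply Subtype.ext
    change LinearMap.toMatrixAlgEquiv b (ρ (g * h)) = LinearMap.toMatrixAlgEquiv b (ρ g) * LinearMap.toMatrixAlgEquiv b (ρ h)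
    rw [map_mul ρ, map_mul]

lemma coe_repSL {n : ℕ} (b : Module.Basis (Fin n) K V) (ρ : G →* Module.End K V)
    (hdet : ∀ g, (ρ g).det = 1) (g : G) :
    (repSL b ρ hdet g : Matrix (Fin n) (Fin n) K) = LinearMap.toMatrixAlgEquiv b (ρ g) := rfl

lemma tr_repSL {n : ℕ} (b : Module.Basis (Fin n) K V) (ρ : G →* Module.End K V)
    (hdet : ∀ g, (ρ g).det = 1) (g : G) : tr (repSL b ρ hdet) g = LinearMap.trace K V (ρ g) := by
  rw [tr, LinearMap.trace_eq_matrix_trace K b]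
  rfl

lemma pow_closure_normal (m : ℕ) : (Subgroup.closure (Set.range (fun g : G => g ^ m))).Normal := by
  refine ⟨fun a ha g => ?_⟩
  induction ha using Subgroup.closure_induction with
  | mem x hx =>
    obtain ⟨z, rfl⟩ := hx
    refine Subgroup.subset_closure ⟨g * z * g⁻¹, ?_⟩
    simp only [conj_pow]
  | one => simpa using Subgroup.one_mem _
  | mul x y _ _ hx hy =>
    have : g * (x * y) * g⁻¹ = (g * x * g⁻¹) * (g * y * g⁻¹) := by group
    rw [this]
    exact Subgroup.mul_mem _ hx hy
  | inv x _ hx =>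
    have : g * x⁻¹ * g⁻¹ = (g * x * g⁻¹)⁻¹ := by group
    rw [this]
    exact Subgroup.inv_mem _ hx

lemma s1_alg [FiniteDimensional K V] [IsAlgClosed K] {ρ : G →* Module.End K V} (h : MSI ρ)
    (hdet : ∀ g, (ρ g).det = 1) (J : ℕ) :
    ∃ (e : Fin (Module.finrank K V) × Fin (Module.finrank K V) → G) (x : G) (y : ℕ → G)
      (i : Fin (Module.finrank K V) × Fin (Module.finrank K V)),
      (∀ i, e i ∈ Subgroup.closure (Set.range (fun g : G => g ^ (Module.finrank K V).factorial))) ∧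
      pv (repSL (Module.finBasis K V) ρ hdet) e (Uw x y J) (e i) ≠ 0 := by
  classical
  set n := Module.finrank K V with hn
  have := h.nontrivial
  let N := Subgroup.closure (Set.range (fun g : G => g ^ n.factorial))
  have hNn : N.Normal := pow_closure_normal _
  obtain ⟨x0, hx0⟩ := e4 h hdet n.factorial (Nat.factorial_pos _)
  have hN : MSI (res ρ N) := e2 h N ⟨_, Subgroup.subset_closure ⟨x0, rfl⟩, hx0⟩
  have hspan : Submodule.span K (ρ '' (N : Set G)) = ⊤ := by
    rw [← burnside (res ρ N) hN.1.irr]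
    congr 1
    ext T
    constructor
    · rintro ⟨g, hg, rfl⟩
      exact ⟨⟨g, hg⟩, rfl⟩
    · rintro ⟨g, rfl⟩
      exact ⟨g, g.2, rfl⟩
  obtain ⟨e, he, hes, hei⟩ := exists_span_fun ρ hspan
  obtain ⟨x, hx⟩ := e4 h hdet J.factorial (Nat.factorial_pos _)
  obtain ⟨y, hy⟩ := exists_Uw h x J hx
  have hq := hy J le_rfl
  have hform : ∀ X : Module.End K V, (∀ i, LinearMap.trace K V (X * ρ (e i)) = 0) → X = 0 := by
    intro X hX
    apply trace_form_zero
    intro Y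
    have hY : Y ∈ Submodule.span K (Set.range (fun i => ρ (e i))) := hes ▸ Submodule.mem_top
    induction hY using Submodule.span_induction with
    | mem Y hY =>
      obtain ⟨i, rfl⟩ := hY
      exact hX i
    | zero => simp
    | add Y Z _ _ h1 h2 => rw [mul_add, map_add, h1, h2, add_zero]
    | smul c Y _ h1 => rw [mul_smul_comm, map_smul, h1, smul_zero]
  have hne : ρ (Uw x y J) - 1 ≠ 0 := by
    intro h0
    exact hq ⟨1, by rw [one_smul]; exact sub_eq_zero.1 h0⟩
  obtain ⟨i, hi⟩ : ∃ i, LinearMap.trace K V ((ρ (Uw x y J) - 1) * ρ (e i)) ≠ 0 := by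
    by_contra hcon
    push Not at hcon
    exact hne (hform _ hcon)
  refine ⟨e, x, y, i, he, mul_ne_zero ?_ ?_⟩
  · intro hdet0
    rw [← Matrix.exists_vecMul_eq_zero_iff] at hdet0
    obtain ⟨a, ha0, ha⟩ := hdet0
    apply ha0
    have h1 : ∑ i, a i • ρ (e i) = 0 := by
      apply hform
      intro j
      have h2 := congrFun ha j
      rw [Matrix.vecMul, dotProduct, Pi.zero_apply] at h2
      rw [← h2, Finset.sum_mul, map_sum]
      refine Finset.sum_congr rfl fun i _ => ?_
      rw [smul_mul_assoc, map_smul, gram, Matrix.of_apply, tr_repSL, map_mul ρ, smul_eq_mul]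
    funext i
    exact Fintype.linearIndependent_iff.1 hei a h1 i
  · rw [tr_repSL, tr_repSL, map_mul ρ, ← map_sub]
    have : ρ (Uw x y J) * ρ (e i) - ρ (e i) = (ρ (Uw x y J) - 1) * ρ (e i) := by rw [sub_mul, one_mul]
    rw [this]
    exact hi

lemma lift_congr {α : Type} [DecidableEq α] (f g : α → G) (w : FreeGroup α) (h : ∀ p ∈ w.toWord, f p.1 = g p.1) :
    FreeGroup.lift f w = FreeGroup.lift g w := by
  rw [← FreeGroup.mk_toWord (x := w), FreeGroup.lift_mk, FreeGroup.lift_mk]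
  congr 1
  refine List.map_congr_left fun p hp => ?_
  rw [h p hp]

lemma Uw_congr (x : G) (y y' : ℕ → G) (J : ℕ) (h : ∀ i < 2 * J, y i = y' i) : Uw x y J = Uw x y' J := by
  induction J with
  | zero => rfl
  | succ J ih =>
    rw [Uw, Uw, ih (fun i hi => h i (by omega)), h (2 * J) (by omega), h (2 * J + 1) (by omega)]

/-- Finitely many words only involve finitely many letters. -/
lemma finite_letters {ι : Type} [Finite ι] (w : ι → FreeGroup G) :
    ∃ (k : ℕ) (s : Fin k → G) (r : G → Fin k), ∀ i,
      FreeGroup.lift s (FreeGroup.map r (w i)) = FreeGroup.lift id (w i) := by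
  classical
  have hfin : (⋃ i, {g : G | ∃ p ∈ (w i).toWord, p.1 = g}).Finite := by
    refine Set.finite_iUnion fun i => ?_
    refine ((w i).toWord.map Prod.fst).toFinset.finite_toSet.subset ?_
    rintro g ⟨p, hp, rfl⟩
    simp only [List.coe_toFinset, Set.mem_ofPred_eq]
    exact List.mem_map_of_mem hp
  let T := insert 1 hfin.toFinset
  have hT1 : (1 : G) ∈ T := Finset.mem_insert_self _ _
  refine ⟨T.card, fun j => (T.equivFin.symm j : G),
    fun g => if hg : g ∈ T then T.equivFin ⟨g, hg⟩ else T.equivFin ⟨1, hT1⟩, fun i => ?_⟩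
  have hcomp : ∀ (r : G → Fin T.card) (s : Fin T.card → G) (u : FreeGroup G),
      FreeGroup.lift s (FreeGroup.map r u) = FreeGroup.lift (s ∘ r) u := by
    intro r s u
    have : (FreeGroup.lift s).comp (FreeGroup.map r) = FreeGroup.lift (s ∘ r) := by
      ext a
      simp
    exact DFunLike.congr_fun this u
  rw [hcomp]
  refine lift_congr _ _ _ fun p hp => ?_
  have hpT : p.1 ∈ T := by
    refine Finset.mem_insert_of_mem ?_
    rw [Set.Finite.mem_toFinset, Set.mem_iUnion]
    exact ⟨i, p, hp, rfl⟩
  simp [hpT]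

lemma lift_closure_pow (m : ℕ) (g : G) (hg : g ∈ Subgroup.closure (Set.range (fun g : G => g ^ m))) :
    ∃ w ∈ Subgroup.closure (Set.range (fun g : FreeGroup G => g ^ m)), FreeGroup.lift id w = g := by
  induction hg using Subgroup.closure_induction with
  | mem x hx =>
    obtain ⟨z, rfl⟩ := hx
    exact ⟨FreeGroup.of z ^ m, Subgroup.subset_closure ⟨_, rfl⟩, by simp⟩
  | one => exact ⟨1, Subgroup.one_mem _, map_one _⟩
  | mul x y _ _ hx hy =>
    obtain ⟨a, ha, rfl⟩ := hx
    obtain ⟨b, hb, rfl⟩ := hy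
    exact ⟨a * b, Subgroup.mul_mem _ ha hb, map_mul _ _ _⟩
  | inv x _ hx =>
    obtain ⟨a, ha, rfl⟩ := hx
    exact ⟨a⁻¹, Subgroup.inv_mem _ ha, map_inv _ _⟩

lemma map_closure_pow {H : Type} [Group H] (φ : G →* H) (m : ℕ) (g : G)
    (hg : g ∈ Subgroup.closure (Set.range (fun g : G => g ^ m))) :
    φ g ∈ Subgroup.closure (Set.range (fun g : H => g ^ m)) := by
  induction hg using Subgroup.closure_induction with
  | mem x hx =>
    obtain ⟨z, rfl⟩ := hx
    exact Subgroup.subset_closure ⟨φ z, (map_pow φ z m).symm⟩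
  | one => rw [map_one]; exact Subgroup.one_mem _
  | mul x y _ _ hx hy => rw [map_mul]; exact Subgroup.mul_mem _ hx hy
  | inv x _ hx => rw [map_inv]; exact Subgroup.inv_mem _ hx

lemma pv_comp {n : ℕ} {H : Type} [Group H] (φ : H →* G) (σ : G →* SL(n, K)) (e : Fin n × Fin n → H)
    (q c : H) : pv (σ.comp φ) e q c = pv σ (fun i => φ (e i)) (φ q) (φ c) := by
  simp only [pv, gram, tr, MonoidHom.comp_apply, map_mul]

/-- Combinatorial types. -/
structure Ty where
  n : ℕ
  k : ℕ
  e : Fin n × Fin n → FreeGroup (Fin k)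
  x : FreeGroup (Fin k)
  c : FreeGroup (Fin k)
  y : List (FreeGroup (Fin k))
  hn : 0 < n
  he : ∀ i, e i ∈ Subgroup.closure (Set.range (fun g : FreeGroup (Fin k) => g ^ n.factorial))

/-- The test word of a type. -/
def Ty.q (J : ℕ → ℕ) (t : Ty) : FreeGroup (Fin t.k) := Uw t.x (fun i => t.y.getD i 1) (J t.n)

theorem s1a [FiniteDimensional K V] [IsAlgClosed K] (J : ℕ → ℕ) (Φ : G →* Module.End K V) :
    VT Φ ∨ ∃ (t : Ty) (f : Fin t.k → G) (σ : FreeGroup (Fin t.k) →* SL(t.n, K))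
      (A : V →ₗ[K] (Fin t.n → K)) (B : (Fin t.n → K) →ₗ[K] V),
      (∀ w, A ∘ₗ Φ (FreeGroup.lift f w) ∘ₗ B = Matrix.toLin' (σ w : Matrix (Fin t.n) (Fin t.n) K)) ∧
      pv σ t.e (t.q J) t.c ≠ 0 := by
  classical
  rcases dich _ V G Φ rfl with h | h
  · exact Or.inl h
  right
  have hex : ∃ m, 2 ≤ m ∧ Sub Φ m := by
    rcases h with ⟨h1, h2⟩ | ⟨m, h1, -, h3⟩
    · exact ⟨_, h2, G, inferInstance, MonoidHom.id G, V, _, _, inferInstance, Φ, LinearMap.id, LinearMap.id,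
        fun _ => rfl, h1, rfl⟩
    · exact ⟨m, h1, h3⟩
  obtain ⟨h2, G', iG', ι, V', i1, i2, i3, ρ, A, B, hAB, hSI, hfr⟩ := Nat.find_spec hex
  have hmin : MSI ρ := by
    refine ⟨hSI, hfr ▸ h2, fun m hm1 hm2 hm3 => ?_⟩
    rw [hfr] at hm2
    exact Nat.find_min hex hm2 ⟨hm1, Sub.trans ι A B hAB hm3⟩
  have hc := hmin.comm
  have hdet := det_comm ρ
  set n := Module.finrank K V' with hn
  obtain ⟨e, x, y, i0, he, hpv⟩ := s1_alg hc hdet (J n)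
  choose w hw hwe using fun i => lift_closure_pow _ (e i) (he i)
  -- all the words
  let W : (Fin n × Fin n) ⊕ (Fin (2 * J n) ⊕ Unit) → FreeGroup (commutator G') :=
    Sum.elim w (Sum.elim (fun i => FreeGroup.of (y i)) (fun _ => FreeGroup.of x))
  obtain ⟨k, s, r, hsr⟩ := finite_letters W
  let b := Module.finBasis K V'
  let σ := repSL b (res ρ (commutator G')) hdet
  let t : Ty :=
    { n := n
      k := k
      e := fun i => FreeGroup.map r (w i)
      x := FreeGroup.map r (FreeGroup.of x)
      c := FreeGroup.map r (w i0)
      y := (List.range (2 * J n)).map (fun i => FreeGroup.map r (FreeGroup.of (y i)))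
      hn := by
        have := hfr ▸ h2
        omega
      he := fun i => map_closure_pow _ _ _ (hw i) }
  have hse : ∀ i, FreeGroup.lift s (FreeGroup.map r (w i)) = e i := fun i => (hsr (Sum.inl i)).trans (hwe i)
  have hsx : FreeGroup.lift s (FreeGroup.map r (FreeGroup.of x)) = x :=
    (hsr (Sum.inr (Sum.inr ()))).trans (by simp [W])
  have hsy : ∀ i, i < 2 * J n → FreeGroup.lift s (FreeGroup.map r (FreeGroup.of (y i))) = y i := fun i hi =>
    (hsr (Sum.inr (Sum.inl ⟨i, hi⟩))).trans (by simp [W])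
  have hq : FreeGroup.lift s (t.q J) = Uw x y (J n) := by
    rw [Ty.q, map_Uw]
    change Uw (FreeGroup.lift s (FreeGroup.map r (FreeGroup.of x))) _ (J n) = _
    rw [hsx]
    refine Uw_congr _ _ _ _ fun i hi => ?_
    rw [← hsy i hi]
    congr 1
    simp [t, List.getD, hi]
  refine ⟨t, fun j => ι (s j), σ.comp (FreeGroup.lift s), b.equivFun.toLinearMap ∘ₗ A,
    B ∘ₗ b.equivFun.symm.toLinearMap, ?_, ?_⟩
  · intro u
    have h1 : FreeGroup.lift (fun j => ι (s j)) u = ι (FreeGroup.lift s u : commutator G') := by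
      have : FreeGroup.lift (fun j => ι (s j)) = (ι.comp (commutator G').subtype).comp (FreeGroup.lift s) := by
        ext a
        simp
      rw [this]
      rfl
    rw [h1]
    have h2 := hAB (FreeGroup.lift s u : commutator G')
    have h3 : Matrix.toLin' ((σ.comp (FreeGroup.lift s)) u : Matrix (Fin n) (Fin n) K) =
        b.equivFun.toLinearMap ∘ₗ ρ (FreeGroup.lift s u : commutator G') ∘ₗ b.equivFun.symm.toLinearMap := by
      rw [MonoidHom.comp_apply, coe_repSL]
      refine LinearMap.ext fun v => ?_
      rw [Matrix.toLin'_apply]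
      simp only [LinearMap.comp_apply, LinearEquiv.coe_coe]
      have h4 := LinearMap.toMatrixAlgEquiv_apply' b
      have h5 := LinearMap.toMatrix_mulVec_repr b b (ρ (FreeGroup.lift s u : commutator G')) (b.equivFun.symm v)
      rw [← Module.Basis.equivFun_apply, ← Module.Basis.equivFun_apply, LinearEquiv.apply_symm_apply] at h5
      exact h5
    rw [← h2] at h3
    exact h3.symm
  · rw [pv_comp, hq]
    have h6 : (fun i => FreeGroup.lift s (t.e i)) = e := funext hse
    have h7 : FreeGroup.lift s t.c = e i0 := hse i0
    rw [h6, h7]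
    exact hpv

end S1a
end WDC
end PartSec15

section PartSec16
open scoped MatrixGroups Pointwise commutatorElement
namespace WDC

section Triang
variable {m : ℕ} {G : Type} [Group G]

/-- Matrices supported on the k-th superdiagonal and above. -/
def UT (k : ℕ) (M : Matrix (Fin m) (Fin m) ℂ) : Prop := ∀ i j : Fin m, (j : ℕ) < i + k → M i j = 0

lemma UT.mul {k l : ℕ} {M N : Matrix (Fin m) (Fin m) ℂ} (hM : UT k M) (hN : UT l N) : UT (k + l) (M * N) := by
  intro i j hij
  rw [Matrix.mul_apply]
  refine Finset.sum_eq_zero fun p _ => ?_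
  by_cases h : (p : ℕ) < i + k
  · rw [hM i p h, zero_mul]
  · rw [hN p j (by omega), mul_zero]

lemma UT.add {k : ℕ} {M N : Matrix (Fin m) (Fin m) ℂ} (hM : UT k M) (hN : UT k N) : UT k (M + N) := by
  intro i j hij
  rw [Matrix.add_apply, hM i j hij, hN i j hij, add_zero]

lemma UT.neg {k : ℕ} {M : Matrix (Fin m) (Fin m) ℂ} (hM : UT k M) : UT k (-M) := by
  intro i j hij
  rw [Matrix.neg_apply, hM i j hij, neg_zero]

lemma UT.mono {k l : ℕ} (h : k ≤ l) {M : Matrix (Fin m) (Fin m) ℂ} (hM : UT l M) : UT k M :=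
  fun i j hij => hM i j (by omega)

lemma UT.one : UT 0 (1 : Matrix (Fin m) (Fin m) ℂ) := by
  intro i j hij
  exact Matrix.one_apply_ne (by rintro rfl; omega)

lemma UT.comm {M N : Matrix (Fin m) (Fin m) ℂ} (hM : UT 0 M) (hN : UT 0 N) : UT 1 (M * N - N * M) := by
  intro i j hij
  rw [Matrix.sub_apply, Matrix.mul_apply, Matrix.mul_apply, ← Finset.sum_sub_distrib]
  refine Finset.sum_eq_zero fun p _ => ?_
  rcases lt_trichotomy (p : ℕ) i with h | h | h
  · rw [hM i p (by omega), hN i p (by omega)]; ring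
  · obtain rfl := Fin.ext h
    rcases eq_or_ne p j with rfl | h2
    · ring
    · have : (j : ℕ) ≠ p := fun h => h2 (Fin.ext h.symm)
      rw [hM p j (by omega), hN p j (by omega)]; ring
  · rw [hM p j (by omega), hN p j (by omega)]; ring

lemma ut_solvable (θ : G →* Matrix (Fin m) (Fin m) ℂ) (hinj : ∀ g, θ g = 1 → g = 1)
    (hU : ∀ g, UT 0 (θ g)) : IsSolvable G := by
  have hsub : ∀ k (S : Set G), (∀ g ∈ S, UT k (θ g - 1)) → ∀ g ∈ Subgroup.closure S, UT k (θ g - 1) := by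
    intro k S hS g hg
    induction hg using Subgroup.closure_induction with
    | mem x hx => exact hS x hx
    | one =>
      rw [map_one, sub_self]
      intro i j _
      rfl
    | mul x y _ _ hx hy =>
      have : θ (x * y) - 1 = (θ x - 1) * θ y + (θ y - 1) := by rw [map_mul]; noncomm_ring
      rw [this]
      exact (hx.mul (hU y)).add hy
    | inv x _ hx =>
      have h1 : θ x⁻¹ * θ x = 1 := by rw [← map_mul, inv_mul_cancel, map_one]
      have : θ x⁻¹ - 1 = -(θ x⁻¹ * (θ x - 1)) := by rw [mul_sub, h1]; noncomm_ring
      rw [this]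
      have := ((hU x⁻¹).mul hx).neg
      rwa [zero_add] at this
  have hkey : ∀ k (g h : G), UT k (θ g * θ h - θ h * θ g) → UT k (θ ⁅g, h⁆ - 1) := by
    intro k g h hgh
    have h1 : θ (h * g) * θ (g⁻¹ * h⁻¹) = 1 := by
      rw [← map_mul]
      have : h * g * (g⁻¹ * h⁻¹) = 1 := by group
      rw [this, map_one]
    have : θ ⁅g, h⁆ - 1 = (θ g * θ h - θ h * θ g) * θ (g⁻¹ * h⁻¹) := by
      have h2 : θ ⁅g, h⁆ = θ (g * h) * θ (g⁻¹ * h⁻¹) := by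
        rw [← map_mul, commutatorElement_def, mul_assoc (g * h)]
      rw [h2, sub_mul, ← map_mul, ← map_mul θ h g, h1, map_mul, map_mul θ g h]
    rw [this]
    exact hgh.mul (hU _)
  have hder : ∀ k, ∀ g ∈ derivedSeries G (k + 1), UT (k + 1) (θ g - 1) := by
    intro k
    induction k with
    | zero =>
      intro g hg
      rw [derivedSeries_succ, Subgroup.commutator_def] at hg
      refine hsub _ _ ?_ g hg
      rintro _ ⟨a, -, b, -, rfl⟩
      exact hkey _ _ _ ((hU a).comm (hU b))
    | succ k ih =>
      intro g hg
      rw [derivedSeries_succ, Subgroup.commutator_def] at hg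
      refine hsub _ _ ?_ g hg
      rintro _ ⟨a, ha, b, hb, rfl⟩
      refine hkey _ _ _ ?_
      have : θ a * θ b - θ b * θ a = (θ a - 1) * (θ b - 1) + -((θ b - 1) * (θ a - 1)) := by noncomm_ring
      rw [this]
      exact (((ih a ha).mul (ih b hb)).add ((ih b hb).mul (ih a ha)).neg).mono (by omega)
  refine ⟨m + 1, ?_⟩
  rw [eq_bot_iff]
  intro g hg
  rw [Subgroup.mem_bot]
  apply hinj
  rw [← sub_eq_zero]
  ext i j
  exact hder m g hg i j (by omega)

lemma UT.inv {M N : Matrix (Fin m) (Fin m) ℂ} (hM : UT 0 M) (h : M * N = 1) : UT 0 N := by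
  have h1 : M.BlockTriangular id := fun i j hij => hM i j (by simpa using hij)
  have h2 : IsUnit M := IsUnit.of_mul_eq_one _ h
  have h3 : M⁻¹ = N := Matrix.inv_eq_right_inv h
  have : Invertible M := h2.invertible
  have h4 := Matrix.blockTriangular_inv_of_blockTriangular h1
  rw [h3] at h4
  exact fun i j hij => h4 (by simpa using hij)

/-- A group permuting finitely many flags is virtually solvable. -/
lemma vs_of_flags {d : ℕ} {ι : Type} [Finite ι] (q0 : ι) (B : ι → Matrix (Fin d) (Fin m) ℂ)
    (B' : ι → Matrix (Fin m) (Fin d) ℂ) (h1 : ∀ q, B q * B' q = 1) (h2 : ∀ q, B' q * B q = 1)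
    (F : Set (GL (Fin d) ℂ)) (hF : ∀ f ∈ F ∪ F⁻¹, ∀ q, ∃ q', UT 0 (B' q' * (f : Matrix (Fin d) (Fin d) ℂ) * B q)) :
    ∃ H : Subgroup ↥(Subgroup.closure F), H.FiniteIndex ∧ IsSolvable ↥H := by
  classical
  have hmul : ∀ (g h : GL (Fin d) ℂ) (q q' q'' : ι), B' q'' * (g * h : GL (Fin d) ℂ).1 * B q =
      (B' q'' * g.1 * B q') * (B' q' * h.1 * B q) := by
    intro g h q q' q''
    calc B' q'' * (g * h : GL (Fin d) ℂ).1 * B q = B' q'' * (g.1 * 1 * h.1) * B q := by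
          rw [mul_one]; rfl
      _ = _ := by rw [← h1 q']; simp only [Matrix.mul_assoc]
  have hall : ∀ g ∈ Subgroup.closure F, (∀ q, ∃ q', UT 0 (B' q' * (g : Matrix (Fin d) (Fin d) ℂ) * B q)) ∧
      (∀ q, ∃ q', UT 0 (B' q' * (g⁻¹ : GL (Fin d) ℂ).1 * B q)) := by
    intro g hg
    induction hg using Subgroup.closure_induction with
    | mem x hx => exact ⟨hF x (Or.inl hx), hF x⁻¹ (Or.inr (by simpa using hx))⟩
    | one =>
      have : ∀ q, ∃ q', UT 0 (B' q' * ((1 : GL (Fin d) ℂ) : Matrix (Fin d) (Fin d) ℂ) * B q) := fun q =>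
        ⟨q, by rw [Units.val_one, Matrix.mul_one, h2]; exact UT.one⟩
      exact ⟨this, by rw [inv_one]; exact this⟩
    | mul x y _ _ hx hy =>
      constructor
      · intro q
        obtain ⟨q', h'⟩ := hy.1 q
        obtain ⟨q'', h''⟩ := hx.1 q'
        exact ⟨q'', by rw [hmul x y q q' q'']; exact h''.mul h'⟩
      · intro q
        obtain ⟨q', h'⟩ := hx.2 q
        obtain ⟨q'', h''⟩ := hy.2 q'
        exact ⟨q'', by rw [mul_inv_rev, hmul _ _ q q' q'']; exact h''.mul h'⟩
    | inv x _ hx => exact ⟨hx.2, by rw [inv_inv]; exact hx.1⟩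
  let θ : Subgroup.closure F →* Matrix (Fin m) (Fin m) ℂ :=
    { toFun := fun g => B' q0 * (g : GL (Fin d) ℂ).1 * B q0
      map_one' := by simp [h2]
      map_mul' := fun g h => hmul g h q0 q0 q0 }
  have hθi : ∀ g, θ g * θ g⁻¹ = 1 := fun g => by rw [← map_mul, mul_inv_cancel, map_one]
  let S : Subgroup (Subgroup.closure F) :=
    { carrier := {g | UT 0 (θ g)}
      one_mem' := by
        change UT 0 (θ 1)
        rw [map_one]; exact UT.one
      mul_mem' := fun {a b} ha hb => by
        change UT 0 (θ (a * b))
        rw [map_mul]; exact UT.mul ha hb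
      inv_mem' := fun {a} ha => UT.inv ha (hθi a) }
  refine ⟨S, ?_, ?_⟩
  · choose φ hφ using fun g : Subgroup.closure F => (hall g g.2).1 q0
    have hinj : Function.Injective (fun c : Subgroup.closure F ⧸ S => φ c.out) := by
      intro c c' hcc
      have hcc' : φ c.out = φ c'.out := hcc
      rw [← QuotientGroup.out_eq' c, ← QuotientGroup.out_eq' c']
      rw [QuotientGroup.eq]
      change UT 0 (θ ((c.out)⁻¹ * c'.out))
      have e1 : θ ((c.out)⁻¹ * c'.out) = (B' q0 * ((c.out)⁻¹ : Subgroup.closure F).1.1 * B (φ c.out)) *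
          (B' (φ c.out) * (c'.out : Subgroup.closure F).1.1 * B q0) := hmul _ _ _ _ _
      rw [e1]
      have e2 : (B' (φ c.out) * (c.out : Subgroup.closure F).1.1 * B q0) *
        (B' q0 * ((c.out)⁻¹ : Subgroup.closure F).1.1 * B (φ c.out)) = 1 := by
        rw [← hmul]
        have : ((c.out : Subgroup.closure F).1 * ((c.out)⁻¹ : Subgroup.closure F).1) = 1 := by simp
        rw [this, Units.val_one, Matrix.mul_one, h2]
      refine UT.mul (k := 0) (l := 0) (UT.inv (hφ _) e2) ?_
      rw [hcc']
      exact hφ _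
    have := Finite.of_injective _ hinj
    exact Subgroup.finiteIndex_of_finite_quotient
  · refine ut_solvable (θ.comp S.subtype) ?_ ?_
    · intro g hg
      have hg' : B' q0 * (g : Subgroup.closure F).1.1 * B q0 = 1 := hg
      have : (g : Subgroup.closure F).1.1 = 1 := by
        calc (g : Subgroup.closure F).1.1 = (B q0 * B' q0) * (g : Subgroup.closure F).1.1 * (B q0 * B' q0) := by
              rw [h1, Matrix.one_mul, Matrix.mul_one]
          _ = B q0 * (B' q0 * (g : Subgroup.closure F).1.1 * B q0) * B' q0 := by simp only [Matrix.mul_assoc]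
          _ = 1 := by rw [hg', Matrix.mul_one, h1]
      exact Subtype.ext (Subtype.ext (Units.ext this))
    · intro g
      exact g.2

end Triang
end WDC
end PartSec16

section PartSec17
open scoped MatrixGroups Pointwise commutatorElement
open Filter
namespace WDC

section Transfer

/-- Evaluation of matrices of sequences. -/
def evm {a b : ℕ} (j : ℕ) (M : Matrix (Fin a) (Fin b) (ℕ → ℂ)) : Matrix (Fin a) (Fin b) ℂ :=
  M.map (Pi.evalRingHom (fun _ => ℂ) j)

lemma evm_mul {a b c : ℕ} (j : ℕ) (M : Matrix (Fin a) (Fin b) (ℕ → ℂ)) (N : Matrix (Fin b) (Fin c) (ℕ → ℂ)) :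
    evm j (M * N) = evm j M * evm j N := Matrix.map_mul

lemma evm_one {a : ℕ} (j : ℕ) : evm j (1 : Matrix (Fin a) (Fin a) (ℕ → ℂ)) = 1 := by
  exact Matrix.map_one _ (map_zero _) (map_one _)

/-- Matrices of sequences out of sequences of invertible matrices. -/
def seqM {d : ℕ} (g : ℕ → GL (Fin d) ℂ) : Matrix (Fin d) (Fin d) (ℕ → ℂ) := Matrix.of fun i k j => (g j).1 i k

lemma evm_seqM {d : ℕ} (g : ℕ → GL (Fin d) ℂ) (j : ℕ) : evm j (seqM g) = (g j).1 := rfl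

lemma evm_ext {a b : ℕ} {M N : Matrix (Fin a) (Fin b) (ℕ → ℂ)} (h : ∀ j, evm j M = evm j N) : M = N := by
  ext i k j
  exact congrFun (congrFun (h j) i) k

lemma seqM_mul {d : ℕ} (g h : ℕ → GL (Fin d) ℂ) : seqM (g * h) = seqM g * seqM h :=
  evm_ext fun j => by rw [evm_mul]; rfl

lemma seqM_one {d : ℕ} : seqM (1 : ℕ → GL (Fin d) ℂ) = 1 :=
  evm_ext fun j => by rw [evm_one]; rfl

/-- Words of length at most N. -/
def Wd {G : Type} [Group G] (F : Set G) (N : ℕ) (g : G) : Prop :=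
  ∃ l : List G, l.length ≤ N ∧ (∀ x ∈ l, x ∈ F ∪ F⁻¹) ∧ l.prod = g

lemma Wd.one {G : Type} [Group G] (F : Set G) (N : ℕ) : Wd F N 1 := ⟨[], by simp, by simp, rfl⟩

lemma Wd.mul {G : Type} [Group G] {F : Set G} {N M : ℕ} {g h : G} (hg : Wd F N g) (hh : Wd F M h) :
    Wd F (N + M) (g * h) := by
  obtain ⟨l, h1, h2, rfl⟩ := hg
  obtain ⟨l', h1', h2', rfl⟩ := hh
  refine ⟨l ++ l', by rw [List.length_append]; omega, fun x hx => ?_, List.prod_append⟩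
  rcases List.mem_append.1 hx with h | h
  · exact h2 x h
  · exact h2' x h

lemma Wd.inv {G : Type} [Group G] {F : Set G} {N : ℕ} {g : G} (hg : Wd F N g) : Wd F N g⁻¹ := by
  obtain ⟨l, h1, h2, rfl⟩ := hg
  refine ⟨(l.map (·⁻¹)).reverse, by simpa using h1, fun x hx => ?_, (List.prod_inv_reverse l).symm⟩
  rw [List.mem_reverse, List.mem_map] at hx
  obtain ⟨y, hy, rfl⟩ := hx
  rcases h2 y hy with h | h
  · exact Or.inr (by simpa using h)
  · exact Or.inl h

lemma Wd.mono {G : Type} [Group G] {F : Set G} {N M : ℕ} (hNM : N ≤ M) {g : G} (hg : Wd F N g) : Wd F M g := by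
  obtain ⟨l, h1, h2, h3⟩ := hg
  exact ⟨l, h1.trans hNM, h2, h3⟩

lemma Wd.of {G : Type} [Group G] {F : Set G} {g : G} (hg : g ∈ F ∪ F⁻¹) : Wd F 1 g :=
  ⟨[g], by simp, by simpa using hg, by simp⟩

/-- Sequences of bounded word length. -/
def Gs {d : ℕ} (F : ℕ → Set (GL (Fin d) ℂ)) : Subgroup (ℕ → GL (Fin d) ℂ) where
  carrier := {g | ∃ N, ∀ j, Wd (F j) N (g j)}
  one_mem' := ⟨0, fun j => Wd.one _ _⟩
  mul_mem' := fun {a b} ⟨N, h⟩ ⟨M, h'⟩ => ⟨N + M, fun j => (h j).mul (h' j)⟩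
  inv_mem' := fun {a} ⟨N, h⟩ => ⟨N, fun j => (h j).inv⟩

variable {K : Type} [Field K] (U : Ultrafilter ℕ) (π : (ℕ → ℂ) →+* K)

/-- The representation of the group of sequences. -/
noncomputable def PhiS {d : ℕ} (F : ℕ → Set (GL (Fin d) ℂ)) : Gs F →* Module.End K (Fin d → K) where
  toFun g := Matrix.toLin' ((seqM g.1).map π)
  map_one' := by
    rw [Subgroup.coe_one, seqM_one, Matrix.map_one _ (map_zero _) (map_one _), Matrix.toLin'_one]
    rfl
  map_mul' g h := by
    rw [Subgroup.coe_mul, seqM_mul, Matrix.map_mul, Matrix.toLin'_mul]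
    rfl

variable (h0 : ∀ x, π x = 0 ↔ ∀ᶠ j in U, x j = 0)

include h0 in
lemma map_eq_iff {a b : ℕ} (M N : Matrix (Fin a) (Fin b) (ℕ → ℂ)) :
    M.map π = N.map π ↔ ∀ᶠ j in U, evm j M = evm j N := by
  have h1 : ∀ x y : ℕ → ℂ, π x = π y ↔ ∀ᶠ j in U, x j = y j := by
    intro x y
    rw [← sub_eq_zero, ← map_sub, h0]
    simp only [Pi.sub_apply, sub_eq_zero]
  rw [← Matrix.ext_iff]
  simp only [Matrix.map_apply, h1, ← Matrix.ext_iff, evm, Pi.evalRingHom_apply]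
  simp only [eventually_all]

lemma exists_lift (hs : Function.Surjective π) {a b : ℕ} (M : Matrix (Fin a) (Fin b) K) :
    ∃ N : Matrix (Fin a) (Fin b) (ℕ → ℂ), N.map π = M := by
  choose f hf using hs
  exact ⟨M.map f, by ext i j; exact hf _⟩

include h0 in
lemma transfer_vt (hs : Function.Surjective π) {d : ℕ} (F : ℕ → Set (GL (Fin d) ℂ)) (h : VT (PhiS π F)) :
    ∀ᶠ j in U, ∃ H : Subgroup ↥(Subgroup.closure (F j)), H.FiniteIndex ∧ IsSolvable ↥H := by
  classical
  obtain ⟨H, hH, m, b, hb⟩ := h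
  let c := Pi.basisFun K (Fin d)
  obtain ⟨B, hB⟩ := exists_lift π hs (c.toMatrix b)
  obtain ⟨B', hB'⟩ := exists_lift π hs (b.toMatrix c)
  have e1 : ∀ᶠ j in U, evm j B * evm j B' = 1 := by
    have : (B * B').map π = (1 : Matrix (Fin d) (Fin d) (ℕ → ℂ)).map π := by
      rw [Matrix.map_mul, hB, hB', Module.Basis.toMatrix_mul_toMatrix_flip,
        Matrix.map_one _ (map_zero _) (map_one _)]
    rw [map_eq_iff U π h0] at this
    filter_upwards [this] with j hj
    rw [← evm_mul, hj, evm_one]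
  have e2 : ∀ᶠ j in U, evm j B' * evm j B = 1 := by
    have : (B' * B).map π = (1 : Matrix (Fin m) (Fin m) (ℕ → ℂ)).map π := by
      rw [Matrix.map_mul, hB, hB', Module.Basis.toMatrix_mul_toMatrix_flip,
        Matrix.map_one _ (map_zero _) (map_one _)]
    rw [map_eq_iff U π h0] at this
    filter_upwards [this] with j hj
    rw [← evm_mul, hj, evm_one]
  have hfin : Finite (Gs F ⧸ H) := Subgroup.finite_quotient_of_finiteIndex
  have e3 : ∀ g ∈ H, ∀ᶠ j in U, UT 0 (evm j B' * (g.1 j).1 * evm j B) := by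
    intro g hg
    have : ∀ i p : Fin m, ∀ᶠ j in U, p < i → (evm j B' * (g.1 j).1 * evm j B) i p = 0 := by
      intro i p
      by_cases hip : p < i
      · have h1 := hb g hg i p hip
        have h2 : b.toMatrix c * ((seqM g.1).map π) * c.toMatrix b = LinearMap.toMatrix b b (PhiS π F g) := by
          rw [← basis_toMatrix_mul_linearMap_toMatrix_mul_basis_toMatrix b c b c]
          congr 2
          exact (LinearMap.toMatrix'_toLin' _).symm
        have h3 : (B' * seqM g.1 * B).map π i p = 0 := by
          rw [Matrix.map_mul, Matrix.map_mul, hB, hB', h2, LinearMap.toMatrix_apply]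
          exact h1
        rw [Matrix.map_apply, h0] at h3
        filter_upwards [h3] with j hj _
        rw [← evm_seqM, ← evm_mul, ← evm_mul]
        exact hj
      · exact Eventually.of_forall fun j hh => absurd hh hip
    simp only [← eventually_all] at this
    filter_upwards [this] with j hj i p hip
    exact hj i p (by rw [Fin.lt_def]; omega)
  have e4 : ∀ᶠ j in U, ∀ f ∈ F j ∪ (F j)⁻¹, ∀ q : Gs F ⧸ H, ∃ q' : Gs F ⧸ H,
      UT 0 ((evm j B' * ((q'.out.1 j)⁻¹ : GL (Fin d) ℂ).1) * f.1 * ((q.out.1 j).1 * evm j B)) := by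
    by_contra hcon
    rw [← Ultrafilter.eventually_not] at hcon
    have hex : ∀ j, ∃ f : GL (Fin d) ℂ, Wd (F j) 1 f ∧ ((¬ ∀ f ∈ F j ∪ (F j)⁻¹, ∀ q : Gs F ⧸ H, ∃ q' : Gs F ⧸ H,
      UT 0 ((evm j B' * ((q'.out.1 j)⁻¹ : GL (Fin d) ℂ).1) * f.1 * ((q.out.1 j).1 * evm j B))) →
      ∃ q : Gs F ⧸ H, ∀ q' : Gs F ⧸ H,
      ¬ UT 0 ((evm j B' * ((q'.out.1 j)⁻¹ : GL (Fin d) ℂ).1) * f.1 * ((q.out.1 j).1 * evm j B))) := by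
      intro j
      by_cases hc : ∀ f ∈ F j ∪ (F j)⁻¹, ∀ q : Gs F ⧸ H, ∃ q' : Gs F ⧸ H,
        UT 0 ((evm j B' * ((q'.out.1 j)⁻¹ : GL (Fin d) ℂ).1) * f.1 * ((q.out.1 j).1 * evm j B))
      · exact ⟨1, Wd.one _ _, fun h => absurd hc h⟩
      · push Not at hc
        obtain ⟨f, hf, hq⟩ := hc
        exact ⟨f, Wd.of hf, fun _ => hq⟩
    choose f hf1 hf2 using hex
    let g : Gs F := ⟨f, 1, hf1⟩
    have hgood : ∀ᶠ j in U, ∀ q : Gs F ⧸ H, 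
        UT 0 ((evm j B' * (((g • q).out.1 j)⁻¹ : GL (Fin d) ℂ).1) * (f j).1 * ((q.out.1 j).1 * evm j B)) := by
      rw [eventually_all]
      intro q
      have hmem : (g • q).out⁻¹ * (g * q.out) ∈ H := by
        rw [← QuotientGroup.eq, QuotientGroup.out_eq', ← smul_eq_mul, ← MulAction.Quotient.smul_mk,
          QuotientGroup.out_eq']
      filter_upwards [e3 _ hmem] with j hj
      have : (((g • q).out⁻¹ * (g * q.out) : Gs F).1 j).1 =
        (((g • q).out.1 j)⁻¹ : GL (Fin d) ℂ).1 * ((f j).1 * (q.out.1 j).1) := rfl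
      rw [this] at hj
      simpa only [Matrix.mul_assoc] using hj
    obtain ⟨j, hj1, hj2⟩ := (hgood.and hcon).exists
    obtain ⟨q, hq⟩ := hf2 j hj2
    exact hq _ (hj1 q)
  filter_upwards [e1, e2, e4] with j h1 h2 h4
  refine vs_of_flags (ι := Gs F ⧸ H) (1 : Gs F) (fun q => (q.out.1 j).1 * evm j B)
    (fun q => evm j B' * ((q.out.1 j)⁻¹ : GL (Fin d) ℂ).1) ?_ ?_ (F j) h4
  · intro q
    have e : (q.out.1 j).1 * ((q.out.1 j)⁻¹ : GL (Fin d) ℂ).1 = 1 := by rw [← Units.val_mul, mul_inv_cancel]; rfl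
    calc _ = (q.out.1 j).1 * (evm j B * evm j B') * ((q.out.1 j)⁻¹ : GL (Fin d) ℂ).1 := by
          simp only [Matrix.mul_assoc]
      _ = 1 := by rw [h1, Matrix.mul_one, e]
  · intro q
    have e : ((q.out.1 j)⁻¹ : GL (Fin d) ℂ).1 * (q.out.1 j).1 = 1 := by rw [← Units.val_mul, inv_mul_cancel]; rfl
    calc _ = evm j B' * (((q.out.1 j)⁻¹ : GL (Fin d) ℂ).1 * (q.out.1 j).1) * evm j B := by
          simp only [Matrix.mul_assoc]
      _ = 1 := by rw [e, Matrix.mul_one, h2]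

end Transfer
end WDC
end PartSec17

section PartSec18
open scoped MatrixGroups Pointwise commutatorElement
open Filter
namespace WDC

/-- A configuration of a given type. -/
def Good (d : ℕ) (J : ℕ → ℕ) (t : Ty) (N : ℕ) (F : Set (GL (Fin d) ℂ)) : Prop :=
  ∃ f : Fin t.k → GL (Fin d) ℂ, (∀ i, Wd F N (f i)) ∧
    ∃ (σ : FreeGroup (Fin t.k) →* SL(t.n, ℂ)) (A : Matrix (Fin t.n) (Fin d) ℂ) (B : Matrix (Fin d) (Fin t.n) ℂ),
      (∀ w, A * (FreeGroup.lift f w).1 * B = (σ w : Matrix (Fin t.n) (Fin t.n) ℂ)) ∧ pv σ t.e (t.q J) t.c ≠ 0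

section Transfer2
variable {K : Type} [Field K] (U : Ultrafilter ℕ) (π : (ℕ → ℂ) →+* K)
variable (h0 : ∀ x, π x = 0 ↔ ∀ᶠ j in U, x j = 0)

include h0 in
lemma lift_SL (hs : Function.Surjective π) {n : ℕ} (g : SL(n, K)) :
    ∃ h : SL(n, ℕ → ℂ), Matrix.SpecialLinearGroup.map π h = g := by
  classical
  obtain ⟨M, hM⟩ := exists_lift π hs (g : Matrix (Fin n) (Fin n) K)
  have hev : ∀ (M : Matrix (Fin n) (Fin n) (ℕ → ℂ)) j, M.det j = (evm j M).det := by
    intro M j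
    have := RingHom.map_det (Pi.evalRingHom (fun _ => ℂ) j) M
    exact this
  have hdet : ∀ᶠ j in U, (evm j M).det = 1 := by
    have h1 : π (M.det - 1) = 0 := by
      rw [map_sub, map_one, RingHom.map_det, RingHom.mapMatrix_apply, hM, g.2, sub_self]
    rw [h0] at h1
    filter_upwards [h1] with j hj
    rw [← hev]
    exact sub_eq_zero.1 hj
  let M' : Matrix (Fin n) (Fin n) (ℕ → ℂ) := Matrix.of fun i k j =>
    (if (evm j M).det = 1 then evm j M else 1) i k
  have hM' : ∀ j, evm j M' = if (evm j M).det = 1 then evm j M else 1 := fun j => rfl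
  refine ⟨⟨M', ?_⟩, ?_⟩
  · funext j
    rw [hev, hM']
    split_ifs with h
    · exact h
    · exact Matrix.det_one
  · apply Subtype.ext
    change M'.map π = _
    rw [← hM, map_eq_iff U π h0]
    filter_upwards [hdet] with j hj
    rw [hM', if_pos hj]

include h0 in
lemma transfer_good (hs : Function.Surjective π) {d : ℕ} (F : ℕ → Set (GL (Fin d) ℂ)) (J : ℕ → ℕ) (t : Ty)
    (f : Fin t.k → Gs F) (σ : FreeGroup (Fin t.k) →* SL(t.n, K))
    (A : (Fin d → K) →ₗ[K] (Fin t.n → K)) (B : (Fin t.n → K) →ₗ[K] (Fin d → K))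
    (hAB : ∀ w, A ∘ₗ PhiS π F (FreeGroup.lift f w) ∘ₗ B = Matrix.toLin' (σ w : Matrix (Fin t.n) (Fin t.n) K))
    (hpv : pv σ t.e (t.q J) t.c ≠ 0) : ∃ N, ∀ᶠ j in U, Good d J t N (F j) := by
  classical
  -- the word length
  choose N hN using fun i => (f i).2
  refine ⟨∑ i, N i, ?_⟩
  -- lifting the representation
  choose s hsl using fun i => lift_SL U π h0 hs (σ (FreeGroup.of i))
  let σR : FreeGroup (Fin t.k) →* SL(t.n, ℕ → ℂ) := FreeGroup.lift s
  have hσ : mapRep π σR = σ := by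
    ext i : 1
    rw [← hsl i]
    simp [mapRep, σR]
  have epv : ∀ᶠ j in U, pv (mapRep (Pi.evalRingHom (fun _ => ℂ) j) σR) t.e (t.q J) t.c ≠ 0 := by
    rw [← hσ, pv_map, Ne, h0, ← Ultrafilter.eventually_not] at hpv
    filter_upwards [hpv] with j hj
    rw [pv_map]
    exact hj
  -- the invariant subspace
  let W : Submodule K (Fin d → K) := ⨆ w, LinearMap.range (PhiS π F (FreeGroup.lift f w) ∘ₗ B)
  obtain ⟨W', hW'⟩ := Submodule.exists_isCompl W
  let P := Submodule.projection W W' hW'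
  have hP1 : ∀ v, P v ∈ W := fun v => Submodule.projection_apply_mem hW' v
  have hP2 : ∀ v ∈ W, P v = v := fun v hv => Submodule.projection_apply_of_mem_left hW' hv
  have hWB : ∀ w z, PhiS π F (FreeGroup.lift f w) (B z) ∈ W := fun w z =>
    (le_iSup (fun w => LinearMap.range (PhiS π F (FreeGroup.lift f w) ∘ₗ B)) w) ⟨z, rfl⟩
  have hWind : ∀ p : (Fin d → K) → Prop, (∀ w z, p (PhiS π F (FreeGroup.lift f w) (B z))) → p 0 →
      (∀ x y, p x → p y → p (x + y)) → ∀ v ∈ W, p v := by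
    intro p h1 h2 h3 v hv
    refine Submodule.iSup_induction _ (motive := p) hv ?_ h2 h3
    rintro w _ ⟨z, rfl⟩
    exact h1 w z
  have hWinv : ∀ u, ∀ v ∈ W, PhiS π F (FreeGroup.lift f u) v ∈ W := by
    intro u
    refine hWind _ ?_ (by rw [map_zero]; exact W.zero_mem) (fun x y hx hy => by rw [map_add]; exact W.add_mem hx hy)
    intro w z
    rw [← Module.End.mul_apply, ← map_mul, ← map_mul]
    exact hWB _ _
  have hAW : ∀ u, ∀ v ∈ W, A (PhiS π F (FreeGroup.lift f u) v) =
      Matrix.toLin' (σ u : Matrix (Fin t.n) (Fin t.n) K) (A v) := by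
    intro u
    refine hWind _ ?_ (by simp) (fun x y hx hy => by simp only [map_add, hx, hy])
    intro w z
    have h1 := LinearMap.congr_fun (hAB (u * w)) z
    have h2 := LinearMap.congr_fun (hAB w) z
    simp only [LinearMap.comp_apply] at h1 h2
    rw [h2, ← Module.End.mul_apply, ← map_mul, ← map_mul, h1, map_mul, Matrix.SpecialLinearGroup.coe_mul,
      Matrix.toLin'_mul]
    rfl
  -- matrices
  have hA : A = Matrix.toLin' (LinearMap.toMatrix' A) := (Matrix.toLin'_toMatrix' A).symm
  have hB : B = Matrix.toLin' (LinearMap.toMatrix' B) := (Matrix.toLin'_toMatrix' B).symm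
  have hP : P = Matrix.toLin' (LinearMap.toMatrix' P) := (Matrix.toLin'_toMatrix' P).symm
  obtain ⟨Am, hAm⟩ := exists_lift π hs (LinearMap.toMatrix' A)
  obtain ⟨Bm, hBm⟩ := exists_lift π hs (LinearMap.toMatrix' B)
  obtain ⟨X, hX⟩ := exists_lift π hs (LinearMap.toMatrix' P)
  rw [← hAm] at hA
  rw [← hBm] at hB
  rw [← hX] at hP
  have hΦ : ∀ u, PhiS π F (FreeGroup.lift f u) = Matrix.toLin' ((seqM (FreeGroup.lift f u).1).map π) := fun u => rfl
  have hσ' : ∀ u, (σ u : Matrix (Fin t.n) (Fin t.n) K) = (σR u : Matrix (Fin t.n) (Fin t.n) (ℕ → ℂ)).map π := by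
    intro u
    rw [← hσ]; rfl
  have q1 : ∀ᶠ j in U, evm j X * evm j Bm = evm j Bm := by
    have : (X * Bm).map π = Bm.map π := by
      rw [Matrix.map_mul]
      apply Matrix.toLin'.injective
      rw [Matrix.toLin'_mul, ← hP, ← hB]
      refine LinearMap.ext fun z => hP2 _ ?_
      have := hWB 1 z
      rwa [map_one, map_one] at this
    rw [map_eq_iff U π h0] at this
    filter_upwards [this] with j hj
    rw [← evm_mul, hj]
  have q2 : ∀ᶠ j in U, evm j Am * evm j Bm = 1 := by
    have : (Am * Bm).map π = (1 : Matrix (Fin t.n) (Fin t.n) (ℕ → ℂ)).map π := by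
      rw [Matrix.map_mul, Matrix.map_one _ (map_zero _) (map_one _)]
      apply Matrix.toLin'.injective
      rw [Matrix.toLin'_mul, ← hA, ← hB]
      have := hAB 1
      rw [map_one, map_one, map_one] at this
      exact this
    rw [map_eq_iff U π h0] at this
    filter_upwards [this] with j hj
    rw [← evm_mul, hj, evm_one]
  have q3 : ∀ u, ∀ᶠ j in U, evm j (seqM (FreeGroup.lift f u).1) * evm j X =
      evm j X * evm j (seqM (FreeGroup.lift f u).1) * evm j X := by
    intro u
    have : (seqM (FreeGroup.lift f u).1 * X).map π = (X * seqM (FreeGroup.lift f u).1 * X).map π := by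
      rw [Matrix.map_mul, Matrix.map_mul, Matrix.map_mul]
      apply Matrix.toLin'.injective
      rw [Matrix.toLin'_mul, Matrix.toLin'_mul, Matrix.toLin'_mul, ← hP, ← hΦ]
      refine LinearMap.ext fun z => (hP2 _ ?_).symm
      exact hWinv u _ (hP1 z)
    rw [map_eq_iff U π h0] at this
    filter_upwards [this] with j hj
    rw [← evm_mul, ← evm_mul, ← evm_mul, hj]
  have q4 : ∀ u, ∀ᶠ j in U, evm j Am * evm j (seqM (FreeGroup.lift f u).1) * evm j X =
      evm j (σR u : Matrix (Fin t.n) (Fin t.n) (ℕ → ℂ)) * evm j Am * evm j X := by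
    intro u
    have : (Am * seqM (FreeGroup.lift f u).1 * X).map π =
        ((σR u : Matrix (Fin t.n) (Fin t.n) (ℕ → ℂ)) * Am * X).map π := by
      rw [Matrix.map_mul, Matrix.map_mul, Matrix.map_mul, Matrix.map_mul]
      apply Matrix.toLin'.injective
      rw [Matrix.toLin'_mul, Matrix.toLin'_mul, Matrix.toLin'_mul, Matrix.toLin'_mul, ← hP, ← hΦ, ← hA, ← hσ']
      exact LinearMap.ext fun z => hAW u _ (hP1 z)
    rw [map_eq_iff U π h0] at this
    filter_upwards [this] with j hj
    rw [← evm_mul, ← evm_mul, ← evm_mul, ← evm_mul, hj]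
  have q3' := fun i => q3 (FreeGroup.of i)
  have q3'' := fun i => q3 (FreeGroup.of i)⁻¹
  have q4' := fun i => q4 (FreeGroup.of i)
  have q4'' := fun i => q4 (FreeGroup.of i)⁻¹
  rw [← eventually_all] at q3' q3'' q4' q4''
  filter_upwards [epv, q1, q2, q3', q3'', q4', q4'', q3 1] with j k0 k1 k2 k3 k3' k4 k4' k5
  have hfj : ∀ u, FreeGroup.lift (fun i => (f i).1 j) u = (FreeGroup.lift f u).1 j := by
    intro u
    have : FreeGroup.lift (fun i => (f i).1 j) =
        ((Pi.evalMonoidHom (fun _ => GL (Fin d) ℂ) j).comp (Gs F).subtype).comp (FreeGroup.lift f) := by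
      ext1 i
      simp
    rw [this]; rfl
  refine ⟨fun i => (f i).1 j, fun i => (hN i j).mono (Finset.single_le_sum (fun _ _ => Nat.zero_le _) (Finset.mem_univ i)),
    mapRep (Pi.evalRingHom (fun _ => ℂ) j) σR, evm j Am, evm j Bm, ?_, k0⟩
  have key : ∀ u, (evm j (seqM (FreeGroup.lift f u).1) * evm j X =
      evm j X * evm j (seqM (FreeGroup.lift f u).1) * evm j X) ∧
      (evm j Am * evm j (seqM (FreeGroup.lift f u).1) * evm j X =
      evm j (σR u : Matrix (Fin t.n) (Fin t.n) (ℕ → ℂ)) * evm j Am * evm j X) := by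
    intro u
    induction u using FreeGroup.induction_on with
    | C1 =>
      constructor
      · exact k5
      · rw [map_one, Subgroup.coe_one, seqM_one, map_one, Matrix.SpecialLinearGroup.coe_one, evm_one, evm_one,
          Matrix.mul_one, Matrix.one_mul]
    | of i => exact ⟨k3 i, k4 i⟩
    | inv_of i _ => exact ⟨k3' i, k4' i⟩
    | mul u v hu hv =>
      rw [map_mul, Subgroup.coe_mul, seqM_mul, map_mul, Matrix.SpecialLinearGroup.coe_mul, evm_mul, evm_mul]
      constructor
      · calc _ = evm j (seqM (FreeGroup.lift f u).1) * (evm j (seqM (FreeGroup.lift f v).1) * evm j X) := by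
              rw [Matrix.mul_assoc]
          _ = (evm j (seqM (FreeGroup.lift f u).1) * evm j X) * (evm j (seqM (FreeGroup.lift f v).1) * evm j X) := by
              conv_lhs => rw [hv.1]
              simp only [Matrix.mul_assoc]
          _ = evm j X * evm j (seqM (FreeGroup.lift f u).1) * 
                (evm j X * evm j (seqM (FreeGroup.lift f v).1) * evm j X) := by
              rw [hu.1]; simp only [Matrix.mul_assoc]
          _ = _ := by rw [← hv.1]; simp only [Matrix.mul_assoc]
      · calc _ = evm j Am * evm j (seqM (FreeGroup.lift f u).1) * (evm j (seqM (FreeGroup.lift f v).1) * evm j X) := by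
              simp only [Matrix.mul_assoc]
          _ = (evm j Am * evm j (seqM (FreeGroup.lift f u).1) * evm j X) * 
                (evm j (seqM (FreeGroup.lift f v).1) * evm j X) := by
              conv_lhs => rw [hv.1]
              simp only [Matrix.mul_assoc]
          _ = evm j (σR u : Matrix (Fin t.n) (Fin t.n) (ℕ → ℂ)) * (evm j Am * 
                (evm j X * evm j (seqM (FreeGroup.lift f v).1) * evm j X)) := by
              rw [hu.2]; simp only [Matrix.mul_assoc]
          _ = evm j (σR u : Matrix (Fin t.n) (Fin t.n) (ℕ → ℂ)) * (evm j Am * 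
                evm j (seqM (FreeGroup.lift f v).1) * evm j X) := by
              rw [← hv.1]; simp only [Matrix.mul_assoc]
          _ = _ := by rw [hv.2]; simp only [Matrix.mul_assoc]
  intro w
  rw [hfj]
  calc evm j Am * ((FreeGroup.lift f w).1 j).1 * evm j Bm 
      = (evm j Am * evm j (seqM (FreeGroup.lift f w).1) * evm j X) * evm j Bm := by
        rw [Matrix.mul_assoc _ (evm j X), k1]; rfl
    _ = evm j (σR w : Matrix (Fin t.n) (Fin t.n) (ℕ → ℂ)) * (evm j Am * (evm j X * evm j Bm)) := by
        rw [(key w).2]; simp only [Matrix.mul_assoc]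
    _ = _ := by rw [k1, k2, Matrix.mul_one]; rfl

end Transfer2

section Ultra

instance : Countable Ty := by
  have hc : ∀ k, Countable (FreeGroup (Fin k)) := fun k => FreeGroup.toWord_injective.countable
  let φ : Ty → Σ n : ℕ, Σ k : ℕ, (Fin n × Fin n → FreeGroup (Fin k)) × FreeGroup (Fin k) × FreeGroup (Fin k) ×
    List (FreeGroup (Fin k)) := fun t => ⟨t.n, t.k, t.e, t.x, t.c, t.y⟩
  refine Function.Injective.countable (f := φ) ?_
  rintro ⟨n, k, e, x, c, y, h1, h2⟩ ⟨n', k', e', x', c', y', h1', h2'⟩ h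
  simp only [φ, Sigma.mk.injEq] at h
  obtain ⟨rfl, h⟩ := h
  rw [heq_iff_eq, Sigma.mk.injEq] at h
  obtain ⟨rfl, h⟩ := h
  simp only [heq_iff_eq, Prod.mk.injEq] at h
  obtain ⟨rfl, rfl, rfl, rfl⟩ := h
  rfl

instance : Nonempty Ty := ⟨⟨1, 0, fun _ => 1, 1, 1, [], Nat.one_pos, fun _ => Subgroup.one_mem _⟩⟩

/-- The ultrapower of the complex field. -/
abbrev Kst : Type := Germ ((hyperfilter ℕ : Ultrafilter ℕ) : Filter ℕ) ℂ

lemma kst_zero (x : ℕ → ℂ) : Germ.coeRingHom ((hyperfilter ℕ : Ultrafilter ℕ) : Filter ℕ) x = 0 ↔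
    ∀ᶠ j in (hyperfilter ℕ : Ultrafilter ℕ), x j = 0 := by
  change (x : Kst) = ((0 : ℕ → ℂ) : Kst) ↔ _
  rw [Germ.coe_eq]
  rfl

lemma kst_surj : Function.Surjective (Germ.coeRingHom (R := ℂ) ((hyperfilter ℕ : Ultrafilter ℕ) : Filter ℕ)) := by
  intro x
  induction x using Germ.inductionOn with
  | h x => exact ⟨x, rfl⟩

instance : IsAlgClosed Kst := by
  refine IsAlgClosed.of_exists_root _ fun p hp hirr => ?_
  let π := Germ.coeRingHom (R := ℂ) ((hyperfilter ℕ : Ultrafilter ℕ) : Filter ℕ)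
  have hl : p ∈ Polynomial.lifts π := by
    rw [Polynomial.lifts_iff_coeff_lifts]
    intro n
    exact kst_surj _
  obtain ⟨q, hq, hdeg, hm⟩ := Polynomial.lifts_and_natDegree_eq_and_monic hl hp
  have hroot : ∀ j, ∃ z : ℂ, (q.map (Pi.evalRingHom (fun _ => ℂ) j)).eval z = 0 := by
    intro j
    refine IsAlgClosed.exists_root _ ?_
    rw [Polynomial.degree_eq_natDegree (hm.map _).ne_zero, hm.natDegree_map, hdeg]
    have := hirr.natDegree_pos
    exact_mod_cast this.ne'
  choose z hz using hroot
  refine ⟨π z, ?_⟩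
  rw [← hq, Polynomial.eval_map, Polynomial.eval₂_hom]
  have : q.eval z = 0 := by
    funext j
    rw [← Pi.evalRingHom_apply (fun _ => ℂ) j (q.eval z), ← Polynomial.eval₂_hom, ← Polynomial.eval_map]
    exact hz j
  rw [this, map_zero]

theorem s1b (d : ℕ) (J : ℕ → ℕ) : ∃ (M : ℕ) (T : ℕ → Ty × ℕ), ∀ F : Set (GL (Fin d) ℂ),
    ¬ (∃ H : Subgroup ↥(Subgroup.closure F), H.FiniteIndex ∧ IsSolvable ↥H) →
    ∃ i ≤ M, Good d J (T i).1 (T i).2 F := by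
  obtain ⟨T, hT⟩ := exists_surjective_nat (Ty × ℕ)
  by_contra hcon
  push Not at hcon
  choose F hF1 hF2 using fun M => hcon M T
  rcases s1a J (PhiS (Germ.coeRingHom (R := ℂ) ((hyperfilter ℕ : Ultrafilter ℕ) : Filter ℕ) : (ℕ → ℂ) →+* Kst) F)
    with h | ⟨t, f, σ, A, B, hAB, hpv⟩
  · obtain ⟨j, H, h1, h2⟩ := (transfer_vt _ _ kst_zero kst_surj F h).exists
    exact hF1 j H h1 h2
  · obtain ⟨N, hN⟩ := transfer_good _ _ kst_zero kst_surj F J t f σ A B hAB hpv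
    obtain ⟨i, hi⟩ := hT (t, N)
    have hge : ∀ᶠ j in (hyperfilter ℕ : Ultrafilter ℕ), i ≤ j :=
      Nat.hyperfilter_le_atTop (eventually_ge_atTop i)
    obtain ⟨j, hj1, hj2⟩ := (hN.and hge).exists
    refine hF2 j i hj2 ?_
    rw [hi]
    exact hj1

end Ultra
end WDC
end PartSec18

section PartSec19
open MvPolynomial
namespace WDC

section Size
variable {n : ℕ}

/-- Sums of at most H signed monomials of degree at most D. -/
inductive Sz {n : ℕ} (D : ℕ) : ℕ → MvPolynomial (Fin n) ℤ → Prop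
  | zero : Sz D 0 0
  | step {H : ℕ} {p : MvPolynomial (Fin n) ℤ} (m : Fin n →₀ ℕ) (ε : ℤ) (hp : Sz D H p) (hm : m.degree ≤ D)
      (hε : |ε| ≤ 1) : Sz D (H + 1) (p + monomial m ε)

lemma Sz.add {D H H' : ℕ} {p q : MvPolynomial (Fin n) ℤ} (hp : Sz D H p) (hq : Sz D H' q) :
    Sz D (H + H') (p + q) := by
  induction hq with
  | zero => simpa using hp
  | step m ε _ hm hε ih =>
    rw [← add_assoc, ← add_assoc]
    exact Sz.step m ε ih hm hε

lemma Sz.monoD {D D' H : ℕ} (h : D ≤ D') {p : MvPolynomial (Fin n) ℤ} (hp : Sz D H p) : Sz D' H p := by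
  induction hp with
  | zero => exact Sz.zero
  | step m ε _ hm hε ih => exact Sz.step m ε ih (hm.trans h) hε

lemma Sz.monoH {D H H' : ℕ} (h : H ≤ H') {p : MvPolynomial (Fin n) ℤ} (hp : Sz D H p) : Sz D H' p := by
  obtain ⟨k, rfl⟩ := Nat.exists_eq_add_of_le h
  clear h
  induction k with
  | zero => exact hp
  | succ k ih =>
    have := Sz.step (0 : Fin n →₀ ℕ) 0 ih (by simp) (by simp)
    simpa [add_assoc] using this

lemma Sz.mono {D D' H H' : ℕ} (hD : D ≤ D') (h : H ≤ H') {p : MvPolynomial (Fin n) ℤ} (hp : Sz D H p) :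
    Sz D' H' p := (hp.monoD hD).monoH h

lemma Sz.monomial {D : ℕ} (m : Fin n →₀ ℕ) (ε : ℤ) (hm : m.degree ≤ D) (hε : |ε| ≤ 1) :
    Sz D 1 (MvPolynomial.monomial m ε) := by
  simpa using Sz.step m ε Sz.zero hm hε

lemma Sz.one {D : ℕ} : Sz D 1 (1 : MvPolynomial (Fin n) ℤ) :=
  Sz.monomial 0 1 (by simp) (by simp)

lemma Sz.var (i : Fin n) : Sz 1 1 (X i : MvPolynomial (Fin n) ℤ) :=
  Sz.monomial (Finsupp.single i 1) 1 (by simp) (by simp)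

lemma Sz.zero' {D H : ℕ} : Sz D H (0 : MvPolynomial (Fin n) ℤ) := Sz.zero.monoH (Nat.zero_le H)

lemma Sz.neg {D H : ℕ} {p : MvPolynomial (Fin n) ℤ} (hp : Sz D H p) : Sz D H (-p) := by
  induction hp with
  | zero => simpa using Sz.zero
  | step m ε _ hm hε ih =>
    have := Sz.step m (-ε) ih hm (by rwa [abs_neg])
    rwa [map_neg, ← neg_add] at this

lemma Sz.sub {D H H' : ℕ} {p q : MvPolynomial (Fin n) ℤ} (hp : Sz D H p) (hq : Sz D H' q) :
    Sz D (H + H') (p - q) := by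
  rw [sub_eq_add_neg]
  exact hp.add hq.neg

lemma Sz.mul_monomial {D D' H : ℕ} {p : MvPolynomial (Fin n) ℤ} (hp : Sz D H p) (m : Fin n →₀ ℕ) (ε : ℤ)
    (hm : m.degree ≤ D') (hε : |ε| ≤ 1) : Sz (D + D') H (p * MvPolynomial.monomial m ε) := by
  induction hp with
  | zero => rw [zero_mul]; exact Sz.zero
  | step m' ε' _ hm' hε' ih =>
    rw [add_mul, monomial_mul]
    refine Sz.step _ _ ih ?_ ?_
    · rw [map_add]
      omega
    · rw [abs_mul]
      exact mul_le_one₀ hε' (abs_nonneg _) hε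

lemma Sz.mul {D D' H H' : ℕ} {p q : MvPolynomial (Fin n) ℤ} (hp : Sz D H p) (hq : Sz D' H' q) :
    Sz (D + D') (H * H') (p * q) := by
  induction hq with
  | zero => rw [mul_zero, mul_zero]; exact Sz.zero
  | step m ε _ hm hε ih =>
    rw [mul_add, mul_add, mul_one]
    exact ih.add (hp.mul_monomial m ε hm hε)

lemma Sz.nat {D : ℕ} (a : ℕ) : Sz D a (a : MvPolynomial (Fin n) ℤ) := by
  induction a with
  | zero => simpa using Sz.zero
  | succ a ih =>
    rw [Nat.cast_succ]
    exact ih.add Sz.one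

lemma Sz.sum {ι : Type*} (s : Finset ι) {D H : ℕ} {p : ι → MvPolynomial (Fin n) ℤ}
    (h : ∀ i ∈ s, Sz D H (p i)) : Sz D (s.card * H) (∑ i ∈ s, p i) := by
  classical
  induction s using Finset.induction with
  | empty => simpa using Sz.zero
  | insert a s ha ih =>
    rw [Finset.sum_insert ha, Finset.card_insert_of_notMem ha, Nat.succ_mul, add_comm (_ * _)]
    exact (h a (Finset.mem_insert_self _ _)).add (ih fun i hi => h i (Finset.mem_insert_of_mem hi))

lemma Sz.prod {ι : Type*} (s : Finset ι) {D H : ℕ} {p : ι → MvPolynomial (Fin n) ℤ}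
    (h : ∀ i ∈ s, Sz D H (p i)) : Sz (s.card * D) (H ^ s.card) (∏ i ∈ s, p i) := by
  classical
  induction s using Finset.induction with
  | empty => simpa using Sz.one
  | insert a s ha ih =>
    rw [Finset.prod_insert ha, Finset.card_insert_of_notMem ha, Nat.succ_mul, pow_succ, add_comm (_ * _),
      mul_comm (_ ^ _)]
    exact (h a (Finset.mem_insert_self _ _)).mul (ih fun i hi => h i (Finset.mem_insert_of_mem hi))

lemma Sz.det {N : ℕ} {D H : ℕ} {M : Matrix (Fin N) (Fin N) (MvPolynomial (Fin n) ℤ)}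
    (h : ∀ i j, Sz D H (M i j)) : Sz (N * D) (N.factorial * H ^ N) M.det := by
  rw [Matrix.det_apply]
  have := Sz.sum (Finset.univ : Finset (Equiv.Perm (Fin N))) (D := N * D) (H := H ^ N)
    (p := fun τ => Equiv.Perm.sign τ • ∏ i, M (τ i) i) ?_
  · rwa [Finset.card_univ, Fintype.card_perm, Fintype.card_fin] at this
  · intro τ _
    have h1 := Sz.prod Finset.univ (p := fun i => M (τ i) i) fun i _ => h _ _
    rw [Finset.card_univ, Fintype.card_fin] at h1
    rcases Int.units_eq_one_or (Equiv.Perm.sign τ) with h2 | h2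
    · rw [h2, one_smul]; exact h1
    · rw [h2, Units.neg_smul, one_smul]; exact h1.neg

lemma aeval_monomial_le {B : ℝ} (hB : 1 ≤ B) {x : Fin n → ℂ} (hx : ∀ i, ‖x i‖ ≤ B) {D : ℕ} (m : Fin n →₀ ℕ)
    (ε : ℤ) (hm : m.degree ≤ D) (hε : |ε| ≤ 1) : ‖aeval x (MvPolynomial.monomial m ε)‖ ≤ B ^ D := by
  rw [aeval_monomial, norm_mul]
  have h1 : ‖algebraMap ℤ ℂ ε‖ ≤ 1 := by
    have : ‖algebraMap ℤ ℂ ε‖ = |(ε : ℝ)| := by simp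
    rw [this]
    exact_mod_cast hε
  have h2 : ‖m.prod fun i k => x i ^ k‖ ≤ B ^ m.degree := by
    rw [Finsupp.prod, norm_prod, Finsupp.degree_apply, ← Finset.prod_pow_eq_pow_sum]
    refine Finset.prod_le_prod (fun _ _ => norm_nonneg _) fun i _ => ?_
    rw [norm_pow]
    exact pow_le_pow_left₀ (norm_nonneg _) (hx i) _
  calc _ ≤ 1 * B ^ m.degree := mul_le_mul h1 h2 (norm_nonneg _) zero_le_one
    _ ≤ B ^ D := by rw [one_mul]; exact pow_le_pow_right₀ hB hm

lemma Sz.eval {D H : ℕ} {p : MvPolynomial (Fin n) ℤ} (hp : Sz D H p) {B : ℝ} (hB : 1 ≤ B) {x : Fin n → ℂ}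
    (hx : ∀ i, ‖x i‖ ≤ B) : ‖aeval x p‖ ≤ H * B ^ D := by
  induction hp with
  | zero => simp
  | step m ε _ hm hε ih =>
    rw [map_add]
    refine (norm_add_le _ _).trans ?_
    have := aeval_monomial_le hB hx m ε hm hε
    push_cast
    linarith

lemma Sz.totalDegree_le {D H : ℕ} {p : MvPolynomial (Fin n) ℤ} (hp : Sz D H p) : p.totalDegree ≤ D := by
  induction hp with
  | zero => simp
  | step m ε _ hm hε ih =>
    refine (totalDegree_add _ _).trans (max_le ih ?_)
    exact (totalDegree_monomial_le m ε).trans hm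

lemma hc_monomial (i : ℕ) (m : Fin n →₀ ℕ) (ε : ℤ) : homogeneousComponent i (MvPolynomial.monomial m ε) =
    if m.degree = i then MvPolynomial.monomial m ε else 0 := by
  classical
  ext u
  rw [coeff_homogeneousComponent, coeff_monomial]
  split_ifs <;> simp_all
  rintro rfl
  contradiction

lemma Sz.trunc {D H : ℕ} {p : MvPolynomial (Fin n) ℤ} (hp : Sz D H p) (e : ℕ) :
    Sz e H (∑ i ∈ Finset.range (e + 1), homogeneousComponent i p) := by
  induction hp with
  | zero => simpa using Sz.zero
  | step m ε _ hm hε ih =>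
    simp only [map_add, Finset.sum_add_distrib, hc_monomial, Finset.sum_ite_eq, Finset.mem_range]
    split_ifs with h
    · exact Sz.step m ε ih (by omega) hε
    · simpa using ih.monoH (Nat.le_succ _)

lemma Sz.deg {D H : ℕ} {p : MvPolynomial (Fin n) ℤ} (hp : Sz D H p) : Sz p.totalDegree H p := by
  have := hp.trunc p.totalDegree
  rwa [sum_homogeneousComponent] at this

/-- Coefficients with respect to the first variable. -/
lemma Sz.coeff {D H : ℕ} {p : MvPolynomial (Fin (n + 1)) ℤ} (hp : Sz D H p) (i : ℕ) :
    Sz (D - i) H ((finSuccEquiv ℤ n p).coeff i) := by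
  induction hp with
  | zero => simpa using Sz.zero
  | step m ε _ hm hε ih =>
    rw [map_add, Polynomial.coeff_add]
    have : (finSuccEquiv ℤ n (MvPolynomial.monomial m ε)).coeff i =
        MvPolynomial.monomial m.tail (if m 0 = i then ε else 0) := by
      ext u
      rw [finSuccEquiv_coeff_coeff, coeff_monomial, coeff_monomial]
      have key : m = Finsupp.cons i u ↔ m.tail = u ∧ m 0 = i := by
        constructor
        · rintro rfl
          simp
        · rintro ⟨rfl, rfl⟩
          exact (Finsupp.cons_tail m).symm
      by_cases h1 : m.tail = u <;> by_cases h2 : m 0 = i <;> simp [key, h1, h2]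
    rw [this]
    by_cases h : m 0 = i
    · rw [if_pos h]
      refine Sz.step _ _ ih ?_ hε
      have hd : m.degree = m 0 + m.tail.degree := by
        rw [Finsupp.degree_eq_sum, Finsupp.degree_eq_sum, Fin.sum_univ_succ]
        rfl
      omega
    · rw [if_neg h]
      simpa using ih.monoH (Nat.le_succ _)

lemma Sz.coeff_big {D H : ℕ} {p : MvPolynomial (Fin (n + 1)) ℤ} (hp : Sz D H p) :
    (finSuccEquiv ℤ n p).natDegree ≤ D := by
  rw [natDegree_finSuccEquiv]
  exact (degreeOf_le_totalDegree p 0).trans hp.totalDegree_le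

/-- Substitution of linear forms. -/
lemma Sz.subst {D H C : ℕ} {p : MvPolynomial (Fin n) ℤ} (hp : Sz D H p) (hC : 1 ≤ C)
    (l : Fin n → MvPolynomial (Fin n) ℤ) (hl : ∀ i, Sz 1 C (l i)) : Sz D (H * C ^ D) (aeval l p) := by
  induction hp with
  | zero => simpa using Sz.zero
  | step m ε _ hm hε ih =>
    rw [map_add, Nat.succ_mul]
    refine ih.add ?_
    rw [aeval_monomial]
    have h1 : Sz m.degree (C ^ m.degree) (m.prod fun i k => l i ^ k) := by
      rw [Finsupp.prod, Finsupp.degree_apply]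
      induction m.support using Finset.induction with
      | empty => simpa using Sz.one
      | insert a s ha ih =>
        rw [Finset.prod_insert ha, Finset.sum_insert ha, pow_add]
        refine Sz.mul ?_ ih
        have := Sz.prod (Finset.range (m a)) (p := fun _ => l a) fun _ _ => hl a
        simpa using this
    have h2 : Sz 0 1 (algebraMap ℤ (MvPolynomial (Fin n) ℤ) ε) := Sz.monomial 0 ε (by simp) hε
    have := h2.mul h1
    exact this.mono (by omega) (by rw [one_mul]; exact Nat.pow_le_pow_right hC hm)

end Size
end WDC
end PartSec19

section PartSec20
open MvPolynomial
namespace WDC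

/-- Evaluation at z kills the Sylvester matrix up to the values of f and g at z. -/
lemma resultant_bound {f g : Polynomial ℂ} {m n : ℕ} (hf : f.natDegree ≤ m) (hg : g.natDegree ≤ n)
    (hmn : 0 < m + n) {K B η : ℝ} (hK : 1 ≤ K) (hB : 1 ≤ B) (hη : 0 ≤ η)
    (hfK : ∀ i, ‖f.coeff i‖ ≤ K) (hgK : ∀ i, ‖g.coeff i‖ ≤ K) {z : ℂ} (hz : ‖z‖ ≤ B)
    (hfz : ‖f.eval z‖ ≤ η) (hgz : ‖g.eval z‖ ≤ η) :
    ‖Polynomial.resultant f g m n‖ ≤ (m + n : ℕ) * (B ^ (m + n) * η * ((m + n).factorial * K ^ (m + n))) := by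
  set M := Polynomial.sylvester f g m n with hM
  have hent : ∀ i j, ‖M i j‖ ≤ K := by
    intro i j
    rw [hM, Polynomial.sylvester, Matrix.of_apply]
    refine Fin.addCases (fun j => ?_) (fun j => ?_) j
    · rw [Fin.addCases_left]
      split_ifs
      · exact hgK _
      · rw [norm_zero]; linarith
    · rw [Fin.addCases_right]
      split_ifs
      · exact hfK _
      · rw [norm_zero]; linarith
  have hsum : ∀ (p : Polynomial ℂ) (r a : ℕ), p.natDegree ≤ r → a + r < m + n →
      ∑ i : Fin (m + n), z ^ (i : ℕ) * (if (i : ℕ) ∈ Set.Icc a (a + r) then p.coeff (i - a) else 0) =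
        z ^ a * p.eval z := by
    intro p r a hp ha
    have h1 : (p * Polynomial.X ^ a).natDegree < m + n := by
      refine lt_of_le_of_lt Polynomial.natDegree_mul_le ?_
      rw [Polynomial.natDegree_X_pow]
      omega
    have h2 : z ^ a * p.eval z = (p * Polynomial.X ^ a).eval z := by
      rw [Polynomial.eval_mul, Polynomial.eval_pow, Polynomial.eval_X, mul_comm]
    rw [h2, Polynomial.eval_eq_sum_range' h1, Finset.sum_range]
    refine Finset.sum_congr rfl fun i _ => ?_
    rw [mul_comm, Polynomial.coeff_mul_X_pow']
    congr 1
    by_cases h3 : a ≤ (i : ℕ)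
    · by_cases h4 : (i : ℕ) ≤ a + r
      · rw [if_pos ⟨h3, h4⟩, if_pos h3]
      · rw [if_neg (fun h => h4 h.2), if_pos h3, Polynomial.coeff_eq_zero_of_natDegree_lt (by omega)]
    · rw [if_neg (fun h => h3 h.1), if_neg h3]
  set v : Fin (m + n) → ℂ := fun i => z ^ (i : ℕ) with hv
  have hw : ∀ j, ‖Matrix.vecMul v M j‖ ≤ B ^ (m + n) * η := by
    have hpw : ∀ a, a ≤ m + n → ‖z ^ a‖ ≤ B ^ (m + n) := fun a ha => by
      rw [norm_pow]
      exact (pow_le_pow_left₀ (norm_nonneg _) hz _).trans (pow_le_pow_right₀ hB ha)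
    intro j
    rw [Matrix.vecMul, dotProduct]
    simp only [hM, Polynomial.sylvester, Matrix.of_apply, hv]
    refine Fin.addCases (fun j => ?_) (fun j => ?_) j
    · simp only [Fin.addCases_left]
      rw [hsum g n j hg (by omega), norm_mul]
      exact mul_le_mul (hpw _ (by omega)) hgz (norm_nonneg _) (by positivity)
    · simp only [Fin.addCases_right]
      rw [hsum f m j hf (by omega), norm_mul]
      exact mul_le_mul (hpw _ (by omega)) hfz (norm_nonneg _) (by positivity)
  have hadj : ∀ i j, ‖M.adjugate i j‖ ≤ (m + n).factorial * K ^ (m + n) := by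
    intro i j
    rw [Matrix.adjugate_apply]
    have := Matrix.det_le (A := M.updateRow j (Pi.single i 1)) (abv := NormedField.toAbsoluteValue ℂ)
      (x := K) ?_
    · rw [nsmul_eq_mul, Fintype.card_fin] at this
      exact this
    · intro a b
      change ‖M.updateRow j (Pi.single i 1) a b‖ ≤ K
      by_cases h : a = j
      · rw [h, Matrix.updateRow_self]
        by_cases h' : b = i
        · rw [h', Pi.single_eq_same, norm_one]; exact hK
        · rw [Pi.single_eq_of_ne h', norm_zero]; linarith
      · rw [Matrix.updateRow_ne h]; exact hent _ _
  have hdet : M.det = ∑ j, Matrix.vecMul v M j * M.adjugate j ⟨0, hmn⟩ := by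
    have h1 : Matrix.vecMul (Matrix.vecMul v M) M.adjugate ⟨0, hmn⟩ = M.det := by
      rw [Matrix.vecMul_vecMul, Matrix.mul_adjugate, Matrix.vecMul_smul, Matrix.vecMul_one]
      simp [hv]
    rw [← h1]; rfl
  rw [Polynomial.resultant, ← hM, hdet]
  refine (norm_sum_le _ _).trans ?_
  refine (Finset.sum_le_card_nsmul _ _ _ fun j _ => ?_).trans (le_of_eq (by
    rw [Finset.card_univ, Fintype.card_fin, nsmul_eq_mul]))
  rw [norm_mul]
  exact mul_le_mul (hw j) (hadj _ _) (norm_nonneg _) (by positivity)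

/-- Pigeonhole: vanishing of sufficiently many resultants gives a common root. -/
lemma common_root {K : Type*} [Field K] [IsAlgClosed K] [CharZero K] {f : Polynomial K} (hf : f ≠ 0) {s D : ℕ}
    (g : Fin s → Polynomial K) (hg : ∀ j, (g j).natDegree ≤ D)
    (h : ∀ t : Fin (f.natDegree * s + 1),
      Polynomial.resultant f (∑ j : Fin s, Polynomial.C (((t : ℕ) : K) ^ (j : ℕ)) * g j) f.natDegree D = 0) :
    ∃ z, ∀ j, (g j).eval z = 0 := by
  classical
  have h1 : ∀ t : Fin (f.natDegree * s + 1), ∃ z ∈ f.roots.toFinset,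
      (∑ j : Fin s, Polynomial.C (((t : ℕ) : K) ^ (j : ℕ)) * g j).eval z = 0 := by
    intro t
    have h2 := h t
    rw [Polynomial.resultant_eq_prod_eval _ _ _ (Polynomial.natDegree_sum_le_of_forall_le _ _ fun j _ =>
      (Polynomial.natDegree_C_mul_le _ _).trans (hg j)) (IsAlgClosed.splits f)] at h2
    have h3 := (mul_eq_zero.mp h2).resolve_left (pow_ne_zero _ (Polynomial.leadingCoeff_ne_zero.mpr hf))
    rw [Multiset.prod_eq_zero_iff, Multiset.mem_map] at h3
    obtain ⟨z, hz, hz2⟩ := h3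
    exact ⟨z, Multiset.mem_toFinset.mpr hz, hz2⟩
  choose ρ hρ hρ2 using h1
  have hcard : f.roots.toFinset.card * s < (Finset.univ : Finset (Fin (f.natDegree * s + 1))).card := by
    rw [Finset.card_univ, Fintype.card_fin]
    have : f.roots.toFinset.card ≤ f.natDegree := (Multiset.toFinset_card_le _).trans (Polynomial.card_roots' f)
    nlinarith [Nat.mul_le_mul_right s this]
  obtain ⟨z, -, hz⟩ := Finset.exists_lt_card_fiber_of_mul_lt_card_of_maps_to (f := ρ) (fun t _ => hρ t) hcard
  refine ⟨z, ?_⟩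
  set P : Polynomial K := ∑ j : Fin s, Polynomial.C ((g j).eval z) * Polynomial.X ^ (j : ℕ) with hP
  have hPdeg : P.natDegree ≤ s := Polynomial.natDegree_sum_le_of_forall_le _ _ fun j _ =>
    (Polynomial.natDegree_C_mul_X_pow_le _ _).trans (by omega)
  set T := (Finset.univ.filter fun t => ρ t = z).image fun t : Fin (f.natDegree * s + 1) => ((t : ℕ) : K) with hT
  have hTc : s < T.card := by
    rw [hT, Finset.card_image_of_injective]
    · exact hz
    · intro a b hab
      exact Fin.ext (Nat.cast_injective hab)
  have hP0 : P = 0 := by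
    refine Polynomial.eq_zero_of_natDegree_lt_card_of_eval_eq_zero' P T ?_ (by omega)
    intro u hu
    rw [hT, Finset.mem_image] at hu
    obtain ⟨t, ht, rfl⟩ := hu
    have ht := (Finset.mem_filter.mp ht).2
    have := hρ2 t
    rw [ht, Polynomial.eval_finsetSum] at this
    rw [hP, Polynomial.eval_finsetSum, ← this]
    refine Finset.sum_congr rfl fun j _ => ?_
    rw [Polynomial.eval_mul, Polynomial.eval_mul, Polynomial.eval_C, Polynomial.eval_C, Polynomial.eval_pow,
      Polynomial.eval_X, mul_comm]
  intro j
  have := congrArg (fun p => Polynomial.coeff p (j : ℕ)) hP0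
  simp only [hP, Polynomial.finsetSum_coeff, Polynomial.coeff_C_mul, Polynomial.coeff_X_pow, Polynomial.coeff_zero] at this
  rw [Finset.sum_eq_single j] at this
  · simpa using this
  · intro b _ hb
    rw [if_neg, mul_zero]
    exact fun h => hb (Fin.ext h.symm)
  · simp

section Change
variable {n : ℕ} (l : Fin (n + 1) → ℕ)

/-- The linear forms of the change of variables. -/
noncomputable def lin : Fin (n + 1) → MvPolynomial (Fin (n + 1)) ℤ :=
  Fin.cons ((l 0 : MvPolynomial (Fin (n + 1)) ℤ) * X 0) fun i => X i.succ + (l i.succ : MvPolynomial (Fin (n + 1)) ℤ) * X 0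

noncomputable def chg (f : MvPolynomial (Fin (n + 1)) ℤ) : Polynomial (MvPolynomial (Fin n) ℤ) :=
  finSuccEquiv ℤ n (aeval (lin l) f)

lemma chg_eval {S : Type*} [CommRing S] (f : MvPolynomial (Fin (n + 1)) ℤ) (y : Fin n → S) (z : S) :
    ((chg l f).map (aeval y : MvPolynomial (Fin n) ℤ →ₐ[ℤ] S).toRingHom).eval z =
      aeval (Fin.cons ((l 0 : S) * z) fun i => y i + (l i.succ : S) * z : Fin (n + 1) → S) f := by
  induction f using MvPolynomial.induction_on with
  | C a => simp [chg]
  | add p q hp hq => simpa [chg] using congrArg₂ (· + ·) hp hq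
  | mul_X p i hp =>
    simp only [chg, map_mul, Polynomial.map_mul, Polynomial.eval_mul, aeval_X] at hp ⊢
    rw [hp]
    congr 1
    refine Fin.cases ?_ (fun i => ?_) i
    · simp [lin, finSuccEquiv_X_zero]
    · simp [lin, finSuccEquiv_X_zero, finSuccEquiv_X_succ]

lemma lin_size {C : ℕ} (hl : ∀ i, l i + 1 ≤ C) (i) : Sz 1 C (lin l i) := by
  refine Fin.cases ?_ (fun i => ?_) i
  · have := (Sz.nat (n := n + 1) (D := 0) (l 0)).mul (Sz.var 0)
    simp only [lin, Fin.cons_zero]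
    exact this.mono (by simp) (by have := hl 0; omega)
  · have := (Sz.var i.succ).add ((Sz.nat (n := n + 1) (D := 0) (l i.succ)).mul (Sz.var 0))
    simp only [lin, Fin.cons_succ]
    exact this.mono (by simp) (by have := hl i.succ; omega)

lemma coeff_ray (f : MvPolynomial (Fin n) ℤ) (a : Fin n → ℤ) (e : ℕ) :
    (aeval (fun i => Polynomial.C (a i) * Polynomial.X) f : Polynomial ℤ).coeff e =
      eval a (homogeneousComponent e f) := by
  induction f using MvPolynomial.induction_on' with
  | add p q hp hq => rw [map_add, Polynomial.coeff_add, hp, hq, map_add, map_add]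
  | monomial m c =>
    rw [hc_monomial, aeval_monomial]
    have : (m.prod fun i k => (Polynomial.C (a i) * Polynomial.X : Polynomial ℤ) ^ k) =
        Polynomial.C (m.prod fun i k => a i ^ k) * Polynomial.X ^ m.degree := by
      rw [Finsupp.prod, Finsupp.prod, Finsupp.degree_apply, map_prod, ← Finset.prod_pow_eq_pow_sum,
        ← Finset.prod_mul_distrib]
      refine Finset.prod_congr rfl fun i _ => ?_
      rw [mul_pow, map_pow]
    rw [this]
    have hc : algebraMap ℤ (Polynomial ℤ) c = Polynomial.C c := rfl
    rw [hc, Polynomial.coeff_C_mul, Polynomial.coeff_C_mul, Polynomial.coeff_X_pow]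
    split_ifs with h1 h2 h2
    · simp [eval_monomial]
    · exact absurd h1.symm h2
    · exact absurd h2.symm h1
    · simp

/-- After the change of variables the top coefficient is a nonzero constant. -/
lemma chg_top {D H : ℕ} {f : MvPolynomial (Fin (n + 1)) ℤ} (hf : Sz D H f) {C : ℕ} (hl : ∀ i, l i + 1 ≤ C)
    (h : eval (fun i => (l i : ℤ)) (homogeneousComponent f.totalDegree f) ≠ 0) :
    ∃ a : ℤ, a ≠ 0 ∧ (chg l f).coeff f.totalDegree = MvPolynomial.C a := by
  have h1 := (hf.deg.subst (Nat.one_le_of_lt (hl 0)) (lin l) (lin_size l hl)).coeff f.totalDegree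
  rw [Nat.sub_self] at h1
  have h2 := totalDegree_eq_zero_iff_eq_C.mp (Nat.le_zero.mp h1.totalDegree_le)
  refine ⟨_, ?_, h2⟩
  intro h0
  rw [h0] at h2
  apply h
  rw [← coeff_ray]
  have h3 : (aeval (fun i => Polynomial.C (l i : ℤ) * Polynomial.X) f : Polynomial ℤ) =
      (chg l f).map (aeval (0 : Fin n → ℤ) : MvPolynomial (Fin n) ℤ →ₐ[ℤ] ℤ).toRingHom := by
    clear h h1 h2 h0 hf
    induction f using MvPolynomial.induction_on with
    | C a => simp [chg]
    | add p q hp hq => simpa [chg] using congrArg₂ (· + ·) hp hq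
    | mul_X p i hp =>
      simp only [chg, map_mul, Polynomial.map_mul, aeval_X] at hp ⊢
      rw [hp]
      congr 1
      refine Fin.cases ?_ (fun i => ?_) i
      · simp [lin, finSuccEquiv_X_zero]
      · simp [lin, finSuccEquiv_X_zero, finSuccEquiv_X_succ]
  rw [h3, Polynomial.coeff_map]
  show aeval (0 : Fin n → ℤ) ((chg l f).coeff f.totalDegree) = 0
  rw [chg, h2]
  simp

lemma exists_dir {D : ℕ} {f : MvPolynomial (Fin (n + 1)) ℤ} (hf : f ≠ 0) (hD : f.totalDegree ≤ D) :
    ∃ l : Fin (n + 1) → ℕ, (∀ i, 1 ≤ l i ∧ l i ≤ D + 1) ∧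
      eval (fun i => (l i : ℤ)) (homogeneousComponent f.totalDegree f) ≠ 0 := by
  by_contra hcon
  push Not at hcon
  have h0 : homogeneousComponent f.totalDegree f = 0 := by
    refine eq_zero_of_eval_zero_at_prod_finset _ (fun _ => (Finset.Icc 1 (D + 1)).map Nat.castEmbedding) ?_ ?_
    · intro i
      rw [Finset.card_map, Nat.card_Icc]
      refine lt_of_le_of_lt (degreeOf_le_totalDegree _ i) ?_
      have := (homogeneousComponent_isHomogeneous f.totalDegree f).totalDegree_le
      omega
    · intro x hx
      choose l hl hl2 using fun i => Finset.mem_map.mp (hx i)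
      have := hcon l fun i => Finset.mem_Icc.mp (hl i)
      have hx : x = fun i => (l i : ℤ) := funext fun i => (hl2 i).symm
      rw [hx]; exact this
  obtain ⟨m, hm, hdeg⟩ : ∃ m ∈ f.support, m.degree = f.totalDegree := by
    obtain ⟨m, hm, h⟩ := Finset.exists_mem_eq_sup f.support (support_nonempty.mpr hf) fun m => m.sum fun _ e => e
    exact ⟨m, hm, h.symm⟩
  have := congrArg (MvPolynomial.coeff m) h0
  rw [coeff_homogeneousComponent, if_pos hdeg, coeff_zero] at this
  exact (mem_support_iff.mp hm) this

end Change
end WDC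
end PartSec20

section PartSec21
open MvPolynomial
namespace WDC

/-- Height of the combined polynomials. -/
def Hg (D : ℕ) : ℕ := D * ((D ^ 2 + 1) ^ D * (2 ^ D * (D + 2) ^ D))

/-- One elimination step. -/
lemma elim_step (Q : Type) [Field Q] [IsAlgClosed Q] [CharZero Q] {n D s : ℕ} (hD : 2 ≤ D) (hs : s ≤ D) (f : Fin s → MvPolynomial (Fin (n + 1)) ℤ)
    (hf : ∀ j, Sz D (2 ^ D) (f j))
    (hz : ∀ z : Fin (n + 1) → Q, ∃ j, aeval z (f j) ≠ 0) :
    ∃ (s' : ℕ) (r : Fin s' → MvPolynomial (Fin n) ℤ), s' ≤ D ^ 2 + 1 ∧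
      (∀ t, Sz (2 * D * D) ((2 * D).factorial * Hg D ^ (2 * D)) (r t)) ∧
      (∀ z : Fin n → Q, ∃ t, aeval z (r t) ≠ 0) ∧
      ∀ (B : ℝ) (x : Fin (n + 1) → ℂ) (η : ℝ), 2 ≤ B → (∀ i, ‖x i‖ ≤ B) → 0 ≤ η →
        (∀ j, ‖aeval x (f j)‖ ≤ η) → ∃ y : Fin n → ℂ, (∀ i, ‖y i‖ ≤ (D + 2 : ℕ) * B) ∧ ∀ t,
          ‖aeval y (r t)‖ ≤ (2 * D : ℕ) * (B ^ (2 * D) * ((D * (D ^ 2 + 1) ^ D : ℕ) * η) *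
            ((2 * D).factorial * (Hg D * ((D + 2 : ℕ) * B) ^ D) ^ (2 * D))) := by
  classical
  obtain ⟨j0, hj0⟩ := hz 0
  have hne : f j0 ≠ 0 := fun h => hj0 (by rw [h, map_zero])
  have he : (f j0).totalDegree ≤ D := (hf j0).totalDegree_le
  obtain ⟨l, hl, htop⟩ := exists_dir hne he
  set e := (f j0).totalDegree with hedef
  have hlC : ∀ i, l i + 1 ≤ D + 2 := fun i => by have := (hl i).2; omega
  obtain ⟨a, ha, hca⟩ := chg_top l (hf j0) hlC htop
  rw [← hedef] at hca
  have hsub : ∀ j, Sz D (2 ^ D * (D + 2) ^ D) (aeval (lin l) (f j)) := fun j =>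
    (hf j).subst (by omega) (lin l) (lin_size l hlC)
  have hsub0 : Sz e (2 ^ D * (D + 2) ^ e) (aeval (lin l) (f j0)) :=
    (hf j0).deg.subst (by omega) (lin l) (lin_size l hlC)
  have hdeg : ∀ j, (chg l (f j)).natDegree ≤ D := fun j => (hsub j).coeff_big
  have hdeg0 : (chg l (f j0)).natDegree ≤ e := hsub0.coeff_big
  set G : ℕ → Polynomial (MvPolynomial (Fin n) ℤ) := fun t =>
    ∑ j : Fin s, Polynomial.C ((t : MvPolynomial (Fin n) ℤ) ^ (j : ℕ)) * chg l (f j) with hG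
  have hGdeg : ∀ t, (G t).natDegree ≤ D := fun t =>
    Polynomial.natDegree_sum_le_of_forall_le _ _ fun j _ => (Polynomial.natDegree_C_mul_le _ _).trans (hdeg j)
  have hes : e * s ≤ D ^ 2 := by rw [pow_two]; exact Nat.mul_le_mul he hs
  have htj : ∀ t : Fin (e * s + 1), ∀ j : Fin s, (t : ℕ) ^ (j : ℕ) ≤ (D ^ 2 + 1) ^ D := fun t j =>
    (Nat.pow_le_pow_left (by omega) _).trans (Nat.pow_le_pow_right (by omega) (by omega))
  have hGsz : ∀ (t : Fin (e * s + 1)) i, Sz D (Hg D) ((G t).coeff i) := by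
    intro t i
    rw [hG]
    simp only [Polynomial.finsetSum_coeff, Polynomial.coeff_C_mul]
    have := Sz.sum (Finset.univ : Finset (Fin s)) (D := D) (H := (D ^ 2 + 1) ^ D * (2 ^ D * (D + 2) ^ D))
      (p := fun j => ((t : ℕ) : MvPolynomial (Fin n) ℤ) ^ (j : ℕ) * (chg l (f j)).coeff i) ?_
    · refine this.monoH ?_
      rw [Finset.card_univ, Fintype.card_fin]
      exact Nat.mul_le_mul_right _ hs
    · intro j _
      have h1 := (Sz.nat (n := n) (D := 0) ((t : ℕ) ^ (j : ℕ))).mul ((hsub j).coeff i)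
      rw [Nat.cast_pow] at h1
      exact h1.mono (by omega) (Nat.mul_le_mul_right _ (htj t j))
  have hHle : 2 ^ D * (D + 2) ^ D ≤ Hg D := by
    rw [Hg, ← mul_assoc]
    exact Nat.le_mul_of_pos_left _ (by positivity)
  have hFsz : ∀ i, Sz D (Hg D) ((chg l (f j0)).coeff i) := fun i => ((hsub j0).coeff i).mono (by omega) hHle
  have hHg1 : 1 ≤ Hg D := le_trans (Nat.one_le_iff_ne_zero.mpr (by positivity)) hHle
  refine ⟨e * s + 1, fun t => Polynomial.resultant (chg l (f j0)) (G t) e D, by omega, ?_, ?_, ?_⟩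
  · intro t
    unfold Polynomial.resultant
    have := Sz.det (M := Polynomial.sylvester (chg l (f j0)) (G t) e D) (D := D) (H := Hg D) ?_
    · refine this.mono (Nat.mul_le_mul_right _ (by omega)) (Nat.mul_le_mul (Nat.factorial_le (by omega)) ?_)
      exact Nat.pow_le_pow_right hHg1 (by omega)
    · intro i j
      rw [Polynomial.sylvester, Matrix.of_apply]
      refine Fin.addCases (fun j => ?_) (fun j => ?_) j
      · rw [Fin.addCases_left]
        split_ifs
        · exact hGsz t _
        · exact Sz.zero'
      · rw [Fin.addCases_right]
        split_ifs
        · exact hFsz _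
        · exact Sz.zero'
  · intro y
    by_contra hcon
    push Not at hcon
    set φ : MvPolynomial (Fin n) ℤ →+* Q :=
      (aeval y : MvPolynomial (Fin n) ℤ →ₐ[ℤ] Q).toRingHom with hφ
    have hF0 : ((chg l (f j0)).map φ).coeff e = (a : Q) := by
      rw [Polynomial.coeff_map, hca, hφ]
      simp
    have ha' : (a : Q) ≠ 0 := by exact_mod_cast ha
    have hFne : (chg l (f j0)).map φ ≠ 0 := fun h => ha' (by rw [← hF0, h, Polynomial.coeff_zero])
    have hFd : ((chg l (f j0)).map φ).natDegree = e := by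
      refine le_antisymm (Polynomial.natDegree_map_le.trans hdeg0) (Polynomial.le_natDegree_of_ne_zero ?_)
      rw [hF0]; exact ha'
    obtain ⟨z, hzz⟩ := common_root hFne (D := D) (fun j => (chg l (f j)).map φ)
      (fun j => Polynomial.natDegree_map_le.trans (hdeg j)) (by
        rw [hFd]
        intro t
        have h1 := hcon t
        have h2 : φ (Polynomial.resultant (chg l (f j0)) (G t) e D) = 0 := h1
        rw [← Polynomial.resultant_map_map] at h2
        have h3 : (G t).map φ = ∑ j : Fin s, Polynomial.C (((t : ℕ) : Q) ^ (j : ℕ)) *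
            (chg l (f j)).map φ := by
          rw [hG, Polynomial.map_sum]
          refine Finset.sum_congr rfl fun j _ => ?_
          rw [Polynomial.map_mul, Polynomial.map_C, map_pow, map_natCast]
        rw [h3] at h2
        exact h2)
    obtain ⟨j, hj⟩ := hz (Fin.cons ((l 0 : Q) * z) fun i => y i + (l i.succ : Q) * z)
    exact hj (by rw [← chg_eval]; exact hzz j)
  · intro B x η hB hx hη hfx
    have hl0 : (l 0 : ℂ) ≠ 0 := by
      have := (hl 0).1
      exact_mod_cast (by omega : l 0 ≠ 0)
    set z := x 0 / l 0 with hzdef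
    have hzB : ‖z‖ ≤ B := by
      rw [hzdef, norm_div, Complex.norm_natCast]
      have h1 : (1 : ℝ) ≤ l 0 := by exact_mod_cast (hl 0).1
      exact (div_le_self (norm_nonneg _) h1).trans (hx 0)
    set y : Fin n → ℂ := fun i => x i.succ - l i.succ * z with hy
    have hxy : x = Fin.cons ((l 0 : ℂ) * z) fun i => y i + (l i.succ : ℂ) * z := by
      ext i
      refine Fin.cases ?_ (fun i => ?_) i
      · rw [Fin.cons_zero, hzdef, mul_div_cancel₀ _ hl0]
      · rw [Fin.cons_succ, hy]; ring
    have hyB : ∀ i, ‖y i‖ ≤ (D + 2 : ℕ) * B := by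
      intro i
      have h1 : ‖(l i.succ : ℂ) * z‖ ≤ (D + 1) * B := by
        rw [norm_mul, Complex.norm_natCast]
        have h2 : (l i.succ : ℝ) ≤ D + 1 := by exact_mod_cast (hl i.succ).2
        exact mul_le_mul h2 hzB (norm_nonneg _) (by positivity)
      have h2 := norm_sub_le (x i.succ) (l i.succ * z)
      have h3 := hx i.succ
      push_cast
      show ‖x i.succ - l i.succ * z‖ ≤ _
      linarith
    have hB' : (1 : ℝ) ≤ (D + 2 : ℕ) * B := by
      push_cast
      nlinarith [(Nat.cast_nonneg D : (0 : ℝ) ≤ D)]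
    refine ⟨y, hyB, fun t => ?_⟩
    set φ : MvPolynomial (Fin n) ℤ →+* ℂ := (aeval y : MvPolynomial (Fin n) ℤ →ₐ[ℤ] ℂ).toRingHom with hφ
    have hval : ∀ j, ((chg l (f j)).map φ).eval z = aeval x (f j) := fun j => by rw [hφ, chg_eval, ← hxy]
    have hcoe : ∀ p : MvPolynomial (Fin n) ℤ, Sz D (Hg D) p → ‖φ p‖ ≤ Hg D * ((D + 2 : ℕ) * B) ^ D :=
      fun p hp => hp.eval hB' hyB
    have hGval : ‖((G t).map φ).eval z‖ ≤ (D * (D ^ 2 + 1) ^ D : ℕ) * η := by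
      rw [hG, Polynomial.map_sum, Polynomial.eval_finsetSum]
      refine (norm_sum_le _ _).trans ((Finset.sum_le_card_nsmul _ _ (((D ^ 2 + 1) ^ D : ℕ) * η) fun j _ => ?_).trans ?_)
      · rw [Polynomial.map_mul, Polynomial.map_C, map_pow, map_natCast, Polynomial.eval_mul, Polynomial.eval_C, hval,
          norm_mul, ← Nat.cast_pow, Complex.norm_natCast]
        exact mul_le_mul (by exact_mod_cast htj t j) (hfx j) (norm_nonneg _) (by positivity)
      · rw [Finset.card_univ, Fintype.card_fin, nsmul_eq_mul, Nat.cast_mul D, mul_assoc]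
        exact mul_le_mul_of_nonneg_right (by exact_mod_cast hs) (by positivity)
    have hη' : η ≤ (D * (D ^ 2 + 1) ^ D : ℕ) * η := by
      refine le_mul_of_one_le_left hη ?_
      exact_mod_cast Nat.one_le_iff_ne_zero.mpr (by positivity)
    have hK1 : (1 : ℝ) ≤ Hg D * ((D + 2 : ℕ) * B) ^ D :=
      one_le_mul_of_one_le_of_one_le (by exact_mod_cast hHg1) (one_le_pow₀ hB')
    have key := resultant_bound (f := (chg l (f j0)).map φ) (g := (G t).map φ) (m := e) (n := D)
      (Polynomial.natDegree_map_le.trans hdeg0) (Polynomial.natDegree_map_le.trans (hGdeg t)) (by omega)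
      hK1 (B := B) (by linarith) (η := (D * (D ^ 2 + 1) ^ D : ℕ) * η) (by positivity)
      (fun i => by rw [Polynomial.coeff_map]; exact hcoe _ (hFsz i))
      (fun i => by rw [Polynomial.coeff_map]; exact hcoe _ (hGsz t i)) hzB
      (by rw [hval]; exact (hfx j0).trans hη') hGval
    rw [Polynomial.resultant_map_map] at key
    refine le_trans key ?_
    have h2D : e + D ≤ 2 * D := by omega
    have hB1 : (1 : ℝ) ≤ B := by linarith
    gcongr

end WDC
end PartSec21

section PartSec22
open MvPolynomial
namespace WDC

section Num
variable {D : ℕ}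

lemma num_a (hD : 2 ≤ D) : D + 2 ≤ 2 ^ D := by
  induction D, hD using Nat.le_induction with
  | base => norm_num
  | succ k hk ih => rw [pow_succ]; omega

lemma num_b (hD : 2 ≤ D) : D ^ 2 + 1 ≤ 2 ^ (2 * D) := by
  have h := num_a hD
  rw [mul_comm, pow_mul]
  calc D ^ 2 + 1 ≤ (D + 2) ^ 2 := by nlinarith
    _ ≤ _ := Nat.pow_le_pow_left h 2

lemma num_c (hD : 2 ≤ D) : D * (D ^ 2 + 1) ^ D ≤ 2 ^ (2 * D ^ 2 + D) := by
  calc D * (D ^ 2 + 1) ^ D ≤ 2 ^ D * (2 ^ (2 * D)) ^ D :=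
        Nat.mul_le_mul (by have := num_a hD; omega) (Nat.pow_le_pow_left (num_b hD) D)
    _ = _ := by rw [← pow_mul, ← pow_add]; congr 1; ring

lemma num_Hg (hD : 2 ≤ D) : Hg D ≤ 2 ^ (4 * D ^ 2) := by
  rw [Hg, ← mul_assoc]
  calc _ ≤ 2 ^ (2 * D ^ 2 + D) * (2 ^ D * (2 ^ D) ^ D) :=
        Nat.mul_le_mul (num_c hD) (Nat.mul_le_mul_left _ (Nat.pow_le_pow_left (num_a hD) D))
    _ = 2 ^ (3 * D ^ 2 + 2 * D) := by rw [← pow_mul, ← pow_add, ← pow_add]; congr 1; ring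
    _ ≤ _ := Nat.pow_le_pow_right (by norm_num) (by nlinarith)

lemma num_f (hD : 2 ≤ D) : (2 * D).factorial ≤ 2 ^ (3 * D ^ 2) := by
  calc _ ≤ (2 * D) ^ (2 * D) := Nat.factorial_le_pow _
    _ ≤ (2 ^ (D + 1)) ^ (2 * D) := Nat.pow_le_pow_left (by rw [pow_succ]; have := num_a hD; omega) _
    _ = 2 ^ (2 * D ^ 2 + 2 * D) := by rw [← pow_mul]; congr 1; ring
    _ ≤ _ := Nat.pow_le_pow_right (by norm_num) (by nlinarith)

lemma num_7 (hD : 2 ≤ D) : 16 * D ^ 3 ≤ D ^ 7 := by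
  have : 2 ^ 4 ≤ D ^ 4 := Nat.pow_le_pow_left hD 4
  calc 16 * D ^ 3 ≤ D ^ 4 * D ^ 3 := Nat.mul_le_mul_right _ (by simpa using this)
    _ = _ := by ring

lemma num_size (hD : 2 ≤ D) : (2 * D).factorial * Hg D ^ (2 * D) ≤ 2 ^ D ^ 7 := by
  calc _ ≤ 2 ^ (3 * D ^ 2) * (2 ^ (4 * D ^ 2)) ^ (2 * D) :=
        Nat.mul_le_mul (num_f hD) (Nat.pow_le_pow_left (num_Hg hD) _)
    _ = 2 ^ (3 * D ^ 2 + 8 * D ^ 3) := by rw [← pow_mul, ← pow_add]; congr 1; ring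
    _ ≤ _ := Nat.pow_le_pow_right (by norm_num) (by
      refine le_trans ?_ (num_7 hD)
      nlinarith [Nat.mul_le_mul_right (D ^ 2) hD])

lemma num_upper (hD : 2 ≤ D) {B η : ℝ} (hB : 2 ≤ B) (hη : 0 ≤ η) :
    (2 * D : ℕ) * (B ^ (2 * D) * ((D * (D ^ 2 + 1) ^ D : ℕ) * η) *
      ((2 * D).factorial * (Hg D * ((D + 2 : ℕ) * B) ^ D) ^ (2 * D))) ≤ B ^ D ^ 7 * η := by
  have hcast : ∀ {a k : ℕ}, a ≤ 2 ^ k → (a : ℝ) ≤ B ^ k := fun {a k} h => by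
    have h1 : (a : ℝ) ≤ 2 ^ k := by exact_mod_cast h
    exact h1.trans (pow_le_pow_left₀ (by norm_num) hB k)
  have hB0 : (0 : ℝ) ≤ B := by linarith
  have h1 : ((2 * D : ℕ) : ℝ) ≤ B ^ (D + 1) := hcast (by rw [pow_succ]; have := num_a hD; omega)
  have h2 : ((D * (D ^ 2 + 1) ^ D : ℕ) : ℝ) ≤ B ^ (2 * D ^ 2 + D) := hcast (num_c hD)
  have h3 : ((2 * D).factorial : ℝ) ≤ B ^ (3 * D ^ 2) := hcast (num_f hD)
  have h4 : (Hg D : ℝ) ≤ B ^ (4 * D ^ 2) := hcast (num_Hg hD)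
  have h5 : ((D + 2 : ℕ) : ℝ) ≤ B ^ D := hcast (num_a hD)
  calc _ ≤ B ^ (D + 1) * (B ^ (2 * D) * (B ^ (2 * D ^ 2 + D) * η) *
      (B ^ (3 * D ^ 2) * (B ^ (4 * D ^ 2) * (B ^ D * B) ^ D) ^ (2 * D))) := by gcongr
    _ = B ^ (D + 1 + 2 * D + (2 * D ^ 2 + D) + 3 * D ^ 2 + (4 * D ^ 2 + (D + 1) * D) * (2 * D)) * η := by
      rw [← pow_succ, ← pow_mul, ← pow_add, ← pow_mul, ← pow_add]
      simp only [pow_add _ _ (_ * _)]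
      ring
    _ ≤ _ := by
      refine mul_le_mul_of_nonneg_right (pow_le_pow_right₀ (by linarith) ?_) hη
      refine le_trans ?_ (num_7 hD)
      have e1 : 2 * D ^ 2 ≤ D ^ 3 := by rw [pow_succ D 2, mul_comm]; exact Nat.mul_le_mul_left _ hD
      have e2 : 2 * D ≤ D ^ 2 := by rw [pow_two]; exact Nat.mul_le_mul_right _ hD
      have e3 : (4 * D ^ 2 + (D + 1) * D) * (2 * D) = 10 * D ^ 3 + 2 * D ^ 2 := by ring
      rw [e3]
      omega

end Num

/-- Effective lower bound for polynomials without common zeros. -/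
theorem lojasiewicz (Q : Type) [Field Q] [IsAlgClosed Q] [CharZero Q] (n : ℕ) : ∃ c : ℕ, ∀ D s : ℕ, 2 ≤ D → s ≤ D →
    ∀ f : Fin s → MvPolynomial (Fin n) ℤ, (∀ j, Sz D (2 ^ D) (f j)) →
    (∀ z : Fin n → Q, ∃ j, aeval z (f j) ≠ 0) →
    ∀ (B : ℝ) (x : Fin n → ℂ), 2 ≤ B → (∀ i, ‖x i‖ ≤ B) → ∃ j, (B ^ D ^ c)⁻¹ ≤ ‖aeval x (f j)‖ := by
  induction n with
  | zero =>
    refine ⟨0, fun D s _ _ f _ hz B x hB _ => ?_⟩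
    obtain ⟨j, hj⟩ := hz 0
    refine ⟨j, ?_⟩
    obtain ⟨a, ha⟩ : ∃ a : ℤ, f j = C a := ⟨_, eq_C_of_isEmpty (f j)⟩
    rw [ha] at hj ⊢
    have ha0 : a ≠ 0 := by
      rintro rfl
      simp at hj
    have h1 : ‖aeval x (C a : MvPolynomial (Fin 0) ℤ)‖ = |(a : ℝ)| := by simp
    rw [h1]
    have h2 : (1 : ℝ) ≤ |(a : ℝ)| := by exact_mod_cast Int.one_le_abs ha0
    refine le_trans ?_ h2
    exact inv_le_one_of_one_le₀ (one_le_pow₀ (by linarith))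
  | succ n ih =>
    obtain ⟨c, hc⟩ := ih
    refine ⟨7 * c + 8, fun D s hD hs f hf hz B x hB hx => ?_⟩
    obtain ⟨s', r, hs', hr, hrz, hup⟩ := elim_step Q hD hs f hf hz
    have hB0 : 0 < B := by linarith
    by_contra hcon
    push Not at hcon
    set η := (B ^ D ^ (7 * c + 8))⁻¹ with hη
    have hη0 : 0 < η := by positivity
    obtain ⟨y, hy, hry⟩ := hup B x η hB hx hη0.le fun j => (hcon j).le
    have h7 := num_7 hD
    have e0 : 1 ≤ D ^ 3 := Nat.one_le_iff_ne_zero.mpr (by positivity)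
    have e1 : 2 * D ^ 2 ≤ D ^ 3 := by rw [pow_succ D 2, mul_comm]; exact Nat.mul_le_mul_left _ hD
    have e2 : 2 * D ≤ D ^ 2 := by rw [pow_two]; exact Nat.mul_le_mul_right _ hD
    have e4 : 2 * D * D = 2 * D ^ 2 := by ring
    have hB' : (2 : ℝ) ≤ (D + 2 : ℕ) * B := by
      push_cast
      nlinarith [(Nat.cast_nonneg D : (0 : ℝ) ≤ D)]
    obtain ⟨t, ht⟩ := hc (D ^ 7) s' (by omega) (by omega) r
      (fun t => (hr t).mono (by omega) (num_size hD)) hrz _ y hB' hy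
    have h1 := (hry t).trans (num_upper hD hB hη0.le)
    have h2 : (D + 2 : ℕ) * B ≤ B ^ (D + 1) := by
      rw [pow_succ]
      refine mul_le_mul_of_nonneg_right ?_ hB0.le
      have : ((D + 2 : ℕ) : ℝ) ≤ 2 ^ D := by exact_mod_cast num_a hD
      exact this.trans (pow_le_pow_left₀ (by norm_num) hB D)
    have h3 : (((D + 2 : ℕ) * B) ^ (D ^ 7) ^ c) ≤ B ^ ((D + 1) * D ^ (7 * c)) := by
      rw [← pow_mul D 7 c, pow_mul B]
      exact pow_le_pow_left₀ (by positivity) h2 _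
    have h4 : (B ^ ((D + 1) * D ^ (7 * c)))⁻¹ ≤ B ^ D ^ 7 * η :=
      (inv_anti₀ (by positivity) h3).trans (ht.trans h1)
    have h5 : (D + 1) * D ^ (7 * c) + D ^ 7 < D ^ (7 * c + 8) := by
      have g1 : 1 ≤ D ^ (7 * c) := Nat.one_le_iff_ne_zero.mpr (by positivity)
      have g2 : D + 1 < D ^ 7 := by omega
      have g3 : D ^ (7 * c + 8) = D ^ (7 * c) * (D * D ^ 7) := by ring
      rw [g3]
      have g4 : 2 * D ^ 7 ≤ D * D ^ 7 := Nat.mul_le_mul_right _ hD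
      nlinarith [Nat.mul_le_mul_left (D ^ (7 * c)) g4, Nat.mul_le_mul_right (D ^ 7) g1, Nat.mul_lt_mul_of_lt_of_le g2 le_rfl g1]
    have h6 : B ^ D ^ (7 * c + 8) ≤ B ^ ((D + 1) * D ^ (7 * c) + D ^ 7) := by
      rw [hη, ← div_eq_mul_inv, inv_eq_one_div, div_le_div_iff₀ (by positivity) (by positivity), one_mul] at h4
      exact h4.trans (le_of_eq (by rw [pow_add B]; exact mul_comm _ _))
    exact absurd h6 (not_le.mpr (pow_lt_pow_right₀ (by linarith) h5))

end WDC
end PartSec22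

section PartSec23
open scoped MatrixGroups Pointwise commutatorElement
open MvPolynomial
namespace WDC

section Words
variable {n k : ℕ} {S : Type*} [CommRing S]

/-- Word evaluation with adjugates in place of inverses. -/
def wm (Z : Fin k → Matrix (Fin n) (Fin n) S) (L : List (Fin k × Bool)) : Matrix (Fin n) (Fin n) S :=
  (L.map fun p => if p.2 then Z p.1 else (Z p.1).adjugate).prod

lemma wm_cons (Z : Fin k → Matrix (Fin n) (Fin n) S) (p : Fin k × Bool) (L : List (Fin k × Bool)) :
    wm Z (p :: L) = (if p.2 then Z p.1 else (Z p.1).adjugate) * wm Z L := by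
  simp [wm]

lemma wm_map {S' : Type*} [CommRing S'] (φ : S →+* S') (Z : Fin k → Matrix (Fin n) (Fin n) S)
    (L : List (Fin k × Bool)) : (wm Z L).map φ = wm (fun s => (Z s).map φ) L := by
  induction L with
  | nil => exact φ.mapMatrix.map_one
  | cons p L ih =>
    rw [wm_cons, wm_cons, Matrix.map_mul, ih]
    congr 1
    split_ifs
    · rfl
    · exact RingHom.map_adjugate φ (Z p.1)

lemma wm_rep (σ : FreeGroup (Fin k) →* SL(n, S)) (L : List (Fin k × Bool)) :
    wm (fun s => (σ (FreeGroup.of s) : Matrix (Fin n) (Fin n) S)) L = (σ (FreeGroup.mk L) : Matrix (Fin n) (Fin n) S) := by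
  induction L with
  | nil =>
    have : (FreeGroup.mk [] : FreeGroup (Fin k)) = 1 := rfl
    rw [this, map_one]
    rfl
  | cons p L ih =>
    obtain ⟨s, b⟩ := p
    have h1 : (FreeGroup.mk ((s, b) :: L) : FreeGroup (Fin k)) = FreeGroup.mk [(s, b)] * FreeGroup.mk L := by
      rw [FreeGroup.mul_mk]; rfl
    rw [wm_cons, ih, h1, map_mul, Matrix.SpecialLinearGroup.coe_mul]
    congr 1
    cases b
    · have : (FreeGroup.mk [(s, false)] : FreeGroup (Fin k)) = (FreeGroup.of s)⁻¹ := rfl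
      rw [this, map_inv, Matrix.SpecialLinearGroup.coe_inv]
      rfl
    · rfl

lemma wm_toWord (σ : FreeGroup (Fin k) →* SL(n, S)) (w : FreeGroup (Fin k)) :
    wm (fun s => (σ (FreeGroup.of s) : Matrix (Fin n) (Fin n) S)) w.toWord = (σ w : Matrix (Fin n) (Fin n) S) := by
  rw [wm_rep, FreeGroup.mk_toWord]

/-- The test quantity for arbitrary matrices. -/
def pvm (Z : Fin k → Matrix (Fin n) (Fin n) S) (e : Fin n × Fin n → FreeGroup (Fin k)) (q c : FreeGroup (Fin k)) : S :=
  (Matrix.of fun i j => (wm Z (e i * e j).toWord).trace).det *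
    ((wm Z (q * c).toWord).trace - (wm Z c.toWord).trace)

lemma pvm_rep (σ : FreeGroup (Fin k) →* SL(n, S)) (e : Fin n × Fin n → FreeGroup (Fin k)) (q c : FreeGroup (Fin k)) :
    pvm (fun s => (σ (FreeGroup.of s) : Matrix (Fin n) (Fin n) S)) e q c = pv σ e q c := by
  simp only [pvm, wm_toWord, pv, gram, tr]

lemma trace_map' {S' : Type*} [CommRing S'] (φ : S →+* S') (M : Matrix (Fin n) (Fin n) S) :
    (M.map φ).trace = φ M.trace := by
  simp [Matrix.trace]

lemma pvm_map {S' : Type*} [CommRing S'] (φ : S →+* S') (Z : Fin k → Matrix (Fin n) (Fin n) S)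
    (e : Fin n × Fin n → FreeGroup (Fin k)) (q c : FreeGroup (Fin k)) :
    φ (pvm Z e q c) = pvm (fun s => (Z s).map φ) e q c := by
  rw [pvm, pvm, map_mul, map_sub, ← trace_map', ← trace_map', wm_map, wm_map, RingHom.map_det]
  congr 2
  ext i j
  simp only [RingHom.mapMatrix_apply, Matrix.map_apply, Matrix.of_apply]
  rw [← trace_map', wm_map]

end Words

lemma Sz.exists {m : ℕ} (p : MvPolynomial (Fin m) ℤ) : ∃ H, Sz p.totalDegree H p := by
  suffices h : ∃ D H, Sz D H p by
    obtain ⟨D, H, h⟩ := h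
    exact ⟨H, h.deg⟩
  induction p using MvPolynomial.induction_on with
  | C a =>
    rcases Int.natAbs_eq a with h | h
    · refine ⟨0, a.natAbs, ?_⟩
      have := Sz.nat (n := m) (D := 0) a.natAbs
      have h2 : (C a : MvPolynomial (Fin m) ℤ) = (a.natAbs : MvPolynomial (Fin m) ℤ) := by
        conv_lhs => rw [h]
        simp
      rw [h2]; exact this
    · refine ⟨0, a.natAbs, ?_⟩
      have := (Sz.nat (n := m) (D := 0) a.natAbs).neg
      have h2 : (C a : MvPolynomial (Fin m) ℤ) = -(a.natAbs : MvPolynomial (Fin m) ℤ) := by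
        conv_lhs => rw [h]
        simp
      rw [h2]; exact this
  | add p q hp hq =>
    obtain ⟨D, H, h⟩ := hp
    obtain ⟨D', H', h'⟩ := hq
    exact ⟨max D D', H + H', (h.monoD (le_max_left _ _)).add (h'.monoD (le_max_right _ _))⟩
  | mul_X p i hp =>
    obtain ⟨D, H, h⟩ := hp
    exact ⟨_, _, h.mul (Sz.var i)⟩

lemma Sz.exists_fin {m : ℕ} {ι : Type*} [Fintype ι] (p : ι → MvPolynomial (Fin m) ℤ) :
    ∃ D, ∀ i, Sz D (2 ^ D) (p i) := by
  choose H hH using fun i => Sz.exists (p i)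
  refine ⟨∑ i, ((p i).totalDegree + H i), fun i => ?_⟩
  have h1 : (p i).totalDegree + H i ≤ ∑ i, ((p i).totalDegree + H i) :=
    Finset.single_le_sum (f := fun i => (p i).totalDegree + H i) (fun _ _ => Nat.zero_le _) (Finset.mem_univ i)
  exact (hH i).mono (by omega) (le_trans (by omega) Nat.lt_two_pow_self.le)

section SizeW
variable {n k m : ℕ}

lemma wm_size {Z : Fin k → Matrix (Fin n) (Fin n) (MvPolynomial (Fin m) ℤ)} (hn : 0 < n) (hZ : ∀ s i j, Sz 1 1 (Z s i j))
    (L : List (Fin k × Bool)) (i j : Fin n) :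
    Sz (L.length * n) ((n * n.factorial) ^ L.length) (wm Z L i j) := by
  induction L generalizing i j with
  | nil =>
    show Sz _ _ ((1 : Matrix (Fin n) (Fin n) (MvPolynomial (Fin m) ℤ)) i j)
    rw [Matrix.one_apply]
    split_ifs
    · simpa using Sz.one
    · exact Sz.zero'
  | cons p L ih =>
    rw [wm_cons, Matrix.mul_apply]
    have hlet : ∀ a, Sz n n.factorial ((if p.2 then Z p.1 else (Z p.1).adjugate) i a) := by
      intro a
      split_ifs
      · exact (hZ _ _ _).mono hn (Nat.one_le_iff_ne_zero.mpr (Nat.factorial_ne_zero n))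
      · rw [Matrix.adjugate_apply]
        have := Sz.det (M := (Z p.1).updateRow a (Pi.single i 1)) (D := 1) (H := 1) ?_
        · simpa using this
        · intro b c
          by_cases h : b = a
          · rw [h, Matrix.updateRow_self]
            by_cases h' : c = i
            · rw [h', Pi.single_eq_same]; exact Sz.one
            · rw [Pi.single_eq_of_ne h']; exact Sz.zero'
          · rw [Matrix.updateRow_ne h]; exact hZ _ _ _
    have := Sz.sum (Finset.univ : Finset (Fin n)) fun a _ => (hlet a).mul (ih a j)
    refine this.mono ?_ ?_
    · rw [List.length_cons, Nat.succ_mul, add_comm]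
    · rw [Finset.card_univ, Fintype.card_fin, List.length_cons, pow_succ]
      apply le_of_eq
      ring

lemma norm_lift_le {N : ℕ} (f : Fin 2 → FreeGroup (Fin k)) (hf : ∀ p, (f p).toWord.length ≤ N) (w : FreeGroup (Fin 2)) :
    (FreeGroup.lift f w).toWord.length ≤ w.toWord.length * N := by
  suffices h : ∀ L : List (Fin 2 × Bool), (FreeGroup.lift f (FreeGroup.mk L)).norm ≤ L.length * N by
    have := h w.toWord
    rwa [FreeGroup.mk_toWord] at this
  intro L
  induction L with
  | nil =>
    have : (FreeGroup.mk [] : FreeGroup (Fin 2)) = 1 := rfl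
    rw [this, map_one, FreeGroup.norm_one]
    exact Nat.zero_le _
  | cons p L ih =>
    obtain ⟨s, b⟩ := p
    have h1 : (FreeGroup.mk ((s, b) :: L) : FreeGroup (Fin 2)) = FreeGroup.mk [(s, b)] * FreeGroup.mk L := by
      rw [FreeGroup.mul_mk]; rfl
    rw [h1, map_mul, List.length_cons, Nat.succ_mul, add_comm]
    refine (FreeGroup.norm_mul_le _ _).trans (Nat.add_le_add ?_ ih)
    cases b
    · have : (FreeGroup.mk [(s, false)] : FreeGroup (Fin 2)) = (FreeGroup.of s)⁻¹ := rfl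
      rw [this, map_inv, FreeGroup.norm_inv_eq, FreeGroup.lift_apply_of]
      exact hf s
    · have : (FreeGroup.mk [(s, true)] : FreeGroup (Fin 2)) = FreeGroup.of s := rfl
      rw [this, FreeGroup.lift_apply_of]
      exact hf s

lemma finite_pairs (N : ℕ) : {f : Fin 2 → FreeGroup (Fin k) | ∀ p, (f p).toWord.length ≤ N}.Finite := by
  have h1 : {g : FreeGroup (Fin k) | g.toWord.length ≤ N}.Finite :=
    Set.Finite.of_finite_image ((List.finite_length_le (Fin k × Bool) N).subset (by
      rintro _ ⟨g, hg, rfl⟩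
      exact hg)) (FreeGroup.toWord_injective.injOn)
  exact (Set.Finite.pi fun _ : Fin 2 => h1).subset fun f hf p _ => hf p

end SizeW
end WDC
end PartSec23

section PartSec24
open scoped MatrixGroups Pointwise commutatorElement
open MvPolynomial
namespace WDC

/-- The quantitative statement for one type. -/
theorem type_bound {n k : ℕ} (hn : 0 < n) (e : Fin n × Fin n → FreeGroup (Fin k)) (q c : FreeGroup (Fin k)) (N : ℕ)
    (hN : ∀ (K : Type) [Field K] [NumberField K] (σ : FreeGroup (Fin k) →* SL(n, K)), pv σ e q c ≠ 0 → FreePair N σ) :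
    ∃ C₀ c₀ : ℕ, ∀ (L : ℕ), 1 ≤ L → ∀ u : (Fin 2 → FreeGroup (Fin k)) → FreeGroup (Fin 2),
      (∀ f, u f ≠ 1) → (∀ f, (u f).toWord.length ≤ L) →
      ∀ σ : FreeGroup (Fin k) →* SL(n, ℂ), pv σ e q c ≠ 0 → ∀ B : ℝ, 2 ≤ B →
      (∀ s i j, ‖(σ (FreeGroup.of s) : Matrix (Fin n) (Fin n) ℂ) i j‖ ≤ B) → ‖(pv σ e q c)⁻¹‖ ≤ B →
      ∃ f : Fin 2 → FreeGroup (Fin k), (∀ p, (f p).toWord.length ≤ N) ∧ ∃ i j, (B ^ (C₀ * L) ^ c₀)⁻¹ ≤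
        ‖((σ (FreeGroup.lift f (u f)) : Matrix (Fin n) (Fin n) ℂ) - 1) i j‖ := by
  classical
  have := (finite_pairs (k := k) N).fintype
  let P := {f : Fin 2 → FreeGroup (Fin k) | ∀ p, (f p).toWord.length ≤ N}
  set m := Fintype.card (Option (Fin k × Fin n × Fin n)) with hm
  let ν : Option (Fin k × Fin n × Fin n) ≃ Fin m := Fintype.equivFin _
  let Z : Fin k → Matrix (Fin n) (Fin n) (MvPolynomial (Fin m) ℤ) := fun s => Matrix.of fun i j => X (ν (some (s, i, j)))
  have hZ : ∀ s i j, Sz 1 1 (Z s i j) := fun s i j => Sz.var _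
  let p₁ : Fin k ⊕ Unit → MvPolynomial (Fin m) ℤ :=
    Sum.elim (fun s => (Z s).det - 1) fun _ => X (ν none) * pvm Z e q c - 1
  obtain ⟨D₁, hD₁⟩ := Sz.exists_fin p₁
  obtain ⟨Q, _, _, _, _⟩ : ∃ (Q : Type) (_ : Field Q) (_ : IsAlgClosed Q) (_ : CharZero Q), Algebra.IsAlgebraic ℚ Q := by
    refine ⟨AlgebraicClosure ℚ, inferInstance, inferInstance, inferInstance, ?_⟩
    have h := AlgebraicClosure.isAlgebraic ℚ
    refine ⟨fun x => ?_⟩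
    obtain ⟨p, hp, hp2⟩ := h.isAlgebraic x
    refine ⟨p, hp, ?_⟩
    rw [Polynomial.aeval_def] at hp2 ⊢
    rw [← hp2]
    congr 1
  obtain ⟨c₀, hc₀⟩ := lojasiewicz Q m
  let I := (Fin k ⊕ Unit) ⊕ (P × Fin n × Fin n)
  set s := Fintype.card I with hs
  let ι : I ≃ Fin s := Fintype.equivFin _
  set C₀ := s + D₁ + N * n + n * n.factorial * N + 3 with hC₀
  refine ⟨C₀, c₀, fun L hL u hu huL σ hσ B hB hσB hpB => ?_⟩
  have hCL : C₀ ≤ C₀ * L := Nat.le_mul_of_pos_right _ hL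
  let F : I → MvPolynomial (Fin m) ℤ := Sum.elim p₁ fun a =>
    (wm Z (FreeGroup.lift a.1.1 (u a.1.1)).toWord - 1) a.2.1 a.2.2
  have hF : ∀ j, Sz (C₀ * L) (2 ^ (C₀ * L)) (F j) := by
    rintro (j | ⟨⟨f, hf⟩, i, j⟩)
    · exact (hD₁ j).mono (by omega) (Nat.pow_le_pow_right (by norm_num) (by omega))
    · have hlen : (FreeGroup.lift f (u f)).toWord.length ≤ L * N :=
        (norm_lift_le f hf (u f)).trans (Nat.mul_le_mul_right _ (huL f))
      have h1 := wm_size hn hZ (FreeGroup.lift f (u f)).toWord i j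
      set ℓ := (FreeGroup.lift f (u f)).toWord.length with hℓ
      have h2 : Sz (ℓ * n) 1 ((1 : Matrix (Fin n) (Fin n) (MvPolynomial (Fin m) ℤ)) i j) := by
        rw [Matrix.one_apply]
        split_ifs
        · exact Sz.one
        · exact Sz.zero'
      refine (h1.sub h2).mono ?_ ?_
      · calc ℓ * n ≤ L * N * n := Nat.mul_le_mul_right _ hlen
          _ = N * n * L := by ring
          _ ≤ C₀ * L := Nat.mul_le_mul_right _ (by omega)
      · set M := n * n.factorial with hM
        have h3 : M ^ ℓ ≤ 2 ^ (M * N * L) := by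
          calc M ^ ℓ ≤ (2 ^ M) ^ ℓ := Nat.pow_le_pow_left Nat.lt_two_pow_self.le _
            _ = 2 ^ (M * ℓ) := (pow_mul 2 M ℓ).symm
            _ ≤ _ := Nat.pow_le_pow_right (by norm_num) (by
              calc M * ℓ ≤ M * (L * N) := Nat.mul_le_mul_left _ hlen
                _ = _ := by ring)
        have h4 : 1 ≤ 2 ^ (M * N * L) := Nat.one_le_two_pow
        have h5 : M * N * L + 1 ≤ C₀ * L := by
          have : (M * N + 1) * L ≤ C₀ * L := Nat.mul_le_mul_right _ (by omega)
          have h6 : (M * N + 1) * L = M * N * L + L := by ring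
          omega
        calc M ^ ℓ + 1 ≤ 2 ^ (M * N * L + 1) := by rw [pow_succ]; omega
          _ ≤ _ := Nat.pow_le_pow_right (by norm_num) h5
  have hZmap : ∀ {S : Type} [CommRing S] (x : Fin m → S) (t : Fin k),
      (Z t).map (aeval x : MvPolynomial (Fin m) ℤ →ₐ[ℤ] S).toRingHom = Matrix.of fun i j => x (ν (some (t, i, j))) := by
    intro S _ x t
    ext i j
    simp [Z]
  have hzero : ∀ z : Fin m → Q, ∃ j, aeval z (F (ι.symm j)) ≠ 0 := by
    intro z
    by_contra hcon
    push Not at hcon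
    have hcon' : ∀ a, aeval z (F a) = 0 := fun a => by
      have := hcon (ι a)
      rwa [Equiv.symm_apply_apply] at this
    let K := IntermediateField.adjoin ℚ (Set.range z)
    have : FiniteDimensional ℚ K :=
      IntermediateField.finiteDimensional_adjoin fun x _ => Algebra.IsIntegral.isIntegral x
    have : NumberField K := { to_charZero := inferInstance, to_finiteDimensional := inferInstance }
    let z' : Fin m → K := fun i => ⟨z i, IntermediateField.subset_adjoin _ _ ⟨i, rfl⟩⟩
    have hz' : ∀ p : MvPolynomial (Fin m) ℤ, aeval z p = 0 → aeval z' p = 0 := by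
      intro p hp
      have h1 : ∀ p : MvPolynomial (Fin m) ℤ, algebraMap K Q (aeval z' p) = aeval z p := by
        intro p
        induction p using MvPolynomial.induction_on with
        | C a => simp
        | add p q hp hq => rw [map_add, map_add, map_add, hp, hq]
        | mul_X p i hp =>
          rw [map_mul, map_mul, map_mul, hp, aeval_X, aeval_X]
          rfl
      exact (algebraMap K Q).injective (by rw [h1, hp, map_zero])
    set φ := (aeval z' : MvPolynomial (Fin m) ℤ →ₐ[ℤ] K).toRingHom with hφ
    have hφ0 : ∀ a, φ (F a) = 0 := fun a => hz' _ (hcon' a)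
    have hdet : ∀ t, ((Z t).map φ).det = 1 := by
      intro t
      have h1 : φ ((Z t).det - 1) = 0 := hφ0 (Sum.inl (Sum.inl t))
      rw [map_sub, map_one, RingHom.map_det, sub_eq_zero] at h1
      exact h1
    let τ : FreeGroup (Fin k) →* SL(n, K) := FreeGroup.lift fun t => ⟨(Z t).map φ, hdet t⟩
    have hτ : (fun t => (τ (FreeGroup.of t) : Matrix (Fin n) (Fin n) K)) = fun t => (Z t).map φ := by
      funext t
      have h1 : τ (FreeGroup.of t) = ⟨(Z t).map φ, hdet t⟩ := FreeGroup.lift_apply_of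
      rw [h1]
    have hpv : pv τ e q c ≠ 0 := by
      rw [← pvm_rep, hτ, ← pvm_map]
      intro h0
      have h1 : φ (X (ν none) * pvm Z e q c - 1) = 0 := hφ0 (Sum.inl (Sum.inr ()))
      rw [map_sub, map_mul, h0, mul_zero, map_one, zero_sub, neg_eq_zero] at h1
      exact one_ne_zero h1
    obtain ⟨f, hf, hfree⟩ := hN K τ hpv
    refine hfree (u f) (hu f) ?_
    rw [lift_comp]
    refine Subtype.ext ?_
    rw [← wm_toWord, hτ, ← wm_map]
    ext i j
    have h1 : φ ((wm Z (FreeGroup.lift f (u f)).toWord - 1) i j) = 0 := hφ0 (Sum.inr (⟨f, hf⟩, i, j))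
    rw [Matrix.sub_apply, map_sub, sub_eq_zero] at h1
    rw [Matrix.map_apply, h1, Matrix.SpecialLinearGroup.coe_one, Matrix.one_apply, Matrix.one_apply]
    split_ifs <;> simp
  let x : Fin m → ℂ := fun a => (ν.symm a).elim (pv σ e q c)⁻¹ fun b =>
    (σ (FreeGroup.of b.1) : Matrix (Fin n) (Fin n) ℂ) b.2.1 b.2.2
  have hx : ∀ a, ‖x a‖ ≤ B := by
    intro a
    simp only [x]
    rcases ν.symm a with _ | b
    · exact hpB
    · exact hσB _ _ _
  obtain ⟨j, hj⟩ := hc₀ (C₀ * L) s (by omega) (by omega) (fun j => F (ι.symm j)) (fun j => hF _) hzero B x hB hx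
  set φ := (aeval x : MvPolynomial (Fin m) ℤ →ₐ[ℤ] ℂ).toRingHom with hφ
  have hZσ : (fun t => (Z t).map φ) = fun t => (σ (FreeGroup.of t) : Matrix (Fin n) (Fin n) ℂ) := by
    funext t
    rw [hφ, hZmap]
    ext i j
    simp [x]
  have hpos : 0 < (B ^ (C₀ * L) ^ c₀)⁻¹ := by positivity
  change _ ≤ ‖φ (F (ι.symm j))‖ at hj
  rcases hjj : ι.symm j with (t | t) | ⟨⟨f, hf⟩, a, b⟩
  · exfalso
    rw [hjj] at hj
    have h1 : φ ((Z t).det - 1) = 0 := by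
      rw [map_sub, map_one, RingHom.map_det, RingHom.mapMatrix_apply, congrFun hZσ t]
      rw [(σ (FreeGroup.of t)).2, sub_self]
    change _ ≤ ‖φ ((Z t).det - 1)‖ at hj
    rw [h1, norm_zero] at hj
    linarith
  · exfalso
    rw [hjj] at hj
    have h1 : φ (X (ν none) * pvm Z e q c - 1) = 0 := by
      rw [map_sub, map_one, map_mul, pvm_map, hZσ, pvm_rep]
      have : φ (X (ν none)) = (pv σ e q c)⁻¹ := by simp [hφ, x]
      rw [this, inv_mul_cancel₀ hσ, sub_self]
    change _ ≤ ‖φ (X (ν none) * pvm Z e q c - 1)‖ at hj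
    rw [h1, norm_zero] at hj
    linarith
  · rw [hjj] at hj
    refine ⟨f, hf, a, b, hj.trans (le_of_eq ?_)⟩
    change ‖φ ((wm Z (FreeGroup.lift f (u f)).toWord - 1) a b)‖ = _
    congr 1
    rw [Matrix.sub_apply, map_sub, Matrix.sub_apply, ← wm_toWord, ← hZσ, ← wm_map, Matrix.map_apply]
    congr 1
    rw [Matrix.one_apply, Matrix.one_apply]
    split_ifs <;> simp

/-- The final numerical comparison. -/
lemma num_final (C₀ c₀ : ℕ) {ε : ℝ} (hε : 0 < ε) (hc : ε * c₀ ≤ 1 / 2) {B C : ℝ} (hB : 2 ≤ B) (hC : 1 ≤ C) :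
    ∃ δ₀ > 0, ∀ δ : ℝ, 0 < δ → δ < δ₀ →
      C * δ < (B ^ (C₀ * (⌊Real.log δ⁻¹ ^ ε⌋₊ + 1)) ^ c₀)⁻¹ := by
  set a : ℝ := (2 * C₀) ^ c₀ * Real.log B with ha
  set b : ℝ := Real.log C with hb
  have hlB : 0 ≤ Real.log B := Real.log_nonneg (by linarith)
  have ha0 : 0 ≤ a := by positivity
  have hb0 : 0 ≤ b := Real.log_nonneg hC
  refine ⟨Real.exp (-(a + b + 1) ^ 2), Real.exp_pos _, fun δ hδ hδ' => ?_⟩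
  set Λ := Real.log δ⁻¹ with hΛ
  have hΛ1 : (a + b + 1) ^ 2 < Λ := by
    rw [hΛ, Real.log_inv]
    have := Real.log_lt_log hδ hδ'
    rw [Real.log_exp] at this
    linarith
  have h1Λ : 1 ≤ Λ := by nlinarith
  have hΛ0 : 0 < Λ := by linarith
  set S := Real.sqrt Λ with hS
  have hSS : S * S = Λ := Real.mul_self_sqrt hΛ0.le
  have hSab : a + b + 1 < S := Real.lt_sqrt_of_sq_lt hΛ1
  set L := ⌊Λ ^ ε⌋₊ + 1 with hL
  have hLle : (L : ℝ) ≤ 2 * Λ ^ ε := by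
    have h1 := Nat.floor_le (Real.rpow_nonneg hΛ0.le ε)
    have h2 := Real.one_le_rpow h1Λ hε.le
    rw [hL]
    push_cast
    linarith
  have hpow : (((C₀ * L) ^ c₀ : ℕ) : ℝ) ≤ (2 * C₀) ^ c₀ * S := by
    push_cast
    have h1 : (C₀ : ℝ) * L ≤ (2 * C₀) * Λ ^ ε := by
      nlinarith [mul_le_mul_of_nonneg_left hLle (Nat.cast_nonneg C₀ : (0 : ℝ) ≤ C₀)]
    refine (pow_le_pow_left₀ (by positivity) h1 c₀).trans ?_
    rw [mul_pow]
    refine mul_le_mul_of_nonneg_left ?_ (by positivity)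
    rw [← Real.rpow_natCast, ← Real.rpow_mul hΛ0.le, hS, Real.sqrt_eq_rpow]
    exact Real.rpow_le_rpow_of_exponent_le h1Λ hc
  have hlog : Real.log (C * δ * B ^ (C₀ * L) ^ c₀) < 0 := by
    rw [Real.log_mul (by positivity) (by positivity), Real.log_mul (by positivity) hδ.ne', Real.log_pow]
    have h1 : (((C₀ * L) ^ c₀ : ℕ) : ℝ) * Real.log B ≤ a * S := by
      rw [ha]
      nlinarith [mul_le_mul_of_nonneg_right hpow hlB]
    have h2 : Real.log δ = -Λ := by rw [hΛ, Real.log_inv, neg_neg]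
    rw [h2]
    nlinarith
  have hpos : 0 < B ^ (C₀ * L) ^ c₀ := by positivity
  rw [lt_inv_comm₀ (by positivity) hpos]
  have h1 := (Real.log_neg_iff (by positivity)).mp hlog
  rw [lt_inv_comm₀ hpos (by positivity), ← one_div, lt_div_iff₀ hpos]
  exact h1

end WDC
end PartSec24

section PartSec25
namespace WDC

lemma entry_le {d : ℕ} (M : Matrix (Fin d) (Fin d) ℂ) (i j : Fin d) : ‖M i j‖ ≤ matrixOpNorm M := by
  have h1 := (LinearMap.toContinuousLinearMap (Matrix.toEuclideanLin M)).le_opNorm (EuclideanSpace.single j 1)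
  have h2 : ‖EuclideanSpace.single j (1 : ℂ)‖ = 1 := by simp
  rw [h2, mul_one] at h1
  refine le_trans ?_ h1
  have h3 := PiLp.norm_apply_le (LinearMap.toContinuousLinearMap (Matrix.toEuclideanLin M) (EuclideanSpace.single j 1)) i
  refine le_trans (le_of_eq ?_) h3
  congr 1
  simp [Matrix.toEuclideanLin, Matrix.toLpLin_apply]

lemma sandwich_le {n d : ℕ} (A : Matrix (Fin n) (Fin d) ℂ) (M : Matrix (Fin d) (Fin d) ℂ) (B : Matrix (Fin d) (Fin n) ℂ)
    (i j : Fin n) : ‖(A * M * B) i j‖ ≤ (∑ a, ∑ b, ‖A a b‖) * (∑ a, ∑ b, ‖B a b‖) * matrixOpNorm M := by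
  have hM : 0 ≤ matrixOpNorm M := norm_nonneg _
  have h1 : (A * M * B) i j = ∑ q, ∑ p, A i p * M p q * B q j := by
    simp only [Matrix.mul_apply, Finset.sum_mul]
  rw [h1]
  calc ‖∑ q, ∑ p, A i p * M p q * B q j‖ ≤ ∑ q, ∑ p, ‖A i p‖ * matrixOpNorm M * ‖B q j‖ := by
        refine (norm_sum_le _ _).trans (Finset.sum_le_sum fun q _ => (norm_sum_le _ _).trans
          (Finset.sum_le_sum fun p _ => ?_))
        rw [norm_mul, norm_mul]
        have := entry_le M p q
        gcongr
    _ = (∑ p, ‖A i p‖) * (∑ q, ‖B q j‖) * matrixOpNorm M := by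
        simp only [Finset.sum_mul, Finset.mul_sum]
        refine Finset.sum_congr rfl fun q _ => Finset.sum_congr rfl fun p _ => ?_
        ring
    _ ≤ _ := by
        refine mul_le_mul_of_nonneg_right (mul_le_mul ?_ ?_ (by positivity) (by positivity)) hM
        · exact Finset.single_le_sum (f := fun a => ∑ b, ‖A a b‖) (fun _ _ => by positivity) (Finset.mem_univ i)
        · exact Finset.sum_le_sum fun q _ =>
            Finset.single_le_sum (f := fun b => ‖B q b‖) (fun _ _ => norm_nonneg _) (Finset.mem_univ j)

lemma Wd.lift {G : Type} [Group G] {F : Set G} {N k : ℕ} {f : Fin k → G} (hf : ∀ i, Wd F N (f i))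
    (w : FreeGroup (Fin k)) : Wd F (w.toWord.length * N) (FreeGroup.lift f w) := by
  suffices h : ∀ L : List (Fin k × Bool), Wd F (L.length * N) (FreeGroup.lift f (FreeGroup.mk L)) by
    have := h w.toWord
    rwa [FreeGroup.mk_toWord] at this
  intro L
  induction L with
  | nil =>
    have : (FreeGroup.mk [] : FreeGroup (Fin k)) = 1 := rfl
    rw [this, map_one]
    exact Wd.one _ _
  | cons p L ih =>
    obtain ⟨s, b⟩ := p
    have h1 : (FreeGroup.mk ((s, b) :: L) : FreeGroup (Fin k)) = FreeGroup.mk [(s, b)] * FreeGroup.mk L := by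
      rw [FreeGroup.mul_mk]; rfl
    rw [h1, map_mul, List.length_cons, Nat.succ_mul, add_comm]
    refine Wd.mul ?_ ih
    cases b
    · have : (FreeGroup.mk [(s, false)] : FreeGroup (Fin k)) = (FreeGroup.of s)⁻¹ := rfl
      rw [this, map_inv, FreeGroup.lift_apply_of]
      exact (hf s).inv
    · have : (FreeGroup.mk [(s, true)] : FreeGroup (Fin k)) = FreeGroup.of s := rfl
      rw [this, FreeGroup.lift_apply_of]
      exact hf s

theorem main_aux (d : ℕ) : ∃ N₀ : ℕ, 1 ≤ N₀ ∧ ∃ ε₁ : ℝ, 0 < ε₁ ∧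
      ∀ F : Set (GL (Fin d) ℂ),
        ¬(∃ H : Subgroup ↥(Subgroup.closure F), H.FiniteIndex ∧ IsSolvable ↥H) →
        ∃ δ₀ : ℝ, 0 < δ₀ ∧ ∀ δ : ℝ, 0 < δ → δ < δ₀ →
          ∃ a b : GL (Fin d) ℂ, Wd F N₀ a ∧ Wd F N₀ b ∧
            ∀ w : FreeGroup (Fin 2), w ≠ 1 →
              ((FreeGroup.toWord w).length : ℝ) ≤ Real.log δ⁻¹ ^ ε₁ →
              δ ≤ matrixOpNorm
                (((FreeGroup.lift (fun i : Fin 2 => if i = 0 then a else b) w :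
                    GL (Fin d) ℂ) : Matrix (Fin d) (Fin d) ℂ) -
                  (1 : Matrix (Fin d) (Fin d) ℂ)) := by
  classical
  choose J hJ using almost_law
  obtain ⟨M, T, hT⟩ := s1b d J
  choose N hN using fun i => s2_main (T i).1.e (T i).1.c (T i).1.hn (T i).1.he (T i).1.x
    (fun j => (T i).1.y.getD j 1) (J (T i).1.n) (hJ _)
  choose C₀ c₀ hbd using fun i => type_bound (T i).1.hn (T i).1.e ((T i).1.q J) (T i).1.c (N i) (hN i)
  set R := Finset.range (M + 1) with hR
  refine ⟨R.sup (fun i => N i * (T i).2) + 1, by omega, 1 / (2 * ((R.sup c₀ : ℕ) + 1)), by positivity, fun F hF => ?_⟩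
  set ε : ℝ := 1 / (2 * ((R.sup c₀ : ℕ) + 1)) with hε
  have hε0 : 0 < ε := by positivity
  obtain ⟨i, hi, f, hf, σ, A, B, hσ, hpv⟩ := hT F hF
  have hiR : i ∈ R := Finset.mem_range.mpr (by omega)
  have hc : ε * c₀ i ≤ 1 / 2 := by
    have h1 : (c₀ i : ℝ) ≤ (R.sup c₀ : ℕ) := by exact_mod_cast Finset.le_sup hiR
    rw [hε, div_mul_eq_mul_div, div_le_div_iff₀ (by positivity) (by norm_num)]
    linarith
  set P := pv σ (T i).1.e ((T i).1.q J) (T i).1.c with hP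
  set B₀ : ℝ := 2 + ∑ s, ∑ a, ∑ b, ‖(σ (FreeGroup.of s) : Matrix (Fin (T i).1.n) (Fin (T i).1.n) ℂ) a b‖ + ‖P⁻¹‖ with hB₀
  set CF : ℝ := (∑ a, ∑ b, ‖A a b‖) * (∑ a, ∑ b, ‖B a b‖) + 1 with hCF
  have hAB0 : 0 ≤ (∑ a, ∑ b, ‖A a b‖) * (∑ a, ∑ b, ‖B a b‖) := by positivity
  have hsum0 : 0 ≤ ∑ s, ∑ a, ∑ b, ‖(σ (FreeGroup.of s) : Matrix (Fin (T i).1.n) (Fin (T i).1.n) ℂ) a b‖ := by positivity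
  have hB2 : 2 ≤ B₀ := by
    have := norm_nonneg P⁻¹
    linarith
  obtain ⟨δ₀, hδ₀, hnum⟩ := num_final (C₀ i) (c₀ i) hε0 hc hB2 (C := CF) (by linarith)
  refine ⟨δ₀, hδ₀, fun δ hδ hδ' => ?_⟩
  by_contra hcon
  push Not at hcon
  set L := ⌊Real.log δ⁻¹ ^ ε⌋₊ + 1 with hL
  have hex : ∀ g : Fin 2 → FreeGroup (Fin (T i).1.k), ∃ w : FreeGroup (Fin 2), w ≠ 1 ∧ w.toWord.length ≤ L ∧
      ((∀ p, (g p).toWord.length ≤ N i) → matrixOpNorm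
        (((FreeGroup.lift f (FreeGroup.lift g w) : GL (Fin d) ℂ) : Matrix (Fin d) (Fin d) ℂ) - 1) < δ) := by
    intro g
    by_cases hg : ∀ p, (g p).toWord.length ≤ N i
    · have hW : ∀ p, Wd F (R.sup (fun i => N i * (T i).2) + 1) (FreeGroup.lift f (g p)) := fun p =>
        (Wd.lift hf (g p)).mono (by
          have h1 : N i * (T i).2 ≤ R.sup (fun i => N i * (T i).2) := Finset.le_sup (f := fun i => N i * (T i).2) hiR
          have h2 := Nat.mul_le_mul_right (T i).2 (hg p)
          omega)
      obtain ⟨w, hw, hlen, hlt⟩ := hcon _ _ (hW 0) (hW 1)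
      refine ⟨w, hw, ?_, fun _ => ?_⟩
      · have := Nat.le_floor hlen
        omega
      · have h1 : (fun p : Fin 2 => if p = 0 then FreeGroup.lift f (g 0) else FreeGroup.lift f (g 1)) =
            fun p => FreeGroup.lift f (g p) := by
          funext p
          fin_cases p <;> rfl
        rw [h1, lift_comp] at hlt
        exact hlt
    · refine ⟨FreeGroup.of 0, FreeGroup.of_ne_one 0, ?_, fun h => absurd h hg⟩
      rw [FreeGroup.toWord_of, List.length_singleton]
      omega
  choose u hu1 hu2 hu3 using hex
  obtain ⟨g, hg, a, b, hab⟩ := hbd i L (by omega) u hu1 hu2 σ hpv B₀ hB2 (fun s a b => by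
    have h1 : ‖(σ (FreeGroup.of s) : Matrix (Fin (T i).1.n) (Fin (T i).1.n) ℂ) a b‖ ≤
        ∑ s, ∑ a, ∑ b, ‖(σ (FreeGroup.of s) : Matrix (Fin (T i).1.n) (Fin (T i).1.n) ℂ) a b‖ := by
      refine le_trans ?_ (Finset.single_le_sum (f := fun s => ∑ a, ∑ b,
        ‖(σ (FreeGroup.of s) : Matrix (Fin (T i).1.n) (Fin (T i).1.n) ℂ) a b‖) (fun _ _ => by positivity) (Finset.mem_univ s))
      refine le_trans ?_ (Finset.single_le_sum (f := fun a => ∑ b,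
        ‖(σ (FreeGroup.of s) : Matrix (Fin (T i).1.n) (Fin (T i).1.n) ℂ) a b‖) (fun _ _ => by positivity) (Finset.mem_univ a))
      exact Finset.single_le_sum (f := fun b =>
        ‖(σ (FreeGroup.of s) : Matrix (Fin (T i).1.n) (Fin (T i).1.n) ℂ) a b‖) (fun _ _ => norm_nonneg _) (Finset.mem_univ b)
    have := norm_nonneg P⁻¹
    linarith) (by linarith)
  have hlt := hu3 g hg
  have h1 : (σ (FreeGroup.lift g (u g)) : Matrix (Fin (T i).1.n) (Fin (T i).1.n) ℂ) - 1 =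
      A * ((FreeGroup.lift f (FreeGroup.lift g (u g)) : GL (Fin d) ℂ).1 - 1) * B := by
    have h2 := hσ 1
    rw [map_one, map_one, Matrix.SpecialLinearGroup.coe_one, Units.val_one] at h2
    rw [Matrix.mul_sub, Matrix.sub_mul, hσ, h2]
  rw [h1] at hab
  have h3 := hab.trans (sandwich_le _ _ _ a b)
  have h4 := hnum δ hδ hδ'
  have h5 : (∑ a, ∑ b, ‖A a b‖) * (∑ a, ∑ b, ‖B a b‖) *
      matrixOpNorm ((FreeGroup.lift f (FreeGroup.lift g (u g)) : GL (Fin d) ℂ).1 - 1) ≤ CF * δ := by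
    refine mul_le_mul (by linarith) hlt.le (norm_nonneg _) (by linarith)
  linarith

end WDC
end PartSec25

/-- **Weak diophantine condition.** Given `d ≥ 1`, there are `N₀ ≥ 1` and `ε₁ > 0` such that for
every finite subset `F` of `GL_d(ℂ)` generating a non virtually solvable subgroup, there is
`δ₀(F) > 0` such that for every `δ ∈ (0, δ₀)` there are two elements `a, b`, products of at most
`N₀` elements of `F ∪ F⁻¹`, with `‖w(a,b) − 1‖ ≥ δ` for every nontrivial reduced word `w ∈ F₂`
of length at most `(log δ⁻¹)^{ε₁}`. -/
theorem weak_diophantine_condition :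
    ∀ d : ℕ, 1 ≤ d → ∃ N₀ : ℕ, 1 ≤ N₀ ∧ ∃ ε₁ : ℝ, 0 < ε₁ ∧
      ∀ F : Set (GL (Fin d) ℂ), F.Finite →
        ¬(∃ H : Subgroup ↥(Subgroup.closure F), H.FiniteIndex ∧ IsSolvable ↥H) →
        ∃ δ₀ : ℝ, 0 < δ₀ ∧ ∀ δ : ℝ, 0 < δ → δ < δ₀ →
          ∃ a b : GL (Fin d) ℂ,
            (∃ l : List (GL (Fin d) ℂ), l.length ≤ N₀ ∧ (∀ g ∈ l, g ∈ F ∪ F⁻¹) ∧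
              l.prod = a) ∧
            (∃ l : List (GL (Fin d) ℂ), l.length ≤ N₀ ∧ (∀ g ∈ l, g ∈ F ∪ F⁻¹) ∧
              l.prod = b) ∧
            ∀ w : FreeGroup (Fin 2), w ≠ 1 →
              ((FreeGroup.toWord w).length : ℝ) ≤ Real.log δ⁻¹ ^ ε₁ →
              δ ≤ matrixOpNorm
                (((FreeGroup.lift (fun i : Fin 2 => if i = 0 then a else b) w :
                    GL (Fin d) ℂ) : Matrix (Fin d) (Fin d) ℂ) -
                  (1 : Matrix (Fin d) (Fin d) ℂ)) := by
  intro d _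
  obtain ⟨N, hN, ε, hε, h⟩ := WDC.main_aux d
  exact ⟨N, hN, ε, hε, fun F _ hF => h F hF⟩
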